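/- Let k ≥ 1 and a, q ≥ 1 be fixed integers with gcd(a,q) = 1 and 1 ≤ a ≤ q, and set α = a/q. Assume GRH(q). Then for every fixed ε > 0, T(log T)^{k²} ≪_{q,k} ∫_T^{2T} |ζ(1/2+it, α)|^{2k} dt ≪_{q,k,ε} T(log T)^{k²+ε} for all sufficiently large T. -/

import Mathlib

open Complex Filter MeasureTheory Finset HurwitzZeta
open scoped ArithmeticFunction Real Classical

noncomputable section

/-- The finite set of primes `p ≤ X`. -/
def primesUpTo (X : ℝ) : Finset ℕ :=
  (Finset.range (Nat.floor X + 1)).filter (fun p => p.Prime ∧ (p : ℝ) ≤ X)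

/-- The finite set of naturals `n ≤ X`. -/
def natsUpTo (X : ℝ) : Finset ℕ :=
  (Finset.range (Nat.floor X + 1)).filter (fun n => (n : ℝ) ≤ X)

/-- Truncated Euler product `P_X(s,χ)`, defined via the primitive character `χ*` inducing `χ`:
`P_X(s,χ) = ∏_{p ∣ q} (1 - χ*(p) p^{-s}) · exp(∑_{n ≤ X} χ*(n) Λ(n) / (n^s log n))`. -/
def PX {q : ℕ} (X : ℝ) (χ : DirichletCharacter ℂ q) (s : ℂ) : ℂ :=
  (∏ p ∈ q.primeFactors, (1 - χ.primitiveCharacter ((p : ℕ) : ZMod χ.conductor) * (p : ℂ) ^ (-s))) *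
    Complex.exp (∑ n ∈ natsUpTo X,
      χ.primitiveCharacter ((n : ℕ) : ZMod χ.conductor) * (Λ n : ℂ) / ((n : ℂ) ^ s * (Real.log n : ℂ)))

/-- `𝓟_X^ℓ(s) = ∏_χ P_X(s,χ)^{ℓ_χ}`. -/
def PXl {q : ℕ} (X : ℝ) (ℓ : DirichletCharacter ℂ q → ℕ) (s : ℂ) : ℂ :=
  ∏ χ : DirichletCharacter ℂ q, (PX X χ s) ^ (ℓ χ)

/-- A Dirichlet character as an arithmetic function. -/
def chiArith {q : ℕ} (χ : DirichletCharacter ℂ q) : ArithmeticFunction ℂ :=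
  ⟨fun n => if n = 0 then 0 else χ ((n : ℕ) : ZMod q), by simp⟩

/-- `d_ℓ`, the coefficients of the Dirichlet series of `𝓛^ℓ(s) = ∏_χ L(s,χ)^{ℓ_χ}`,
i.e. the Dirichlet convolution product `∏_χ χ^{*ℓ_χ}`. -/
def dcoef {q : ℕ} (ℓ : DirichletCharacter ℂ q → ℕ) : ArithmeticFunction ℂ :=
  ∏ χ : DirichletCharacter ℂ q, (chiArith χ) ^ (ℓ χ)

/-- `P*_X(s,χ) = ∏_{p ≤ X}(1 − χ(p)p^{−s})^{−1} · ∏_{√X < p ≤ X}(1 + χ(p)²/(2p^{2s}))^{−1}`. -/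
def PstarX {q : ℕ} (X : ℝ) (χ : DirichletCharacter ℂ q) (s : ℂ) : ℂ :=
  ((primesUpTo X).prod (fun p : ℕ => (1 - χ ((p : ℕ) : ZMod q) * (p : ℂ) ^ (-s))⁻¹)) *
    ((primesUpTo X).filter (fun p : ℕ => Real.sqrt X < (p : ℝ))).prod
      (fun p : ℕ => (1 + χ ((p : ℕ) : ZMod q) ^ 2 / (2 * (p : ℂ) ^ (2 * s)))⁻¹)

/-- `𝓟*_X^ℓ(s) = ∏_χ P*_X(s,χ)^{ℓ_χ}`. -/
def PstarXl {q : ℕ} (X : ℝ) (ℓ : DirichletCharacter ℂ q → ℕ) (s : ℂ) : ℂ :=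
  ∏ χ : DirichletCharacter ℂ q, (PstarX X χ s) ^ (ℓ χ)

/-- `Q_X(s,χ) = ∏_{p ≤ √X}(1 − χ(p)p^{−s}) · ∏_{√X < p ≤ X}(1 − χ(p)p^{−s} + χ(p)²/(2p^{2s}))`. -/
def QX {q : ℕ} (X : ℝ) (χ : DirichletCharacter ℂ q) (s : ℂ) : ℂ :=
  (((primesUpTo X).filter (fun p : ℕ => (p : ℝ) ≤ Real.sqrt X)).prod
      (fun p : ℕ => 1 - χ ((p : ℕ) : ZMod q) * (p : ℂ) ^ (-s))) *
    ((primesUpTo X).filter (fun p : ℕ => Real.sqrt X < (p : ℝ))).prod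
      (fun p : ℕ => 1 - χ ((p : ℕ) : ZMod q) * (p : ℂ) ^ (-s)
        + χ ((p : ℕ) : ZMod q) ^ 2 / (2 * (p : ℂ) ^ (2 * s)))

/-- `𝓠_X^ℓ(s) = ∏_χ Q_X(s,χ)^{ℓ_χ}`. -/
def QXl {q : ℕ} (X : ℝ) (ℓ : DirichletCharacter ℂ q → ℕ) (s : ℂ) : ℂ :=
  ∏ χ : DirichletCharacter ℂ q, (QX X χ s) ^ (ℓ χ)

/-- `𝓛^ℓ(s) = ∏_χ L(s,χ)^{ℓ_χ}`. -/
def Ll {q : ℕ} [NeZero q] (ℓ : DirichletCharacter ℂ q → ℕ) (s : ℂ) : ℂ :=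
  ∏ χ : DirichletCharacter ℂ q, (DirichletCharacter.LFunction χ s) ^ (ℓ χ)

/-- GRH for the Dirichlet L-functions modulo `q`: every zero `ρ` of `L(s,χ)` with
`0 < Re ρ < 1` satisfies `Re ρ = 1/2`. -/
def GRHmod (q : ℕ) [NeZero q] : Prop :=
  ∀ χ : DirichletCharacter ℂ q, ∀ ρ : ℂ,
    DirichletCharacter.LFunction χ ρ = 0 → 0 < ρ.re → ρ.re < 1 → ρ.re = 1 / 2

end

lemma norm_integral_exp_le {θ : ℝ} (hθ : θ ≠ 0) (a b : ℝ) :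
    ‖∫ t in a..b, cexp ((θ * t : ℝ) * I)‖ ≤ 2 * (1 / |θ|) := by
  have hc : (θ : ℂ) * I ≠ 0 := mul_ne_zero (by exact_mod_cast hθ) I_ne_zero
  have h : ∫ t in a..b, cexp ((θ * t : ℝ) * I) = ∫ t in a..b, cexp ((θ * I) * t) := by
    congr 1; ext t; push_cast; ring_nf
  rw [h, integral_exp_mul_complex hc, norm_div]
  have h1 : ∀ t : ℝ, ‖cexp ((θ * I) * t)‖ = 1 := fun t => by
    rw [show (θ * I) * (t : ℂ) = ((θ * t : ℝ) : ℂ) * I by push_cast; ring, norm_exp_ofReal_mul_I]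
  have h2 : ‖(θ : ℂ) * I‖ = |θ| := by simp
  rw [h2]
  have := norm_sub_le (cexp ((θ * I) * b)) (cexp ((θ * I) * a))
  rw [h1, h1] at this
  rw [mul_one_div]
  gcongr
  linarith

/-- Mean value of a finite exponential sum whose distinct frequencies are separated by `1 / Y`. -/
lemma integral_norm_sq_expSum_le {ι : Type*} (s : Finset ι) (A : ι → ℂ) (fr : ι → ℝ) {T Y : ℝ}
    (hT : 0 ≤ T) (hY : 0 ≤ Y)
    (hgap : ∀ v ∈ s, ∀ w ∈ s, fr v ≠ fr w → 1 / |fr v - fr w| ≤ Y) :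
    ∫ t in T..(2*T), ‖∑ v ∈ s, A v * cexp ((fr v * t : ℝ) * I)‖ ^ 2 ≤
      T * (∑ v ∈ s, ∑ w ∈ s, if fr v = fr w then ‖A v‖ * ‖A w‖ else 0) +
        2 * Y * (∑ v ∈ s, ‖A v‖) ^ 2 := by
  have hpt : ∀ t : ℝ, ((‖∑ v ∈ s, A v * cexp ((fr v * t : ℝ) * I)‖ ^ 2 : ℝ) : ℂ) =
      ∑ v ∈ s, ∑ w ∈ s, A v * (starRingEnd ℂ (A w)) * cexp (((fr v - fr w) * t : ℝ) * I) := by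
    intro t
    rw [ofReal_pow, ← Complex.mul_conj', map_sum, Finset.sum_mul_sum]
    refine Finset.sum_congr rfl fun v _ => Finset.sum_congr rfl fun w _ => ?_
    rw [map_mul, ← Complex.exp_conj, map_mul, conj_I, conj_ofReal,
      show ((((fr v - fr w) * t : ℝ) : ℂ) * I) = ((fr v * t : ℝ) : ℂ) * I +
        ((fr w * t : ℝ) : ℂ) * (-I) by push_cast; ring, Complex.exp_add]
    ring
  have hI : ∀ v w, IntervalIntegrable (fun t : ℝ =>
      A v * (starRingEnd ℂ (A w)) * cexp (((fr v - fr w) * t : ℝ) * I)) volume T (2*T) := by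
    intro v w
    apply Continuous.intervalIntegrable
    fun_prop
  have hint : ((∫ t in T..(2*T), ‖∑ v ∈ s, A v * cexp ((fr v * t : ℝ) * I)‖ ^ 2 : ℝ) : ℂ) =
      ∑ v ∈ s, ∑ w ∈ s, A v * (starRingEnd ℂ (A w)) *
        ∫ t in T..(2*T), cexp (((fr v - fr w) * t : ℝ) * I) := by
    rw [← intervalIntegral.integral_ofReal]
    simp_rw [hpt]
    rw [intervalIntegral.integral_finsetSum
      (fun v _ => (continuous_finsetSum s fun w _ => by fun_prop).intervalIntegrable _ _)]
    refine Finset.sum_congr rfl fun v _ => ?_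
    rw [intervalIntegral.integral_finsetSum (fun w _ => hI v w)]
    refine Finset.sum_congr rfl fun w _ => ?_
    rw [intervalIntegral.integral_const_mul]
  have hJ : ∀ v ∈ s, ∀ w ∈ s, ‖∫ t in T..(2*T), cexp (((fr v - fr w) * t : ℝ) * I)‖ ≤
      (if fr v = fr w then T else 0) + 2 * Y := by
    intro v hv w hw
    by_cases h : fr v = fr w
    · simp only [h, sub_self, zero_mul, ofReal_zero, Complex.exp_zero, if_true]
      rw [intervalIntegral.integral_const]
      have : ‖(2 * T - T) • (1 : ℂ)‖ = T := by
        rw [norm_smul, norm_one, mul_one, Real.norm_eq_abs, abs_of_nonneg] <;> linarith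
      linarith
    · rw [if_neg h, zero_add]
      refine (norm_integral_exp_le (sub_ne_zero.2 h) _ _).trans ?_
      have := hgap v hv w hw h
      linarith
  have h0 : ∫ t in T..(2*T), ‖∑ v ∈ s, A v * cexp ((fr v * t : ℝ) * I)‖ ^ 2 ≤
      ‖((∫ t in T..(2*T), ‖∑ v ∈ s, A v * cexp ((fr v * t : ℝ) * I)‖ ^ 2 : ℝ) : ℂ)‖ := by
    rw [norm_real]; exact le_abs_self _
  refine h0.trans ?_
  rw [hint]
  refine (norm_sum_le _ _).trans ?_
  calc _ ≤ ∑ v ∈ s, ∑ w ∈ s, ‖A v‖ * ‖A w‖ * ((if fr v = fr w then T else 0) + 2 * Y) := by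
        refine Finset.sum_le_sum fun v hv => (norm_sum_le _ _).trans
          (Finset.sum_le_sum fun w hw => ?_)
        rw [norm_mul, norm_mul, RCLike.norm_conj]
        gcongr
        exact hJ v hv w hw
    _ = _ := by
        rw [pow_two, Finset.sum_mul_sum]
        simp_rw [Finset.mul_sum, ← Finset.sum_add_distrib]
        refine Finset.sum_congr rfl fun v _ => Finset.sum_congr rfl fun w _ => ?_
        split_ifs <;> ring

lemma one_div_abs_log_sub_log_le {m n : ℕ} (hm : 0 < m) (hn : 0 < n) (h : m ≠ n) {Y : ℝ}
    (hmY : (m : ℝ) ≤ Y) (hnY : (n : ℝ) ≤ Y) : 1 / |Real.log m - Real.log n| ≤ Y := by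
  wlog hmn : m < n generalizing m n
  · rw [abs_sub_comm]
    exact this hn hm h.symm hnY hmY (lt_of_le_of_ne (not_lt.1 hmn) h.symm)
  have hm' : (0 : ℝ) < m := by exact_mod_cast hm
  have hn' : (0 : ℝ) < n := by exact_mod_cast hn
  have h1 : (m : ℝ) + 1 ≤ n := by exact_mod_cast hmn
  have h2 : Real.log m - Real.log n ≤ -(1 / n) := by
    rw [← Real.log_div hm'.ne' hn'.ne']
    have := Real.log_le_sub_one_of_pos (div_pos hm' hn')
    refine this.trans ?_
    rw [div_sub_one hn'.ne', ← neg_div]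
    gcongr
    linarith
  have h3 : 1 / (n : ℝ) ≤ |Real.log m - Real.log n| := by
    rw [abs_of_nonpos (h2.trans (by have := one_div_pos.2 hn'; linarith))]
    linarith
  calc 1 / |Real.log m - Real.log n| ≤ 1 / (1 / (n : ℝ)) :=
        one_div_le_one_div_of_le (one_div_pos.2 hn') h3
    _ = n := one_div_one_div _
    _ ≤ Y := hnY

/-- Two tuples of primes with the same product are permutations of each other. -/
lemma exists_perm_of_prod_eq {r : ℕ} {v w : Fin r → ℕ} (hv : ∀ i, (v i).Prime)
    (hw : ∀ i, (w i).Prime) (h : ∏ i, v i = ∏ i, w i) : ∃ σ : Equiv.Perm (Fin r), v ∘ σ = w := by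
  have h1 := Nat.primeFactorsList_unique (n := ∏ i, v i) (l := List.ofFn v) (by rw [List.prod_ofFn])
    (by intro p hp; obtain ⟨i, rfl⟩ := List.mem_ofFn.1 hp; exact hv i)
  have h2 := Nat.primeFactorsList_unique (n := ∏ i, v i) (l := List.ofFn w)
    (by rw [List.prod_ofFn, h])
    (by intro p hp; obtain ⟨i, rfl⟩ := List.mem_ofFn.1 hp; exact hw i)
  have h3 : List.ofFn (v ∘ Tuple.sort v) = List.ofFn (w ∘ Tuple.sort w) :=
    (((Tuple.sort v).ofFn_comp_perm v).trans ((h1.trans h2.symm).trans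
      ((Tuple.sort w).ofFn_comp_perm w).symm)).eq_of_pairwise'
      (Tuple.monotone_sort v).sortedLE_ofFn.pairwise (Tuple.monotone_sort w).sortedLE_ofFn.pairwise
  have h4 := List.ofFn_injective h3
  refine ⟨(Tuple.sort w).symm.trans (Tuple.sort v), ?_⟩
  ext i
  have := congrFun h4 ((Tuple.sort w).symm i)
  simpa using congrArg id this

lemma length_eq_of_prod_eq {r r' : ℕ} {v : Fin r → ℕ} {w : Fin r' → ℕ} (hv : ∀ i, (v i).Prime)
    (hw : ∀ i, (w i).Prime) (h : ∏ i, v i = ∏ i, w i) : r = r' := by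
  have h1 := Nat.primeFactorsList_unique (n := ∏ i, v i) (l := List.ofFn v) (by rw [List.prod_ofFn])
    (by intro p hp; obtain ⟨i, rfl⟩ := List.mem_ofFn.1 hp; exact hv i)
  have h2 := Nat.primeFactorsList_unique (n := ∏ i, v i) (l := List.ofFn w)
    (by rw [List.prod_ofFn, h])
    (by intro p hp; obtain ⟨i, rfl⟩ := List.mem_ofFn.1 hp; exact hw i)
  simpa using (h1.trans h2.symm).length_eq

lemma sum_tuple_diagonal_le (S : Finset ℕ) (hS : ∀ p ∈ S, p.Prime) (b : ℕ → ℝ) (r : ℕ)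
    (v : Fin r → ℕ) (hv : ∀ i, v i ∈ S) :
    ∑ w ∈ Fintype.piFinset (fun _ : Fin r => S),
      (if ∏ i, v i = ∏ i, w i then (∏ i, b (v i)) * ∏ i, b (w i) else 0) ≤
      r.factorial * (∏ i, b (v i)) ^ 2 := by
  calc _ ≤ ∑ w ∈ (univ : Finset (Equiv.Perm (Fin r))).image (fun σ : Equiv.Perm (Fin r) => v ∘ ⇑σ),
        (∏ i, b (v i)) ^ 2 := by
        rw [← Finset.sum_filter]
        refine (Finset.sum_le_sum (g := fun _ => (∏ i, b (v i)) ^ 2) ?_).trans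
          (Finset.sum_le_sum_of_subset_of_nonneg ?_ ?_)
        · intro w hw
          rw [Finset.mem_filter, Fintype.mem_piFinset] at hw
          obtain ⟨σ, hσ⟩ := exists_perm_of_prod_eq (fun i => hS _ (hv i)) (fun i => hS _ (hw.1 i)) hw.2
          have : ∏ i, b (w i) = ∏ i, b (v i) := by
            rw [← hσ]; exact Equiv.prod_comp σ (fun i => b (v i))
          rw [this, sq]
        · intro w hw
          rw [Finset.mem_filter, Fintype.mem_piFinset] at hw
          obtain ⟨σ, hσ⟩ := exists_perm_of_prod_eq (fun i => hS _ (hv i)) (fun i => hS _ (hw.1 i)) hw.2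
          exact Finset.mem_image.2 ⟨σ, Finset.mem_univ _, hσ⟩
        · intro _ _ _; positivity
    _ ≤ _ := by
        rw [Finset.sum_const, nsmul_eq_mul]
        gcongr
        refine Finset.card_image_le.trans ?_
        rw [Finset.card_univ, Fintype.card_perm, Fintype.card_fin]

/-- Mean square of a polynomial in a Dirichlet polynomial supported on primes. -/
lemma integral_norm_sq_primePoly_le (S : Finset ℕ) (hS : ∀ p ∈ S, p.Prime) (a : ℕ → ℂ)
    (c : ℕ → ℝ) (hc : ∀ r, 0 ≤ c r) {θ x T : ℝ} (hθ : 1 ≤ θ) (hx : 1 ≤ x) (hT : 0 ≤ T)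
    (hSx : ∀ p ∈ S, (p : ℝ) ≤ x) (N : ℕ) :
    ∫ t in T..(2*T), ‖∑ r ∈ range (N + 1), (c r : ℂ) *
        (∑ p ∈ S, a p * cexp ((-(θ * Real.log p) * t : ℝ) * I)) ^ r‖ ^ 2 ≤
      T * (∑ r ∈ range (N + 1), c r ^ 2 * r.factorial * (∑ p ∈ S, ‖a p‖ ^ 2) ^ r) +
        2 * x ^ N * (∑ r ∈ range (N + 1), c r * (∑ p ∈ S, ‖a p‖) ^ r) ^ 2 := by
  set s : Finset (Σ r : ℕ, Fin r → ℕ) :=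
    (range (N + 1)).sigma (fun r => Fintype.piFinset (fun _ : Fin r => S)) with hs
  set A : (Σ r : ℕ, Fin r → ℕ) → ℂ := fun v => c v.1 * ∏ i, a (v.2 i) with hA
  set fr : (Σ r : ℕ, Fin r → ℕ) → ℝ := fun v => -(θ * Real.log (∏ i, v.2 i : ℕ)) with hfr
  have hsp : ∀ v ∈ s, v.1 ≤ N ∧ ∀ i, v.2 i ∈ S := by
    intro v hv
    rw [hs, Finset.mem_sigma, Fintype.mem_piFinset, Finset.mem_range] at hv
    exact ⟨by omega, hv.2⟩
  have hpos : ∀ v ∈ s, 0 < ∏ i, v.2 i :=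
    fun v hv => Finset.prod_pos fun i _ => (hS _ ((hsp v hv).2 i)).pos
  have hle : ∀ v ∈ s, ((∏ i, v.2 i : ℕ) : ℝ) ≤ x ^ N := by
    intro v hv
    push_cast
    calc ∏ i, (v.2 i : ℝ) ≤ ∏ _i : Fin v.1, x :=
          Finset.prod_le_prod (fun _ _ => by positivity) (fun i _ => hSx _ ((hsp v hv).2 i))
      _ = x ^ v.1 := by simp
      _ ≤ x ^ N := pow_le_pow_right₀ hx (hsp v hv).1
  have hinj : ∀ v ∈ s, ∀ w ∈ s, fr v = fr w ↔ ∏ i, v.2 i = ∏ i, w.2 i := by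
    intro v hv w hw
    constructor
    · intro h
      have h1 : Real.log (∏ i, v.2 i : ℕ) = Real.log (∏ i, w.2 i : ℕ) := by
        have : θ ≠ 0 := by positivity
        simpa [hfr, this] using h
      have := Real.log_injOn_pos (Set.mem_Ioi.2 (Nat.cast_pos.2 (hpos v hv)))
        (Set.mem_Ioi.2 (Nat.cast_pos.2 (hpos w hw))) h1
      exact_mod_cast this
    · intro h; simp only [hfr, h]
  have hexp : ∀ t : ℝ, ∑ r ∈ range (N + 1), (c r : ℂ) *
      (∑ p ∈ S, a p * cexp ((-(θ * Real.log p) * t : ℝ) * I)) ^ r =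
      ∑ v ∈ s, A v * cexp ((fr v * t : ℝ) * I) := by
    intro t
    rw [hs, Finset.sum_sigma]
    refine Finset.sum_congr rfl fun r hr => ?_
    have h1 : (∑ p ∈ S, a p * cexp ((-(θ * Real.log p) * t : ℝ) * I)) ^ r =
        ∑ w ∈ Fintype.piFinset (fun _ : Fin r => S),
          ∏ i, (a (w i) * cexp ((-(θ * Real.log (w i)) * t : ℝ) * I)) := by
      have := Finset.prod_univ_sum (fun _ : Fin r => S)
        (fun _ p => a p * cexp ((-(θ * Real.log p) * t : ℝ) * I))
      rw [← this, Finset.prod_const, Finset.card_univ, Fintype.card_fin]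
    rw [h1, Finset.mul_sum]
    refine Finset.sum_congr rfl fun w hw => ?_
    rw [Finset.prod_mul_distrib, ← Complex.exp_sum, hA, hfr, mul_assoc]
    congr 3
    have hw' := Fintype.mem_piFinset.1 hw
    have : Real.log (∏ i, w i : ℕ) = ∑ i, Real.log (w i) := by
      rw [Nat.cast_prod, Real.log_prod]
      intro i _
      exact_mod_cast (hS _ (hw' i)).ne_zero
    simp only [this]
    push_cast
    rw [Finset.mul_sum, ← Finset.sum_neg_distrib, Finset.sum_mul, Finset.sum_mul]
  simp_rw [hexp]
  refine (integral_norm_sq_expSum_le s A fr hT (by positivity : 0 ≤ x ^ N) ?_).trans ?_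
  · intro v hv w hw h
    have h1 : ∏ i, v.2 i ≠ ∏ i, w.2 i := fun h' => h ((hinj v hv w hw).2 h')
    have h2 := one_div_abs_log_sub_log_le (hpos v hv) (hpos w hw) h1 (hle v hv) (hle w hw)
    refine le_trans ?_ h2
    have h3 : |fr v - fr w| = θ * |Real.log (∏ i, v.2 i : ℕ) - Real.log (∏ i, w.2 i : ℕ)| := by
      have h0 : fr v - fr w =
          -(θ * (Real.log (∏ i, v.2 i : ℕ) - Real.log (∏ i, w.2 i : ℕ))) := by
        simp only [hfr]; ring
      rw [h0, abs_neg, abs_mul, abs_of_nonneg (by positivity : 0 ≤ θ)]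
    have h4 : 0 < |Real.log (∏ i, v.2 i : ℕ) - Real.log (∏ i, w.2 i : ℕ)| := by
      rw [abs_pos, sub_ne_zero]
      intro h5
      exact h (by simp only [hfr, h5])
    rw [h3]
    apply one_div_le_one_div_of_le h4
    nlinarith
  · have hnA : ∀ v, ‖A v‖ = c v.1 * ∏ i, ‖a (v.2 i)‖ := by
      intro v
      rw [hA]; simp [abs_of_nonneg (hc _)]
    have hpow : ∀ (f : ℕ → ℝ) (r : ℕ), ∑ w ∈ Fintype.piFinset (fun _ : Fin r => S), ∏ i, f (w i) =
        (∑ p ∈ S, f p) ^ r := by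
      intro f r
      have := Finset.prod_univ_sum (fun _ : Fin r => S) (fun _ p => f p)
      rw [← this, Finset.prod_const, Finset.card_univ, Fintype.card_fin]
    have hsumA : ∑ v ∈ s, ‖A v‖ = ∑ r ∈ range (N + 1), c r * (∑ p ∈ S, ‖a p‖) ^ r := by
      rw [hs, Finset.sum_sigma]
      refine Finset.sum_congr rfl fun r _ => ?_
      simp_rw [hnA]
      rw [← Finset.mul_sum, hpow (fun p => ‖a p‖)]
    rw [hsumA]
    gcongr
    rw [hs, Finset.sum_sigma]
    refine Finset.sum_le_sum fun r hr => ?_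
    calc _ ≤ ∑ v ∈ Fintype.piFinset (fun _ : Fin r => S),
          c r ^ 2 * (r.factorial * (∏ i, ‖a (v i)‖) ^ 2) := by
          refine Finset.sum_le_sum fun v hv => ?_
          have hv' := Fintype.mem_piFinset.1 hv
          have hvs : (⟨r, v⟩ : Σ r : ℕ, Fin r → ℕ) ∈ s := Finset.mem_sigma.2 ⟨hr, hv⟩
          rw [Finset.sum_sigma]
          refine (Finset.sum_le_sum (g := fun r' => if r' = r then
            c r ^ 2 * (r.factorial * (∏ i, ‖a (v i)‖) ^ 2) else 0) fun r' hr' => ?_).trans ?_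
          · split_ifs with hrr
            · subst hrr
              refine le_trans (le_of_eq ?_) (mul_le_mul_of_nonneg_left
                (sum_tuple_diagonal_le S hS (fun p => ‖a p‖) r' v hv') (sq_nonneg (c r')))
              rw [Finset.mul_sum]
              refine Finset.sum_congr rfl fun w hw => ?_
              have hws : (⟨r', w⟩ : Σ r : ℕ, Fin r → ℕ) ∈ s := Finset.mem_sigma.2 ⟨hr, hw⟩
              have := hinj _ hvs _ hws
              simp only at this
              simp only [this, hnA]
              split_ifs <;> ring
            · refine le_of_eq (Finset.sum_eq_zero fun w hw => ?_)
              have hws : (⟨r', w⟩ : Σ r : ℕ, Fin r → ℕ) ∈ s := Finset.mem_sigma.2 ⟨hr', hw⟩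
              rw [if_neg]
              rw [hinj _ hvs _ hws]
              intro h
              exact hrr (length_eq_of_prod_eq (fun i => hS _ (hv' i))
                (fun i => hS _ (Fintype.mem_piFinset.1 hw i)) h).symm
          · rw [Finset.sum_ite_eq' (range (N + 1)) r, if_pos hr]
      _ = _ := by
          rw [← Finset.mul_sum, ← Finset.mul_sum, ← hpow (fun p => ‖a p‖ ^ 2)]
          simp_rw [Finset.prod_pow]
          ring

/-- The primes up to `n`. -/
def primesTo (n : ℕ) : Finset ℕ := (range (n + 1)).filter Nat.Prime

lemma mem_primesTo {n p : ℕ} : p ∈ primesTo n ↔ p ≤ n ∧ p.Prime := by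
  simp [primesTo]

lemma sum_log_primesTo_le (n : ℕ) : ∑ p ∈ primesTo n, Real.log p ≤ n * Real.log 4 := by
  have h1 : ∑ p ∈ primesTo n, Real.log p = Real.log (primorial n) := by
    rw [primorial, Nat.cast_prod, Real.log_prod]
    · rfl
    · intro p hp
      exact_mod_cast (mem_primesTo.1 hp).2.ne_zero
  rw [h1, ← Real.log_pow]
  apply Real.log_le_log
  · exact_mod_cast primorial_pos n
  · exact_mod_cast primorial_le_four_pow n

lemma sum_log_div_primesTo_le {n : ℕ} (hn : 1 ≤ n) :
    ∑ p ∈ primesTo n, Real.log p / p ≤ Real.log n + Real.log 4 := by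
  have hn' : (0 : ℝ) < n := by exact_mod_cast hn
  have h1 : ∑ p ∈ primesTo n, (n / p : ℕ) * Real.log p ≤ n * Real.log n := by
    have h2 : ∀ m ∈ Ioc 0 n, ∑ p ∈ (primesTo n).filter (· ∣ m), Real.log p ≤ Real.log n := by
      intro m hm
      rw [Finset.mem_Ioc] at hm
      have h3 : (primesTo n).filter (· ∣ m) = m.primeFactors := by
        ext p
        simp only [Finset.mem_filter, mem_primesTo, Nat.mem_primeFactors]
        constructor
        · rintro ⟨⟨_, h⟩, h'⟩; exact ⟨h, h', hm.1.ne'⟩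
        · rintro ⟨h, h', _⟩; exact ⟨⟨(Nat.le_of_dvd hm.1 h').trans hm.2, h⟩, h'⟩
      rw [h3, ← Real.log_prod]
      · apply Real.log_le_log
        · exact Finset.prod_pos fun p hp => by exact_mod_cast (Nat.prime_of_mem_primeFactors hp).pos
        · rw [← Nat.cast_prod]
          exact_mod_cast (Nat.le_of_dvd hm.1 (Nat.prod_primeFactors_dvd m)).trans hm.2
      · intro p hp; exact_mod_cast (Nat.prime_of_mem_primeFactors hp).ne_zero
    have h4 := Finset.sum_le_sum h2
    simp_rw [Finset.sum_filter] at h4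
    rw [Finset.sum_comm] at h4
    simp only [Finset.sum_const, Nat.card_Ioc, tsub_zero, nsmul_eq_mul] at h4
    refine le_trans (le_of_eq ?_) h4
    refine Finset.sum_congr rfl fun p _ => ?_
    rw [← Finset.sum_filter, Finset.sum_const, nsmul_eq_mul, Nat.Ioc_filter_dvd_card_eq_div]
  have h5 : ∀ p ∈ primesTo n, (n : ℝ) * (Real.log p / p) ≤
      (n / p : ℕ) * Real.log p + Real.log p := by
    intro p hp
    have hp' := (mem_primesTo.1 hp).2
    have hp0 : (0 : ℝ) < p := by exact_mod_cast hp'.pos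
    have h6 : (n : ℝ) / p ≤ (n / p : ℕ) + 1 := by
      rw [div_le_iff₀ hp0]
      have := Nat.lt_mul_of_div_lt (Nat.lt_succ_self (n / p)) hp'.pos
      rw [mul_comm] at this
      exact_mod_cast this.le.trans (mul_comm _ _).le
    have h7 : 0 ≤ Real.log p := Real.log_natCast_nonneg p
    calc (n : ℝ) * (Real.log p / p) = (n / p) * Real.log p := by ring
      _ ≤ ((n / p : ℕ) + 1) * Real.log p := by gcongr
      _ = _ := by ring
  have h8 := Finset.sum_le_sum h5
  rw [← Finset.mul_sum, Finset.sum_add_distrib] at h8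
  have h9 := sum_log_primesTo_le n
  have : (n : ℝ) * ∑ p ∈ primesTo n, Real.log p / p ≤ n * (Real.log n + Real.log 4) := by
    linarith
  exact le_of_mul_le_mul_left this hn'

lemma primesTo_succ (n : ℕ) : primesTo (n + 1) =
    if (n + 1).Prime then insert (n + 1) (primesTo n) else primesTo n := by
  rw [primesTo, Finset.range_add_one, Finset.filter_insert]
  rfl

lemma sum_primesTo_succ (f : ℕ → ℝ) (n : ℕ) : ∑ p ∈ primesTo (n + 1), f p =
    (if (n + 1).Prime then f (n + 1) else 0) + ∑ p ∈ primesTo n, f p := by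
  rw [primesTo_succ]
  split_ifs
  · rw [Finset.sum_insert]
    rw [mem_primesTo]; omega
  · simp

lemma sum_inv_primesTo_le {n : ℕ} (hn : 2 ≤ n) :
    ∑ p ∈ primesTo n, (1 : ℝ) / p ≤ Real.log (Real.log n) + 5 := by
  have key : ∀ n : ℕ, 2 ≤ n → ∑ p ∈ primesTo n, (1 : ℝ) / p ≤
      (∑ p ∈ primesTo n, Real.log p / p) / Real.log n +
      (Real.log (Real.log n) - Real.log (Real.log 2)) +
      Real.log 4 * (1 / Real.log 2 - 1 / Real.log n) := by
    intro n hn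
    induction n, hn using Nat.le_induction with
    | base =>
      have h2 : primesTo 2 = {2} := by decide
      rw [h2]
      have : Real.log 2 ≠ 0 := (Real.log_pos (by norm_num)).ne'
      simp only [Finset.sum_singleton]
      push_cast
      field_simp
      simp
    | succ n hn ih =>
      rw [sum_primesTo_succ, sum_primesTo_succ (fun p => Real.log p / p)]
      set A := ∑ p ∈ primesTo n, Real.log p / p with hA
      have hA1 := sum_log_div_primesTo_le (n := n) (by omega)
      rw [← hA] at hA1
      have hn1 : (1 : ℝ) < n := by exact_mod_cast hn
      have hl : 0 < Real.log n := Real.log_pos hn1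
      have hl1 : Real.log n < Real.log (n + 1 : ℕ) := by
        apply Real.log_lt_log (by linarith); push_cast; linarith
      set l := Real.log n
      set l1 := Real.log (n + 1 : ℕ)
      have hl1p : 0 < l1 := hl.trans hl1
      have hll : 1 - l / l1 ≤ Real.log l1 - Real.log l := by
        rw [← Real.log_div hl1p.ne' hl.ne']
        have := Real.one_sub_inv_le_log_of_pos (div_pos hl1p hl)
        rwa [inv_div] at this
      have e1 : (if (n + 1).Prime then (1 : ℝ) / ((n + 1 : ℕ) : ℝ) else 0) =
          (if (n + 1).Prime then l1 / ((n + 1 : ℕ) : ℝ) else 0) / l1 := by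
        split_ifs
        · field_simp
        · rw [zero_div]
      have e2 : A / l = A / l1 + A * (1 / l - 1 / l1) := by ring
      have e3 : A * (1 / l - 1 / l1) ≤ (l + Real.log 4) * (1 / l - 1 / l1) := by
        apply mul_le_mul_of_nonneg_right hA1
        rw [sub_nonneg]; exact one_div_le_one_div_of_le hl hl1.le
      have e4 : (l + Real.log 4) * (1 / l - 1 / l1) =
          1 - l / l1 + Real.log 4 * (1 / l - 1 / l1) := by
        field_simp
      rw [e1, add_div]
      have e5 : Real.log 4 * (1 / Real.log 2 - 1 / l1) = Real.log 4 * (1 / Real.log 2 - 1 / l) +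
        Real.log 4 * (1 / l - 1 / l1) := by ring
      linarith
  have h := key n hn
  have hn1 : (2 : ℝ) ≤ n := by exact_mod_cast hn
  have hl : 0 < Real.log n := Real.log_pos (by linarith)
  have h2 : 0 < Real.log 2 := Real.log_pos (by norm_num)
  have hA1 := sum_log_div_primesTo_le (n := n) (by omega)
  have h4 : Real.log 4 = 2 * Real.log 2 := by
    rw [show (4 : ℝ) = 2 ^ 2 by norm_num, Real.log_pow]; norm_num
  have h5 : (∑ p ∈ primesTo n, Real.log p / p) / Real.log n ≤ 1 + Real.log 4 * (1 / Real.log n) := by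
    rw [div_le_iff₀ hl]
    have : (1 + Real.log 4 * (1 / Real.log n)) * Real.log n = Real.log n + Real.log 4 := by
      field_simp
    linarith
  have h6 : - Real.log (Real.log 2) ≤ 1 := by
    have := Real.one_sub_inv_le_log_of_pos h2
    have h7 : (Real.log 2)⁻¹ ≤ 2 := by
      rw [inv_le_comm₀ h2 (by norm_num)]
      have := Real.log_two_gt_d9; norm_num at this ⊢; linarith
    linarith
  have h8 : Real.log 4 * (1 / Real.log 2) = 2 := by rw [h4]; field_simp
  have h9 : Real.log 4 * (1 / Real.log 2 - 1 / Real.log n) =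
      Real.log 4 * (1 / Real.log 2) - Real.log 4 * (1 / Real.log n) := by ring
  linarith

lemma sum_inv_primesTo_filter_le {n : ℕ} (hn : 1 ≤ n) {z : ℝ} (hz : 1 < z) :
    ∑ p ∈ (primesTo n).filter (fun p : ℕ => z < p), (1 : ℝ) / p ≤
      (Real.log n + Real.log 4) / Real.log z := by
  have hl := Real.log_pos hz
  rw [le_div_iff₀ hl, Finset.sum_mul]
  apply le_trans _ (sum_log_div_primesTo_le hn)
  calc _ ≤ ∑ p ∈ (primesTo n).filter (fun p : ℕ => z < p), Real.log (p : ℝ) / p := by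
        refine Finset.sum_le_sum fun p hp => ?_
        have h := (Finset.mem_filter.1 hp).2
        rw [one_div_mul_eq_div]
        gcongr
    _ ≤ _ := by
        refine Finset.sum_le_sum_of_subset_of_nonneg (Finset.filter_subset (fun p : ℕ => z < (p : ℝ)) (primesTo n)) ?_
        intro p _ _
        exact div_nonneg (Real.log_natCast_nonneg p) (Nat.cast_nonneg p)

/-- Tail of the sum of inverse squares. -/
lemma sum_inv_sq_le {s : Finset ℕ} {m : ℕ} (hm : 1 ≤ m) (hs : ∀ n ∈ s, m < n) :
    ∑ n ∈ s, (1 : ℝ) / (n : ℝ) ^ 2 ≤ 1 / m := by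
  have h1 : s ⊆ Ioc m (s.sup id + m) := by
    intro n hn
    rw [Finset.mem_Ioc]
    have : n ≤ s.sup id := Finset.le_sup (f := id) hn
    exact ⟨hs n hn, by omega⟩
  refine (Finset.sum_le_sum_of_subset_of_nonneg h1 (fun _ _ _ => by positivity)).trans ?_
  have := sum_Ioc_inv_sq_le_sub (α := ℝ) (k := m) (n := s.sup id + m) (by omega) (by omega)
  simp only [one_div]
  refine this.trans ?_
  have : (0 : ℝ) ≤ ((s.sup id + m : ℕ) : ℝ)⁻¹ := by positivity
  linarith

/-- The integers `1 ≤ n ≤ z` in the residue class `r` modulo `Q`. -/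
def apSet (Q : ℕ) (r : ZMod Q) (z : ℕ) : Finset ℕ := (Icc 1 z).filter (fun n => (n : ZMod Q) = r)

lemma mem_apSet {Q : ℕ} {r : ZMod Q} {z n : ℕ} :
    n ∈ apSet Q r z ↔ (1 ≤ n ∧ n ≤ z) ∧ (n : ZMod Q) = r := by
  simp [apSet]

lemma sum_inv_apSet_le (Q : ℕ) [NeZero Q] (r : ZMod Q) (z : ℕ) :
    ∑ n ∈ apSet Q r z, (1 : ℝ) / n ≤ 2 + (1 / Q) * Real.log z := by
  have hQ : 0 < Q := NeZero.pos Q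
  have hQ' : (1 : ℝ) ≤ Q := by exact_mod_cast hQ
  have hinj : Set.InjOn (fun n => n / Q) (apSet Q r z : Set ℕ) := by
    intro n hn m hm h
    have h1 := (mem_apSet.1 hn).2.trans (mem_apSet.1 hm).2.symm
    rw [ZMod.natCast_eq_natCast_iff'] at h1
    have h2 : n / Q = m / Q := h
    rw [← Nat.div_add_mod n Q, ← Nat.div_add_mod m Q, h1, h2]
  have h1 : ∀ n ∈ apSet Q r z, (1 : ℝ) / n ≤
      (fun m : ℕ => if m = 0 then (1 : ℝ) else (1 / Q) * (1 / m)) (n / Q) := by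
    intro n hn
    obtain ⟨⟨hn1, _⟩, _⟩ := mem_apSet.1 hn
    have hn1' : (1 : ℝ) ≤ n := by exact_mod_cast hn1
    simp only
    split_ifs with h
    · rw [div_le_one (by linarith)]; exact hn1'
    · rw [one_div_mul_one_div]
      have h2 : Q * (n / Q) ≤ n := Nat.mul_div_le n Q
      have h3 : 0 < Q * (n / Q) := Nat.mul_pos hQ (Nat.pos_of_ne_zero h)
      apply one_div_le_one_div_of_le
      · exact_mod_cast h3
      · exact_mod_cast h2
  refine (Finset.sum_le_sum h1).trans ?_
  rw [← Finset.sum_image (f := fun m : ℕ => if m = 0 then (1 : ℝ) else (1 / Q) * (1 / m)) hinj]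
  have hsub : (apSet Q r z).image (fun n => n / Q) ⊆ range (z + 1) := by
    intro m hm
    obtain ⟨n, hn, rfl⟩ := Finset.mem_image.1 hm
    have := (mem_apSet.1 hn).1.2
    rw [Finset.mem_range]
    have := Nat.div_le_self n Q
    omega
  refine (Finset.sum_le_sum_of_subset_of_nonneg hsub ?_).trans ?_
  · intro m _ _; split_ifs <;> positivity
  · rw [Finset.sum_range_succ']
    have h2 : (harmonic z : ℝ) = ∑ m ∈ range z, 1 / ((m : ℝ) + 1) := by
      rw [harmonic]; push_cast; simp
    have h3 := harmonic_le_one_add_log z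
    rw [h2] at h3
    have h4 : ∑ m ∈ range z, (if m + 1 = 0 then (1 : ℝ) else 1 / (Q : ℝ) * (1 / ((m + 1 : ℕ) : ℝ))) =
        (1 / Q) * ∑ m ∈ range z, 1 / ((m : ℝ) + 1) := by
      rw [Finset.mul_sum]
      refine Finset.sum_congr rfl fun m _ => ?_
      rw [if_neg (by omega)]; push_cast; rfl
    rw [h4, if_pos rfl]
    have h5 : 1 / (Q : ℝ) * ∑ m ∈ range z, 1 / ((m : ℝ) + 1) ≤ 1 / (Q : ℝ) * (1 + Real.log z) := by
      gcongr
    have h6 : 1 / (Q : ℝ) ≤ 1 := by rw [div_le_one (by linarith)]; exact hQ'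
    linarith

lemma le_sum_inv_apSet (Q : ℕ) [NeZero Q] (r : ZMod Q) (z : ℕ) (hz : 1 ≤ z) :
    (1 / Q) * (Real.log z - Real.log Q) ≤ ∑ n ∈ apSet Q r z, (1 : ℝ) / n := by
  have hQ : 0 < Q := NeZero.pos Q
  have hQ' : (0 : ℝ) < Q := by exact_mod_cast hQ
  obtain ⟨ρ, hρ1, hρQ, hρ⟩ : ∃ ρ : ℕ, 1 ≤ ρ ∧ ρ ≤ Q ∧ (ρ : ZMod Q) = r := by
    by_cases h : r.val = 0
    · refine ⟨Q, hQ, le_rfl, ?_⟩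
      rw [ZMod.natCast_self, eq_comm, ← ZMod.val_eq_zero, h]
    · exact ⟨r.val, Nat.pos_of_ne_zero h, (ZMod.val_lt r).le, ZMod.natCast_zmod_val r⟩
  have hinj : Set.InjOn (fun m => ρ + Q * m) (range (z / Q) : Set ℕ) := by
    intro m _ m' _ h
    simpa [hQ.ne'] using h
  have hsub : (range (z / Q)).image (fun m => ρ + Q * m) ⊆ apSet Q r z := by
    intro n hn
    obtain ⟨m, hm, rfl⟩ := Finset.mem_image.1 hn
    rw [Finset.mem_range] at hm
    rw [mem_apSet]
    refine ⟨⟨by omega, ?_⟩, by push_cast; simp [hρ]⟩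
    calc ρ + Q * m ≤ Q + Q * m := by omega
      _ = Q * (m + 1) := by ring
      _ ≤ Q * (z / Q) := Nat.mul_le_mul_left _ hm
      _ ≤ z := Nat.mul_div_le z Q
  refine le_trans ?_ (Finset.sum_le_sum_of_subset_of_nonneg hsub (fun _ _ _ => by positivity))
  rw [Finset.sum_image hinj]
  have h1 : ∀ m ∈ range (z / Q), (1 / (Q : ℝ)) * (1 / ((m : ℝ) + 1)) ≤ 1 / ((ρ + Q * m : ℕ) : ℝ) := by
    intro m _
    rw [one_div_mul_one_div]
    apply one_div_le_one_div_of_le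
    · exact_mod_cast (by omega : 0 < ρ + Q * m)
    · have : ρ + Q * m ≤ Q * (m + 1) := by rw [mul_add]; omega
      exact_mod_cast this
  refine le_trans ?_ (Finset.sum_le_sum h1)
  rw [← Finset.mul_sum]
  have h2 : (harmonic (z / Q) : ℝ) = ∑ m ∈ range (z / Q), 1 / ((m : ℝ) + 1) := by
    rw [harmonic]; push_cast; simp
  rw [← h2]
  gcongr
  refine le_trans ?_ (log_add_one_le_harmonic (z / Q))
  have hz' : (0 : ℝ) < z := by exact_mod_cast hz
  rw [← Real.log_div hz'.ne' hQ'.ne']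
  apply Real.log_le_log (by positivity)
  rw [div_le_iff₀ hQ']
  have := Nat.lt_mul_of_div_lt (Nat.lt_succ_self (z / Q)) hQ
  rw [mul_comm] at this
  exact_mod_cast this.le.trans (mul_comm _ _).le

lemma sum_inv_apSet_dvd_le (Q : ℕ) [NeZero Q] (r : ZMod Q) (hr : IsUnit r) (z p : ℕ)
    (hp : p.Prime) :
    ∑ n ∈ (apSet Q r z).filter (p ∣ ·), (1 : ℝ) / n ≤ (1 / p) * (2 + (1 / Q) * Real.log z) := by
  have hp0 : 0 < p := hp.pos
  by_cases hu : IsUnit (p : ZMod Q)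
  · obtain ⟨u, hu⟩ := hu
    have hinj : Set.InjOn (fun n => n / p) ((apSet Q r z).filter (p ∣ ·) : Set ℕ) := by
      intro n hn m hm h
      have hn' := (Finset.mem_filter.1 hn).2
      have hm' := (Finset.mem_filter.1 hm).2
      have h' : n / p = m / p := h
      rw [← Nat.div_mul_cancel hn', ← Nat.div_mul_cancel hm', h']
    have hsub : ((apSet Q r z).filter (p ∣ ·)).image (fun n => n / p) ⊆
        apSet Q ((u⁻¹ : (ZMod Q)ˣ) * r) z := by
      intro m hm
      obtain ⟨n, hn, rfl⟩ := Finset.mem_image.1 hm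
      obtain ⟨hn1, c, rfl⟩ := Finset.mem_filter.1 hn
      obtain ⟨⟨h1, h2⟩, h3⟩ := mem_apSet.1 hn1
      simp only [Nat.mul_div_cancel_left c hp0]
      rw [mem_apSet]
      refine ⟨⟨?_, ?_⟩, ?_⟩
      · by_contra h; interval_cases c; simp at h1
      · exact (Nat.le_mul_of_pos_left c hp0).trans h2
      · rw [← h3]; push_cast; rw [← hu, Units.inv_mul_cancel_left]
    have h1 : ∀ n ∈ (apSet Q r z).filter (p ∣ ·), (1 : ℝ) / n =
        (1 / p) * (fun m : ℕ => (1 : ℝ) / m) (n / p) := by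
      intro n hn
      obtain ⟨_, c, rfl⟩ := Finset.mem_filter.1 hn
      simp only [Nat.mul_div_cancel_left c hp0]
      push_cast
      rw [one_div_mul_one_div]
    rw [Finset.sum_congr rfl h1, ← Finset.mul_sum,
      ← Finset.sum_image (f := fun m : ℕ => (1 : ℝ) / m) hinj]
    gcongr
    refine (Finset.sum_le_sum_of_subset_of_nonneg hsub (fun _ _ _ => by positivity)).trans ?_
    exact sum_inv_apSet_le Q _ z
  · have : (apSet Q r z).filter (p ∣ ·) = ∅ := by
      rw [Finset.filter_eq_empty_iff]
      rintro n hn ⟨c, rfl⟩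
      have h3 := (mem_apSet.1 hn).2
      push_cast at h3
      rw [← h3] at hr
      exact hu (isUnit_of_mul_isUnit_left hr)
    rw [this, Finset.sum_empty]
    have : 0 ≤ Real.log z := Real.log_natCast_nonneg z
    positivity

lemma sum_piFinset_dvd_pair_le {E : Type*} [Fintype E] (Q : ℕ) [NeZero Q] (R : E → ZMod Q)
    (hR : ∀ e, IsUnit (R e)) (z : ℕ) {e₁ e₂ : E} (he : e₁ ≠ e₂) {p : ℕ}
    (hp : p.Prime) :
    ∑ n ∈ (Fintype.piFinset (fun e => apSet Q (R e) z)).filter (fun n => p ∣ n e₁ ∧ p ∣ n e₂),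
      ∏ e, (1 : ℝ) / n e ≤
      (2 + (1 / Q) * Real.log z) ^ Fintype.card E * (1 / (p : ℝ) ^ 2) := by
  set U : ℝ := 2 + (1 / Q) * Real.log z with hU
  have hU0 : 0 ≤ U := by have := Real.log_natCast_nonneg z; positivity
  set G' : E → Finset ℕ := fun e => if e = e₁ ∨ e = e₂ then (apSet Q (R e) z).filter (p ∣ ·)
    else apSet Q (R e) z with hG'
  have hsub : (Fintype.piFinset (fun e => apSet Q (R e) z)).filter
      (fun n => p ∣ n e₁ ∧ p ∣ n e₂) ⊆ Fintype.piFinset G' := by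
    intro n hn
    obtain ⟨h1, h2, h3⟩ := Finset.mem_filter.1 hn
    rw [Fintype.mem_piFinset] at h1 ⊢
    intro e
    simp only [hG']
    split_ifs with h
    · refine Finset.mem_filter.2 ⟨h1 e, ?_⟩
      rcases h with rfl | rfl <;> assumption
    · exact h1 e
  refine (Finset.sum_le_sum_of_subset_of_nonneg hsub
    (fun _ _ _ => Finset.prod_nonneg fun _ _ => by positivity)).trans ?_
  rw [← Finset.prod_univ_sum G' (fun _ m => (1 : ℝ) / m)]
  calc ∏ e, ∑ m ∈ G' e, (1 : ℝ) / m ≤ ∏ e, (U * if e = e₁ ∨ e = e₂ then 1 / (p : ℝ) else 1) := by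
        refine Finset.prod_le_prod (fun _ _ => Finset.sum_nonneg fun _ _ => by positivity)
          fun e _ => ?_
        simp only [hG']
        split_ifs with h
        · rw [mul_comm]; exact sum_inv_apSet_dvd_le Q _ (hR e) z p hp
        · rw [mul_one]; exact sum_inv_apSet_le Q _ z
    _ = _ := by
        rw [Finset.prod_mul_distrib, Finset.prod_const, Finset.card_univ]
        congr 1
        rw [← Finset.prod_filter, Finset.prod_const]
        have : (univ : Finset E).filter (fun e => e = e₁ ∨ e = e₂) = {e₁, e₂} := by
          ext e; simp
        rw [this, Finset.card_pair he, one_div_pow]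

lemma sum_piFinset_coprime_ge {E : Type*} [Fintype E] (Q P₀ : ℕ) [NeZero Q] (R : E → ZMod Q)
    (hR : ∀ e, IsUnit (R e)) (hP₀ : 1 ≤ P₀) (hQ : ∀ p : ℕ, p.Prime → p ≤ P₀ → p ∣ Q)
    (z : ℕ) (hz : Q ≤ z) :
    ((1 / Q) * (Real.log z - Real.log Q)) ^ Fintype.card E -
      (Fintype.card E : ℝ) ^ 2 / P₀ * (2 + (1 / Q) * Real.log z) ^ Fintype.card E ≤
    ∑ n ∈ (Fintype.piFinset (fun e => apSet Q (R e) z)).filter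
      (fun n => ∀ e₁ e₂, e₁ ≠ e₂ → (n e₁).Coprime (n e₂)), ∏ e, (1 : ℝ) / n e := by
  have hQ0 : 0 < Q := NeZero.pos Q
  have hz1 : 1 ≤ z := hQ0.trans_le hz
  set U : ℝ := 2 + (1 / Q) * Real.log z with hU
  have hU0 : 0 ≤ U := by have := Real.log_natCast_nonneg z; positivity
  set G := Fintype.piFinset (fun e => apSet Q (R e) z) with hG
  set f : (E → ℕ) → ℝ := fun n => ∏ e, (1 : ℝ) / n e with hf
  have hf0 : ∀ n, 0 ≤ f n := fun n => Finset.prod_nonneg fun _ _ => by positivity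
  have hall : ((1 / Q) * (Real.log z - Real.log Q)) ^ Fintype.card E ≤ ∑ n ∈ G, f n := by
    rw [hG, hf, ← Finset.prod_univ_sum (fun e => apSet Q (R e) z) (fun _ m => (1 : ℝ) / m),
      ← Finset.card_univ, ← Finset.prod_const]
    refine Finset.prod_le_prod (fun e _ => ?_) (fun e _ => le_sum_inv_apSet Q (R e) z hz1)
    have : Real.log Q ≤ Real.log z :=
      Real.log_le_log (by exact_mod_cast hQ0) (by exact_mod_cast hz)
    exact mul_nonneg (by positivity) (by linarith)
  have hsplit := Finset.sum_filter_add_sum_filter_not G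
    (fun n => ∀ e₁ e₂, e₁ ≠ e₂ → (n e₁).Coprime (n e₂)) f
  set Pr := (Ioc P₀ z).filter Nat.Prime with hPr
  have hbad : ∑ n ∈ G.filter (fun n => ¬ ∀ e₁ e₂, e₁ ≠ e₂ → (n e₁).Coprime (n e₂)), f n ≤
      (Fintype.card E : ℝ) ^ 2 / P₀ * U ^ Fintype.card E := by
    calc _ ≤ ∑ n ∈ G, ∑ e₁ : E, ∑ e₂ : E, ∑ p ∈ Pr,
          (if e₁ ≠ e₂ ∧ p ∣ n e₁ ∧ p ∣ n e₂ then f n else 0) := by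
          rw [Finset.sum_filter]
          refine Finset.sum_le_sum fun n hn => ?_
          split_ifs with h
          swap
          · have hnn : ∀ e₁ e₂ : E, ∀ p : ℕ,
                0 ≤ (if e₁ ≠ e₂ ∧ p ∣ n e₁ ∧ p ∣ n e₂ then f n else 0) := by
              intro _ _ _; split_ifs; exacts [hf0 n, le_rfl]
            push Not at h
            obtain ⟨e₁, e₂, he, hc⟩ := h
            obtain ⟨p, hp, h1, h2⟩ := Nat.Prime.not_coprime_iff_dvd.1 hc
            have hn1 := mem_apSet.1 (Fintype.mem_piFinset.1 hn e₁)
            have hpP : p ∈ Pr := by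
              rw [hPr, Finset.mem_filter, Finset.mem_Ioc]
              refine ⟨⟨?_, (Nat.le_of_dvd hn1.1.1 h1).trans hn1.1.2⟩, hp⟩
              by_contra hle
              have hpQ := hQ p hp (not_lt.1 hle)
              have hu := hR e₁
              rw [← hn1.2, ZMod.isUnit_iff_coprime] at hu
              exact Nat.Prime.not_coprime_iff_dvd.2 ⟨p, hp, h1, hpQ⟩ hu
            calc f n = (if e₁ ≠ e₂ ∧ p ∣ n e₁ ∧ p ∣ n e₂ then f n else 0) := by
                  rw [if_pos ⟨he, h1, h2⟩]
              _ ≤ ∑ p ∈ Pr, (if e₁ ≠ e₂ ∧ p ∣ n e₁ ∧ p ∣ n e₂ then f n else 0) :=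
                  Finset.single_le_sum (f := fun p : ℕ =>
                    if e₁ ≠ e₂ ∧ p ∣ n e₁ ∧ p ∣ n e₂ then f n else 0)
                    (fun p _ => hnn e₁ e₂ p) hpP
              _ ≤ ∑ e₂ : E, ∑ p ∈ Pr, (if e₁ ≠ e₂ ∧ p ∣ n e₁ ∧ p ∣ n e₂ then f n else 0) :=
                  Finset.single_le_sum (f := fun e₂ : E => ∑ p ∈ Pr,
                    if e₁ ≠ e₂ ∧ p ∣ n e₁ ∧ p ∣ n e₂ then f n else 0)
                    (fun e₂ _ => Finset.sum_nonneg fun p _ => hnn e₁ e₂ p) (Finset.mem_univ e₂)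
              _ ≤ _ :=
                  Finset.single_le_sum (f := fun e₁ : E => ∑ e₂ : E, ∑ p ∈ Pr,
                    if e₁ ≠ e₂ ∧ p ∣ n e₁ ∧ p ∣ n e₂ then f n else 0)
                    (fun e₁ _ => Finset.sum_nonneg fun e₂ _ =>
                      Finset.sum_nonneg fun p _ => hnn e₁ e₂ p) (Finset.mem_univ e₁)
          · exact Finset.sum_nonneg fun e₁ _ => Finset.sum_nonneg fun e₂ _ =>
              Finset.sum_nonneg fun p _ => by split_ifs; exacts [hf0 n, le_rfl]
      _ = ∑ e₁ : E, ∑ e₂ : E, ∑ p ∈ Pr, ∑ n ∈ G,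
          (if e₁ ≠ e₂ ∧ p ∣ n e₁ ∧ p ∣ n e₂ then f n else 0) := by
          rw [Finset.sum_comm]
          refine Finset.sum_congr rfl fun e₁ _ => ?_
          rw [Finset.sum_comm]
          refine Finset.sum_congr rfl fun e₂ _ => ?_
          rw [Finset.sum_comm]
      _ ≤ ∑ e₁ : E, ∑ e₂ : E, ∑ p ∈ Pr, U ^ Fintype.card E * (1 / (p : ℝ) ^ 2) := by
          refine Finset.sum_le_sum fun e₁ _ => Finset.sum_le_sum fun e₂ _ =>
            Finset.sum_le_sum fun p hp => ?_
          by_cases he : e₁ = e₂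
          · simp only [he, ne_eq, not_true, false_and, if_false, Finset.sum_const_zero]
            positivity
          · simp only [ne_eq, he, not_false_eq_true, true_and]
            rw [← Finset.sum_filter]
            exact sum_piFinset_dvd_pair_le Q R hR z he (Finset.mem_filter.1 hp).2
      _ ≤ ∑ e₁ : E, ∑ e₂ : E, U ^ Fintype.card E * (1 / P₀) := by
          refine Finset.sum_le_sum fun e₁ _ => Finset.sum_le_sum fun e₂ _ => ?_
          rw [← Finset.mul_sum]
          gcongr
          exact sum_inv_sq_le hP₀ fun n hn => (Finset.mem_Ioc.1 (Finset.mem_filter.1 hn).1).1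
      _ = _ := by
          simp only [Finset.sum_const, Finset.card_univ, nsmul_eq_mul]; ring
  linarith

/-- The diagonal sum attached to the `2k`-th moment of `∑ n⁻ˢ` over `n ≤ y`, `n ≡ a (mod q)`. -/
noncomputable def diagSum (q : ℕ) (a : ZMod q) (k y : ℕ) : ℝ :=
  ∑ b ∈ Fintype.piFinset (fun _ : Fin k => apSet q a y),
    ∑ c ∈ Fintype.piFinset (fun _ : Fin k => apSet q a y),
      if ∏ i, b i = ∏ i, c i then 1 / ((∏ i, c i : ℕ) : ℝ) else 0

lemma sum_coprime_matrix_le_diagSum (q Q k z : ℕ) [NeZero q] [NeZero Q] (hqQ : q ∣ Q)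
    (a : ZMod q) (R : Fin k × Fin k → ZMod Q)
    (hR : ∀ i j, ZMod.castHom hqQ (ZMod q) (R (i, j)) = if i = j then a else 1) :
    ∑ n ∈ (Fintype.piFinset (fun e => apSet Q (R e) z)).filter
      (fun n => ∀ e₁ e₂, e₁ ≠ e₂ → (n e₁).Coprime (n e₂)), ∏ e, (1 : ℝ) / n e ≤
      diagSum q a k (z ^ k) := by
  set G := (Fintype.piFinset (fun e => apSet Q (R e) z)).filter
      (fun n => ∀ e₁ e₂, e₁ ≠ e₂ → (n e₁).Coprime (n e₂)) with hG
  set B : (Fin k × Fin k → ℕ) → (Fin k → ℕ) × (Fin k → ℕ) :=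
    fun n => (fun i => ∏ j, n (i, j), fun j => ∏ i, n (i, j)) with hB
  have hGm : ∀ n ∈ G, (∀ i j, 1 ≤ n (i, j) ∧ n (i, j) ≤ z ∧
      (n (i, j) : ZMod q) = if i = j then a else 1) := by
    intro n hn i j
    have h := mem_apSet.1 (Fintype.mem_piFinset.1 (Finset.mem_filter.1 hn).1 (i, j))
    refine ⟨h.1.1, h.1.2, ?_⟩
    rw [← hR, ← h.2, map_natCast]
  have hgcd : ∀ n ∈ G, ∀ i j, Nat.gcd ((B n).1 i) ((B n).2 j) = n (i, j) := by
    intro n hn i j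
    have hc := (Finset.mem_filter.1 hn).2
    simp only [hB]
    rw [← Finset.mul_prod_erase univ (fun j => n (i, j)) (Finset.mem_univ j),
      ← Finset.mul_prod_erase univ (fun i => n (i, j)) (Finset.mem_univ i), Nat.gcd_mul_left]
    have : Nat.Coprime (∏ j' ∈ univ.erase j, n (i, j')) (∏ i' ∈ univ.erase i, n (i', j)) := by
      refine Nat.Coprime.prod_left fun j' hj' => Nat.Coprime.prod_right fun i' hi' => ?_
      apply hc
      intro h
      rw [Prod.mk.injEq] at h
      exact (Finset.mem_erase.1 hj').1 h.2
    rw [Nat.coprime_iff_gcd_eq_one.1 this, mul_one]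
  have hinj : Set.InjOn B (G : Set (Fin k × Fin k → ℕ)) := by
    intro n hn m hm h
    ext ⟨i, j⟩
    rw [← hgcd n hn i j, ← hgcd m hm i j, h]
  have hprod : ∀ n : Fin k × Fin k → ℕ, ∏ j, (B n).2 j = ∏ e, n e := by
    intro n
    rw [Fintype.prod_prod_type_right]
  have hprod' : ∀ n : Fin k × Fin k → ℕ, ∏ j, (B n).1 j = ∏ e, n e := by
    intro n
    rw [Fintype.prod_prod_type]
  have hsub : G.image B ⊆ (Fintype.piFinset (fun _ : Fin k => apSet q a (z ^ k))) ×ˢ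
      (Fintype.piFinset (fun _ : Fin k => apSet q a (z ^ k))) := by
    intro bc hbc
    obtain ⟨n, hn, rfl⟩ := Finset.mem_image.1 hbc
    have h := hGm n hn
    rw [Finset.mem_product, Fintype.mem_piFinset, Fintype.mem_piFinset]
    refine ⟨fun i => mem_apSet.2 ⟨⟨?_, ?_⟩, ?_⟩, fun j => mem_apSet.2 ⟨⟨?_, ?_⟩, ?_⟩⟩
    · show 1 ≤ ∏ j, n (i, j)
      exact Nat.one_le_iff_ne_zero.2 (Finset.prod_ne_zero_iff.2 fun j _ =>
        Nat.one_le_iff_ne_zero.1 (h i j).1)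
    · show ∏ j, n (i, j) ≤ z ^ k
      exact (Finset.prod_le_prod' (g := fun _ => z) fun j _ => (h i j).2.1).trans (by simp)
    · simp only [hB]; push_cast
      rw [Finset.prod_congr rfl fun j _ => (h i j).2.2, Finset.prod_ite_eq univ i, if_pos (Finset.mem_univ i)]
    · show 1 ≤ ∏ i, n (i, j)
      exact Nat.one_le_iff_ne_zero.2 (Finset.prod_ne_zero_iff.2 fun i _ =>
        Nat.one_le_iff_ne_zero.1 (h i j).1)
    · show ∏ i, n (i, j) ≤ z ^ k
      exact (Finset.prod_le_prod' (g := fun _ => z) fun i _ => (h i j).2.1).trans (by simp)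
    · simp only [hB]; push_cast
      rw [Finset.prod_congr rfl fun i _ => (h i j).2.2, Finset.prod_ite_eq' univ j, if_pos (Finset.mem_univ j)]
  rw [diagSum, ← Finset.sum_product']
  refine le_trans (le_of_eq ?_) (Finset.sum_le_sum_of_subset_of_nonneg hsub
    (fun _ _ _ => by split_ifs <;> positivity))
  rw [Finset.sum_image hinj]
  refine Finset.sum_congr rfl fun n _ => ?_
  rw [if_pos ((hprod' n).trans (hprod n).symm), hprod, Finset.prod_div_distrib]
  simp


lemma exists_le_diagSum (q k : ℕ) [NeZero q] (hk : 1 ≤ k) (a : ZMod q) (ha : IsUnit a) :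
    ∃ c : ℝ, 0 < c ∧ ∃ z₀ : ℕ, ∀ z : ℕ, z₀ ≤ z →
      c * Real.log z ^ (k ^ 2) ≤ diagSum q a k (z ^ k) := by
  obtain ⟨K, hK⟩ : ∃ K, K = k ^ 2 := ⟨_, rfl⟩
  rw [← hK]
  have hK1 : 1 ≤ K := hK ▸ Nat.one_le_pow _ _ hk
  obtain ⟨P₀, hP₀⟩ : ∃ P, P = 2 * 4 ^ K * K ^ 2 := ⟨_, rfl⟩
  have hP₀1 : 1 ≤ P₀ := by rw [hP₀]; exact Nat.one_le_iff_ne_zero.2 (by positivity)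
  obtain ⟨Q, hQ⟩ : ∃ Q, Q = q * P₀.factorial := ⟨_, rfl⟩
  have hQ0 : Q ≠ 0 := hQ ▸ mul_ne_zero (NeZero.ne q) (Nat.factorial_ne_zero _)
  have : NeZero Q := ⟨hQ0⟩
  have hqQ : q ∣ Q := Dvd.intro _ hQ.symm
  obtain ⟨u, rfl⟩ := ha
  obtain ⟨v, hv⟩ := ZMod.unitsMap_surjective hqQ u
  set R : Fin k × Fin k → ZMod Q := fun e => if e.1 = e.2 then (v : ZMod Q) else 1 with hR
  have hRu : ∀ e, IsUnit (R e) := by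
    intro e; simp only [hR]; split_ifs
    · exact v.isUnit
    · exact isUnit_one
  have hRc : ∀ i j, ZMod.castHom hqQ (ZMod q) (R (i, j)) = if i = j then (u : ZMod q) else 1 := by
    intro i j; simp only [hR]
    split_ifs with h
    · rw [← hv]; rfl
    · exact map_one _
  have hdvd : ∀ p : ℕ, p.Prime → p ≤ P₀ → p ∣ Q := by
    intro p hp hle
    rw [hQ]
    exact Dvd.dvd.mul_left (Nat.dvd_factorial hp.pos hle) q
  clear hQ
  have hQr : (0 : ℝ) < Q := by exact_mod_cast Nat.pos_of_ne_zero hQ0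
  have htend : Tendsto (fun z : ℕ => Real.log z) atTop atTop :=
    Real.tendsto_log_atTop.comp tendsto_natCast_atTop_atTop
  obtain ⟨z₀, hz₀⟩ := ((htend.eventually_ge_atTop (2 * Real.log Q)).and
    (htend.eventually_ge_atTop (2 * Q : ℝ))).exists_forall_of_atTop
  refine ⟨1 / 2 * (1 / (2 * Q)) ^ K, by positivity, max z₀ Q, fun z hz => ?_⟩
  obtain ⟨h1, h2⟩ := hz₀ z ((le_max_left _ _).trans hz)
  have hcard : Fintype.card (Fin k × Fin k) = K := by simp [hK, sq]
  have h3 := sum_piFinset_coprime_ge Q P₀ R hRu hP₀1 hdvd z ((le_max_right _ _).trans hz)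
  refine le_trans ?_ (le_trans (le_trans h3 (le_of_eq ?_))
    (sum_coprime_matrix_le_diagSum q Q k z hqQ u R hRc))
  swap
  · congr
    exact Subsingleton.elim _ _
  rw [hcard]
  set L := Real.log z with hL
  have hL0 : 0 ≤ L := by positivity
  have h5 : (1 / (2 * Q) * L) ^ K ≤ (1 / Q * (L - Real.log Q)) ^ K := by
    apply pow_le_pow_left₀ (by positivity)
    rw [div_mul_eq_mul_div, div_mul_eq_mul_div, div_le_div_iff₀ (by positivity) hQr]
    nlinarith
  have h6 : (2 + 1 / Q * L) ^ K ≤ (4 * (1 / (2 * Q) * L)) ^ K := by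
    apply pow_le_pow_left₀ (by positivity)
    have : 2 ≤ 1 / Q * L := by
      rw [div_mul_eq_mul_div, le_div_iff₀ hQr]; linarith
    have h7 : 4 * (1 / (2 * Q) * L) = 2 * (1 / Q * L) := by field_simp; norm_num
    rw [h7]; linarith
  have h8 : (K : ℝ) ^ 2 / P₀ * (4 * (1 / (2 * Q) * L)) ^ K = 1 / 2 * (1 / (2 * Q) * L) ^ K := by
    rw [mul_pow, hP₀]
    have : (K : ℝ) ≠ 0 := by positivity
    push_cast
    field_simp
  have h9 : (K : ℝ) ^ 2 / P₀ * (2 + 1 / Q * L) ^ K ≤ 1 / 2 * (1 / (2 * Q) * L) ^ K := by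
    rw [← h8]; gcongr
  rw [mul_assoc, ← mul_pow]
  linarith

/-- `(s - 1)` times the difference between `x⁻ˢ` and `∫ u⁻ˢ du` over `[x, x + 1]`. -/
noncomputable def emTerm (x : ℝ) (s : ℂ) : ℂ :=
  (s - 1) * (x : ℂ) ^ (-s) - ((x : ℂ) ^ (1 - s) - ((x + 1 : ℝ) : ℂ) ^ (1 - s))

lemma norm_cpow_neg_sub_le {x u : ℝ} {s : ℂ} (hx : 0 < x) (hs : 0 ≤ s.re) (hxu : x ≤ u)
    (hux : u ≤ x + 1) : ‖(x : ℂ) ^ (-s) - (u : ℂ) ^ (-s)‖ ≤ ‖s‖ * x ^ (-s.re - 1) := by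
  have hd : ∀ v ∈ Set.Icc x u, HasDerivWithinAt (fun v : ℝ => (v : ℂ) ^ (-s))
      (-s * (v : ℂ) ^ (-s - 1)) (Set.Icc x u) v := by
    intro v hv
    have hv0 : (0 : ℝ) < v := hx.trans_le hv.1
    by_cases h0 : s = 0
    · subst h0; simpa using hasDerivWithinAt_const v (Set.Icc x u) (1 : ℂ)
    · exact (hasDerivAt_ofReal_cpow_const hv0.ne' (neg_ne_zero.2 h0)).hasDerivWithinAt
  have hb : ∀ v ∈ Set.Icc x u, ‖-s * (v : ℂ) ^ (-s - 1)‖ ≤ ‖s‖ * x ^ (-s.re - 1) := by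
    intro v hv
    have hv0 : (0 : ℝ) < v := hx.trans_le hv.1
    rw [norm_mul, norm_neg, norm_cpow_eq_rpow_re_of_pos hv0]
    gcongr
    simp only [sub_re, neg_re, one_re]
    exact Real.rpow_le_rpow_of_nonpos hx hv.1 (by linarith)
  have := (convex_Icc x u).norm_image_sub_le_of_norm_hasDerivWithin_le hd hb
    (Set.left_mem_Icc.2 hxu) (Set.right_mem_Icc.2 hxu)
  rw [norm_sub_rev]
  refine this.trans ?_
  rw [Real.norm_eq_abs, abs_of_nonneg (by linarith)]
  have : 0 ≤ ‖s‖ * x ^ (-s.re - 1) := by positivity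
  nlinarith

lemma norm_emTerm_le {x : ℝ} {s : ℂ} (hx : 0 < x) (hs : 0 ≤ s.re) :
    ‖emTerm x s‖ ≤ ‖s - 1‖ * ‖s‖ * x ^ (-s.re - 1) := by
  by_cases h1 : s = 1
  · subst h1; simp [emTerm]
  have h1' : 1 - s ≠ 0 := sub_ne_zero.2 (Ne.symm h1)
  have hd : ∀ v ∈ Set.Icc x (x + 1), HasDerivWithinAt
      (fun v : ℝ => (s - 1) * ((v : ℂ) * (x : ℂ) ^ (-s)) + (v : ℂ) ^ (1 - s))
      ((s - 1) * ((x : ℂ) ^ (-s) - (v : ℂ) ^ (-s))) (Set.Icc x (x + 1)) v := by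
    intro v hv
    have hv0 : (0 : ℝ) < v := hx.trans_le hv.1
    have h3 := hasDerivAt_ofReal_cpow_const hv0.ne' h1'
    have h4 : HasDerivAt (fun v : ℝ => (v : ℂ)) 1 v := ofRealCLM.hasDerivAt
    have h5 := ((h4.mul_const ((x : ℂ) ^ (-s))).const_mul (s - 1)).add h3
    refine (h5.hasDerivWithinAt (s := Set.Icc x (x + 1))).congr_deriv ?_
    rw [show 1 - s - 1 = -s by ring]
    ring
  have hb : ∀ v ∈ Set.Icc x (x + 1), ‖(s - 1) * ((x : ℂ) ^ (-s) - (v : ℂ) ^ (-s))‖ ≤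
      ‖s - 1‖ * ‖s‖ * x ^ (-s.re - 1) := by
    intro v hv
    rw [norm_mul, mul_assoc]
    gcongr
    exact norm_cpow_neg_sub_le hx hs hv.1 hv.2
  have := (convex_Icc x (x + 1)).norm_image_sub_le_of_norm_hasDerivWithin_le hd hb
    (Set.left_mem_Icc.2 (by linarith)) (Set.right_mem_Icc.2 (by linarith))
  rw [add_sub_cancel_left, norm_one, mul_one] at this
  refine le_trans (le_of_eq ?_) this
  rw [emTerm]; congr 1; push_cast; ring

lemma differentiable_emTerm {x : ℝ} (hx : 0 < x) : Differentiable ℂ (emTerm x) := by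
  have h1 : (x : ℂ) ≠ 0 := by exact_mod_cast hx.ne'
  have h2 : ((x + 1 : ℝ) : ℂ) ≠ 0 := by exact_mod_cast (by linarith : x + 1 ≠ 0)
  intro s
  unfold emTerm
  refine DifferentiableAt.sub (DifferentiableAt.mul (by fun_prop) ?_) (DifferentiableAt.sub ?_ ?_)
  · exact DifferentiableAt.const_cpow (by fun_prop) (Or.inl h1)
  · exact DifferentiableAt.const_cpow (by fun_prop) (Or.inl h1)
  · exact DifferentiableAt.const_cpow (by fun_prop) (Or.inl h2)

lemma summable_add_rpow {α σ : ℝ} (hα : 0 < α) (hσ : 0 < σ) :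
    Summable (fun n : ℕ => ((n : ℝ) + α) ^ (-σ - 1)) := by
  have h := (Real.summable_nat_rpow (p := -σ - 1)).2 (by linarith)
  rw [← summable_nat_add_iff 1] at h ⊢
  refine Summable.of_nonneg_of_le (fun n => by positivity) (fun n => ?_) h
  apply Real.rpow_le_rpow_of_nonpos (by positivity) (by linarith) (by linarith)

lemma summable_emTerm {α : ℝ} (hα : 0 < α) {s : ℂ} (hs : 0 < s.re) :
    Summable (fun n : ℕ => emTerm (n + α) s) := by
  refine Summable.of_norm_bounded ((summable_add_rpow hα hs).mul_left (‖s - 1‖ * ‖s‖)) fun n => ?_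
  exact norm_emTerm_le (by positivity) hs.le

lemma differentiableOn_tsum_emTerm {α : ℝ} (hα : 0 < α) :
    DifferentiableOn ℂ (fun s => ∑' n : ℕ, emTerm (n + α) s) {s | 0 < s.re} := by
  intro s₀ hs₀
  have hs₀' : 0 < s₀.re := hs₀
  set U : Set ℂ := {s | s₀.re / 2 < s.re} ∩ Metric.ball 0 (‖s₀‖ + 1) with hU
  have hUo : IsOpen U := (isOpen_lt continuous_const continuous_re).inter Metric.isOpen_ball
  have hsU : s₀ ∈ U := ⟨by show s₀.re / 2 < s₀.re; linarith, by simp⟩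
  have hone : ∀ n : ℕ, ∀ σ, s₀.re / 2 < σ → σ ≤ ‖s₀‖ + 1 → ((n : ℝ) + α) ^ (-σ - 1) ≤
      (1 + α ^ (-(‖s₀‖ + 1) - 1)) * ((n : ℝ) + α) ^ (-(s₀.re / 2) - 1) + 
      (if n = 0 then α ^ (-(‖s₀‖ + 1) - 1) else 0) := by
    intro n σ h1 h2
    have hp : (0:ℝ) < n + α := by positivity
    by_cases h : 1 ≤ (n : ℝ) + α
    · have h3 : ((n : ℝ) + α) ^ (-σ - 1) ≤ ((n : ℝ) + α) ^ (-(s₀.re / 2) - 1) :=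
        Real.rpow_le_rpow_of_exponent_le h (by linarith)
      have h4 : 0 ≤ α ^ (-(‖s₀‖ + 1) - 1) := by positivity
      have h5 : 0 ≤ ((n : ℝ) + α) ^ (-(s₀.re / 2) - 1) := by positivity
      have h6 : (0 : ℝ) ≤ (if n = 0 then α ^ (-(‖s₀‖ + 1) - 1) else 0) := by
        split_ifs; exacts [h4, le_rfl]
      nlinarith
    · have hn : n = 0 := by
        by_contra hn
        have : (1 : ℝ) ≤ n := by exact_mod_cast Nat.one_le_iff_ne_zero.2 hn
        linarith
      subst hn
      simp only [Nat.cast_zero, zero_add, if_true] at h ⊢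
      have h3 : α ^ (-σ - 1) ≤ α ^ (-(‖s₀‖ + 1) - 1) :=
        Real.rpow_le_rpow_of_exponent_ge hα (by linarith) (by linarith)
      have : 0 ≤ (1 + α ^ (-(‖s₀‖ + 1) - 1)) * α ^ (-(s₀.re / 2) - 1) := by positivity
      linarith
  have hsum : Summable (fun n : ℕ => ((‖s₀‖ + 1) + 1) * (‖s₀‖ + 1) *
      ((1 + α ^ (-(‖s₀‖ + 1) - 1)) * ((n : ℝ) + α) ^ (-(s₀.re / 2) - 1) + 
      (if n = 0 then α ^ (-(‖s₀‖ + 1) - 1) else 0))) := by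
    refine Summable.mul_left _ (((summable_add_rpow hα (by linarith)).mul_left _).add ?_)
    exact summable_of_ne_finset_zero (s := {0}) (by intro n hn; simp at hn; simp [hn])
  have := differentiableOn_tsum_of_summable_norm hsum (F := fun (n : ℕ) (s : ℂ) => emTerm (n + α) s) (U := U)
    (fun n => (differentiable_emTerm (by positivity)).differentiableOn) hUo (by
      rintro n s ⟨h1, h2⟩
      have h1' : s₀.re / 2 < s.re := h1
      have h2' : ‖s‖ < ‖s₀‖ + 1 := by simpa using h2
      refine (norm_emTerm_le (by positivity) (by linarith)).trans ?_
      have h3 : s.re ≤ ‖s‖ := re_le_norm s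
      gcongr
      · refine (norm_sub_le _ _).trans ?_
        rw [norm_one]; linarith
      · exact hone n s.re h1' (by linarith))
  exact (this.differentiableAt (hUo.mem_nhds hsU)).differentiableWithinAt

lemma preconnected_re_pos : IsPreconnected {s : ℂ | 0 < s.re} :=
  (convex_halfSpace_re_gt 0).isPreconnected

lemma sub_one_mul_hurwitzZeta_eq {α : ℝ} (hα : 0 < α) (hα1 : α ≤ 1) {s : ℂ} (hs : 0 < s.re)
    (hs1 : s ≠ 1) : (s - 1) * hurwitzZeta (α : UnitAddCircle) s =
      (α : ℂ) ^ (1 - s) + ∑' n : ℕ, emTerm (n + α) s := by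
  set g : ℂ → ℂ := fun s => (α : ℂ) ^ (1 - s) + ∑' n : ℕ, emTerm (n + α) s with hg
  set f : ℂ → ℂ := Function.update (fun s => (s - 1) * hurwitzZeta (α : UnitAddCircle) s) 1 1 with hf
  have hα0 : (α : ℂ) ≠ 0 := by exact_mod_cast hα.ne'
  have hgd : DifferentiableOn ℂ g {s | 0 < s.re} := by
    refine DifferentiableOn.add ?_ (differentiableOn_tsum_emTerm hα)
    exact fun s _ => (DifferentiableAt.const_cpow (by fun_prop) (Or.inl hα0)).differentiableWithinAt
  have hfd : Differentiable ℂ f := by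
    have hne : ∀ s : ℂ, s ≠ 1 → DifferentiableAt ℂ f s := by
      intro s hs
      have h1 : DifferentiableAt ℂ (fun s => (s - 1) * hurwitzZeta (α : UnitAddCircle) s) s :=
        DifferentiableAt.mul (by fun_prop) (differentiableAt_hurwitzZeta _ hs)
      refine h1.congr_of_eventuallyEq ?_
      filter_upwards [isOpen_ne.mem_nhds hs] with w hw
      exact Function.update_of_ne hw _ _
    intro s
    by_cases hs : s = 1
    · subst hs
      refine (Complex.analyticAt_of_differentiable_on_punctured_nhds_of_continuousAt ?_ ?_).differentiableAt
      · exact eventually_nhdsWithin_of_forall fun w hw => hne w hw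
      · exact continuousAt_update_same.2 (hurwitzZeta_residue_one _)
    · exact hne s hs
  have hopen : IsOpen {s : ℂ | 0 < s.re} := isOpen_lt continuous_const continuous_re
  have hfa : AnalyticOnNhd ℂ f {s | 0 < s.re} := hfd.differentiableOn.analyticOnNhd hopen
  have hga : AnalyticOnNhd ℂ g {s | 0 < s.re} := hgd.analyticOnNhd hopen
  have hev : f =ᶠ[nhds (2 : ℂ)] g := by
    have hopen1 : IsOpen {s : ℂ | 1 < s.re} := isOpen_lt continuous_const continuous_re
    filter_upwards [hopen1.mem_nhds (show (2 : ℂ) ∈ {s : ℂ | 1 < s.re} by simp)] with s hs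
    have hs' : 1 < s.re := hs
    have hsne : s ≠ 1 := by rintro rfl; simp at hs'
    rw [hf, Function.update_of_ne hsne, hg]
    have h1 := (hasSum_hurwitzZeta_of_one_lt_re (a := α) ⟨hα.le, hα1⟩ hs').mul_left (s - 1)
    have h2 := summable_emTerm hα (s := s) (by linarith)
    have h3 := h1.sub h2.hasSum
    have h4 : ∀ n : ℕ, (s - 1) * (1 / ((n : ℂ) + α) ^ s) - emTerm (n + α) s =
        (((n : ℝ) + α : ℝ) : ℂ) ^ (1 - s) - ((((n + 1 : ℕ) : ℝ) + α : ℝ) : ℂ) ^ (1 - s) := by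
      intro n
      rw [emTerm, cpow_neg]; push_cast
      rw [show (n : ℂ) + α + 1 = n + 1 + α by ring]; ring
    simp only [h4] at h3
    have h5 := h3.tendsto_sum_nat
    simp only [Finset.sum_range_sub'] at h5
    have h6 : Tendsto (fun n : ℕ => (((0 : ℕ) : ℝ) + α : ℝ) ^ (1 - s) - (((n : ℝ) + α : ℝ) : ℂ) ^ (1 - s))
        atTop (nhds ((((0 : ℕ) : ℝ) + α : ℝ) ^ (1 - s) - 0)) := by
      refine tendsto_const_nhds.sub ?_
      rw [tendsto_zero_iff_norm_tendsto_zero]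
      have h7 : ∀ n : ℕ, ‖(((n : ℝ) + α : ℝ) : ℂ) ^ (1 - s)‖ = ((n : ℝ) + α) ^ (-(s.re - 1)) := by
        intro n
        rw [norm_cpow_eq_rpow_re_of_pos (by positivity)]
        simp
      simp only [h7]
      exact (tendsto_rpow_neg_atTop (by linarith)).comp
        (tendsto_atTop_add_const_right _ _ tendsto_natCast_atTop_atTop)
    have h8 := tendsto_nhds_unique h5 h6
    rw [sub_eq_iff_eq_add] at h8
    rw [h8]; simp
  have := hfa.eqOn_of_preconnected_of_eventuallyEq hga preconnected_re_pos
    (show (2 : ℂ) ∈ {s : ℂ | 0 < s.re} by simp) hev hs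
  rw [hf, Function.update_of_ne hs1] at this
  exact this

lemma sub_one_mul_hurwitzZeta_eq_sum {α : ℝ} (hα : 0 < α) (hα1 : α ≤ 1) {s : ℂ} (hs : 0 < s.re)
    (hs1 : s ≠ 1) (N : ℕ) : (s - 1) * hurwitzZeta (α : UnitAddCircle) s =
      (s - 1) * ∑ n ∈ range N, (((n : ℝ) + α : ℝ) : ℂ) ^ (-s) + (((N : ℝ) + α : ℝ) : ℂ) ^ (1 - s) +
        ∑' n : ℕ, emTerm (((n + N : ℕ) : ℝ) + α) s := by
  rw [sub_one_mul_hurwitzZeta_eq hα hα1 hs hs1,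
    ← (summable_emTerm hα hs).sum_add_tsum_nat_add N]
  have : ∑ n ∈ range N, emTerm (n + α) s = (s - 1) * ∑ n ∈ range N, (((n : ℝ) + α : ℝ) : ℂ) ^ (-s)
      - ((α : ℂ) ^ (1 - s) - (((N : ℝ) + α : ℝ) : ℂ) ^ (1 - s)) := by
    have h := Finset.sum_range_sub' (fun n : ℕ => (((n : ℝ) + α : ℝ) : ℂ) ^ (1 - s)) N
    simp only [Nat.cast_zero, zero_add] at h
    rw [← h, Finset.mul_sum, ← Finset.sum_sub_distrib]
    refine Finset.sum_congr rfl fun n _ => ?_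
    rw [emTerm]; push_cast
    rw [show (n : ℂ) + α + 1 = n + 1 + α by ring]
  rw [this]; ring

lemma norm_tsum_emTerm_le {α : ℝ} (hα : 0 < α) {s : ℂ} (hs : 0 < s.re) (N : ℕ) {b : ℕ → ℝ}
    (hb : Summable b) (h : ∀ n : ℕ, (((n + N : ℕ) : ℝ) + α) ^ (-s.re - 1) ≤ b n) :
    ‖∑' n : ℕ, emTerm (((n + N : ℕ) : ℝ) + α) s‖ ≤ ‖s - 1‖ * ‖s‖ * ∑' n, b n := by
  rw [← tsum_mul_left]
  refine tsum_of_norm_bounded (hb.mul_left _).hasSum fun n => ?_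
  refine (norm_emTerm_le (by positivity) hs.le).trans ?_
  gcongr
  exact h n

lemma rpow_neg_le_mul_rpow_neg {α y u v w : ℝ} (hα : 0 < α) (hα1 : α ≤ 1) (hy : α ≤ y)
    (h0 : 0 ≤ u) (huv : u ≤ v) (hvw : v ≤ w) : y ^ (-v) ≤ α ^ (-w) * y ^ (-u) := by
  have hy0 : 0 < y := hα.trans_le hy
  by_cases h : 1 ≤ y
  · have h1 : y ^ (-v) ≤ y ^ (-u) := Real.rpow_le_rpow_of_exponent_le h (by linarith)
    have h2 : 1 ≤ α ^ (-w) := Real.one_le_rpow_of_pos_of_le_one_of_nonpos hα hα1 (by linarith)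
    have h3 : 0 ≤ y ^ (-u) := by positivity
    nlinarith
  · push Not at h
    have h1 : y ^ (-v) ≤ α ^ (-v) := Real.rpow_le_rpow_of_nonpos hα hy (by linarith)
    have h2 : α ^ (-v) ≤ α ^ (-w) := Real.rpow_le_rpow_of_exponent_ge hα hα1 (by linarith)
    have h3 : 1 ≤ y ^ (-u) := Real.one_le_rpow_of_pos_of_le_one_of_nonpos hy0 h.le (by linarith)
    have h4 : 0 ≤ α ^ (-w) := by positivity
    nlinarith

lemma exists_norm_sub_one_mul_hurwitzZeta_le {α : ℝ} (hα : 0 < α) (hα1 : α ≤ 1) :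
    ∃ C : ℝ, 0 < C ∧ ∀ s : ℂ, 1 / 10 ≤ s.re → s.re ≤ 4 →
      ‖(s - 1) * hurwitzZeta (α : UnitAddCircle) s‖ ≤ C * (1 + ‖s‖) ^ 2 := by
  have hsum := summable_add_rpow hα (show (0 : ℝ) < 1 / 10 by norm_num)
  set S : ℝ := ∑' n : ℕ, ((n : ℝ) + α) ^ (-(1 / 10 : ℝ) - 1) with hS
  have hS0 : 0 ≤ S := tsum_nonneg fun n => by positivity
  refine ⟨α ^ (-3 : ℝ) + α ^ (-5 : ℝ) * S, by positivity, fun s h1 h2 => ?_⟩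
  by_cases hs1 : s = 1
  · subst hs1; simp only [sub_self, zero_mul, norm_zero]; positivity
  rw [sub_one_mul_hurwitzZeta_eq hα hα1 (by linarith) hs1]
  have h3 := norm_tsum_emTerm_le hα (s := s) (by linarith) 0 (hsum.mul_left (α ^ (-5 : ℝ))) (fun n => by
    have := rpow_neg_le_mul_rpow_neg (u := 1 / 10 + 1) (v := s.re + 1) (w := 5) (y := (n : ℝ) + α)
      hα hα1 (by simp) (by norm_num) (by linarith) (by linarith)
    rw [neg_add', neg_add'] at this
    simpa using this)
  rw [tsum_mul_left, ← hS] at h3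
  simp only [add_zero] at h3
  have h4 : ‖(α : ℂ) ^ (1 - s)‖ ≤ α ^ (-3 : ℝ) := by
    rw [norm_cpow_eq_rpow_re_of_pos hα]
    apply Real.rpow_le_rpow_of_exponent_ge hα hα1
    simp; linarith
  have h5 : ‖s - 1‖ ≤ 1 + ‖s‖ := by
    refine (norm_sub_le _ _).trans ?_
    rw [norm_one]; linarith
  have h6 : ‖s - 1‖ * ‖s‖ ≤ (1 + ‖s‖) ^ 2 := by
    rw [sq]; gcongr; linarith
  have h7 : 1 ≤ (1 + ‖s‖) ^ 2 := one_le_pow₀ (by linarith [norm_nonneg s])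
  refine (norm_add_le _ _).trans ?_
  have h8 : 0 ≤ α ^ (-5 : ℝ) * S := by positivity
  have h9 : 0 ≤ α ^ (-3 : ℝ) := by positivity
  nlinarith [mul_le_mul_of_nonneg_right h6 h8, mul_le_mul_of_nonneg_left h7 h9]

lemma exists_norm_hurwitzZeta_le {α : ℝ} (hα : 0 < α) (hα1 : α ≤ 1) :
    ∃ C : ℝ, 0 < C ∧ ∀ s : ℂ, 1 / 2 ≤ s.re → s.re ≤ 2 → 1 ≤ |s.im| →
      ‖hurwitzZeta (α : UnitAddCircle) s‖ ≤ C * |s.im| ^ (3 / 4 : ℝ) := by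
  have hsum := summable_add_rpow hα (show (0 : ℝ) < 1 / 4 by norm_num)
  set S : ℝ := ∑' n : ℕ, ((n : ℝ) + α) ^ (-(1 / 4 : ℝ) - 1) with hS
  have hS0 : 0 ≤ S := tsum_nonneg fun n => by positivity
  refine ⟨2 * α ^ (-2 : ℝ) * S + 3 + 3 * S, by positivity, fun s h1 h2 h3 => ?_⟩
  set τ := |s.im| with hτ
  have hτ0 : 0 < τ := by linarith
  have hs1 : s ≠ 1 := by rintro rfl; simp at hτ; linarith
  set N := ⌈τ⌉₊ with hN
  have hN1 : τ ≤ N := Nat.le_ceil τ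
  have hN2 : (N : ℝ) ≤ 2 * τ := by have := Nat.ceil_lt_add_one hτ0.le; linarith
  have hNpos : (0 : ℝ) < N := by linarith
  have hsτ : ‖s‖ ≤ 3 * τ := by
    refine (norm_le_abs_re_add_abs_im s).trans ?_
    rw [abs_of_nonneg (by linarith)]; linarith
  have hs1τ : τ ≤ ‖s - 1‖ := by
    have := abs_im_le_norm (s - 1)
    simpa using this
  have hn0 : 0 < ‖s - 1‖ := by linarith
  have hkey := sub_one_mul_hurwitzZeta_eq_sum hα hα1 (s := s) (by linarith) hs1 N
  -- the finite sum
  have e1 : ‖∑ n ∈ range N, (((n : ℝ) + α : ℝ) : ℂ) ^ (-s)‖ ≤ 2 * α ^ (-2 : ℝ) * S * τ ^ (3 / 4 : ℝ) := by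
    have h4 : ∀ n ∈ range N, ‖(((n : ℝ) + α : ℝ) : ℂ) ^ (-s)‖ ≤
        (α ^ (-2 : ℝ) * (N : ℝ) ^ (3 / 4 : ℝ)) * ((n : ℝ) + α) ^ (-(1 / 4 : ℝ) - 1) := by
      intro n hn
      have hn' : (n : ℝ) + 1 ≤ N := by exact_mod_cast Finset.mem_range.1 hn
      have hp : 0 < (n : ℝ) + α := by positivity
      rw [norm_cpow_eq_rpow_re_of_pos hp, neg_re]
      have := rpow_neg_le_mul_rpow_neg (u := 1 / 2) (v := s.re) (w := 2) (y := (n : ℝ) + α)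
        hα hα1 (by simp) (by norm_num) h1 h2
      refine this.trans ?_
      rw [mul_assoc]
      gcongr
      calc ((n : ℝ) + α) ^ (-(1 / 2) : ℝ) =
          ((n : ℝ) + α) ^ (3 / 4 : ℝ) * ((n : ℝ) + α) ^ (-(1 / 4 : ℝ) - 1) := by
            rw [← Real.rpow_add hp]; norm_num
        _ ≤ _ := by gcongr; linarith
    refine (norm_sum_le _ _).trans ((Finset.sum_le_sum h4).trans ?_)
    rw [← Finset.mul_sum]
    have h5 : ∑ n ∈ range N, ((n : ℝ) + α) ^ (-(1 / 4 : ℝ) - 1) ≤ S :=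
      hsum.sum_le_tsum _ fun n _ => by positivity
    have h6 : (N : ℝ) ^ (3 / 4 : ℝ) ≤ 2 * τ ^ (3 / 4 : ℝ) := by
      calc (N : ℝ) ^ (3 / 4 : ℝ) ≤ (2 * τ) ^ (3 / 4 : ℝ) := by gcongr
        _ = 2 ^ (3 / 4 : ℝ) * τ ^ (3 / 4 : ℝ) := Real.mul_rpow (by norm_num) hτ0.le
        _ ≤ 2 ^ (1 : ℝ) * τ ^ (3 / 4 : ℝ) := by
            gcongr <;> norm_num
        _ = _ := by rw [Real.rpow_one]
    calc α ^ (-2 : ℝ) * (N : ℝ) ^ (3 / 4 : ℝ) * ∑ n ∈ range N, ((n : ℝ) + α) ^ (-(1 / 4 : ℝ) - 1)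
        ≤ α ^ (-2 : ℝ) * (2 * τ ^ (3 / 4 : ℝ)) * S := by gcongr
      _ = _ := by ring
  have hτ34 : 1 ≤ τ ^ (3 / 4 : ℝ) := Real.one_le_rpow h3 (by norm_num)
  have e2 : ‖(((N : ℝ) + α : ℝ) : ℂ) ^ (1 - s)‖ ≤ ‖s - 1‖ * (3 * τ ^ (3 / 4 : ℝ)) := by
    rw [norm_cpow_eq_rpow_re_of_pos (by positivity)]
    have : ((N : ℝ) + α) ^ (1 - s).re ≤ ((N : ℝ) + α) ^ (1 : ℝ) :=
      Real.rpow_le_rpow_of_exponent_le (by linarith) (by simp; linarith)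
    rw [Real.rpow_one] at this
    nlinarith
  have e3 : ‖∑' n : ℕ, emTerm (((n + N : ℕ) : ℝ) + α) s‖ ≤ ‖s - 1‖ * (3 * S * τ ^ (3 / 4 : ℝ)) := by
    have h4 := norm_tsum_emTerm_le hα (s := s) (by linarith) N
      (hsum.mul_left (τ ^ (-(1 / 4) : ℝ))) (fun n => by
      have hp : 0 < (((n + N : ℕ) : ℝ) + α) := by positivity
      have hle : (1 : ℝ) ≤ ((n + N : ℕ) : ℝ) + α := by push_cast; linarith [(Nat.cast_nonneg n : (0:ℝ) ≤ n)]
      calc (((n + N : ℕ) : ℝ) + α) ^ (-s.re - 1)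
          ≤ (((n + N : ℕ) : ℝ) + α) ^ (-(1 / 4 : ℝ) + (-(1 / 4 : ℝ) - 1)) :=
            Real.rpow_le_rpow_of_exponent_le hle (by linarith)
        _ = (((n + N : ℕ) : ℝ) + α) ^ (-(1 / 4 : ℝ)) * (((n + N : ℕ) : ℝ) + α) ^ (-(1 / 4 : ℝ) - 1) :=
            Real.rpow_add hp _ _
        _ ≤ _ := by
          gcongr ?_ * ?_
          · apply Real.rpow_le_rpow_of_nonpos hτ0 _ (by norm_num)
            push_cast; linarith [(Nat.cast_nonneg n : (0:ℝ) ≤ n)]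
          · apply Real.rpow_le_rpow_of_nonpos (by positivity) _ (by norm_num)
            push_cast; linarith)
    rw [tsum_mul_left, ← hS] at h4
    refine h4.trans ?_
    rw [mul_assoc]
    refine mul_le_mul_of_nonneg_left ?_ hn0.le
    have : τ * τ ^ (-(1 / 4) : ℝ) = τ ^ (3 / 4 : ℝ) := by
      nth_rw 1 [← Real.rpow_one τ]
      rw [← Real.rpow_add hτ0]; norm_num
    rw [← this]
    have h5 : 0 ≤ τ ^ (-(1 / 4) : ℝ) * S := by positivity
    nlinarith
  have h10 : ‖s - 1‖ * ‖hurwitzZeta (α : UnitAddCircle) s‖ ≤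
      ‖s - 1‖ * ((2 * α ^ (-2 : ℝ) * S + 3 + 3 * S) * τ ^ (3 / 4 : ℝ)) := by
    rw [← norm_mul, hkey]
    refine (norm_add₃_le).trans ?_
    rw [norm_mul]
    have := mul_le_mul_of_nonneg_left e1 hn0.le
    linarith
  exact le_of_mul_le_mul_left h10 hn0

/-- The Dirichlet polynomial `∑_{n ∈ N} n⁻ˢ`. -/
noncomputable def dirPoly (N : Finset ℕ) (s : ℂ) : ℂ := ∑ n ∈ N, (n : ℂ) ^ (-s)

lemma natCast_prod_cpow {ι : Type*} (t : Finset ι) (b : ι → ℕ) (s : ℂ) :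
    ((∏ i ∈ t, b i : ℕ) : ℂ) ^ s = ∏ i ∈ t, (b i : ℂ) ^ s := by
  induction t using Finset.induction_on with
  | empty => simp
  | insert i t hi ih =>
    rw [Finset.prod_insert hi, Finset.prod_insert hi, Nat.cast_mul, natCast_mul_natCast_cpow, ih]

lemma dirPoly_pow (N : Finset ℕ) (s : ℂ) (j : ℕ) :
    dirPoly N s ^ j = ∑ b ∈ Fintype.piFinset (fun _ : Fin j => N), ((∏ i, b i : ℕ) : ℂ) ^ (-s) := by
  simp_rw [natCast_prod_cpow]
  rw [← Finset.prod_univ_sum (fun _ : Fin j => N) (fun _ n => (n : ℂ) ^ (-s))]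
  simp [dirPoly]

lemma one_div_abs_log_sub_log_le_two_mul {u v : ℕ} (hu : 0 < u) (hv : 0 < v) (h : u ≠ v) :
    1 / |Real.log v - Real.log u| ≤ 2 * v := by
  have hv1 : (1 : ℝ) ≤ v := by exact_mod_cast hv
  by_cases huv : u ≤ 2 * v
  · exact one_div_abs_log_sub_log_le hv hu h.symm (by linarith) (by exact_mod_cast huv)
  · push Not at huv
    have h2 : Real.log 2 ≤ |Real.log v - Real.log u| := by
      rw [abs_sub_comm]
      refine le_trans ?_ (le_abs_self _)
      have : Real.log ((2 * v : ℕ) : ℝ) ≤ Real.log u :=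
        Real.log_le_log (by positivity) (by exact_mod_cast huv.le)
      push_cast at this
      rw [Real.log_mul (by norm_num) (by positivity)] at this
      linarith
    have h3 := Real.log_two_gt_d9
    calc 1 / |Real.log v - Real.log u| ≤ 1 / Real.log 2 :=
          one_div_le_one_div_of_le (by linarith) h2
      _ ≤ 2 := by rw [div_le_iff₀ (by linarith)]; linarith
      _ ≤ 2 * v := by linarith

lemma natCast_cpow_line {u : ℕ} (hu : 0 < u) (σ t : ℝ) :
    (u : ℂ) ^ (-(σ + t * I : ℂ)) = ((u : ℝ) ^ (-σ) : ℝ) * cexp ((-Real.log u * t : ℝ) * I) := by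
  have hu0 : (u : ℂ) ≠ 0 := by exact_mod_cast hu.ne'
  rw [neg_add, cpow_add _ _ hu0, ofReal_cpow (by positivity)]
  congr 1
  · push_cast; rfl
  · rw [cpow_def_of_ne_zero hu0, ← natCast_log]; push_cast; congr 1; ring

lemma le_re_integral_two_line {u v : ℕ} (hu : 0 < u) (hv : 0 < v) (T : ℝ) :
    (if u = v then T / v else 0) - 4 * (v : ℝ) ^ 2 * (1 / (u : ℝ) ^ 2) ≤
      (∫ t in T..(2 * T), (u : ℂ) ^ (-(2 + t * I : ℂ)) * (v : ℂ) ^ (-(1 - (2 + t * I : ℂ)))).re := by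
  have hu0 : (0 : ℝ) < u := by exact_mod_cast hu
  have hv0 : (0 : ℝ) < v := by exact_mod_cast hv
  have h : ∀ t : ℝ, (u : ℂ) ^ (-(2 + t * I : ℂ)) * (v : ℂ) ^ (-(1 - (2 + t * I : ℂ))) =
      ((v / u ^ 2 : ℝ) : ℂ) * cexp (((Real.log v - Real.log u) * t : ℝ) * I) := by
    intro t
    have h1 := natCast_cpow_line hu 2 t
    have h2 := natCast_cpow_line hv (-1) (-t)
    rw [show (-(1 - (2 + t * I)) : ℂ) = -(((-1 : ℝ) : ℂ) + ((-t : ℝ) : ℂ) * I) by push_cast; ring,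
      h2]
    have h3 : (-(2 + t * I) : ℂ) = -(((2 : ℝ) : ℂ) + t * I) := by push_cast; ring
    rw [h3, h1, neg_neg, Real.rpow_one, Real.rpow_neg hu0.le, Real.rpow_two]
    rw [show ((Real.log v - Real.log u) * t : ℝ) = -Real.log u * t + (-Real.log v) * (-t) by ring,
      ofReal_add, add_mul, Complex.exp_add]
    push_cast
    ring
  simp_rw [h]
  rw [intervalIntegral.integral_const_mul, re_ofReal_mul]
  have hp : 0 ≤ 4 * (v : ℝ) ^ 2 * (1 / (u : ℝ) ^ 2) := by positivity
  split_ifs with huv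
  · subst huv
    simp only [sub_self, zero_mul, ofReal_zero, Complex.exp_zero, intervalIntegral.integral_const]
    simp only [real_smul, mul_one, ofReal_re]
    have : (u : ℝ) / u ^ 2 * (2 * T - T) = T / u := by field_simp; ring
    rw [this]; linarith
  · have hne : Real.log v - Real.log u ≠ 0 := by
      rw [sub_ne_zero]
      intro h
      exact huv (by exact_mod_cast (Real.log_injOn_pos hv0 hu0 h).symm)
    have h1 := norm_integral_exp_le hne T (2 * T)
    have h2 := one_div_abs_log_sub_log_le_two_mul hu hv huv
    have h3 := abs_re_le_norm (∫ t in T..(2 * T), cexp (((Real.log v - Real.log u) * t : ℝ) * I))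
    have h4 := neg_abs_le (∫ t in T..(2 * T), cexp (((Real.log v - Real.log u) * t : ℝ) * I)).re
    have h5 : -(4 * (v : ℝ)) ≤ (∫ t in T..(2 * T), cexp (((Real.log v - Real.log u) * t : ℝ) * I)).re := by
      linarith
    have h6 := mul_le_mul_of_nonneg_left h5 (show 0 ≤ (v : ℝ) / u ^ 2 by positivity)
    refine le_trans (le_of_eq ?_) h6
    field_simp; ring

lemma norm_dirPoly_le {N : Finset ℕ} {y : ℕ} (hN : N ⊆ Icc 1 y) {s : ℂ} (hs : -1 ≤ s.re) :
    ‖dirPoly N s‖ ≤ (y : ℝ) ^ 2 := by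
  have : ∀ n ∈ N, ‖(n : ℂ) ^ (-s)‖ ≤ y := by
    intro n hn
    obtain ⟨h1, h2⟩ := Finset.mem_Icc.1 (hN hn)
    have h1' : (1 : ℝ) ≤ n := by exact_mod_cast h1
    rw [norm_natCast_cpow_of_pos h1]
    calc (n : ℝ) ^ (-s).re ≤ (n : ℝ) ^ (1 : ℝ) :=
          Real.rpow_le_rpow_of_exponent_le h1' (by simp; linarith)
      _ ≤ y := by rw [Real.rpow_one]; exact_mod_cast h2
  refine (norm_sum_le _ _).trans ((Finset.sum_le_card_nsmul _ _ _ this).trans ?_)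
  rw [nsmul_eq_mul, sq]
  gcongr
  have := Finset.card_le_card hN
  simpa using this

lemma prod_mem_of_mem_piFinset {N : Finset ℕ} {y j : ℕ} (hN : N ⊆ Icc 1 y) {b : Fin j → ℕ}
    (hb : b ∈ Fintype.piFinset (fun _ : Fin j => N)) : 0 < ∏ i, b i ∧ ∏ i, b i ≤ y ^ j := by
  have h := fun i => Finset.mem_Icc.1 (hN (Fintype.mem_piFinset.1 hb i))
  refine ⟨Finset.prod_pos fun i _ => (h i).1, ?_⟩
  exact (Finset.prod_le_prod' (g := fun _ => y) fun i _ => (h i).2).trans (by simp)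

lemma card_piFinset_le {N : Finset ℕ} {y j : ℕ} (hN : N ⊆ Icc 1 y) :
    ((Fintype.piFinset (fun _ : Fin j => N)).card : ℝ) ≤ (y : ℝ) ^ j := by
  rw [Fintype.card_piFinset]
  have := Finset.card_le_card hN
  simp only [Finset.prod_const, Finset.card_univ, Fintype.card_fin]
  push_cast
  gcongr
  simpa using this

lemma continuous_natCast_cpow {u : ℕ} (hu : 0 < u) {g : ℝ → ℂ} (hg : Continuous g) :
    Continuous (fun t => (u : ℂ) ^ (g t)) := by
  have hu0 : (u : ℂ) ≠ 0 := by exact_mod_cast hu.ne'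
  exact hg.const_cpow (Or.inl hu0)

lemma le_re_integral_sum_two_line {N : Finset ℕ} {y : ℕ} (hN : N ⊆ Icc 1 y) (w : ℕ) (hw : 0 < w)
    (i j : ℕ) (T : ℝ) :
    T * (∑ b ∈ Fintype.piFinset (fun _ : Fin i => N), ∑ c ∈ Fintype.piFinset (fun _ : Fin j => N),
      if w * ∏ l, b l = ∏ l, c l then 1 / ((∏ l, c l : ℕ) : ℝ) else 0)
      - 4 * (y : ℝ) ^ (i + 3 * j) * (1 / (w : ℝ) ^ 2) ≤
      (∫ t in T..(2 * T), (w : ℂ) ^ (-(2 + t * I : ℂ)) * dirPoly N (2 + t * I) ^ i *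
        dirPoly N (1 - (2 + t * I)) ^ j).re := by
  set P := Fintype.piFinset (fun _ : Fin i => N)
  set P' := Fintype.piFinset (fun _ : Fin j => N)
  have hpt : ∀ t : ℝ, (w : ℂ) ^ (-(2 + t * I : ℂ)) * dirPoly N (2 + t * I) ^ i *
        dirPoly N (1 - (2 + t * I)) ^ j = ∑ b ∈ P, ∑ c ∈ P',
        ((w * ∏ l, b l : ℕ) : ℂ) ^ (-(2 + t * I : ℂ)) *
          ((∏ l, c l : ℕ) : ℂ) ^ (-(1 - (2 + t * I : ℂ))) := by
    intro t
    rw [dirPoly_pow, dirPoly_pow, Finset.mul_sum _ _ ((w : ℂ) ^ _), Finset.sum_mul]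
    refine Finset.sum_congr rfl fun b _ => ?_
    rw [Finset.mul_sum]
    refine Finset.sum_congr rfl fun c _ => ?_
    rw [Nat.cast_mul, natCast_mul_natCast_cpow]
  simp_rw [hpt]
  have hbp : ∀ b ∈ P, 0 < w * ∏ l, b l := fun b hb =>
    Nat.mul_pos hw (prod_mem_of_mem_piFinset hN hb).1
  have hcont : ∀ b ∈ P, ∀ c ∈ P', Continuous fun t : ℝ =>
      ((w * ∏ l, b l : ℕ) : ℂ) ^ (-(2 + t * I : ℂ)) *
          ((∏ l, c l : ℕ) : ℂ) ^ (-(1 - (2 + t * I : ℂ))) := by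
    intro b hb c hc
    exact (continuous_natCast_cpow (hbp b hb) (by fun_prop)).mul
      (continuous_natCast_cpow (prod_mem_of_mem_piFinset hN hc).1 (by fun_prop))
  rw [intervalIntegral.integral_finsetSum (fun b hb =>
    (continuous_finsetSum _ fun c hc => hcont b hb c hc).intervalIntegrable _ _)]
  rw [Finset.sum_congr rfl fun b hb => intervalIntegral.integral_finsetSum (fun c hc =>
    (hcont b hb c hc).intervalIntegrable _ _)]
  rw [re_sum, Finset.sum_congr rfl fun b hb => re_sum _ _]
  have hterm : ∀ b ∈ P, ∀ c ∈ P', T * (if w * ∏ l, b l = ∏ l, c l then 1 / ((∏ l, c l : ℕ) : ℝ) else 0)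
      - 4 * ((y : ℝ) ^ j) ^ 2 * (1 / (w : ℝ) ^ 2) ≤
      (∫ t in T..(2 * T), ((w * ∏ l, b l : ℕ) : ℂ) ^ (-(2 + t * I : ℂ)) *
          ((∏ l, c l : ℕ) : ℂ) ^ (-(1 - (2 + t * I : ℂ)))).re := by
    intro b hb c hc
    obtain ⟨hc1, hc2⟩ := prod_mem_of_mem_piFinset hN hc
    have hb1 := (prod_mem_of_mem_piFinset hN hb).1
    refine le_trans ?_ (le_re_integral_two_line (hbp b hb) hc1 T)
    have h1 : ((∏ l, c l : ℕ) : ℝ) ≤ (y : ℝ) ^ j := by exact_mod_cast hc2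
    have h2 : (w : ℝ) ≤ ((w * ∏ l, b l : ℕ) : ℝ) := by
      exact_mod_cast Nat.le_mul_of_pos_right w hb1
    have hw' : (0 : ℝ) < w := by exact_mod_cast hw
    have h3 : 4 * ((∏ l, c l : ℕ) : ℝ) ^ 2 * (1 / ((w * ∏ l, b l : ℕ) : ℝ) ^ 2) ≤
        4 * ((y : ℝ) ^ j) ^ 2 * (1 / (w : ℝ) ^ 2) := by gcongr
    refine sub_le_sub (le_of_eq ?_) h3
    split_ifs
    · rw [mul_one_div]
    · simp
  refine le_trans ?_ (Finset.sum_le_sum fun b hb => Finset.sum_le_sum fun c hc => hterm b hb c hc)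
  simp only [Finset.sum_sub_distrib, ← Finset.mul_sum, Finset.sum_const, nsmul_eq_mul]
  refine sub_le_sub le_rfl ?_
  have h1 : (P.card : ℝ) ≤ (y : ℝ) ^ i := card_piFinset_le hN
  have h2 : (P'.card : ℝ) ≤ (y : ℝ) ^ j := card_piFinset_le hN
  have h3 : (P.card : ℝ) * P'.card ≤ (y : ℝ) ^ i * (y : ℝ) ^ j := by gcongr
  have h4 := mul_le_mul_of_nonneg_right h3
    (show 0 ≤ 4 * ((y : ℝ) ^ j) ^ 2 * (1 / (w : ℝ) ^ 2) by positivity)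
  refine le_trans (le_of_eq ?_) (h4.trans (le_of_eq ?_)) <;> ring

/-- The Dirichlet series `∑ n⁻ˢ` over `n ≡ a (mod q)`, continued analytically. -/
noncomputable def apZeta (q a : ℕ) (s : ℂ) : ℂ :=
  (q : ℂ) ^ (-s) * hurwitzZeta (((a : ℝ) / (q : ℝ) : ℝ) : UnitAddCircle) s

lemma hasSum_apZeta {q a : ℕ} (ha : 1 ≤ a) (haq : a ≤ q) {s : ℂ} (hs : 1 < s.re) :
    HasSum (fun m : ℕ => ((q * m + a : ℕ) : ℂ) ^ (-s)) (apZeta q a s) := by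
  have hq : 0 < q := by omega
  have hq' : (0 : ℝ) < q := by exact_mod_cast hq
  have haq' : (a : ℝ) ≤ q := by exact_mod_cast haq
  have h := (hasSum_hurwitzZeta_of_one_lt_re (a := (a : ℝ) / q)
    ⟨by positivity, by rw [div_le_one hq']; exact haq'⟩ hs).mul_left ((q : ℂ) ^ (-s))
  refine h.congr_fun fun m => ?_
  rw [one_div, ← cpow_neg]
  have h1 : ((m : ℂ) + ((a : ℝ) / (q : ℝ) : ℝ)) = (((m : ℝ) + a / q : ℝ) : ℂ) := by push_cast; rfl
  have h2 : (q : ℂ) = ((q : ℝ) : ℂ) := by push_cast; rfl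
  rw [h1, h2, ← mul_cpow_ofReal_nonneg hq'.le (by positivity), ← ofReal_mul]
  congr 1
  have : (q : ℝ) * (m + a / q) = ((q * m + a : ℕ) : ℝ) := by push_cast; field_simp
  rw [this]; push_cast; rfl

lemma hasSum_dirPoly_apSet {q a : ℕ} (ha : 1 ≤ a) (haq : a ≤ q) (y : ℕ) (s : ℂ) :
    HasSum (fun m : ℕ => if q * m + a ∈ apSet q (a : ZMod q) y then ((q * m + a : ℕ) : ℂ) ^ (-s) else 0)
      (dirPoly (apSet q (a : ZMod q) y) s) := by
  have hq : 0 < q := by omega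
  have hinj : Function.Injective (fun m : ℕ => q * m + a) := by
    intro m m' h; simpa [hq.ne'] using h
  have h0 : HasSum (fun n : ℕ => if n ∈ apSet q (a : ZMod q) y then (n : ℂ) ^ (-s) else 0)
      (dirPoly (apSet q (a : ZMod q) y) s) := by
    have : HasSum (fun n : ℕ => if n ∈ apSet q (a : ZMod q) y then (n : ℂ) ^ (-s) else 0)
        (∑ n ∈ apSet q (a : ZMod q) y, if n ∈ apSet q (a : ZMod q) y then (n : ℂ) ^ (-s) else 0) :=
      hasSum_sum_of_ne_finset_zero (fun n hn => if_neg hn)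
    convert this using 1
    exact Finset.sum_congr rfl fun n hn => (if_pos hn).symm
  refine (hinj.hasSum_iff (f := fun n : ℕ => if n ∈ apSet q (a : ZMod q) y then (n : ℂ) ^ (-s) else 0)
    fun n hn => if_neg fun hmem => hn ?_).2 h0
  obtain ⟨⟨h1, h2⟩, h3⟩ := mem_apSet.1 hmem
  rw [ZMod.natCast_eq_natCast_iff] at h3
  have hle : a ≤ n := by
    by_contra hlt
    push Not at hlt
    have := (Nat.modEq_iff_dvd' hlt.le).1 h3
    have := Nat.le_of_dvd (by omega) this
    omega
  obtain ⟨c, hc⟩ := (Nat.modEq_iff_dvd' hle).1 h3.symm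
  exact ⟨c, by simp only; omega⟩

lemma apSet_subset (q : ℕ) (r : ZMod q) (y : ℕ) : apSet q r y ⊆ Icc 1 y := Finset.filter_subset _ _

lemma continuous_dirPoly {N : Finset ℕ} {y : ℕ} (hN : N ⊆ Icc 1 y) {g : ℝ → ℂ} (hg : Continuous g) :
    Continuous (fun t => dirPoly N (g t)) := by
  unfold dirPoly
  exact continuous_finsetSum _ fun n hn =>
    continuous_natCast_cpow (Finset.mem_Icc.1 (hN hn)).1 hg.neg

lemma exists_le_re_integral_apZeta_two_line (q a j : ℕ) (ha : 1 ≤ a) (haq : a ≤ q) :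
    ∃ C : ℝ, 0 < C ∧ ∀ (y : ℕ) (T : ℝ), 1 ≤ y → 0 ≤ T →
      T * diagSum q (a : ZMod q) (j + 1) y - C * (y : ℝ) ^ (4 * (j + 1)) ≤
        (∫ t in T..(2 * T), apZeta q a (2 + t * I) *
          dirPoly (apSet q (a : ZMod q) y) (2 + t * I) ^ j *
          dirPoly (apSet q (a : ZMod q) y) (1 - (2 + t * I)) ^ (j + 1)).re := by
  have hq : 0 < q := by omega
  have hsum2 : Summable (fun m : ℕ => 1 / ((m : ℝ) + 1) ^ 2) := by
    have := (summable_nat_add_iff 1).2 (Real.summable_one_div_nat_pow (p := 2)|>.2 (by norm_num))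
    simpa using this
  set Z := ∑' m : ℕ, 1 / ((m : ℝ) + 1) ^ 2 with hZ
  have hZ0 : 0 ≤ Z := tsum_nonneg fun _ => by positivity
  refine ⟨4 * (1 + Z), by positivity, fun y T hy hT => ?_⟩
  have hy' : (1 : ℝ) ≤ y := by exact_mod_cast hy
  set N := apSet q (a : ZMod q) y with hNdef
  have hN : N ⊆ Icc 1 y := apSet_subset _ _ _
  set H : ℝ → ℂ := fun t => dirPoly N (2 + t * I) ^ j * dirPoly N (1 - (2 + t * I)) ^ (j + 1) with hH
  have hHc : Continuous H := ((continuous_dirPoly hN (by fun_prop)).pow j).mul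
    ((continuous_dirPoly hN (by fun_prop)).pow (j + 1))
  set B : ℝ := ((y : ℝ) ^ 2) ^ j * ((y : ℝ) ^ 2) ^ (j + 1) with hB
  have hHB : ∀ t, ‖H t‖ ≤ B := by
    intro t
    simp only [hH, norm_mul, norm_pow]
    exact mul_le_mul
      (pow_le_pow_left₀ (norm_nonneg _) (norm_dirPoly_le hN (by simp; norm_num)) j)
      (pow_le_pow_left₀ (norm_nonneg _) (norm_dirPoly_le hN (by simp; norm_num)) (j + 1))
      (by positivity) (by positivity)
  set f : ℕ → ℝ → ℂ := fun m t =>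
    (if q * m + a ∈ N then 0 else ((q * m + a : ℕ) : ℂ) ^ (-(2 + t * I : ℂ))) * H t with hf
  have hfc : ∀ m, Continuous (f m) := by
    intro m
    simp only [hf]
    split_ifs
    · simpa using continuous_const
    · exact (continuous_natCast_cpow (by omega) (by fun_prop)).mul hHc
  have hwm : ∀ m : ℕ, (m : ℝ) + 1 ≤ ((q * m + a : ℕ) : ℝ) := by
    intro m
    have : m + 1 ≤ q * m + a := by nlinarith
    exact_mod_cast this
  have hfb : ∀ m t, ‖f m t‖ ≤ B * (1 / ((m : ℝ) + 1) ^ 2) := by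
    intro m t
    simp only [hf, norm_mul]
    rw [mul_comm]
    gcongr
    · exact hHB t
    · split_ifs
      · rw [norm_zero]; positivity
      · rw [norm_natCast_cpow_of_pos (by omega)]
        have : (-(2 + t * I : ℂ)).re = -2 := by simp
        rw [this, Real.rpow_neg (by positivity), one_div, Real.rpow_two]
        apply inv_anti₀ (by positivity)
        exact pow_le_pow_left₀ (by positivity) (hwm m) 2
  have hlim : ∀ t : ℝ, HasSum (fun m => f m t) ((apZeta q a (2 + t * I) - dirPoly N (2 + t * I)) * H t) := by
    intro t
    have h1 := (hasSum_apZeta ha haq (s := 2 + t * I) (by simp)).sub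
      (hasSum_dirPoly_apSet ha haq y (2 + t * I))
    refine (h1.mul_right (H t)).congr_fun fun m => ?_
    simp only [hf]
    split_ifs <;> simp
  have hint := intervalIntegral.hasSum_integral_of_dominated_convergence (μ := volume) (a := T) (b := 2 * T)
    (fun m _ => B * (1 / ((m : ℝ) + 1) ^ 2)) (F := f)
    (f := fun t => (apZeta q a (2 + t * I) - dirPoly N (2 + t * I)) * H t)
    (fun m => (hfc m).aestronglyMeasurable) (fun m => Eventually.of_forall fun t _ => hfb m t)
    (Eventually.of_forall fun t _ => hsum2.mul_left B) intervalIntegrable_const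
    (Eventually.of_forall fun t _ => hlim t)
  have hre := (Complex.hasSum_iff _ _).1 hint |>.1
  have hlow : ∀ m : ℕ, -(4 * (y : ℝ) ^ (j + 3 * (j + 1)) * (1 / ((m : ℝ) + 1) ^ 2)) ≤
      (∫ t in T..(2 * T), f m t).re := by
    intro m
    by_cases hm : q * m + a ∈ N
    · simp only [hf, if_pos hm, zero_mul, intervalIntegral.integral_zero, zero_re]
      have : 0 ≤ 4 * (y : ℝ) ^ (j + 3 * (j + 1)) * (1 / ((m : ℝ) + 1) ^ 2) := by positivity
      linarith
    · have h1 := le_re_integral_sum_two_line hN (q * m + a) (by omega) j (j + 1) T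
      have h2 : ∫ t in T..(2 * T), f m t = ∫ t in T..(2 * T), ((q * m + a : ℕ) : ℂ) ^ (-(2 + t * I : ℂ)) *
          dirPoly N (2 + t * I) ^ j * dirPoly N (1 - (2 + t * I)) ^ (j + 1) := by
        congr 1; ext t; simp only [hf, if_neg hm, hH]; ring
      rw [h2]
      refine le_trans ?_ h1
      have h3 : 0 ≤ T * (∑ b ∈ Fintype.piFinset (fun _ : Fin j => N),
          ∑ c ∈ Fintype.piFinset (fun _ : Fin (j + 1) => N),
          if (q * m + a) * ∏ l, b l = ∏ l, c l then 1 / ((∏ l, c l : ℕ) : ℝ) else 0) := by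
        refine mul_nonneg hT (Finset.sum_nonneg fun _ _ => Finset.sum_nonneg fun _ _ => ?_)
        split_ifs <;> positivity
      have h4 : 4 * (y : ℝ) ^ (j + 3 * (j + 1)) * (1 / ((q * m + a : ℕ) : ℝ) ^ 2) ≤
          4 * (y : ℝ) ^ (j + 3 * (j + 1)) * (1 / ((m : ℝ) + 1) ^ 2) := by
        have := hwm m
        gcongr
      linarith
  have hge := hasSum_le hlow (hsum2.mul_left (4 * (y : ℝ) ^ (j + 3 * (j + 1)))).neg.hasSum hre
  rw [tsum_neg, tsum_mul_left, ← hZ] at hge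
  have hmain := le_re_integral_sum_two_line hN 1 one_pos (j + 1) (j + 1) T
  have hAc : Continuous fun t : ℝ => dirPoly N (2 + t * I) * H t :=
    (continuous_dirPoly hN (by fun_prop)).mul hHc
  have hdc : Continuous fun t : ℝ => (apZeta q a (2 + t * I) - dirPoly N (2 + t * I)) * H t := by
    have := continuous_tsum hfc (hsum2.mul_left B) hfb
    convert this using 2 with t
    exact (hlim t).tsum_eq.symm
  have hsplit : ∫ t in T..(2 * T), apZeta q a (2 + t * I) *
          dirPoly N (2 + t * I) ^ j * dirPoly N (1 - (2 + t * I)) ^ (j + 1) =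
      (∫ t in T..(2 * T), (apZeta q a (2 + t * I) - dirPoly N (2 + t * I)) * H t) +
      ∫ t in T..(2 * T), ((1 : ℕ) : ℂ) ^ (-(2 + t * I : ℂ)) * dirPoly N (2 + t * I) ^ (j + 1) *
        dirPoly N (1 - (2 + t * I)) ^ (j + 1) := by
    have : ∀ t : ℝ, ((1 : ℕ) : ℂ) ^ (-(2 + t * I : ℂ)) * dirPoly N (2 + t * I) ^ (j + 1) *
        dirPoly N (1 - (2 + t * I)) ^ (j + 1) = dirPoly N (2 + t * I) * H t := by
      intro t; simp only [hH, Nat.cast_one, one_cpow]; ring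
    simp_rw [this]
    rw [← intervalIntegral.integral_add (hdc.intervalIntegrable _ _) (hAc.intervalIntegrable _ _)]
    congr 1; ext t; simp only [hH]; ring
  rw [hsplit, add_re]
  have hdiag : diagSum q (a : ZMod q) (j + 1) y =
      ∑ b ∈ Fintype.piFinset (fun _ : Fin (j + 1) => N), ∑ c ∈ Fintype.piFinset (fun _ : Fin (j + 1) => N),
      if 1 * ∏ l, b l = ∏ l, c l then 1 / ((∏ l, c l : ℕ) : ℝ) else 0 := by
    simp only [diagSum, one_mul, hNdef]
  rw [← hdiag] at hmain
  have h1 : (y : ℝ) ^ (j + 3 * (j + 1)) ≤ (y : ℝ) ^ (4 * (j + 1)) := pow_le_pow_right₀ hy' (by omega)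
  have h2 : j + 1 + 3 * (j + 1) = 4 * (j + 1) := by ring
  rw [h2] at hmain
  have h3 := mul_le_mul_of_nonneg_right h1 hZ0
  simp only [Nat.cast_one] at hmain
  norm_num at hmain hge ⊢
  linarith

lemma differentiableAt_dirPoly {N : Finset ℕ} {y : ℕ} (hN : N ⊆ Icc 1 y) {g : ℂ → ℂ} {s : ℂ}
    (hg : DifferentiableAt ℂ g s) : DifferentiableAt ℂ (fun s => dirPoly N (g s)) s := by
  unfold dirPoly
  refine DifferentiableAt.fun_sum fun n hn => ?_
  have : (n : ℂ) ≠ 0 := by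
    have := (Finset.mem_Icc.1 (hN hn)).1
    exact_mod_cast (by omega : n ≠ 0)
  exact hg.neg.const_cpow (Or.inl this)

lemma differentiableAt_apZeta {q a : ℕ} (hq : 0 < q) {s : ℂ} (hs : s ≠ 1) :
    DifferentiableAt ℂ (apZeta q a) s := by
  unfold apZeta
  have : (q : ℂ) ≠ 0 := by exact_mod_cast hq.ne'
  exact (differentiableAt_id.neg.const_cpow (Or.inl this)).mul (differentiableAt_hurwitzZeta _ hs)

lemma norm_dirPoly_one_sub {N : Finset ℕ} {y : ℕ} (hN : N ⊆ Icc 1 y) (t : ℝ) :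
    ‖dirPoly N (1 - (1 / 2 + t * I))‖ = ‖dirPoly N (1 / 2 + t * I)‖ := by
  rw [← Complex.norm_conj (dirPoly N (1 / 2 + t * I))]
  congr 1
  simp only [dirPoly, map_sum]
  refine Finset.sum_congr rfl fun n hn => ?_
  have hn0 : 0 < n := (Finset.mem_Icc.1 (hN hn)).1
  have h1 : (n : ℂ) = ((n : ℝ) : ℂ) := by push_cast; rfl
  have h := Complex.cpow_conj (n : ℂ) (-(1 / 2 + t * I))
    (by rw [h1, Complex.arg_ofReal_of_nonneg (by positivity)]; exact Real.pi_pos.ne)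
  rw [Complex.conj_natCast] at h
  rw [← h]
  congr 1
  have h2 : (starRingEnd ℂ) 2 = 2 := map_ofNat _ 2
  simp [h2]
  ring

lemma integral_norm_dirPoly_pow_le {N : Finset ℕ} {y : ℕ} (hN : N ⊆ Icc 1 y) (k : ℕ) {T : ℝ}
    (hT : 0 ≤ T) :
    ∫ t in T..(2 * T), ‖dirPoly N (1 / 2 + t * I)‖ ^ (2 * k) ≤
      T * (∑ b ∈ Fintype.piFinset (fun _ : Fin k => N), ∑ c ∈ Fintype.piFinset (fun _ : Fin k => N),
        if ∏ l, b l = ∏ l, c l then 1 / ((∏ l, c l : ℕ) : ℝ) else 0) + 2 * (y : ℝ) ^ (3 * k) := by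
  set s := Fintype.piFinset (fun _ : Fin k => N) with hs
  have hpos : ∀ b ∈ s, 1 ≤ ∏ l, b l ∧ ∏ l, b l ≤ y ^ k := by
    intro b hb
    have := prod_mem_of_mem_piFinset hN hb
    simpa [Nat.one_le_iff_ne_zero, Nat.pos_iff_ne_zero, Finset.prod_ne_zero_iff] using this
  have hposR : ∀ b ∈ s, (0:ℝ) < ((∏ l, b l : ℕ) : ℝ) := fun b hb => by
    have := (hpos b hb).1
    exact_mod_cast this
  have h := integral_norm_sq_expSum_le s (fun b => ((((∏ l, b l : ℕ) : ℝ) ^ (-(1 / 2) : ℝ) : ℝ) : ℂ))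
    (fun b => -Real.log ((∏ l, b l : ℕ) : ℝ)) (Y := (y : ℝ) ^ k) hT (by positivity) (by
      intro v hv w hw hvw
      have h1 := one_div_abs_log_sub_log_le (hpos v hv).1 (hpos w hw).1
        (fun h => hvw (by rw [h])) (Y := (y : ℝ) ^ k)
        (by exact_mod_cast (hpos v hv).2) (by exact_mod_cast (hpos w hw).2)
      rwa [show (-Real.log ((∏ l, v l : ℕ) : ℝ) - -Real.log ((∏ l, w l : ℕ) : ℝ)) =
        -(Real.log ((∏ l, v l : ℕ) : ℝ) - Real.log ((∏ l, w l : ℕ) : ℝ)) by ring, abs_neg])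
  have hL : ∀ t : ℝ, ‖dirPoly N (1 / 2 + t * I)‖ ^ (2 * k) = ‖∑ v ∈ s,
      ((((∏ l, v l : ℕ) : ℝ) ^ (-(1 / 2) : ℝ) : ℝ) : ℂ) * cexp ((-Real.log ((∏ l, v l : ℕ) : ℝ) * t : ℝ) * I)‖ ^ 2 := by
    intro t
    rw [mul_comm 2 k, pow_mul, ← norm_pow, dirPoly_pow]
    congr 2
    refine Finset.sum_congr rfl fun b hb => ?_
    have := natCast_cpow_line (hpos b hb).1 (1 / 2) t
    rw [← this]
    congr 2
    push_cast
    ring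
  simp_rw [hL]
  refine h.trans ?_
  gcongr T * ?_ + ?_
  · refine Finset.sum_le_sum fun b hb => Finset.sum_le_sum fun c hc => ?_
    have hb0 := hposR b hb
    have hc0 := hposR c hc
    by_cases hbc : ∏ l, b l = ∏ l, c l
    · rw [if_pos hbc, if_pos (by rw [hbc]), hbc, Complex.norm_real, Real.norm_of_nonneg (by positivity),
        ← Real.rpow_add hc0]
      norm_num
      rw [Real.rpow_neg_one]
    · rw [if_neg hbc, if_neg]
      intro h'
      have := Real.log_injOn_pos hb0 hc0 (neg_injective h')
      exact hbc (by exact_mod_cast this)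
  · have h1 : ∑ v ∈ s, ‖((((∏ l, v l : ℕ) : ℝ) ^ (-(1 / 2) : ℝ) : ℝ) : ℂ)‖ ≤ (y : ℝ) ^ k := by
      calc _ ≤ ∑ v ∈ s, (1 : ℝ) := by
            refine Finset.sum_le_sum fun b hb => ?_
            have h1 : (1:ℝ) ≤ ((∏ l, b l : ℕ) : ℝ) := by exact_mod_cast (hpos b hb).1
            rw [Complex.norm_real, Real.norm_of_nonneg (by positivity)]
            exact Real.rpow_le_one_of_one_le_of_nonpos h1 (by norm_num)
        _ ≤ _ := by
            rw [Finset.sum_const, nsmul_eq_mul, mul_one]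
            exact card_piFinset_le hN
    calc _ ≤ 2 * (y : ℝ) ^ k * ((y : ℝ) ^ k) ^ 2 := by gcongr
      _ = _ := by ring

lemma mul_pow_le_quarter (j : ℕ) {x u : ℝ} (hx : 0 ≤ x) (hu : 0 ≤ u) :
    x * u ^ (2 * j + 1) ≤ 1 / 4 * u ^ (2 * (j + 1)) + 4 ^ (2 * j + 1) * x ^ (2 * (j + 1)) := by
  have e1 : u ^ (2 * (j + 1)) = u * u ^ (2 * j + 1) := by ring
  have e2 : x ^ (2 * (j + 1)) = x * x ^ (2 * j + 1) := by ring
  by_cases h : x ≤ u / 4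
  · have : x * u ^ (2 * j + 1) ≤ u / 4 * u ^ (2 * j + 1) := by gcongr
    have : 0 ≤ 4 ^ (2 * j + 1) * x ^ (2 * (j + 1)) := by positivity
    rw [e1]; linarith
  · have hux : u ≤ 4 * x := by linarith
    have h1 : x * u ^ (2 * j + 1) ≤ x * (4 * x) ^ (2 * j + 1) := by gcongr
    have : 0 ≤ 1 / 4 * u ^ (2 * (j + 1)) := by positivity
    rw [mul_pow] at h1
    rw [e2]; linarith

lemma exists_diagSum_le_integral (q a j : ℕ) (ha : 1 ≤ a) (haq : a ≤ q) :
    ∃ C : ℝ, 0 < C ∧ ∀ (y : ℕ) (T : ℝ), 1 ≤ y → 1 ≤ T →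
      3 / 4 * T * diagSum q (a : ZMod q) (j + 1) y - C * T ^ (3 / 4 : ℝ) * (y : ℝ) ^ (4 * (j + 1)) ≤
        4 ^ (2 * j + 1) * ∫ t in T..(2 * T), ‖apZeta q a (1 / 2 + t * I)‖ ^ (2 * (j + 1)) := by
  have hq : 0 < q := by omega
  have hq' : (0 : ℝ) < q := by exact_mod_cast hq
  have haq' : (a : ℝ) ≤ q := by exact_mod_cast haq
  obtain ⟨C₁, hC₁, h₁⟩ := exists_le_re_integral_apZeta_two_line q a j ha haq
  obtain ⟨C₂, hC₂, h₂⟩ := exists_norm_hurwitzZeta_le (α := (a : ℝ) / q) (by positivity)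
    (by rw [div_le_one hq']; exact haq')
  refine ⟨C₁ + 6 * C₂ + 1, by positivity, fun y T hy hT => ?_⟩
  have hT0 : 0 < T := by linarith
  have hy' : (1 : ℝ) ≤ y := by exact_mod_cast hy
  set N := apSet q (a : ZMod q) y with hNdef
  have hN : N ⊆ Icc 1 y := apSet_subset _ _ _
  set G : ℂ → ℂ := fun s => apZeta q a s * dirPoly N s ^ j * dirPoly N (1 - s) ^ (j + 1) with hG
  have hGd : ∀ s, s ≠ 1 → DifferentiableAt ℂ G s := fun s hs =>
    ((differentiableAt_apZeta hq hs).mul ((differentiableAt_dirPoly hN differentiableAt_id).pow j)).mul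
      ((differentiableAt_dirPoly hN (differentiableAt_id.const_sub 1)).pow (j + 1))
  have hapb : ∀ s : ℂ, 1 / 2 ≤ s.re → s.re ≤ 2 → 1 ≤ |s.im| → ‖apZeta q a s‖ ≤ C₂ * |s.im| ^ (3 / 4 : ℝ) := by
    intro s hs1 hs2 hs3
    have := h₂ s hs1 hs2 hs3
    rw [apZeta, norm_mul, norm_natCast_cpow_of_pos hq]
    have h1 : (q : ℝ) ^ (-s).re ≤ 1 := Real.rpow_le_one_of_one_le_of_nonpos (by exact_mod_cast hq)
      (by rw [neg_re]; linarith)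
    calc _ ≤ 1 * _ := mul_le_mul h1 this (norm_nonneg _) zero_le_one
      _ = _ := one_mul _
  have hGb : ∀ s : ℂ, 1 / 2 ≤ s.re → s.re ≤ 2 → T ≤ s.im → s.im ≤ 2 * T →
      ‖G s‖ ≤ 2 * C₂ * T ^ (3 / 4 : ℝ) * (y : ℝ) ^ (4 * (j + 1)) := by
    intro s hs1 hs2 hs3 hs4
    have him : |s.im| = s.im := abs_of_nonneg (by linarith)
    have h1 := hapb s hs1 hs2 (by rw [him]; linarith)
    rw [him] at h1
    have h2 : s.im ^ (3 / 4 : ℝ) ≤ 2 * T ^ (3 / 4 : ℝ) := by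
      calc s.im ^ (3 / 4 : ℝ) ≤ (2 * T) ^ (3 / 4 : ℝ) := Real.rpow_le_rpow (by linarith) hs4 (by norm_num)
        _ = 2 ^ (3 / 4 : ℝ) * T ^ (3 / 4 : ℝ) := Real.mul_rpow (by norm_num) hT0.le
        _ ≤ 2 * T ^ (3 / 4 : ℝ) := by
            gcongr
            calc (2 : ℝ) ^ (3 / 4 : ℝ) ≤ 2 ^ (1 : ℝ) := Real.rpow_le_rpow_of_exponent_le (by norm_num) (by norm_num)
              _ = 2 := by norm_num
    have h3 : ‖dirPoly N s‖ ^ j ≤ ((y : ℝ) ^ 2) ^ j :=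
      pow_le_pow_left₀ (norm_nonneg _) (norm_dirPoly_le hN (by linarith)) j
    have h4 : ‖dirPoly N (1 - s)‖ ^ (j + 1) ≤ ((y : ℝ) ^ 2) ^ (j + 1) :=
      pow_le_pow_left₀ (norm_nonneg _) (norm_dirPoly_le hN (by simp; linarith)) _
    simp only [hG, norm_mul, norm_pow]
    have h5 : ‖apZeta q a s‖ ≤ C₂ * (2 * T ^ (3 / 4 : ℝ)) := h1.trans (by gcongr)
    calc _ ≤ C₂ * (2 * T ^ (3 / 4 : ℝ)) * ((y : ℝ) ^ 2) ^ j * ((y : ℝ) ^ 2) ^ (j + 1) := by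
          refine mul_le_mul (mul_le_mul h5 h3 (by positivity) (by positivity)) h4 (by positivity) (by positivity)
      _ = 2 * C₂ * T ^ (3 / 4 : ℝ) * (y : ℝ) ^ (2 * j + 2 * (j + 1)) := by ring
      _ ≤ _ := by
          have := pow_le_pow_right₀ hy' (show 2 * j + 2 * (j + 1) ≤ 4 * (j + 1) by omega)
          exact mul_le_mul_of_nonneg_left this (by positivity)
  have hrect := Complex.integral_boundary_rect_eq_zero_of_differentiableOn G
    (1 / 2 + T * I) (2 + (2 * T : ℝ) * I) (by
      intro s hs
      refine (hGd s ?_).differentiableWithinAt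
      rintro rfl
      have := (Complex.mem_reProdIm.1 hs).2
      simp at this
      rw [Set.uIcc_of_le (by linarith)] at this
      linarith [this.1])
  have e1 : (1 / 2 + (T : ℂ) * I).re = 1 / 2 := by simp
  have e2 : (1 / 2 + (T : ℂ) * I).im = T := by simp
  have e3 : (2 + ((2 * T : ℝ) : ℂ) * I).re = 2 := by simp
  have e4 : (2 + ((2 * T : ℝ) : ℂ) * I).im = 2 * T := by simp
  rw [e1, e2, e3, e4] at hrect
  set E := 2 * C₂ * T ^ (3 / 4 : ℝ) * (y : ℝ) ^ (4 * (j + 1)) with hE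
  have hhor : ∀ τ : ℝ, T ≤ τ → τ ≤ 2 * T → ‖∫ x in (1 / 2 : ℝ)..2, G (x + τ * I)‖ ≤ E * (3 / 2) := by
    intro τ hτ1 hτ2
    have := intervalIntegral.norm_integral_le_of_norm_le_const (a := (1 / 2 : ℝ)) (b := 2) (C := E)
      (f := fun x : ℝ => G (x + τ * I)) (by
        intro x hx
        rw [Set.uIoc_of_le (by norm_num)] at hx
        exact hGb _ (by simpa using hx.1.le) (by simpa using hx.2) (by simpa using hτ1) (by simpa using hτ2))
    calc _ ≤ _ := this
      _ = _ := by norm_num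
  have hA := hhor T le_rfl (by linarith)
  have hB := hhor (2 * T) (by linarith) le_rfl
  have h2 := h₁ y T hy hT0.le
  have hshift : (∫ t in T..(2 * T), G ((2 : ℝ) + t * I)).re - 3 * E ≤
      ‖∫ t in T..(2 * T), G ((1 / 2 : ℝ) + t * I)‖ := by
    set I1 := ∫ x in (1 / 2 : ℝ)..2, G (x + T * I)
    set I2 := ∫ x in (1 / 2 : ℝ)..2, G (x + (2 * T : ℝ) * I)
    set I3 := ∫ t in T..(2 * T), G ((2 : ℝ) + t * I)
    set I4 := ∫ t in T..(2 * T), G ((1 / 2 : ℝ) + t * I)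
    have h3 : I1 - I2 + I * I3 - I * I4 = 0 := hrect
    have h4 : I3 = I4 + I * (I1 - I2) := by
      linear_combination -I * h3 + (I3 - I4) * I_mul_I
    have h5 : ‖I3‖ ≤ ‖I4‖ + (‖I1‖ + ‖I2‖) := by
      rw [h4]
      refine (norm_add_le _ _).trans ?_
      gcongr
      rw [norm_mul, norm_I, one_mul]
      exact norm_sub_le _ _
    have := re_le_norm I3
    linarith
  have hre2 : (∫ t in T..(2 * T), G ((2 : ℝ) + t * I)) = ∫ t in T..(2 * T), apZeta q a (2 + t * I) *
          dirPoly N (2 + t * I) ^ j * dirPoly N (1 - (2 + t * I)) ^ (j + 1) := by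
    simp only [hG]; push_cast; rfl
  rw [hre2] at hshift
  have hline : ∀ t : ℝ, (1 / 2 + t * I : ℂ) ≠ 1 := by
    intro t h
    have := congrArg re h
    norm_num at this
  have hFc : Continuous fun t : ℝ => apZeta q a (1 / 2 + t * I) := by
    rw [continuous_iff_continuousAt]
    intro t
    have h1 : ContinuousAt (apZeta q a) (1 / 2 + t * I) :=
      (differentiableAt_apZeta hq (hline t)).continuousAt
    exact ContinuousAt.comp (f := fun t : ℝ => (1 / 2 + t * I : ℂ)) h1 (by fun_prop)
  have hAc : Continuous fun t : ℝ => dirPoly N (1 / 2 + t * I) := continuous_dirPoly hN (by fun_prop)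
  have hup : ‖∫ t in T..(2 * T), G ((1 / 2 : ℝ) + t * I)‖ ≤
      1 / 4 * (∫ t in T..(2 * T), ‖dirPoly N (1 / 2 + t * I)‖ ^ (2 * (j + 1))) +
      4 ^ (2 * j + 1) * ∫ t in T..(2 * T), ‖apZeta q a (1 / 2 + t * I)‖ ^ (2 * (j + 1)) := by
    have hle : T ≤ 2 * T := by linarith
    rw [← intervalIntegral.integral_const_mul, ← intervalIntegral.integral_const_mul,
      ← intervalIntegral.integral_add
        (Continuous.intervalIntegrable (by fun_prop) _ _)
        (Continuous.intervalIntegrable (by fun_prop) _ _)]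
    refine intervalIntegral.norm_integral_le_of_norm_le hle (Eventually.of_forall fun t _ => ?_)
      (Continuous.intervalIntegrable (by fun_prop) _ _)
    have h1 : ((1 / 2 : ℝ) + t * I : ℂ) = 1 / 2 + t * I := by push_cast; rfl
    rw [h1]
    simp only [hG, norm_mul, norm_pow, norm_dirPoly_one_sub hN]
    refine le_trans (le_of_eq ?_) (mul_pow_le_quarter j (norm_nonneg _) (norm_nonneg _))
    ring
  have hdiag := integral_norm_dirPoly_pow_le hN (j + 1) hT0.le
  have hdd : (∑ b ∈ Fintype.piFinset (fun _ : Fin (j + 1) => N), ∑ c ∈ Fintype.piFinset (fun _ : Fin (j + 1) => N),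
        if ∏ l, b l = ∏ l, c l then 1 / ((∏ l, c l : ℕ) : ℝ) else 0) = diagSum q (a : ZMod q) (j + 1) y := rfl
  rw [hdd] at hdiag
  have hTp : 1 ≤ T ^ (3 / 4 : ℝ) := Real.one_le_rpow hT (by norm_num)
  have hy3 : (y : ℝ) ^ (3 * (j + 1)) ≤ (y : ℝ) ^ (4 * (j + 1)) := pow_le_pow_right₀ hy' (by omega)
  have hy4 : 0 ≤ (y : ℝ) ^ (4 * (j + 1)) := by positivity
  set W := (y : ℝ) ^ (4 * (j + 1)) with hW
  have hWT : W ≤ T ^ (3 / 4 : ℝ) * W := le_mul_of_one_le_left hy4 hTp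
  have hC1W : C₁ * W ≤ C₁ * (T ^ (3 / 4 : ℝ) * W) := mul_le_mul_of_nonneg_left hWT hC₁.le
  have h2' : T * diagSum q (↑a) (j + 1) y - C₁ * W ≤ (∫ t in T..(2 * T), apZeta q a (2 + t * I) *
          dirPoly N (2 + t * I) ^ j * dirPoly N (1 - (2 + t * I)) ^ (j + 1)).re := h2
  have hEe : E = 2 * C₂ * (T ^ (3 / 4 : ℝ) * W) := by rw [hE]; ring
  have : (C₁ + 6 * C₂ + 1) * T ^ (3 / 4 : ℝ) * W = C₁ * (T ^ (3 / 4 : ℝ) * W) + 6 * C₂ * (T ^ (3 / 4 : ℝ) * W) +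
    (T ^ (3 / 4 : ℝ) * W) := by ring
  rw [this]
  linarith

lemma exists_lower_bound_moment (q a k : ℕ) [NeZero q] (hk : 1 ≤ k) (ha : 1 ≤ a) (haq : a ≤ q)
    (hgcd : Nat.gcd a q = 1) :
    ∃ c : ℝ, 0 < c ∧ ∀ᶠ T : ℝ in atTop, c * T * Real.log T ^ (k ^ 2) ≤
      ∫ t in T..(2 * T),
        ‖hurwitzZeta (((a : ℝ) / (q : ℝ) : ℝ) : UnitAddCircle) (1 / 2 + t * I)‖ ^ (2 * k) := by
  have hq : 0 < q := by omega
  obtain ⟨j, rfl⟩ : ∃ j, k = j + 1 := ⟨k - 1, by omega⟩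
  obtain ⟨C, hC, h1⟩ := exists_diagSum_le_integral q a j ha haq
  obtain ⟨c, hc, z₀, h2⟩ := exists_le_diagSum q (j + 1) (by omega) (a : ZMod q)
    ((ZMod.isUnit_iff_coprime a q).2 hgcd)
  set k := j + 1 with hkdef
  have hk0 : (0 : ℝ) < k := by exact_mod_cast (by omega : 0 < k)
  set β : ℝ := 1 / (40 * k ^ 2) with hβ
  have hβ0 : 0 < β := by positivity
  refine ⟨c / 2 * (β / 2) ^ (k ^ 2) / 4 ^ (2 * j + 1), by positivity, ?_⟩
  have ev1 : ∀ᶠ T : ℝ in atTop, 2 ≤ T ^ β := (tendsto_rpow_atTop hβ0).eventually_ge_atTop 2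
  have ev2 : ∀ᶠ T : ℝ in atTop, (z₀ : ℝ) + 1 ≤ T ^ β := (tendsto_rpow_atTop hβ0).eventually_ge_atTop _
  have ev3 : ∀ᶠ T : ℝ in atTop, 4 * C / c ≤ T ^ (3 / 20 : ℝ) :=
    (tendsto_rpow_atTop (by norm_num)).eventually_ge_atTop _
  have ev4 : ∀ᶠ T : ℝ in atTop, (1 + Real.log 2) * (2 / β) ≤ Real.log T :=
    Real.tendsto_log_atTop.eventually_ge_atTop _
  filter_upwards [ev1, ev2, ev3, ev4, eventually_ge_atTop 1] with T e1 e2 e3 e4 hT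
  have hT0 : 0 < T := by linarith
  set z : ℕ := ⌊T ^ β⌋₊ with hz
  have hzle : (z : ℝ) ≤ T ^ β := Nat.floor_le (by positivity)
  have hzlt : T ^ β < z + 1 := Nat.lt_floor_add_one _
  have hz0 : z₀ ≤ z := by
    have : (z₀ : ℝ) < z + 1 := by linarith
    have : z₀ < z + 1 := by exact_mod_cast this
    omega
  have hzhalf : T ^ β / 2 ≤ z := by linarith
  have hz1 : (1 : ℝ) ≤ z := by linarith
  have hlz : β / 2 * Real.log T ≤ Real.log z := by
    have := Real.log_le_log (by positivity) hzhalf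
    rw [Real.log_div (by positivity) (by norm_num), Real.log_rpow hT0] at this
    have : (1 + Real.log 2) * (2 / β) * (β / 2) ≤ Real.log T * (β / 2) := by gcongr
    have h3 : (1 + Real.log 2) * (2 / β) * (β / 2) = 1 + Real.log 2 := by field_simp
    linarith
  have hlz1 : 1 ≤ β / 2 * Real.log T := by
    have : (1 + Real.log 2) * (2 / β) * (β / 2) ≤ Real.log T * (β / 2) := by gcongr
    have h3 : (1 + Real.log 2) * (2 / β) * (β / 2) = 1 + Real.log 2 := by field_simp
    have := Real.log_pos (show (1 : ℝ) < 2 by norm_num)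
    linarith
  have hD := h2 z hz0
  have hI := h1 (z ^ k) T (Nat.one_le_pow _ _ (by exact_mod_cast hz1)) hT
  have hyp : ((z ^ k : ℕ) : ℝ) ^ (4 * k) ≤ T ^ (1 / 10 : ℝ) := by
    push_cast
    rw [← pow_mul]
    calc (z : ℝ) ^ (k * (4 * k)) ≤ (T ^ β) ^ (k * (4 * k)) := pow_le_pow_left₀ (by positivity) hzle _
      _ = T ^ (β * ((k * (4 * k) : ℕ) : ℝ)) := by rw [← Real.rpow_natCast, ← Real.rpow_mul hT0.le]
      _ = T ^ (1 / 10 : ℝ) := by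
          congr 1; rw [hβ]; push_cast; field_simp; norm_num
  set L := (β / 2 * Real.log T) ^ (k ^ 2) with hL
  have hL1 : 1 ≤ L := one_le_pow₀ hlz1
  have hDL : c * L ≤ diagSum q (a : ZMod q) k (z ^ k) :=
    le_trans (mul_le_mul_of_nonneg_left (pow_le_pow_left₀ (by linarith) hlz _) hc.le) hD
  have herr : C * T ^ (3 / 4 : ℝ) * ((z ^ k : ℕ) : ℝ) ^ (4 * k) ≤ 1 / 4 * T * (c * L) := by
    calc C * T ^ (3 / 4 : ℝ) * ((z ^ k : ℕ) : ℝ) ^ (4 * k) ≤ C * T ^ (3 / 4 : ℝ) * T ^ (1 / 10 : ℝ) := by gcongr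
      _ = C * T ^ (17 / 20 : ℝ) := by rw [mul_assoc, ← Real.rpow_add hT0]; norm_num
      _ = c / 4 * (4 * C / c) * T ^ (17 / 20 : ℝ) := by field_simp
      _ ≤ c / 4 * T ^ (3 / 20 : ℝ) * T ^ (17 / 20 : ℝ) := by gcongr
      _ = c / 4 * T := by rw [mul_assoc, ← Real.rpow_add hT0]; norm_num
      _ ≤ c / 4 * T * L := le_mul_of_one_le_right (by positivity) hL1
      _ = _ := by ring
  have hmain : c / 2 * T * L ≤ 4 ^ (2 * j + 1) * ∫ t in T..(2 * T), ‖apZeta q a (1 / 2 + t * I)‖ ^ (2 * k) := by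
    have : T * (c * L) ≤ T * diagSum q (a : ZMod q) k (z ^ k) := by gcongr
    have hI' : 3 / 4 * T * diagSum q (↑a) k (z ^ k) - C * T ^ (3 / 4 : ℝ) * ((z ^ k : ℕ) : ℝ) ^ (4 * k) ≤ _ := hI
    linarith
  have hline : ∀ t : ℝ, (1 / 2 + t * I : ℂ) ≠ 1 := by
    intro t h
    have := congrArg re h
    norm_num at this
  have hcont : ∀ f : ℂ → ℂ, (∀ s, s ≠ 1 → DifferentiableAt ℂ f s) →
      Continuous fun t : ℝ => f (1 / 2 + t * I) := by
    intro f hf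
    rw [continuous_iff_continuousAt]
    intro t
    exact ContinuousAt.comp (f := fun t : ℝ => (1 / 2 + t * I : ℂ)) (hf _ (hline t)).continuousAt (by fun_prop)
  have hcmp : ∫ t in T..(2 * T), ‖apZeta q a (1 / 2 + t * I)‖ ^ (2 * k) ≤ ∫ t in T..(2 * T),
        ‖hurwitzZeta (((a : ℝ) / (q : ℝ) : ℝ) : UnitAddCircle) (1 / 2 + t * I)‖ ^ (2 * k) := by
    refine intervalIntegral.integral_mono_on (by linarith) ?_ ?_ fun t _ => ?_
    · exact (((hcont _ fun s hs => differentiableAt_apZeta hq hs).norm).pow _).intervalIntegrable _ _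
    · exact (((hcont _ fun s hs => differentiableAt_hurwitzZeta _ hs).norm).pow _).intervalIntegrable _ _
    · refine pow_le_pow_left₀ (norm_nonneg _) ?_ _
      rw [apZeta, norm_mul, norm_natCast_cpow_of_pos hq]
      exact mul_le_of_le_one_left (norm_nonneg _) (Real.rpow_le_one_of_one_le_of_nonpos
        (by exact_mod_cast hq) (by norm_num))
  have hfin : c / 2 * T * L ≤ 4 ^ (2 * j + 1) * ∫ t in T..(2 * T),
        ‖hurwitzZeta (((a : ℝ) / (q : ℝ) : ℝ) : UnitAddCircle) (1 / 2 + t * I)‖ ^ (2 * k) :=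
    hmain.trans (by gcongr)
  rw [hL, mul_pow] at hfin
  calc _ = (c / 2 * T * ((β / 2) ^ (k ^ 2) * Real.log T ^ (k ^ 2))) / 4 ^ (2 * j + 1) := by ring
    _ ≤ _ := by rw [div_le_iff₀' (by positivity)]; exact hfin

open scoped SchwartzMap FourierTransform in
/-- A nonnegative even kernel with all moments whose Fourier transform is supported in `[-1, 1]`. -/
lemma exists_bandlimited_kernel : ∃ k : ℝ → ℝ, (∀ v, 0 ≤ k v) ∧ (∀ v, k (-v) = k v) ∧ Continuous k ∧
    (∀ n : ℕ, Integrable (fun v => |v| ^ n * k v)) ∧ ∫ v, k v = 1 ∧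
    ∀ y : ℝ, 1 ≤ |y| → ∫ v, (k v : ℂ) * cexp (-(v * y : ℝ) * I) = 0 := by
  let φ : ContDiffBump (0 : ℝ) := ⟨1 / 32, 1 / 16, by norm_num, by norm_num⟩
  have hφc : HasCompactSupport (fun x => (φ x : ℂ)) :=
    φ.hasCompactSupport.comp_left (g := fun x : ℝ => (x : ℂ)) (by simp)
  have hφs : ContDiff ℝ (⊤ : ℕ∞) (fun x => (φ x : ℂ)) := Complex.ofRealCLM.contDiff.comp φ.contDiff
  let g : 𝓢(ℝ, ℂ) := hφc.toSchwartzMap hφs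
  have hg : ∀ x, g x = (φ x : ℂ) := fun x => rfl
  let h : 𝓢(ℝ, ℂ) := SchwartzMap.convolution (ContinuousLinearMap.mul ℂ ℂ) g g
  have hFh : ∀ v, (𝓕 h) v = (𝓕 g) v * (𝓕 g) v := by
    intro v
    have := SchwartzMap.fourier_convolution (ContinuousLinearMap.mul ℂ ℂ) g g
    simp [h, this]
  have hFg : ∀ v, (𝓕 g) v = ∫ x : ℝ, cexp (↑(-2 * π * x * v) * I) * (φ x : ℂ) := by
    intro v
    rw [SchwartzMap.fourier_coe, Real.fourier_real_eq_integral_exp_smul]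
    simp [hg]
  have heven : ∀ v, (𝓕 g) (-v) = (𝓕 g) v := by
    intro v
    rw [hFg, hFg, ← integral_neg_eq_self]
    refine integral_congr_ae (Eventually.of_forall fun x => ?_)
    simp only [φ.neg]
    congr 3
    push_cast; ring
  have hreal : ∀ v, (starRingEnd ℂ) ((𝓕 g) v) = (𝓕 g) v := by
    intro v
    conv_rhs => rw [← heven v]
    rw [hFg, hFg, ← integral_conj]
    refine integral_congr_ae (Eventually.of_forall fun x => ?_)
    simp only [map_mul, conj_ofReal, ← exp_conj, conj_I]
    congr 2
    push_cast; ring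
  have hk : ∀ v, (𝓕 h) v = ((‖(𝓕 g) v‖ ^ 2 : ℝ) : ℂ) := by
    intro v
    rw [hFh]
    nth_rewrite 1 [← hreal v]
    rw [Complex.conj_mul']
    push_cast; rfl
  have hnorm : ∀ v, ‖(𝓕 g) v‖ ^ 2 = ‖(𝓕 h) v‖ := by
    intro v
    rw [hk, Complex.norm_real, Real.norm_of_nonneg (by positivity)]
  have hinv : ∀ w : ℝ, ∫ v : ℝ, cexp (↑(2 * π * v * w) * I) * (𝓕 h) v = h w := by
    intro w
    have h1 : 𝓕⁻ (𝓕 h) = h := FourierTransform.fourierInv_fourier_eq h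
    have h2 : (𝓕⁻ (𝓕 h)) w = h w := by rw [h1]
    rw [SchwartzMap.fourierInv_coe, Real.fourierInv_eq'] at h2
    rw [← h2]
    refine integral_congr_ae (Eventually.of_forall fun x => ?_)
    simp only [smul_eq_mul]
    congr 3
    simp [mul_comm, mul_assoc, mul_left_comm]
  have hconv : ∀ w, h w = ∫ t, (φ t : ℂ) * (φ (w - t) : ℂ) := by
    intro w
    have := SchwartzMap.convolution_apply (ContinuousLinearMap.mul ℂ ℂ) g g w
    simp only [h, this, MeasureTheory.convolution, ContinuousLinearMap.mul_apply', hg]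
  have hsupp : ∀ w : ℝ, 1 / 8 ≤ |w| → h w = 0 := by
    intro w hw
    rw [hconv]
    rw [integral_eq_zero_of_ae]
    refine Eventually.of_forall fun t => ?_
    by_cases ht : 1 / 16 ≤ |t|
    · have : φ t = 0 := φ.zero_of_le_dist (by rw [Real.dist_eq, sub_zero]; exact ht)
      simp [this]
    · have : φ (w - t) = 0 := φ.zero_of_le_dist (by
        rw [Real.dist_eq, sub_zero]
        show (1 : ℝ) / 16 ≤ _
        have := abs_sub_abs_le_abs_sub w t
        linarith)
      simp [this]
  have hS : ∀ n : ℕ, Integrable (fun v : ℝ => |v| ^ n * ‖(𝓕 g) v‖ ^ 2) := by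
    intro n
    have := SchwartzMap.integrable_pow_mul volume (𝓕 h) n
    simpa only [hnorm, Real.norm_eq_abs] using this
  set m := ∫ v, ‖(𝓕 g) v‖ ^ 2 with hm
  have hmh : (m : ℂ) = h 0 := by
    rw [← hinv 0, hm, ← integral_complex_ofReal]
    refine integral_congr_ae (Eventually.of_forall fun x => ?_)
    simp only [hk]; simp
  have hm0 : 0 < m := by
    have h1 : h 0 = ((∫ t, φ t ^ 2 : ℝ) : ℂ) := by
      rw [hconv, ← integral_complex_ofReal]
      refine integral_congr_ae (Eventually.of_forall fun x => ?_)
      simp only [zero_sub, φ.neg]; push_cast; ring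
    have h2 : m = ∫ t, φ t ^ 2 := by
      have := hmh.trans h1
      exact_mod_cast this
    rw [h2]
    have hc : Continuous fun t => φ t ^ 2 := φ.continuous.pow 2
    refine hc.integral_pos_of_hasCompactSupport_nonneg_nonzero ?_ (fun t => by positivity) (x := 0) ?_
    · exact φ.hasCompactSupport.comp_left (g := fun x : ℝ => x ^ 2) (by simp)
    · have : φ 0 = 1 := φ.one_of_mem_closedBall (by simp [φ.rIn_pos.le])
      simp [this]
  refine ⟨fun v => ‖(𝓕 g) v‖ ^ 2 / m, fun v => by positivity, fun v => by simp only [heven], ?_, ?_, ?_, ?_⟩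
  · exact (((𝓕 g).continuous.norm).pow 2).div_const m
  · intro n
    have := (hS n).div_const m
    refine this.congr (Eventually.of_forall fun v => ?_)
    simp only; ring
  · rw [integral_div, ← hm, div_self hm0.ne']
  · intro y hy
    have h1 : ∀ v : ℝ, ((‖(𝓕 g) v‖ ^ 2 / m : ℝ) : ℂ) * cexp (-(v * y : ℝ) * I) =
        (cexp (↑(2 * π * v * (-y / (2 * π))) * I) * (𝓕 h) v) / m := by
      intro v
      rw [hk]
      have : 2 * π * v * (-y / (2 * π)) = -(v * y) := by field_simp
      rw [this]
      push_cast; ring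
    simp_rw [h1]
    rw [integral_div, hinv, hsupp, zero_div]
    rw [abs_div, abs_neg, abs_of_pos (by positivity : 0 < 2 * π), le_div_iff₀ (by positivity)]
    have := Real.pi_lt_four
    linarith

lemma exists_log_of_convex {U : Set ℂ} (hc : Convex ℝ U) (ho : IsOpen U) {f : ℂ → ℂ}
    (hf : DifferentiableOn ℂ f U) (h0 : ∀ s ∈ U, f s ≠ 0) {s₀ w : ℂ} (hs₀ : s₀ ∈ U)
    (hw : cexp w = f s₀) :
    ∃ h : ℂ → ℂ, DifferentiableOn ℂ h U ∧ (∀ s ∈ U, cexp (h s) = f s) ∧ h s₀ = w := by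
  have hsc : IsSimplyConnected U := by
    have : ContractibleSpace U := hc.contractibleSpace ⟨s₀, hs₀⟩
    exact SimplyConnectedSpace.ofContractible U
  obtain ⟨g, hgc, hg⟩ := exists_continuousOn_eqOn_exp_comp hsc ho hf.continuousOn
    (by rintro ⟨s, hs, h⟩; exact h0 s hs h)
  have hg' : ∀ s ∈ U, cexp (g s) = f s := fun s hs => hg hs
  refine ⟨fun s => g s - g s₀ + w, ?_, fun s hs => ?_, by ring⟩
  · suffices hgd : DifferentiableOn ℂ g U from (hgd.sub_const (g s₀)).add_const w
    intro s hs
    refine DifferentiableAt.differentiableWithinAt ?_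
    have hgs : ContinuousAt g s := (hgc s hs).continuousAt (ho.mem_nhds hs)
    have hfs : DifferentiableAt ℂ f s := (hf s hs).differentiableAt (ho.mem_nhds hs)
    have hev : g =ᶠ[nhds s] fun z => g s + Complex.log (f z / f s) := by
      have h1 : ∀ᶠ z in nhds s, dist (g z) (g s) < Real.pi :=
        Metric.tendsto_nhds.1 hgs _ Real.pi_pos
      filter_upwards [h1, ho.mem_nhds hs] with z hz hzU
      rw [dist_eq_norm] at hz
      have him : |(g z - g s).im| < Real.pi := (abs_im_le_norm _).trans_lt hz
      rw [← hg' z hzU, ← hg' s hs, ← Complex.exp_sub, Complex.log_exp]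
      · ring
      · exact (abs_lt.1 him).1
      · exact (abs_lt.1 him).2.le
    refine DifferentiableAt.congr_of_eventuallyEq ?_ hev
    have : f s / f s ∈ slitPlane := by rw [div_self (h0 s hs)]; exact one_mem_slitPlane
    exact ((hfs.div_const _).clog this).const_add _
  · rw [Complex.exp_add, Complex.exp_sub, hg' s hs, hg' s₀ hs₀, hw, div_mul_cancel₀ _ (h0 s₀ hs₀)]

lemma norm_sub_le_of_norm_le_ball {h : ℂ → ℂ} {s₀ : ℂ} {r d B : ℝ} (hd : 0 < d)
    (hh : DifferentiableOn ℂ h (Metric.ball s₀ (r + 2 * d)))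
    (hB : ∀ s ∈ Metric.closedBall s₀ (r + d), ‖h s‖ ≤ B) {s s' : ℂ}
    (hs : s ∈ Metric.closedBall s₀ r) (hs' : s' ∈ Metric.closedBall s₀ r) :
    ‖h s - h s'‖ ≤ B / d * ‖s - s'‖ := by
  refine (convex_closedBall s₀ r).norm_image_sub_le_of_norm_deriv_le (𝕜 := ℂ) (fun z hz => ?_)
    (fun z hz => ?_) hs' hs
  · refine (hh z ?_).differentiableAt (Metric.isOpen_ball.mem_nhds ?_) <;>
    · rw [Metric.mem_closedBall] at hz; rw [Metric.mem_ball]; linarith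
  · rw [Metric.mem_closedBall] at hz
    refine norm_deriv_le_of_forall_mem_sphere_norm_le hd (DifferentiableOn.diffContOnCl ?_) ?_
    · refine hh.mono fun w hw => ?_
      have := Metric.mem_closedBall.1 (Metric.closure_ball_subset_closedBall hw)
      rw [Metric.mem_ball]
      linarith [dist_triangle w z s₀]
    · intro w hw
      refine hB w ?_
      rw [Metric.mem_sphere] at hw
      rw [Metric.mem_closedBall]
      linarith [dist_triangle w z s₀]

lemma exists_factor_zeros {f : ℂ → ℂ} {s₀ : ℂ} {M L : ℝ}
    (hf : DifferentiableOn ℂ f (Metric.ball s₀ 0.45)) (hM : ∀ s ∈ Metric.ball s₀ 0.45, ‖f s‖ ≤ M)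
    (hf0 : f s₀ ≠ 0) (hL : Real.log (M / ‖f s₀‖) ≤ L) :
    ∃ (n : ℕ) (ρ : Fin n → ℂ) (g : ℂ → ℂ), (∀ i, ρ i ∈ Metric.closedBall s₀ 0.2 ∧ f (ρ i) = 0) ∧
      n * Real.log 1.2 ≤ L ∧ DifferentiableOn ℂ g (Metric.ball s₀ 0.45) ∧
      (∀ s ∈ Metric.ball s₀ 0.45, f s = (∏ i, (s - ρ i)) * g s) ∧
      (∀ s ∈ Metric.closedBall s₀ 0.2, g s ≠ 0) ∧
      (∀ s ∈ Metric.closedBall s₀ 0.44, Real.log (‖g s‖ / ‖g s₀‖) ≤ L ∨ g s = 0) := by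
  have hs₀ : s₀ ∈ Metric.ball s₀ 0.45 := Metric.mem_ball_self (by norm_num)
  have hf0' : 0 < ‖f s₀‖ := norm_pos_iff.2 hf0
  have hM0 : 0 < M := hf0'.trans_le (hM _ hs₀)
  let P : ℕ → Prop := fun n => ∃ (ρ : Fin n → ℂ) (g : ℂ → ℂ),
    (∀ i, ρ i ∈ Metric.closedBall s₀ 0.2 ∧ f (ρ i) = 0) ∧ DifferentiableOn ℂ g (Metric.ball s₀ 0.45) ∧
      (∀ s ∈ Metric.ball s₀ 0.45, f s = (∏ i, (s - ρ i)) * g s)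
  have hbound : ∀ n (ρ : Fin n → ℂ) (g : ℂ → ℂ),
    (∀ i, ρ i ∈ Metric.closedBall s₀ 0.2 ∧ f (ρ i) = 0) → DifferentiableOn ℂ g (Metric.ball s₀ 0.45) →
      (∀ s ∈ Metric.ball s₀ 0.45, f s = (∏ i, (s - ρ i)) * g s) →
      ∀ s ∈ Metric.closedBall s₀ 0.44, (‖f s₀‖ / ‖g s₀‖) * ‖g s‖ * 1.2 ^ n ≤ M := by
    intro n ρ g hρ hg hfg s hs
    have h1 : ‖g s‖ ≤ M / 0.24 ^ n := by
      refine norm_le_of_forall_mem_frontier_norm_le (U := Metric.ball s₀ 0.44) Metric.isBounded_ball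
        (DifferentiableOn.diffContOnCl (hg.mono ?_)) ?_ ?_
      · rw [closure_ball _ (by norm_num)]
        exact Metric.closedBall_subset_ball (by norm_num)
      · intro z hz
        rw [frontier_ball _ (by norm_num), Metric.mem_sphere] at hz
        have hzb : z ∈ Metric.ball s₀ 0.45 := by rw [Metric.mem_ball, hz]; norm_num
        have h2 := hM z hzb
        rw [hfg z hzb, norm_mul, norm_prod] at h2
        have h3 : (0.24 : ℝ) ^ n ≤ ∏ i, ‖z - ρ i‖ := by
          have h6 : (0.24 : ℝ) ^ n = ∏ _i : Fin n, (0.24 : ℝ) := by simp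
          rw [h6]
          refine Finset.prod_le_prod (fun _ _ => by norm_num) fun i _ => ?_
          have h4 := Metric.mem_closedBall.1 (hρ i).1
          have h5 := dist_triangle z (ρ i) s₀
          rw [← dist_eq_norm]
          linarith
        rw [le_div_iff₀ (by positivity), mul_comm]
        exact (mul_le_mul_of_nonneg_right h3 (norm_nonneg _)).trans h2
      · rw [closure_ball _ (by norm_num)]; exact hs
    have h2 : ‖f s₀‖ ≤ 0.2 ^ n * ‖g s₀‖ := by
      rw [hfg s₀ hs₀, norm_mul, norm_prod]
      refine mul_le_mul_of_nonneg_right ?_ (norm_nonneg _)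
      calc ∏ i, ‖s₀ - ρ i‖ ≤ ∏ i : Fin n, (0.2 : ℝ) := by
            refine Finset.prod_le_prod (fun _ _ => norm_nonneg _) fun i _ => ?_
            rw [← dist_eq_norm, dist_comm]
            exact Metric.mem_closedBall.1 (hρ i).1
        _ = _ := by simp
    have hg0 : 0 < ‖g s₀‖ := by
      rw [norm_pos_iff]; intro h
      apply hf0
      rw [hfg s₀ hs₀, h, mul_zero]
    have h3 : ‖f s₀‖ / ‖g s₀‖ ≤ 0.2 ^ n := by rwa [div_le_iff₀ hg0]
    calc (‖f s₀‖ / ‖g s₀‖) * ‖g s‖ * 1.2 ^ n ≤ 0.2 ^ n * (M / 0.24 ^ n) * 1.2 ^ n := by gcongr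
      _ = M := by
          rw [show (0.24 : ℝ) = 0.2 * 1.2 by norm_num, mul_pow]
          field_simp
  have hg0 : ∀ n (ρ : Fin n → ℂ) (g : ℂ → ℂ),
      (∀ s ∈ Metric.ball s₀ 0.45, f s = (∏ i, (s - ρ i)) * g s) → 0 < ‖g s₀‖ := by
    intro n ρ g hfg
    rw [norm_pos_iff]; intro h
    apply hf0
    rw [hfg s₀ hs₀, h, mul_zero]
  have hPn : ∀ n, P n → n * Real.log 1.2 ≤ L := by
    rintro n ⟨ρ, g, hρ, hg, hfg⟩
    have h1 := hbound n ρ g hρ hg hfg s₀ (Metric.mem_closedBall_self (by norm_num))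
    rw [div_mul_cancel₀ _ (hg0 n ρ g hfg).ne'] at h1
    refine le_trans ?_ hL
    rw [← Real.log_pow]
    apply Real.log_le_log (by positivity)
    rw [le_div_iff₀ hf0', mul_comm]
    exact h1
  have hlog : 0 < Real.log 1.2 := Real.log_pos (by norm_num)
  obtain ⟨n, hn, hn1⟩ : ∃ n, P n ∧ ¬ P (n + 1) := by
    by_contra hcon
    push Not at hcon
    have hall : ∀ n, P n := by
      intro n
      induction n with
      | zero => exact ⟨Fin.elim0, f, fun i => i.elim0, hf, fun s _ => by simp⟩
      | succ n ih => exact hcon n ih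
    obtain ⟨m, hm⟩ := exists_nat_gt (L / Real.log 1.2)
    have := hPn m (hall m)
    rw [div_lt_iff₀ hlog] at hm
    linarith
  have hnL := hPn n hn
  obtain ⟨ρ, g, hρ, hg, hfg⟩ := hn
  refine ⟨n, ρ, g, hρ, hnL, hg, hfg, ?_, ?_⟩
  · intro z hz hgz
    apply hn1
    have hzb : z ∈ Metric.ball s₀ 0.45 := Metric.closedBall_subset_ball (by norm_num) hz
    refine ⟨Fin.snoc ρ z, dslope g z, ?_, ?_, ?_⟩
    · intro i
      refine Fin.lastCases ?_ (fun i => ?_) i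
      · simp only [Fin.snoc_last]
        exact ⟨hz, by rw [hfg z hzb, hgz, mul_zero]⟩
      · simp only [Fin.snoc_castSucc]; exact hρ i
    · exact (Complex.differentiableOn_dslope (Metric.isOpen_ball.mem_nhds hzb)).2 hg
    · intro s hs
      rw [hfg s hs, Fin.prod_univ_castSucc]
      simp only [Fin.snoc_castSucc, Fin.snoc_last]
      have := sub_smul_dslope g z s
      rw [hgz, sub_zero, smul_eq_mul] at this
      rw [mul_assoc, this]
  · intro s hs
    by_cases hgs : g s = 0
    · exact Or.inr hgs
    · left
      have h1 := hbound n ρ g hρ hg hfg s hs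
      have h0 := hg0 n ρ g hfg
      have hgs' := norm_pos_iff.2 hgs
      refine le_trans ?_ hL
      apply Real.log_le_log (by positivity)
      rw [div_le_div_iff₀ h0 hf0']
      have h2 : ‖f s₀‖ / ‖g s₀‖ * ‖g s‖ ≤ M := by
        refine le_trans ?_ h1
        exact le_mul_of_one_le_right (by positivity) (one_le_pow₀ (by norm_num))
      rw [div_mul_eq_mul_div, div_le_iff₀ h0] at h2
      linarith

/-- Local decomposition of `log |f|` near `s₀` into zeros and a Lipschitz remainder. -/
lemma exists_local_log_decomposition {f : ℂ → ℂ} {s₀ : ℂ} {M L : ℝ}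
    (hf : DifferentiableOn ℂ f (Metric.ball s₀ 0.45)) (hM : ∀ s ∈ Metric.ball s₀ 0.45, ‖f s‖ ≤ M)
    (hf0 : f s₀ ≠ 0) (hL : Real.log (M / ‖f s₀‖) ≤ L) (hL0 : 0 < L) :
    ∃ (n : ℕ) (ρ : Fin n → ℂ) (G : ℂ → ℝ), (∀ i, ρ i ∈ Metric.closedBall s₀ 0.2 ∧ f (ρ i) = 0) ∧
      n * Real.log 1.2 ≤ L ∧
      (∀ s ∈ Metric.closedBall s₀ 0.15, f s ≠ 0 → Real.log ‖f s‖ = ∑ i, Real.log ‖s - ρ i‖ + G s) ∧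
      (∀ s ∈ Metric.closedBall s₀ 0.15, ∀ s' ∈ Metric.closedBall s₀ 0.15,
        |G s - G s'| ≤ 560 * L * ‖s - s'‖) ∧
      G s₀ = Real.log ‖f s₀‖ - ∑ i, Real.log ‖s₀ - ρ i‖ := by
  obtain ⟨n, ρ, g, hρ, hn, hg, hfg, hg0, hgL⟩ := exists_factor_zeros hf hM hf0 hL
  have hs₀ : s₀ ∈ Metric.closedBall s₀ (0.2 : ℝ) := Metric.mem_closedBall_self (by norm_num)
  have hg00 := hg0 s₀ hs₀
  have hsub : Metric.ball s₀ (0.2 : ℝ) ⊆ Metric.closedBall s₀ 0.2 := Metric.ball_subset_closedBall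
  obtain ⟨h, hhd, hhe, hh0⟩ := exists_log_of_convex (convex_ball s₀ (0.2 : ℝ)) Metric.isOpen_ball
    (f := fun s => g s / g s₀) ((hg.mono (Metric.ball_subset_ball (by norm_num))).div_const _)
    (fun s hs => div_ne_zero (hg0 s (hsub hs)) hg00)
    (s₀ := s₀) (w := 0) (Metric.mem_ball_self (by norm_num)) (by rw [Complex.exp_zero, div_self hg00])
  have hre : ∀ s ∈ Metric.ball s₀ (0.2 : ℝ), (h s).re = Real.log ‖g s‖ - Real.log ‖g s₀‖ := by
    intro s hs
    have := congrArg (fun z => Real.log ‖z‖) (hhe s hs)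
    simp only [Complex.norm_exp, Real.log_exp, norm_div] at this
    rw [this, Real.log_div (norm_ne_zero_iff.2 (hg0 s (hsub hs))) (norm_ne_zero_iff.2 hg00)]
  have hBC : ∀ s ∈ Metric.closedBall s₀ (0.15 + 0.025 : ℝ), ‖h s‖ ≤ 14 * L := by
    intro s hs
    have hsn : ‖s - s₀‖ ≤ 0.175 := by
      rw [← dist_eq_norm]; have := Metric.mem_closedBall.1 hs; norm_num at this ⊢; linarith
    have hshift : ∀ z ∈ Metric.ball (0 : ℂ) (0.2 : ℝ), s₀ + z ∈ Metric.ball s₀ (0.2 : ℝ) := by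
      intro z hz
      rw [Metric.mem_ball, dist_eq_norm] at hz ⊢
      simpa using hz
    have := borelCaratheodory_zero (f := fun z => h (s₀ + z)) (M := L) (R := 0.2) (z := s - s₀) hL0
      (hhd.comp (by fun_prop) hshift) (by
        intro z hz
        have hz' := hshift z hz
        show (h (s₀ + z)).re ≤ L
        rw [hre _ hz', ← Real.log_div (norm_ne_zero_iff.2 (hg0 _ (hsub hz'))) (norm_ne_zero_iff.2 hg00)]
        refine (hgL _ (Metric.closedBall_subset_closedBall (by norm_num) (hsub hz'))).resolve_right ?_
        exact hg0 _ (hsub hz')) (by norm_num) (by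
        rw [Metric.mem_ball, dist_zero_right]; linarith) (by simpa using hh0)
    rw [add_sub_cancel] at this
    refine this.trans ?_
    rw [div_le_iff₀ (by linarith)]
    nlinarith
  refine ⟨n, ρ, fun s => Real.log ‖g s₀‖ + (h s).re, hρ, hn, ?_, ?_, ?_⟩
  · intro s hs hfs
    have hs' : s ∈ Metric.ball s₀ (0.2 : ℝ) := Metric.closedBall_subset_ball (by norm_num) hs
    have hs'' : s ∈ Metric.ball s₀ (0.45 : ℝ) := Metric.closedBall_subset_ball (by norm_num) hs
    show Real.log ‖f s‖ = ∑ i, Real.log ‖s - ρ i‖ + (Real.log ‖g s₀‖ + (h s).re)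
    rw [hre s hs', hfg s hs'', norm_mul, norm_prod]
    rw [hfg s hs''] at hfs
    have h1 : ∀ i, s - ρ i ≠ 0 := fun i => Finset.prod_ne_zero_iff.1 (left_ne_zero_of_mul hfs) i (Finset.mem_univ i)
    rw [Real.log_mul (Finset.prod_ne_zero_iff.2 fun i _ => norm_ne_zero_iff.2 (h1 i))
      (norm_ne_zero_iff.2 (right_ne_zero_of_mul hfs)), Real.log_prod (fun i _ => norm_ne_zero_iff.2 (h1 i))]
    ring
  · intro s hs s' hs'
    have := norm_sub_le_of_norm_le_ball (h := h) (s₀ := s₀) (r := 0.15) (d := 0.025) (by norm_num)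
      (hhd.mono (Metric.ball_subset_ball (by norm_num))) hBC hs hs'
    calc |Real.log ‖g s₀‖ + (h s).re - (Real.log ‖g s₀‖ + (h s').re)| = |(h s - h s').re| := by
          rw [sub_re]; congr 1; ring
      _ ≤ ‖h s - h s'‖ := abs_re_le_norm _
      _ ≤ _ := this
      _ = _ := by rw [show 14 * L / 0.025 = 560 * L by ring]
  · have hs'' : s₀ ∈ Metric.ball s₀ (0.45 : ℝ) := Metric.mem_ball_self (by norm_num)
    simp only [hh0, zero_re, add_zero]
    have hfs := hf0
    rw [hfg s₀ hs''] at hfs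
    have h1 : ∀ i, s₀ - ρ i ≠ 0 := fun i => Finset.prod_ne_zero_iff.1 (left_ne_zero_of_mul hfs) i (Finset.mem_univ i)
    rw [hfg s₀ hs'', norm_mul, norm_prod, Real.log_mul (Finset.prod_ne_zero_iff.2 fun i _ => norm_ne_zero_iff.2 (h1 i))
      (norm_ne_zero_iff.2 hg00), Real.log_prod (fun i _ => norm_ne_zero_iff.2 (h1 i))]
    ring

/-- Pointwise lower bound for the shifted logarithmic distance to a zero; the linear term is
odd in `v`, so it disappears against an even kernel. -/
lemma exists_log_norm_shift_ge {a X y : ℝ} (ha : 1 ≤ a) (hX : 0 < X) (hy : y ≠ 0) :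
    ∃ Z c : ℝ, 0 < Z ∧ ∀ v : ℝ,
      Real.log |y| + (a ^ 2 - (16 * |v| ^ 2 + 20 * |v| ^ 4 + 4 * |v| ^ 6)) / (2 * Z) + c * v
        ≤ Real.log ‖((a / X : ℝ) : ℂ) + ((y + v / X : ℝ) : ℂ) * I‖ := by
  set Y := y * X with hY
  have hY0 : Y ≠ 0 := mul_ne_zero hy hX.ne'
  have hY2 : 0 < Y ^ 2 := by positivity
  set Z := a ^ 2 + Y ^ 2 with hZ
  have hZ1 : 1 ≤ Z := by nlinarith
  have hZ0 : 0 < Z := by linarith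
  refine ⟨Z, Y ^ 3 / Z ^ 2, hZ0, fun v => ?_⟩
  set W := a ^ 2 + (Y + v) ^ 2 with hW
  have hW0 : 0 < W := by nlinarith [sq_nonneg (Y + v)]
  have e2 : |v| ^ 2 = v ^ 2 := sq_abs v
  have e4 : |v| ^ 4 = v ^ 4 := by rw [show 4 = 2 * 2 from rfl, pow_mul, sq_abs, ← pow_mul]
  have e6 : |v| ^ 6 = v ^ 6 := by rw [show 6 = 2 * 3 from rfl, pow_mul, sq_abs, ← pow_mul]
  rw [e2, e4, e6]
  have hZW : Z ≤ 2 * (1 + v ^ 2) * W := by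
    have h1 : Z ≤ 2 * W + 2 * v ^ 2 := by rw [hZ, hW]; nlinarith [sq_nonneg (Y + 2 * v), sq_nonneg a]
    have h2 : 1 ≤ W := by nlinarith [sq_nonneg (Y + v)]
    nlinarith [sq_nonneg v]
  have hkey : Y ^ 2 / W ≤ 1 - a ^ 2 / Z - 2 * (Y ^ 3 / Z ^ 2) * v
      + (16 * v ^ 2 + 20 * v ^ 4 + 4 * v ^ 6) / Z := by
    set w := 2 * Y * v + v ^ 2 with hw
    have hWZ : W = Z + w := by rw [hW, hZ, hw]; ring
    have h1 : Y ^ 2 / W = Y ^ 2 / Z - Y ^ 2 * w / Z ^ 2 + Y ^ 2 * w ^ 2 / (Z ^ 2 * W) := by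
      have : Y ^ 2 / Z - Y ^ 2 * w / Z ^ 2 + Y ^ 2 * w ^ 2 / (Z ^ 2 * W)
        = Y ^ 2 * (Z * W - w * W + w ^ 2) / (Z ^ 2 * W) := by field_simp
      rw [this, show Z * W - w * W + w ^ 2 = Z ^ 2 by rw [hWZ]; ring]
      field_simp
    have h2 : Y ^ 2 * w ^ 2 / (Z ^ 2 * W) ≤ (16 * v ^ 2 + 20 * v ^ 4 + 4 * v ^ 6) / Z := by
      rw [div_le_div_iff₀ (by positivity) hZ0]
      have hw2 : w ^ 2 ≤ 8 * Y ^ 2 * v ^ 2 + 2 * v ^ 4 := by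
        rw [hw]; nlinarith [sq_nonneg (2 * Y * v - v ^ 2)]
      have hYZ : Y ^ 2 ≤ Z := by nlinarith
      have hv4 : v ^ 4 = (v ^ 2) ^ 2 := by ring
      have h3 : w ^ 2 ≤ Z * (8 * v ^ 2 + 2 * v ^ 4) := by
        have : 0 ≤ v ^ 4 := by positivity
        nlinarith [sq_nonneg v]
      have h4 : Y ^ 2 * w ^ 2 ≤ Z * (Z * (8 * v ^ 2 + 2 * v ^ 4)) :=
        mul_le_mul hYZ h3 (sq_nonneg _) hZ0.le
      calc Y ^ 2 * w ^ 2 * Z ≤ Z * (Z * (8 * v ^ 2 + 2 * v ^ 4)) * (2 * (1 + v ^ 2) * W) :=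
            mul_le_mul h4 hZW hZ0.le (by positivity)
        _ = _ := by ring
    have h5 : Y ^ 2 / Z = 1 - a ^ 2 / Z := by rw [hZ]; field_simp; ring
    have h6 : Y ^ 2 * w / Z ^ 2 = 2 * (Y ^ 3 / Z ^ 2) * v + Y ^ 2 * v ^ 2 / Z ^ 2 := by
      rw [hw]; field_simp
    have h7 : 0 ≤ Y ^ 2 * v ^ 2 / Z ^ 2 := by positivity
    linarith
  have hnorm : ‖((a / X : ℝ) : ℂ) + ((y + v / X : ℝ) : ℂ) * I‖ ^ 2 = W / X ^ 2 := by
    rw [Complex.norm_add_mul_I, Real.sq_sqrt (by positivity), hW, hY]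
    field_simp
  have hlog : Real.log (W / Y ^ 2) =
      2 * Real.log ‖((a / X : ℝ) : ℂ) + ((y + v / X : ℝ) : ℂ) * I‖ - 2 * Real.log |y| := by
    have h1 : W / Y ^ 2 = ‖((a / X : ℝ) : ℂ) + ((y + v / X : ℝ) : ℂ) * I‖ ^ 2 / |y| ^ 2 := by
      rw [hnorm, sq_abs, hY]; field_simp
    have h2 : 0 < ‖((a / X : ℝ) : ℂ) + ((y + v / X : ℝ) : ℂ) * I‖ ^ 2 := by rw [hnorm]; positivity
    rw [h1, Real.log_div h2.ne' (by positivity), Real.log_pow, Real.log_pow]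
    norm_num
  have hle : 1 - Y ^ 2 / W ≤ Real.log (W / Y ^ 2) := by
    have := Real.one_sub_inv_le_log_of_pos (show 0 < W / Y ^ 2 by positivity)
    rwa [inv_div] at this
  have h8 : (a ^ 2 - (16 * v ^ 2 + 20 * v ^ 4 + 4 * v ^ 6)) / (2 * Z)
      = (a ^ 2 / Z - (16 * v ^ 2 + 20 * v ^ 4 + 4 * v ^ 6) / Z) / 2 := by
    field_simp
  rw [h8]
  linarith

/-- A function with polynomial growth, zeros only on the critical line, and a logarithm `H` to
the right of that line. -/
structure GrowthLog (f H : ℂ → ℂ) (A : ℝ) (m : ℕ) (B : ℝ) : Prop where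
  one_le : 1 ≤ A
  diff : DifferentiableOn ℂ f {s | 1 / 10 < s.re}
  bound : ∀ s : ℂ, 1 / 10 ≤ s.re → s.re ≤ 4 → ‖f s‖ ≤ A * (1 + ‖s‖) ^ m
  zeros : ∀ s : ℂ, 1 / 10 < s.re → f s = 0 → s.re = 1 / 2
  logDiff : DifferentiableOn ℂ H {s | 1 / 2 < s.re}
  exp_eq : ∀ s : ℂ, 1 / 2 < s.re → cexp (H s) = f s
  logBound : ∀ t : ℝ, ‖H (2 + t * I)‖ ≤ B

lemma GrowthLog.log_norm_bound {f H : ℂ → ℂ} {A B : ℝ} {m : ℕ} (h : GrowthLog f H A m B) {s : ℂ} {t : ℝ}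
    (h1 : 1 / 10 ≤ s.re) (h2 : s.re ≤ 4) (h3 : |s.im - t| ≤ 2) :
    A * (1 + ‖s‖) ^ m ≤ A * (3 + |t|) ^ (2 * m) := by
  have hn : ‖s‖ ≤ 6 + |t| := by
    have := Complex.norm_le_abs_re_add_abs_im s
    rw [abs_of_nonneg (by linarith)] at this
    have h4 : |s.im| ≤ |s.im - t| + |t| := by
      have := abs_add_le (s.im - t) t; rwa [sub_add_cancel] at this
    linarith
  have h0 := abs_nonneg t
  have : 1 + ‖s‖ ≤ (3 + |t|) ^ 2 := by nlinarith
  rw [pow_mul]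
  have hA := h.one_le
  exact mul_le_mul_of_nonneg_left (pow_le_pow_left₀ (by positivity) this m) (by linarith)

lemma GrowthLog.log_le {f H : ℂ → ℂ} {A B : ℝ} {m : ℕ} (h : GrowthLog f H A m B) {s : ℂ} {t : ℝ}
    (h1 : 1 / 10 ≤ s.re) (h2 : s.re ≤ 4) (h3 : |s.im - t| ≤ 2) :
    ‖f s‖ ≤ Real.exp ((Real.log A + 2 * m) * Real.log (3 + |t|)) := by
  refine (h.bound s h1 h2).trans ((h.log_norm_bound h1 h2 h3).trans ?_)
  have hA := h.one_le
  have ht := abs_nonneg t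
  have hl : 1 ≤ Real.log (3 + |t|) := by
    rw [Real.le_log_iff_exp_le (by linarith)]
    linarith [Real.exp_one_lt_d9]
  have hAe : A = Real.exp (Real.log A) := (Real.exp_log (by linarith)).symm
  have hte : (3 + |t|) ^ (2 * m) = Real.exp (2 * m * Real.log (3 + |t|)) := by
    rw [mul_comm (2 * (m : ℝ)), Real.exp_mul, Real.exp_log (by linarith), ← Real.rpow_natCast]; push_cast; rfl
  rw [hte]
  nth_rewrite 1 [hAe]
  rw [← Real.exp_add]
  apply Real.exp_le_exp.2
  nlinarith [Real.log_nonneg hA]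

/-- Borel–Carathéodory bound for the logarithm near the critical line. -/
lemma GrowthLog.norm_log_le {f H : ℂ → ℂ} {A B : ℝ} {m : ℕ} (h : GrowthLog f H A m B) :
    ∃ C : ℝ, 0 < C ∧ ∀ s : ℂ, 1 / 2 < s.re → s.re ≤ 2 →
      ‖H s‖ ≤ C / (s.re - 1 / 2) * Real.log (3 + |s.im|) := by
  have hA := Real.log_nonneg h.one_le
  have hB : 0 ≤ B := (norm_nonneg _).trans (h.logBound 0)
  refine ⟨6 * (Real.log A + 2 * m + B + 1) + 2 * B, by positivity, fun s hs1 hs2 => ?_⟩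
  set l := Real.log (3 + |s.im|) with hldef
  have ht := abs_nonneg s.im
  have hl : 1 ≤ l := by
    rw [hldef, Real.le_log_iff_exp_le (by linarith)]
    linarith [Real.exp_one_lt_d9]
  set d := s.re - 1 / 2 with hd
  have hd0 : 0 < d := by linarith
  set M := (Real.log A + 2 * m + B + 1) * l with hM
  have hM0 : 0 < M := by positivity
  set c : ℂ := 2 + (s.im : ℝ) * I with hc
  have hcre : c.re = 2 := by simp [hc]
  have hcim : c.im = s.im := by simp [hc]
  have hre : ∀ z ∈ Metric.ball (0 : ℂ) (3 / 2 - d / 2), 1 / 2 < (c + z).re ∧ (c + z).re ≤ 4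
      ∧ |(c + z).im - s.im| ≤ 2 := by
    intro z hz
    rw [Metric.mem_ball, dist_zero_right] at hz
    have h1 := (abs_le.1 (Complex.abs_re_le_norm z))
    have h2 := (Complex.abs_im_le_norm z)
    rw [add_re, add_im, hcre, hcim]
    refine ⟨by linarith, by linarith, ?_⟩
    rw [add_sub_cancel_left]; linarith
  have hz : ‖s - c‖ = 3 / 2 - d := by
    have : s - c = ((s.re - 2 : ℝ) : ℂ) := by
      apply Complex.ext <;> simp [hc]
    rw [this, Complex.norm_real, Real.norm_eq_abs, abs_of_nonpos (by linarith)]; rw [hd]; ring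
  have key := borelCaratheodory_zero (f := fun z => H (c + z) - H c) (M := M) (R := 3 / 2 - d / 2)
    (z := s - c) hM0 (by
      suffices hh : DifferentiableOn ℂ (fun z => H (c + z)) (Metric.ball 0 (3 / 2 - d / 2)) from
        hh.sub_const (H c)
      exact h.logDiff.comp (by fun_prop) fun z hz => (hre z hz).1) (by
      intro z hz
      obtain ⟨h1, h2, h3⟩ := hre z hz
      show (H (c + z) - H c).re ≤ M
      have h4 := h.log_le (by linarith) h2 h3
      rw [← h.exp_eq _ h1, Complex.norm_exp, Real.exp_le_exp] at h4
      have h5 : -(H c).re ≤ B := (neg_le_abs _).trans ((Complex.abs_re_le_norm _).trans (h.logBound _))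
      rw [sub_re, hM]
      nlinarith) (by linarith) (by rw [Metric.mem_ball, dist_zero_right, hz]; linarith) (by simp)
  simp only [add_sub_cancel] at key
  rw [hz, show (3 / 2 - d / 2 - (3 / 2 - d)) = d / 2 by ring] at key
  have h6 : ‖H s‖ ≤ ‖H s - H c‖ + ‖H c‖ := by
    have := norm_add_le (H s - H c) (H c); rwa [sub_add_cancel] at this
  have h7 : 2 * M * (3 / 2 - d) / (d / 2) ≤ 6 * M / d := by
    rw [div_le_div_iff₀ (by positivity) hd0]
    nlinarith [mul_pos hM0 hd0, mul_pos (mul_pos hM0 hd0) hd0]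
  have h8 : B ≤ 2 * B * l / d := by
    rw [le_div_iff₀ hd0]; nlinarith [mul_nonneg hB (by linarith : (0:ℝ) ≤ l - 1)]
  have h9 := h.logBound s.im
  calc ‖H s‖ ≤ 6 * M / d + 2 * B * l / d := by linarith
    _ = _ := by rw [hM]; field_simp

/-- An even probability density with all moments whose Fourier transform vanishes outside
`(-1, 1)`. -/
structure BandKernel (k : ℝ → ℝ) : Prop where
  nonneg : ∀ v, 0 ≤ k v
  even : ∀ v, k (-v) = k v
  cont : Continuous k
  moment : ∀ n : ℕ, Integrable (fun v => |v| ^ n * k v)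
  integral_eq : ∫ v, k v = 1
  fourier : ∀ y : ℝ, 1 ≤ |y| → ∫ v, (k v : ℂ) * cexp (-(v * y : ℝ) * I) = 0

lemma BandKernel.integrable {k : ℝ → ℝ} (hk : BandKernel k) : Integrable k := by
  simpa using hk.moment 0

lemma BandKernel.integrable_id_mul {k : ℝ → ℝ} (hk : BandKernel k) : Integrable fun v => v * k v := by
  refine (hk.moment 1).mono' (continuous_id.mul hk.cont).aestronglyMeasurable
    (Eventually.of_forall fun v => ?_)
  rw [norm_mul, Real.norm_eq_abs, Real.norm_eq_abs, abs_of_nonneg (hk.nonneg v), pow_one]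

lemma BandKernel.integral_id_mul {k : ℝ → ℝ} (hk : BandKernel k) : ∫ v, v * k v = 0 := by
  have h := integral_neg_eq_self (fun v => v * k v) volume
  simp only [hk.even, neg_mul] at h
  rw [integral_neg] at h
  linarith

/-- Integrability of anything of linear growth against the kernel. -/
lemma BandKernel.integrable_mul_of_le {k : ℝ → ℝ} (hk : BandKernel k) {F : ℝ → ℂ} (hF : Continuous F)
    {a b : ℝ} (hab : ∀ v, ‖F v‖ ≤ a + b * |v|) : Integrable fun v => F v * (k v : ℂ) := by
  have h1 : Integrable fun v => a * k v + b * (|v| ^ 1 * k v) :=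
    (hk.integrable.const_mul a).add ((hk.moment 1).const_mul b)
  refine h1.mono' (hF.mul (continuous_ofReal.comp hk.cont)).aestronglyMeasurable
    (Eventually.of_forall fun v => ?_)
  rw [norm_mul, Complex.norm_real, Real.norm_eq_abs, abs_of_nonneg (hk.nonneg v)]
  calc ‖F v‖ * k v ≤ (a + b * |v|) * k v := mul_le_mul_of_nonneg_right (hab v) (hk.nonneg v)
    _ = _ := by ring

lemma GrowthLog.continuous_shift {f H : ℂ → ℂ} {A B : ℝ} {m : ℕ} (h : GrowthLog f H A m B) {s : ℂ}
    (hs1 : 1 / 2 < s.re) (X : ℝ) : Continuous fun v : ℝ => H (s + ((v / X : ℝ) : ℂ) * I) := by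
  refine h.logDiff.continuousOn.comp_continuous (by fun_prop) fun v => ?_
  simpa using hs1

lemma GrowthLog.exists_linear_bound {f H : ℂ → ℂ} {A B : ℝ} {m : ℕ} (h : GrowthLog f H A m B) {s : ℂ}
    (hs1 : 1 / 2 < s.re) (hs2 : s.re ≤ 2) {X : ℝ} (hX : 0 < X) :
    ∃ a b : ℝ, ∀ v : ℝ, ‖H (s + ((v / X : ℝ) : ℂ) * I)‖ ≤ a + b * |v| := by
  obtain ⟨C, hC, hb⟩ := h.norm_log_le
  have hd : 0 < s.re - 1 / 2 := by linarith
  refine ⟨C / (s.re - 1 / 2) * (3 + |s.im|), C / (s.re - 1 / 2) / X, fun v => ?_⟩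
  have hre : (s + ((v / X : ℝ) : ℂ) * I).re = s.re := by simp
  have him : (s + ((v / X : ℝ) : ℂ) * I).im = s.im + v / X := by simp
  have h1 := hb (s + ((v / X : ℝ) : ℂ) * I) (by rw [hre]; exact hs1) (by rw [hre]; exact hs2)
  rw [hre, him] at h1
  refine h1.trans ?_
  have h2 : Real.log (3 + |s.im + v / X|) ≤ 3 + |s.im| + |v| / X := by
    have h3 := abs_add_le s.im (v / X)
    rw [abs_div, abs_of_pos hX] at h3
    exact (Real.log_le_self (by positivity)).trans (by linarith)
  calc C / (s.re - 1 / 2) * Real.log (3 + |s.im + v / X|)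
      ≤ C / (s.re - 1 / 2) * (3 + |s.im| + |v| / X) := by gcongr
    _ = _ := by field_simp

lemma GrowthLog.integrable_shift {f H : ℂ → ℂ} {A B : ℝ} {m : ℕ} (h : GrowthLog f H A m B) {s : ℂ}
    (hs1 : 1 / 2 < s.re) (hs2 : s.re ≤ 2) {X : ℝ} (hX : 0 < X) {k : ℝ → ℝ} (hk : BandKernel k) :
    Integrable fun v : ℝ => H (s + ((v / X : ℝ) : ℂ) * I) * (k v : ℂ) := by
  obtain ⟨a, b, hab⟩ := h.exists_linear_bound hs1 hs2 hX
  exact hk.integrable_mul_of_le (h.continuous_shift hs1 X) hab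

/-- Local decomposition at height `t`, normalised to the critical line. -/
lemma GrowthLog.exists_decomposition {f H : ℂ → ℂ} {A B : ℝ} {m : ℕ} (h : GrowthLog f H A m B) :
    ∃ C : ℝ, 1 ≤ C ∧ ∀ t : ℝ, 3 ≤ t → ∃ (n : ℕ) (γ : Fin n → ℝ) (G : ℂ → ℝ),
      (n : ℝ) ≤ C * Real.log t ∧ (∀ i, |t - γ i| ≤ 1 / 5) ∧
      (∀ i, f (1 / 2 + (γ i : ℂ) * I) = 0) ∧
      (∀ s ∈ Metric.closedBall (0.6 + (t : ℂ) * I) 0.15, f s ≠ 0 →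
        Real.log ‖f s‖ = ∑ i, Real.log ‖s - (1 / 2 + (γ i : ℂ) * I)‖ + G s) ∧
      (∀ s ∈ Metric.closedBall (0.6 + (t : ℂ) * I) 0.15, ∀ s' ∈ Metric.closedBall (0.6 + (t : ℂ) * I) 0.15,
        |G s - G s'| ≤ C * Real.log t * ‖s - s'‖) ∧
      G (1 / 2 + (t : ℂ) * I) ≤ C * Real.log t := by
  obtain ⟨C₁, hC₁, hHb⟩ := h.norm_log_le
  have hA := Real.log_nonneg h.one_le
  obtain ⟨K, hK⟩ : ∃ K, K = Real.log A + 2 * m + 1 := ⟨_, rfl⟩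
  have hK1 : 1 ≤ K := by rw [hK]; have : (0:ℝ) ≤ m := Nat.cast_nonneg m; linarith
  obtain ⟨C₂, hC₂⟩ : ∃ C₂, C₂ = 2 * K + 20 * C₁ := ⟨_, rfl⟩
  have hC₂1 : 1 ≤ C₂ := by rw [hC₂]; linarith
  refine ⟨560 * C₂ + 56 * C₂ + 20 * C₁ + 60 * C₂, by linarith, fun t ht => ?_⟩
  have habs : |t| = t := abs_of_nonneg (by linarith)
  obtain ⟨l, hl⟩ : ∃ l, l = Real.log t := ⟨_, rfl⟩
  have hl1 : 1 ≤ l := by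
    rw [hl, Real.le_log_iff_exp_le (by linarith)]; linarith [Real.exp_one_lt_d9]
  have hl3 : Real.log (3 + t) ≤ 2 * l := by
    rw [hl, show (2 : ℝ) * Real.log t = Real.log (t ^ 2) by rw [Real.log_pow]; norm_num]
    exact Real.log_le_log (by linarith) (by nlinarith)
  set s₀ : ℂ := 0.6 + (t : ℂ) * I with hs₀
  have hs₀re : s₀.re = 0.6 := by rw [hs₀]; norm_num [Complex.div_re, Complex.normSq]
  have hs₀im : s₀.im = t := by rw [hs₀]; norm_num [Complex.div_im, Complex.normSq]
  have hball : ∀ r : ℝ, r ≤ 0.45 → ∀ s ∈ Metric.closedBall s₀ r, |s.re - 0.6| ≤ r ∧ |s.im - t| ≤ r := by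
    intro r hr s hs
    rw [Metric.mem_closedBall, dist_eq_norm] at hs
    have h1 := Complex.abs_re_le_norm (s - s₀)
    have h2 := Complex.abs_im_le_norm (s - s₀)
    rw [sub_re, hs₀re] at h1
    rw [sub_im, hs₀im] at h2
    exact ⟨h1.trans hs, h2.trans hs⟩
  have hH0 : ‖H s₀‖ ≤ 20 * C₁ * l := by
    have := hHb s₀ (by rw [hs₀re]; norm_num) (by rw [hs₀re]; norm_num)
    rw [hs₀re, hs₀im, habs] at this
    refine this.trans ?_
    rw [show C₁ / (0.6 - 1 / 2) = 10 * C₁ by ring]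
    nlinarith
  have hf0n : ‖f s₀‖ = Real.exp (H s₀).re := by
    rw [← h.exp_eq s₀ (by rw [hs₀re]; norm_num), Complex.norm_exp]
  have hf0 : f s₀ ≠ 0 := by
    rw [← h.exp_eq s₀ (by rw [hs₀re]; norm_num)]; exact Complex.exp_ne_zero _
  have hreH := abs_le.1 ((Complex.abs_re_le_norm (H s₀)).trans hH0)
  obtain ⟨n, ρ, G, hρ, hn, hG, hGL, hG0⟩ := exists_local_log_decomposition (f := f) (s₀ := s₀)
    (M := Real.exp (K * Real.log (3 + t))) (L := C₂ * l)
    (h.diff.mono fun s hs => by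
      have := (abs_le.1 (hball 0.45 le_rfl s (Metric.ball_subset_closedBall hs)).1)
      show 1 / 10 < s.re
      norm_num at this ⊢; linarith) (fun s hs => by
      have h3 := hball 0.45 le_rfl s (Metric.ball_subset_closedBall hs)
      have h1 := (abs_le.1 h3.1)
      refine (h.log_le (t := t) (by norm_num at h1 ⊢; linarith) (by norm_num at h1 ⊢; linarith)
        (h3.2.trans (by norm_num))).trans (Real.exp_le_exp.2 ?_)
      rw [habs, hK]
      have : 0 ≤ Real.log (3 + t) := Real.log_nonneg (by linarith)
      nlinarith) hf0 (by
      rw [hf0n, ← Real.exp_sub, Real.log_exp, hC₂]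
      nlinarith) (by positivity)
  have hρre : ∀ i, ρ i = 1 / 2 + ((ρ i).im : ℂ) * I := by
    intro i
    have h1 := (abs_le.1 (hball 0.2 (by norm_num) _ (hρ i).1).1)
    have h2 := h.zeros (ρ i) (by norm_num at h1 ⊢; linarith) (hρ i).2
    apply Complex.ext
    · rw [h2]; norm_num
    · norm_num
  have hn6 : (n : ℝ) ≤ 6 * (C₂ * l) := by
    have h1 : (1 : ℝ) / 6 ≤ Real.log 1.2 := by
      have := Real.one_sub_inv_le_log_of_pos (show (0 : ℝ) < 1.2 by norm_num)
      norm_num at this ⊢; linarith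
    have h2 : (0 : ℝ) ≤ n := Nat.cast_nonneg n
    nlinarith
  have hC₂l : 0 ≤ C₂ * l := by positivity
  have hC₁l : 0 ≤ C₁ * l := by positivity
  refine ⟨n, fun i => (ρ i).im, G, ?_, fun i => ?_, fun i => ?_, fun s hs hfs => ?_, fun s hs s' hs' => ?_, ?_⟩
  · rw [← hl]; nlinarith
  · have := (hball 0.2 (by norm_num) _ (hρ i).1).2
    rw [abs_sub_comm]; norm_num at this ⊢; exact this
  · rw [← hρre i]; exact (hρ i).2
  · simp only [← hρre]; exact hG s hs hfs
  · refine (hGL s hs s' hs').trans (mul_le_mul_of_nonneg_right ?_ (norm_nonneg _))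
    rw [← hl]; nlinarith
  · have h1 := hGL (1 / 2 + (t : ℂ) * I) (by
        rw [Metric.mem_closedBall, dist_eq_norm, hs₀]; norm_num) s₀ (by
        rw [Metric.mem_closedBall, dist_self]; norm_num)
    rw [show (1 / 2 + (t : ℂ) * I - s₀) = ((-0.1 : ℝ) : ℂ) by rw [hs₀]; push_cast; ring,
      Complex.norm_real] at h1
    have h2 := (abs_le.1 h1).2
    have h3 : ∀ i, -10 ≤ Real.log ‖s₀ - ρ i‖ := by
      intro i
      have h4 : (0.1 : ℝ) ≤ ‖s₀ - ρ i‖ := by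
        have := Complex.abs_re_le_norm (s₀ - ρ i)
        rw [sub_re, hs₀re, hρre i] at this
        norm_num at this ⊢
        rw [hρre i]; norm_num; exact this
      have h5 := Real.one_sub_inv_le_log_of_pos (show 0 < ‖s₀ - ρ i‖ by linarith)
      have h6 : ‖s₀ - ρ i‖⁻¹ ≤ 10 := by
        rw [show (10 : ℝ) = (0.1 : ℝ)⁻¹ by norm_num]; exact inv_anti₀ (by norm_num) h4
      linarith
    have h7 : ∑ i : Fin n, (-10 : ℝ) ≤ ∑ i, Real.log ‖s₀ - ρ i‖ := Finset.sum_le_sum fun i _ => h3 i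
    simp only [Finset.sum_const, Finset.card_univ, Fintype.card_fin, nsmul_eq_mul] at h7
    have h8 : Real.log ‖f s₀‖ ≤ 20 * C₁ * l := by rw [hf0n, Real.log_exp]; exact hreH.2
    rw [← hl]
    rw [hG0] at h2
    norm_num at h2
    nlinarith

set_option maxHeartbeats 1000000 in
/-- Pointwise comparison of `log |f|` on the critical line with `Re H` on a shifted vertical
segment. -/
lemma GrowthLog.exists_pointwise {f H : ℂ → ℂ} {A B : ℝ} {m : ℕ} (h : GrowthLog f H A m B) {a : ℝ}
    (ha : 1 ≤ a) :
    ∃ C : ℝ, 0 < C ∧ ∀ t : ℝ, 3 ≤ t → ∀ X : ℝ, 10 * a ≤ X → f (1 / 2 + (t : ℂ) * I) ≠ 0 →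
      ∃ (n : ℕ) (Z c : Fin n → ℝ), (∀ i, 0 < Z i) ∧ ∀ v : ℝ,
        Real.log ‖f (1 / 2 + (t : ℂ) * I)‖
          + ∑ i, ((a ^ 2 - (16 * |v| ^ 2 + 20 * |v| ^ 4 + 4 * |v| ^ 6)) / (2 * Z i) + c i * v)
          - C * Real.log t / X * (1 + |v| + |v| ^ 2 + |v| ^ 3)
        ≤ (H ((1 / 2 + (a / X : ℝ) + (t : ℂ) * I) + ((v / X : ℝ) : ℂ) * I)).re := by
  obtain ⟨C₁, hC₁, hHb⟩ := h.norm_log_le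
  obtain ⟨C₂, hC₂, hdec⟩ := h.exists_decomposition
  refine ⟨C₂ * a + 30 * C₂ + 1000 * C₁, by positivity, fun t ht X hX hft => ?_⟩
  obtain ⟨n, γ, G, hn, hγ, hγ0, hG, hGL, hG1⟩ := hdec t ht
  obtain ⟨l, hl⟩ : ∃ l, l = Real.log t := ⟨_, rfl⟩
  rw [← hl] at hn hG1 ⊢
  simp only [← hl] at hGL
  have hX0 : 0 < X := by linarith
  have habs : |t| = t := abs_of_nonneg (by linarith)
  have hl1 : 1 ≤ l := by
    rw [hl, Real.le_log_iff_exp_le (by linarith)]; linarith [Real.exp_one_lt_d9]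
  have hl3 : Real.log (3 + t) ≤ 2 * l := by
    rw [hl, show (2 : ℝ) * Real.log t = Real.log (t ^ 2) by rw [Real.log_pow]; norm_num]
    exact Real.log_le_log (by linarith) (by nlinarith)
  have hy : ∀ i, t - γ i ≠ 0 := by
    intro i hi
    apply hft
    rw [sub_eq_zero.1 hi]; exact hγ0 i
  choose Z c hZ hZc using fun i => exists_log_norm_shift_ge ha hX0 (hy i)
  refine ⟨n, Z, c, hZ, fun v => ?_⟩
  set s₁ : ℂ := 1 / 2 + (t : ℂ) * I with hs₁
  set s : ℂ := (1 / 2 + (a / X : ℝ) + (t : ℂ) * I) + ((v / X : ℝ) : ℂ) * I with hs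
  have hsre : s.re = 1 / 2 + a / X := by
    rw [hs]; simp only [add_re, mul_re, ofReal_re, I_re, ofReal_im, I_im]; norm_num
  have hsim : s.im = t + v / X := by
    rw [hs]; simp only [add_im, mul_im, ofReal_re, I_re, ofReal_im, I_im]; norm_num
  have haX : 0 < a / X := by positivity
  have haX1 : a / X ≤ 1 / 10 := by rw [div_le_iff₀ hX0]; linarith
  have hs₁mem : s₁ ∈ Metric.closedBall (0.6 + (t : ℂ) * I) 0.15 := by
    rw [Metric.mem_closedBall, dist_eq_norm, hs₁]; norm_num
  have hlog1 : Real.log ‖f s₁‖ = ∑ i, Real.log |t - γ i| + G s₁ := by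
    rw [hG s₁ hs₁mem hft]
    congr 1
    refine Finset.sum_congr rfl fun i _ => ?_
    rw [show s₁ - (1 / 2 + (γ i : ℂ) * I) = ((t - γ i : ℝ) : ℂ) * I by rw [hs₁]; push_cast; ring,
      norm_mul, Complex.norm_I, mul_one, Complex.norm_real, Real.norm_eq_abs]
  have hsρ : ∀ i, s - (1 / 2 + (γ i : ℂ) * I)
      = ((a / X : ℝ) : ℂ) + ((t - γ i + v / X : ℝ) : ℂ) * I := by
    intro i; rw [hs]; push_cast; ring
  have hsum : ∑ i, Real.log |t - γ i|
      + ∑ i, ((a ^ 2 - (16 * |v| ^ 2 + 20 * |v| ^ 4 + 4 * |v| ^ 6)) / (2 * Z i) + c i * v)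
      ≤ ∑ i, Real.log ‖s - (1 / 2 + (γ i : ℂ) * I)‖ := by
    rw [← Finset.sum_add_distrib]
    refine Finset.sum_le_sum fun i _ => ?_
    rw [hsρ i, ← add_assoc]
    exact hZc i v
  have hshalf : 1 / 2 < s.re := by rw [hsre]; linarith
  have hfs : f s ≠ 0 := by rw [← h.exp_eq s hshalf]; exact Complex.exp_ne_zero _
  have hfsH : Real.log ‖f s‖ = (H s).re := by
    rw [← h.exp_eq s hshalf, Complex.norm_exp, Real.log_exp]
  set u := |v| with hu
  have hu0 : 0 ≤ u := abs_nonneg v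
  suffices hmain : ∑ i, Real.log ‖s - (1 / 2 + (γ i : ℂ) * I)‖ + G s₁
      - (C₂ * a + 30 * C₂ + 1000 * C₁) * l / X * (1 + u + u ^ 2 + u ^ 3) ≤ (H s).re by
    rw [hlog1]; linarith
  have hlX : 0 ≤ l / X := by positivity
  have hrw : (C₂ * a + 30 * C₂ + 1000 * C₁) * l / X * (1 + u + u ^ 2 + u ^ 3)
      = (C₂ * a + 30 * C₂ + 1000 * C₁) * (1 + u + u ^ 2 + u ^ 3) * (l / X) := by ring
  rw [hrw]
  have hu2 : 0 ≤ u ^ 2 := by positivity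
  have hu3 : 0 ≤ u ^ 3 := by positivity
  by_cases hv : u ≤ X / 20
  · have hvX : u / X ≤ 1 / 20 := by rw [div_le_iff₀ hX0]; linarith
    have hvXe : |v / X| = u / X := by rw [abs_div, abs_of_pos hX0]
    have hsmem : s ∈ Metric.closedBall (0.6 + (t : ℂ) * I) 0.15 := by
      rw [Metric.mem_closedBall, dist_eq_norm,
        show s - (0.6 + (t : ℂ) * I) = ((a / X - 0.1 : ℝ) : ℂ) + ((v / X : ℝ) : ℂ) * I by
          rw [hs]; push_cast; ring]
      refine (norm_add_le _ _).trans ?_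
      rw [norm_mul, Complex.norm_I, mul_one, Complex.norm_real, Complex.norm_real, Real.norm_eq_abs,
        Real.norm_eq_abs, hvXe, abs_of_nonpos (by linarith)]
      linarith
    rw [← hfsH, hG s hsmem hfs]
    have h1 := (abs_le.1 (hGL s hsmem s₁ hs₁mem)).1
    have h2 : ‖s - s₁‖ ≤ a / X + u / X := by
      rw [show s - s₁ = ((a / X : ℝ) : ℂ) + ((v / X : ℝ) : ℂ) * I by rw [hs, hs₁]; ring]
      refine (norm_add_le _ _).trans ?_
      rw [norm_mul, Complex.norm_I, mul_one, Complex.norm_real, Complex.norm_real, Real.norm_eq_abs,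
        Real.norm_eq_abs, hvXe, abs_of_nonneg haX.le]
    have h3 : C₂ * l * ‖s - s₁‖ ≤ C₂ * (a + u) * (l / X) := by
      calc C₂ * l * ‖s - s₁‖ ≤ C₂ * l * (a / X + u / X) :=
            mul_le_mul_of_nonneg_left h2 (by positivity)
        _ = _ := by field_simp
    have h4 : C₂ * (a + u) ≤ (C₂ * a + 30 * C₂ + 1000 * C₁) * (1 + u + u ^ 2 + u ^ 3) := by
      have e1 : 0 ≤ C₂ * a := by positivity
      have e2 : 0 ≤ C₂ * a * (u + u ^ 2 + u ^ 3) := by positivity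
      have e3 : 0 ≤ 1000 * C₁ * (1 + u + u ^ 2 + u ^ 3) := by positivity
      have e4 : 0 ≤ C₂ * (30 + 29 * u + 30 * u ^ 2 + 30 * u ^ 3) := by positivity
      linarith
    have h5 := mul_le_mul_of_nonneg_right h4 hlX
    linarith
  · push Not at hv
    have hvX : 1 / 20 < u / X := by rw [lt_div_iff₀ hX0]; linarith
    have huX : u = (u / X) * X := by field_simp
    obtain ⟨r, hr⟩ : ∃ r, r = u / X := ⟨_, rfl⟩
    rw [← hr] at hvX
    have hr0 : 0 < r := by linarith
    have hrX : r * l = u * (l / X) := by rw [hr]; ring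
    have hH : -(H s).re ≤ C₁ * (800 * u ^ 2 * (1 + u)) * (l / X) := by
      have h1 := hHb s hshalf (by rw [hsre]; linarith)
      rw [hsre, hsim, add_sub_cancel_left] at h1
      have h2 : -(H s).re ≤ ‖H s‖ := (neg_le_abs _).trans (Complex.abs_re_le_norm _)
      have h3 : Real.log (3 + |t + v / X|) ≤ 2 * l * (1 + u) := by
        have e1 : |t + v / X| ≤ t + u := by
          refine (abs_add_le _ _).trans ?_
          rw [habs, abs_div, abs_of_pos hX0]
          have : u / X ≤ u := div_le_self hu0 (by linarith)
          linarith
        have e2 : 3 + |t + v / X| ≤ (3 + t) * (1 + u) := by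
            have := mul_nonneg (show 0 ≤ t by linarith) hu0
            linarith
        calc Real.log (3 + |t + v / X|) ≤ Real.log ((3 + t) * (1 + u)) :=
              Real.log_le_log (by positivity) e2
          _ = Real.log (3 + t) + Real.log (1 + u) := Real.log_mul (by linarith) (by linarith)
          _ ≤ 2 * l + u := by
              have := Real.log_le_sub_one_of_pos (show 0 < 1 + u by linarith); linarith
          _ ≤ _ := by
            have := mul_le_mul_of_nonneg_right hl1 hu0
            linarith
      have h4 : C₁ / (a / X) ≤ C₁ * X := by
        rw [div_div_eq_mul_div, div_le_iff₀ (by linarith)]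
        have : 0 ≤ C₁ * X := by positivity
        exact le_mul_of_one_le_right this ha
      have h5 : X ≤ 400 * u ^ 2 / X := by
        rw [le_div_iff₀ hX0, ← sq]
        calc X ^ 2 ≤ (20 * u) ^ 2 := pow_le_pow_left₀ hX0.le (by linarith) 2
          _ = _ := by ring
      calc -(H s).re ≤ C₁ / (a / X) * Real.log (3 + |t + v / X|) := h2.trans h1
        _ ≤ (C₁ * (400 * u ^ 2 / X)) * (2 * l * (1 + u)) :=
            mul_le_mul (h4.trans (mul_le_mul_of_nonneg_left h5 hC₁.le)) h3
              (Real.log_nonneg (by linarith [abs_nonneg (t + v / X)])) (by positivity)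
        _ = _ := by ring
    have hPhi : ∑ i, Real.log ‖s - (1 / 2 + (γ i : ℂ) * I)‖ ≤ C₂ * l * (7 * r) := by
      have h1 : ∀ i, Real.log ‖s - (1 / 2 + (γ i : ℂ) * I)‖ ≤ 7 * r := by
        intro i
        refine (Real.log_le_self (norm_nonneg _)).trans ?_
        rw [hsρ i]
        refine (norm_add_le _ _).trans ?_
        rw [norm_mul, Complex.norm_I, mul_one, Complex.norm_real, Complex.norm_real, Real.norm_eq_abs,
          Real.norm_eq_abs, abs_of_nonneg haX.le]
        have e1 := abs_add_le (t - γ i) (v / X)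
        have e2 : |v / X| = r := by rw [abs_div, abs_of_pos hX0, hr]
        have e3 := hγ i
        linarith
      refine (Finset.sum_le_sum fun i _ => h1 i).trans ?_
      rw [Finset.sum_const, Finset.card_univ, Fintype.card_fin, nsmul_eq_mul]
      exact mul_le_mul_of_nonneg_right hn (by positivity)
    have hG1' : G s₁ ≤ C₂ * l * (20 * r) := by
      refine hG1.trans ?_
      have : 0 < C₂ * l := by positivity
      exact le_mul_of_one_le_right this.le (by linarith)
    have h6 : C₂ * l * (7 * r) + C₂ * l * (20 * r) = C₂ * 27 * u * (l / X) := by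
      rw [mul_assoc (C₂ * 27), ← hrX]; ring
    have h7 : C₂ * 27 * u + C₁ * (800 * u ^ 2 * (1 + u))
        ≤ (C₂ * a + 30 * C₂ + 1000 * C₁) * (1 + u + u ^ 2 + u ^ 3) := by
      have e1 : 0 ≤ C₂ * a * (1 + u + u ^ 2 + u ^ 3) := by positivity
      have e2 : 0 ≤ C₂ * (30 + 3 * u + 30 * u ^ 2 + 30 * u ^ 3) := by positivity
      have e3 : 0 ≤ C₁ * (1000 + 1000 * u + 200 * u ^ 2 + 200 * u ^ 3) := by positivity
      linarith
    have h8 := mul_le_mul_of_nonneg_right h7 hlX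
    rw [add_mul] at h8
    linarith

set_option maxHeartbeats 400000 in
/-- Averaged upper bound for `log |f|` on the critical line. -/
theorem GrowthLog.exists_log_norm_le {f H : ℂ → ℂ} {A B : ℝ} {m : ℕ} (h : GrowthLog f H A m B)
    {k : ℝ → ℝ} (hk : BandKernel k) :
    ∃ a C : ℝ, 1 ≤ a ∧ 0 < C ∧ ∀ t : ℝ, 3 ≤ t → ∀ X : ℝ, 10 * a ≤ X → f (1 / 2 + (t : ℂ) * I) ≠ 0 →
      Real.log ‖f (1 / 2 + (t : ℂ) * I)‖ ≤
        (∫ v : ℝ, H ((1 / 2 + (a / X : ℝ) + (t : ℂ) * I) + ((v / X : ℝ) : ℂ) * I) * (k v : ℂ)).re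
          + C * Real.log t / X := by
  set μ : ℕ → ℝ := fun n => ∫ v, |v| ^ n * k v with hμ
  have hμ0 : ∀ n, 0 ≤ μ n := fun n =>
    integral_nonneg fun v => mul_nonneg (by positivity) (hk.nonneg v)
  have hμ0' : μ 0 = 1 := by simp only [hμ, pow_zero, one_mul]; exact hk.integral_eq
  obtain ⟨a, ha⟩ : ∃ a, a = 1 + (16 * μ 2 + 20 * μ 4 + 4 * μ 6) := ⟨_, rfl⟩
  have hM : 0 ≤ 16 * μ 2 + 20 * μ 4 + 4 * μ 6 := by
    have := hμ0 2; have := hμ0 4; have := hμ0 6; positivity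
  have ha1 : 1 ≤ a := by linarith
  obtain ⟨C, hC, hpt⟩ := h.exists_pointwise ha1
  refine ⟨a, C * (1 + μ 1 + μ 2 + μ 3), ha1, ?_, fun t ht X hX hft => ?_⟩
  · have := hμ0 1; have := hμ0 2; have := hμ0 3; positivity
  obtain ⟨n, Z, c, hZ, hle⟩ := hpt t ht X hX hft
  have hX0 : 0 < X := by linarith
  have hint := h.integrable_shift (s := 1 / 2 + (a / X : ℝ) + (t : ℂ) * I) (by
      simp only [add_re, mul_re, ofReal_re, I_re, ofReal_im, I_im]
      have : 0 < a / X := by positivity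
      norm_num; linarith) (by
      simp only [add_re, mul_re, ofReal_re, I_re, ofReal_im, I_im]
      have : a / X ≤ 1 / 10 := by rw [div_le_iff₀ hX0]; linarith
      norm_num; linarith) hX0 hk
  set Lg := Real.log ‖f (1 / 2 + (t : ℂ) * I)‖ with hLg
  set D := C * Real.log t / X with hD
  set S := ∑ i, 1 / (2 * Z i) with hS
  have hS0 : 0 ≤ S := Finset.sum_nonneg fun i _ => by have := hZ i; positivity
  have hre := integral_re hint
  have hexp : ∀ v, (Lg + ∑ i, ((a ^ 2 - (16 * |v| ^ 2 + 20 * |v| ^ 4 + 4 * |v| ^ 6)) / (2 * Z i) + c i * v)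
      - D * (1 + |v| + |v| ^ 2 + |v| ^ 3)) * k v
      = (Lg + S * a ^ 2 - D) * (|v| ^ 0 * k v) + (-D) * (|v| ^ 1 * k v)
        + (-D - 16 * S) * (|v| ^ 2 * k v) + (-D) * (|v| ^ 3 * k v) + (-20 * S) * (|v| ^ 4 * k v)
        + (-4 * S) * (|v| ^ 6 * k v) + (∑ i, c i) * (v * k v) := by
    intro v
    have h1 : ∑ i, ((a ^ 2 - (16 * |v| ^ 2 + 20 * |v| ^ 4 + 4 * |v| ^ 6)) / (2 * Z i) + c i * v)
        = (a ^ 2 - (16 * |v| ^ 2 + 20 * |v| ^ 4 + 4 * |v| ^ 6)) * S + (∑ i, c i) * v := by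
      rw [hS, Finset.sum_add_distrib, Finset.mul_sum, Finset.sum_mul]
      congr 1
      exact Finset.sum_congr rfl fun i _ => by ring
    rw [h1]; ring
  have i0 := (hk.moment 0).const_mul (Lg + S * a ^ 2 - D)
  have i1 := (hk.moment 1).const_mul (-D)
  have i2 := (hk.moment 2).const_mul (-D - 16 * S)
  have i3 := (hk.moment 3).const_mul (-D)
  have i4 := (hk.moment 4).const_mul (-20 * S)
  have i6 := (hk.moment 6).const_mul (-4 * S)
  have i7 := hk.integrable_id_mul.const_mul (∑ i, c i)
  have hmono := integral_mono ((((((i0.add i1).add i2).add i3).add i4).add i6).add i7) hint.re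
    (fun v => by
      have h1 := mul_le_mul_of_nonneg_right (hle v) (hk.nonneg v)
      rw [hexp v] at h1
      simp only [Pi.add_apply]
      refine h1.trans (le_of_eq ?_)
      show _ = (_ : ℂ).re
      rw [mul_re, ofReal_re, ofReal_im]; ring)
  rw [integral_add' (((((i0.add i1).add i2).add i3).add i4).add i6) i7,
    integral_add' ((((i0.add i1).add i2).add i3).add i4) i6, integral_add' (((i0.add i1).add i2).add i3) i4,
    integral_add' ((i0.add i1).add i2) i3, integral_add' (i0.add i1) i2, integral_add' i0 i1] at hmono
  simp only [integral_const_mul, hk.integral_id_mul] at hmono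
  rw [hre] at hmono
  have hfin : (Lg + S * a ^ 2 - D) * μ 0 + -D * μ 1 + (-D - 16 * S) * μ 2 + -D * μ 3 + -20 * S * μ 4
      + -4 * S * μ 6 + (∑ i, c i) * 0 ≤ (∫ v : ℝ, H ((1 / 2 + (a / X : ℝ) + (t : ℂ) * I) + ((v / X : ℝ) : ℂ) * I) * (k v : ℂ)).re := hmono
  rw [hμ0'] at hfin
  have hfin2 : S * (16 * μ 2 + 20 * μ 4 + 4 * μ 6) ≤ S * a ^ 2 := by
    apply mul_le_mul_of_nonneg_left _ hS0
    nlinarith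
  have hfin3 : C * (1 + μ 1 + μ 2 + μ 3) * Real.log t / X = D * (1 + μ 1 + μ 2 + μ 3) := by rw [hD]; ring
  rw [hfin3]
  linarith

/-- Holomorphy of a parameter integral under local domination (no derivative needed). -/
lemma differentiableOn_integral_of_dominated {α : Type*} [MeasurableSpace α] {μ : Measure α}
    {F : ℂ → α → ℂ} {U : Set ℂ} (hmeas : ∀ s ∈ U, AEStronglyMeasurable (F s) μ)
    (hdiff : ∀ x, DifferentiableOn ℂ (fun s => F s x) U)
    (hb : ∀ s₀ ∈ U, ∃ r > 0, ∃ bound : α → ℝ, Integrable bound μ ∧ Metric.ball s₀ r ⊆ U ∧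
      ∀ᵐ x ∂μ, ∀ s ∈ Metric.ball s₀ r, ‖F s x‖ ≤ bound x) :
    DifferentiableOn ℂ (fun s => ∫ x, F s x ∂μ) U := by
  intro s₀ hs₀
  obtain ⟨r, hr, bound, hbi, hrU, hbd⟩ := hb s₀ hs₀
  refine DifferentiableAt.differentiableWithinAt ?_
  have hdAt : ∀ x, ∀ s ∈ Metric.ball s₀ r, DifferentiableAt ℂ (fun s => F s x) s := fun x s hs =>
    ((hdiff x).mono hrU).differentiableAt (Metric.isOpen_ball.mem_nhds hs)
  have hs₀r : s₀ ∈ Metric.ball s₀ r := Metric.mem_ball_self hr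
  refine (hasDerivAt_integral_of_dominated_loc_of_deriv_le (F := F)
    (F' := fun s x => deriv (fun s => F s x) s) (bound := fun x => bound x / (r / 4))
    (Metric.ball_mem_nhds s₀ (half_pos hr)) ?_ ?_ ?_ ?_ (hbi.div_const _) ?_).2.differentiableAt
  · filter_upwards [Metric.ball_mem_nhds s₀ hr] with s hs using hmeas s (hrU hs)
  · refine hbi.mono' (hmeas s₀ hs₀) ?_
    filter_upwards [hbd] with x hx using hx s₀ hs₀r
  · have hseq : Tendsto (fun n : ℕ => ((r / 2 / (n + 1) : ℝ) : ℂ)) atTop (nhds 0) := by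
      rw [← ofReal_zero]
      refine (continuous_ofReal.tendsto 0).comp ?_
      have := (tendsto_one_div_add_atTop_nhds_zero_nat (𝕜 := ℝ)).const_mul (r / 2)
      simpa [div_eq_mul_inv] using this
    have hne : ∀ n : ℕ, ((r / 2 / (n + 1) : ℝ) : ℂ) ≠ 0 := fun n => by
      rw [Ne, ofReal_eq_zero]; positivity
    have hin : ∀ n : ℕ, s₀ + ((r / 2 / (n + 1) : ℝ) : ℂ) ∈ Metric.ball s₀ r := by
      intro n
      have hpos : 0 ≤ r / 2 / (n + 1) := by positivity
      rw [Metric.mem_ball, dist_eq_norm, add_sub_cancel_left, Complex.norm_real, Real.norm_eq_abs,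
        abs_of_nonneg hpos]
      have : r / 2 / (n + 1) ≤ r / 2 := div_le_self (by positivity) (by
        have : (0 : ℝ) ≤ n := Nat.cast_nonneg n
        linarith)
      linarith
    refine aestronglyMeasurable_of_tendsto_ae atTop (f := fun (n : ℕ) x =>
      (((r / 2 / (n + 1) : ℝ) : ℂ))⁻¹ * (F (s₀ + ((r / 2 / (n + 1) : ℝ) : ℂ)) x - F s₀ x))
      (fun n => ((hmeas _ (hrU (hin n))).sub (hmeas _ hs₀)).const_mul _) (Eventually.of_forall fun x => ?_)
    have h1 := (hdAt x s₀ hs₀r).hasDerivAt.tendsto_slope_zero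
    have h2 : Tendsto (fun n : ℕ => ((r / 2 / (n + 1) : ℝ) : ℂ)) atTop (nhdsWithin 0 {0}ᶜ) :=
      tendsto_nhdsWithin_iff.2 ⟨hseq, Eventually.of_forall hne⟩
    simpa [Function.comp_def, smul_eq_mul] using h1.comp h2
  · filter_upwards [hbd] with x hx s hs
    have hsub : Metric.closedBall s (r / 4) ⊆ Metric.ball s₀ r := by
      intro z hz
      have h1 := Metric.mem_closedBall.1 hz
      have h2 := Metric.mem_ball.1 hs
      have h3 := dist_triangle z s s₀
      rw [Metric.mem_ball]; linarith
    refine norm_deriv_le_of_forall_mem_sphere_norm_le (by positivity) ?_ ?_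
    · refine DifferentiableOn.diffContOnCl ?_
      rw [closure_ball _ (by positivity)]
      exact (hdiff x).mono (hsub.trans hrU)
    · exact fun z hz => hx z (hsub (Metric.sphere_subset_closedBall hz))
  · exact Eventually.of_forall fun x s hs =>
      (hdAt x s (Metric.ball_subset_ball (by linarith) hs)).hasDerivAt

/-- Fourier transform of the kernel. -/
noncomputable def kernelFT (k : ℝ → ℝ) (y : ℝ) : ℂ := ∫ v, (k v : ℂ) * cexp (-(v * y : ℝ) * I)

lemma norm_cexp_neg_mul_I (x : ℝ) : ‖cexp (-(x : ℂ) * I)‖ = 1 := by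
  rw [← ofReal_neg]; exact norm_exp_ofReal_mul_I _

lemma norm_cexp_neg_mul_mul_I (v y : ℝ) : ‖cexp (-((v * y : ℝ) : ℂ) * I)‖ = 1 :=
  norm_cexp_neg_mul_I _

lemma BandKernel.integrable_exp {k : ℝ → ℝ} (hk : BandKernel k) (y : ℝ) :
    Integrable fun v => (k v : ℂ) * cexp (-(v * y : ℝ) * I) := by
  have hc := hk.cont
  refine hk.integrable.mono' (by fun_prop) (Eventually.of_forall fun v => ?_)
  rw [norm_mul, norm_cexp_neg_mul_mul_I, mul_one, Complex.norm_real, Real.norm_eq_abs,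
    abs_of_nonneg (hk.nonneg v)]

lemma BandKernel.norm_kernelFT_le {k : ℝ → ℝ} (hk : BandKernel k) (y : ℝ) : ‖kernelFT k y‖ ≤ 1 := by
  refine (norm_integral_le_integral_norm _).trans (le_of_eq ?_)
  rw [← hk.integral_eq]
  refine integral_congr_ae (Eventually.of_forall fun v => ?_)
  show ‖_‖ = _
  rw [norm_mul, norm_cexp_neg_mul_mul_I, mul_one, Complex.norm_real, Real.norm_eq_abs,
    abs_of_nonneg (hk.nonneg v)]

lemma BandKernel.kernelFT_zero {k : ℝ → ℝ} (hk : BandKernel k) : kernelFT k 0 = 1 := by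
  unfold kernelFT
  simp only [mul_zero, ofReal_zero, neg_zero, zero_mul, Complex.exp_zero, mul_one]
  rw [integral_complex_ofReal, hk.integral_eq, ofReal_one]

lemma BandKernel.kernelFT_eq_zero {k : ℝ → ℝ} (hk : BandKernel k) {y : ℝ} (hy : 1 ≤ |y|) :
    kernelFT k y = 0 := hk.fourier y hy

/-- Derivative of the Fourier transform of the kernel. -/
noncomputable def kernelFTDeriv (k : ℝ → ℝ) (y : ℝ) : ℂ :=
  ∫ v, (k v : ℂ) * (cexp (-(v * y : ℝ) * I) * (-(v : ℂ) * I))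

lemma norm_kernelFTDeriv_integrand {k : ℝ → ℝ} (hk : BandKernel k) (y v : ℝ) :
    ‖(k v : ℂ) * (cexp (-(v * y : ℝ) * I) * (-(v : ℂ) * I))‖ = |v| ^ 1 * k v := by
  rw [norm_mul, norm_mul, norm_cexp_neg_mul_mul_I, one_mul, norm_mul, norm_neg, Complex.norm_I,
    Complex.norm_real, Complex.norm_real, Real.norm_eq_abs, Real.norm_eq_abs, abs_of_nonneg (hk.nonneg v)]
  ring

lemma BandKernel.hasDerivAt_kernelFT {k : ℝ → ℝ} (hk : BandKernel k) (y : ℝ) :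
    HasDerivAt (kernelFT k) (kernelFTDeriv k y) y := by
  have hc := hk.cont
  refine (hasDerivAt_integral_of_dominated_loc_of_deriv_le (s := Set.univ)
    (F := fun (y : ℝ) v => (k v : ℂ) * cexp (-(v * y : ℝ) * I))
    (F' := fun (y : ℝ) v => (k v : ℂ) * (cexp (-(v * y : ℝ) * I) * (-(v : ℂ) * I)))
    (bound := fun v => |v| ^ 1 * k v) Filter.univ_mem
    (Eventually.of_forall fun x => (hk.integrable_exp x).aestronglyMeasurable)
    (hk.integrable_exp y) (by fun_prop)
    (Eventually.of_forall fun v x _ => (norm_kernelFTDeriv_integrand hk x v).le) (hk.moment 1)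
    (Eventually.of_forall fun v x _ => ?_)).2
  refine HasDerivAt.const_mul _ (HasDerivAt.cexp ?_)
  have h1 : HasDerivAt (fun x : ℝ => ((v * x : ℝ) : ℂ)) (v : ℂ) x := by
    have := ((hasDerivAt_id x).const_mul v).ofReal_comp
    simpa using this
  exact h1.neg.mul_const I

lemma BandKernel.norm_kernelFTDeriv_le {k : ℝ → ℝ} (hk : BandKernel k) (y : ℝ) :
    ‖kernelFTDeriv k y‖ ≤ ∫ v, |v| ^ 1 * k v := by
  refine (norm_integral_le_integral_norm _).trans (le_of_eq ?_)
  exact integral_congr_ae (Eventually.of_forall fun v => norm_kernelFTDeriv_integrand hk y v)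

lemma BandKernel.continuous_kernelFT {k : ℝ → ℝ} (hk : BandKernel k) : Continuous (kernelFT k) :=
  continuous_iff_continuousAt.2 fun y => (hk.hasDerivAt_kernelFT y).continuousAt

lemma BandKernel.continuous_kernelFTDeriv {k : ℝ → ℝ} (hk : BandKernel k) :
    Continuous (kernelFTDeriv k) := by
  have hc := hk.cont
  refine continuous_of_dominated (bound := fun v => |v| ^ 1 * k v) (fun y => by fun_prop)
    (fun y => Eventually.of_forall fun v => (norm_kernelFTDeriv_integrand hk y v).le) (hk.moment 1)
    (Eventually.of_forall fun v => by fun_prop)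

/-- Smoothed truncation of `1 / z`. -/
noncomputable def kernelLaplace (k : ℝ → ℝ) (X : ℝ) (z : ℂ) : ℂ :=
  ∫ y in Set.Ioc 0 X, cexp (-z * y) * kernelFT k (y / X)

lemma BandKernel.norm_kernelLaplace_le {k : ℝ → ℝ} (hk : BandKernel k) {X : ℝ} (hX : 0 < X) {z : ℂ}
    (hz : z ≠ 0) (hz1 : -(1 / 2) ≤ z.re) :
    ‖kernelLaplace k X z‖ ≤ (1 + ∫ v, |v| ^ 1 * k v) * Real.exp (X / 2) / ‖z‖ := by
  have hc1 := hk.continuous_kernelFT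
  have hc2 := hk.continuous_kernelFTDeriv
  set m := ∫ v, |v| ^ 1 * k v with hm
  have hm0 : 0 ≤ m := (norm_nonneg _).trans (hk.norm_kernelFTDeriv_le 0)
  unfold kernelLaplace
  rw [← intervalIntegral.integral_of_le hX.le]
  have hu : ∀ y : ℝ, HasDerivAt (fun y : ℝ => -cexp (-z * y) / z) (cexp (-z * y)) y := by
    intro y
    have h1 : HasDerivAt (fun y : ℝ => -z * (y : ℂ)) (-z) y := by
      have := (ofRealCLM.hasDerivAt (x := y)).const_mul (-z)
      simpa using this
    have h2 := (h1.cexp.neg).div_const z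
    have h3 : cexp (-z * y) = -(cexp (-z * y) * -z) / z := by rw [eq_div_iff hz]; ring
    rw [h3]
    simpa using h2
  have hv : ∀ y : ℝ, HasDerivAt (fun y : ℝ => kernelFT k (y / X)) (kernelFTDeriv k (y / X) * ((1 / X : ℝ) : ℂ)) y := by
    intro y
    have h1 := HasDerivAt.scomp (h := fun y : ℝ => y / X) y (hk.hasDerivAt_kernelFT (y / X)) ((hasDerivAt_id y).div_const X)
    simpa [Function.comp_def, mul_comm] using h1
  have hparts := intervalIntegral.integral_deriv_mul_eq_sub (a := 0) (b := X) (fun y _ => hu y) (fun y _ => hv y)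
    (Continuous.intervalIntegrable (by fun_prop) _ _) (Continuous.intervalIntegrable (by fun_prop) _ _)
  rw [intervalIntegral.integral_add (Continuous.intervalIntegrable (by fun_prop) _ _)
    (Continuous.intervalIntegrable (by fun_prop) _ _)] at hparts
  rw [div_self hX.ne', hk.kernelFT_eq_zero (by norm_num), zero_div, hk.kernelFT_zero] at hparts
  simp only [ofReal_zero, mul_zero, Complex.exp_zero, mul_one, zero_sub] at hparts
  have hz0 : 0 < ‖z‖ := norm_pos_iff.2 hz
  have h3 : ‖∫ y in (0 : ℝ)..X, -cexp (-z * y) / z * (kernelFTDeriv k (y / X) * ((1 / X : ℝ) : ℂ))‖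
      ≤ Real.exp (X / 2) / ‖z‖ * (m * (1 / X)) * |X - 0| := by
    refine intervalIntegral.norm_integral_le_of_norm_le_const fun y hy => ?_
    rw [Set.uIoc_of_le hX.le] at hy
    rw [norm_mul, norm_div, norm_neg, norm_mul, Complex.norm_real, Complex.norm_exp, Real.norm_eq_abs,
      abs_of_pos (by positivity : 0 < 1 / X)]
    refine mul_le_mul (div_le_div_of_nonneg_right (Real.exp_le_exp.2 ?_) hz0.le)
      (mul_le_mul_of_nonneg_right (hk.norm_kernelFTDeriv_le _) (by positivity)) (by positivity) (by positivity)
    have : (-z * (y : ℂ)).re = -z.re * y := by simp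
    rw [this]
    nlinarith [hy.1, hy.2]
  have h4 : ‖-(-1 / z)‖ ≤ Real.exp (X / 2) / ‖z‖ := by
    rw [norm_neg, norm_div, norm_neg, norm_one]
    exact div_le_div_of_nonneg_right (Real.one_le_exp (by positivity)) hz0.le
  rw [eq_sub_of_add_eq hparts]
  refine (norm_sub_le _ _).trans ((add_le_add h4 h3).trans (le_of_eq ?_))
  rw [sub_zero, abs_of_pos hX]
  field_simp

lemma norm_kernelLaplace_le_of_norm {k : ℝ → ℝ} (hk : BandKernel k) {X : ℝ} (hX : 0 < X) (z : ℂ) :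
    ‖kernelLaplace k X z‖ ≤ Real.exp (‖z‖ * X) * X := by
  unfold kernelLaplace
  rw [← intervalIntegral.integral_of_le hX.le]
  have : ‖∫ y in (0 : ℝ)..X, cexp (-z * y) * kernelFT k (y / X)‖ ≤ Real.exp (‖z‖ * X) * 1 * |X - 0| := by
    refine intervalIntegral.norm_integral_le_of_norm_le_const fun y hy => ?_
    rw [Set.uIoc_of_le hX.le] at hy
    rw [norm_mul]
    refine mul_le_mul ?_ (hk.norm_kernelFT_le _) (norm_nonneg _) (by positivity)
    refine (Complex.norm_exp_le_exp_norm _).trans (Real.exp_le_exp.2 ?_)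
    rw [norm_mul, norm_neg, Complex.norm_real, Real.norm_eq_abs, abs_of_pos hy.1]
    exact mul_le_mul_of_nonneg_left hy.2 (norm_nonneg _)
  rwa [mul_one, sub_zero, abs_of_pos hX] at this

lemma BandKernel.differentiable_kernelLaplace {k : ℝ → ℝ} (hk : BandKernel k) (X : ℝ) :
    Differentiable ℂ (kernelLaplace k X) := by
  rw [← differentiableOn_univ]
  have hc1 := hk.continuous_kernelFT
  unfold kernelLaplace
  refine differentiableOn_integral_of_dominated (fun s _ => ?_) (fun y => ?_) fun s₀ _ => ?_
  · exact Continuous.aestronglyMeasurable (by fun_prop)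
  · exact Differentiable.differentiableOn (by fun_prop)
  · refine ⟨1, one_pos, fun _ => Real.exp ((‖s₀‖ + 1) * X), ?_, Set.subset_univ _, ?_⟩
    · exact integrable_const _
    · filter_upwards [ae_restrict_mem measurableSet_Ioc] with y hy s hs
      rw [norm_mul]
      rw [← mul_one (Real.exp ((‖s₀‖ + 1) * X))]
      refine mul_le_mul ?_ (hk.norm_kernelFT_le _) (norm_nonneg _) (by positivity)
      refine (Complex.norm_exp_le_exp_norm _).trans (Real.exp_le_exp.2 ?_)
      rw [norm_mul, norm_neg, Complex.norm_real, Real.norm_eq_abs, abs_of_pos hy.1]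
      have h1 : ‖s‖ ≤ ‖s₀‖ + 1 := by
        have h2 := Metric.mem_ball.1 hs
        rw [dist_eq_norm] at h2
        have := norm_add_le (s - s₀) s₀
        rw [sub_add_cancel] at this
        linarith
      exact mul_le_mul h1 hy.2 hy.1.le (by positivity)

/-- `log ((s + 1) / (s - 1))` as an integral. -/
noncomputable def poleLog (s : ℂ) : ℂ := ∫ w in Set.Ioc (-1 : ℝ) 1, (s + w)⁻¹

/-- Smoothed version of `poleLog`. -/
noncomputable def kernelPole (k : ℝ → ℝ) (X : ℝ) (s : ℂ) : ℂ :=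
  ∫ w in Set.Ioc (-1 : ℝ) 1, kernelLaplace k X (s + w)

lemma BandKernel.differentiable_kernelPole {k : ℝ → ℝ} (hk : BandKernel k) {X : ℝ} (hX : 0 < X) :
    Differentiable ℂ (kernelPole k X) := by
  rw [← differentiableOn_univ]
  have hd := hk.differentiable_kernelLaplace X
  have hc := hd.continuous
  unfold kernelPole
  refine differentiableOn_integral_of_dominated (fun s _ => ?_) (fun w => ?_) fun s₀ _ => ?_
  · exact Continuous.aestronglyMeasurable (by fun_prop)
  · exact Differentiable.differentiableOn (by fun_prop)
  · refine ⟨1, one_pos, fun _ => Real.exp ((‖s₀‖ + 2) * X) * X, integrable_const _, Set.subset_univ _, ?_⟩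
    filter_upwards [ae_restrict_mem measurableSet_Ioc] with w hw s hs
    refine (norm_kernelLaplace_le_of_norm hk hX _).trans (mul_le_mul_of_nonneg_right
      (Real.exp_le_exp.2 (mul_le_mul_of_nonneg_right ?_ hX.le)) hX.le)
    have h2 := Metric.mem_ball.1 hs
    rw [dist_eq_norm] at h2
    have h3 := norm_add_le (s - s₀) s₀
    rw [sub_add_cancel] at h3
    have h4 := norm_add_le s (w : ℂ)
    have h5 : ‖(w : ℂ)‖ ≤ 1 := by
      rw [Complex.norm_real, Real.norm_eq_abs, abs_le]; exact ⟨hw.1.le, hw.2⟩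
    linarith

lemma BandKernel.norm_kernelPole_le {k : ℝ → ℝ} (hk : BandKernel k) :
    ∃ C : ℝ, 0 < C ∧ ∀ X : ℝ, 0 < X → ∀ s : ℂ, 1 / 2 ≤ s.re → s.im ≠ 0 →
      ‖kernelPole k X s‖ ≤ C * Real.exp (X / 2) / |s.im| := by
  have hm0 : 0 ≤ ∫ v, |v| ^ 1 * k v := (norm_nonneg _).trans (hk.norm_kernelFTDeriv_le 0)
  refine ⟨2 * (1 + ∫ v, |v| ^ 1 * k v), by positivity, fun X hX s hs him => ?_⟩
  have him0 : 0 < |s.im| := abs_pos.2 him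
  have := norm_setIntegral_le_of_norm_le_const (μ := volume) (s := Set.Ioc (-1 : ℝ) 1)
    (f := fun w : ℝ => kernelLaplace k X (s + w))
    (C := (1 + ∫ v, |v| ^ 1 * k v) * Real.exp (X / 2) / |s.im|) (by simp) (fun w hw => by
      have h1 : |s.im| ≤ ‖s + w‖ := by
        have := Complex.abs_im_le_norm (s + w); simpa using this
      refine (hk.norm_kernelLaplace_le hX (norm_pos_iff.1 (him0.trans_le h1)) ?_).trans ?_
      · rw [add_re, ofReal_re]; linarith [hw.1]
      · exact div_le_div_of_nonneg_left (by positivity) him0 h1)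
  refine this.trans (le_of_eq ?_)
  rw [measureReal_def, Real.volume_Ioc]
  norm_num
  ring

/-- Against the kernel, `1 / z` becomes its smoothed truncation. -/
lemma BandKernel.integral_inv_mul {k : ℝ → ℝ} (hk : BandKernel k) {X : ℝ} (hX : 0 < X) {z : ℂ}
    (hz : 0 < z.re) :
    ∫ v : ℝ, (z + ((v / X : ℝ) : ℂ) * I)⁻¹ * (k v : ℂ) = kernelLaplace k X z := by
  have hc := hk.cont
  have h1 : ∀ v : ℝ, (z + ((v / X : ℝ) : ℂ) * I)⁻¹ * (k v : ℂ)
      = ∫ y in Set.Ioi (0 : ℝ), cexp (-z * y) * ((k v : ℂ) * cexp (-(v * (y / X) : ℝ) * I)) := by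
    intro v
    have h2 := integral_exp_mul_complex_Ioi (a := -(z + ((v / X : ℝ) : ℂ) * I)) (by
      simpa using hz) 0
    simp only [ofReal_zero, mul_zero, Complex.exp_zero, neg_div_neg_eq, one_div] at h2
    rw [← h2, ← integral_mul_const]
    refine integral_congr_ae (Eventually.of_forall fun y => ?_)
    show _ * _ = _ * (_ * _)
    rw [mul_comm ((k v : ℂ)), ← mul_assoc, ← Complex.exp_add]
    congr 2
    push_cast; ring
  have hint : Integrable (Function.uncurry fun (v y : ℝ) =>
      cexp (-z * y) * ((k v : ℂ) * cexp (-(v * (y / X) : ℝ) * I)))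
      (volume.prod (volume.restrict (Set.Ioi 0))) := by
    have hE := integrableOn_exp_mul_complex_Ioi (a := -z) (by simpa using hz) 0
    have h3 : Integrable (fun p : ℝ × ℝ => (k p.1 : ℂ) * cexp (-z * p.2))
        (volume.prod (volume.restrict (Set.Ioi 0))) := (hk.integrable.ofReal (𝕜 := ℂ)).mul_prod hE
    refine h3.mono (Continuous.aestronglyMeasurable (by unfold Function.uncurry; fun_prop))
      (Eventually.of_forall fun p => le_of_eq ?_)
    simp only [Function.uncurry]
    rw [norm_mul, norm_mul, norm_mul, norm_cexp_neg_mul_mul_I]; ring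
  simp only [h1]
  rw [integral_integral_swap hint]
  unfold kernelLaplace
  have h4 : ∀ y : ℝ, ∫ v : ℝ, cexp (-z * y) * ((k v : ℂ) * cexp (-(v * (y / X) : ℝ) * I))
      = cexp (-z * y) * kernelFT k (y / X) := fun y => integral_const_mul _ _
  simp only [h4]
  refine setIntegral_eq_of_subset_of_forall_sdiff_eq_zero measurableSet_Ioi Set.Ioc_subset_Ioi_self
    fun y hy => ?_
  have hy1 : X < y := by
    by_contra hcon
    exact hy.2 ⟨hy.1, not_lt.1 hcon⟩
  rw [hk.kernelFT_eq_zero, mul_zero]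
  have hy0 : 0 < y := hX.trans hy1
  rw [abs_of_pos (by positivity), le_div_iff₀ hX]; linarith

lemma BandKernel.integral_poleLog_mul {k : ℝ → ℝ} (hk : BandKernel k) {X : ℝ} (hX : 0 < X) {s : ℂ}
    (hs : 1 < s.re) :
    Integrable (fun v : ℝ => poleLog (s + ((v / X : ℝ) : ℂ) * I) * (k v : ℂ)) ∧
    ∫ v : ℝ, poleLog (s + ((v / X : ℝ) : ℂ) * I) * (k v : ℂ) = kernelPole k X s := by
  have hc := hk.cont
  have hre : ∀ v w : ℝ, (s + ((v / X : ℝ) : ℂ) * I + w).re = s.re + w := by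
    intro v w; simp
  have hint : Integrable (Function.uncurry fun (v w : ℝ) =>
      (s + ((v / X : ℝ) : ℂ) * I + w)⁻¹ * (k v : ℂ)) (volume.prod (volume.restrict (Set.Ioc (-1) 1))) := by
    have h3 : Integrable (fun p : ℝ × ℝ => (k p.1) * ((s.re - 1)⁻¹))
        (volume.prod (volume.restrict (Set.Ioc (-1) 1))) :=
      hk.integrable.mul_prod (integrable_const _)
    refine h3.mono' (Measurable.aestronglyMeasurable (by unfold Function.uncurry; fun_prop)) ?_
    have h5 : ∀ᵐ p : ℝ × ℝ ∂(volume.prod (volume.restrict (Set.Ioc (-1 : ℝ) 1))), p.2 ∈ Set.Ioc (-1 : ℝ) 1 :=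
      Measure.quasiMeasurePreserving_snd.ae (ae_restrict_mem measurableSet_Ioc)
    filter_upwards [h5] with p hp
    simp only [Function.uncurry]
    rw [norm_mul, norm_inv, Complex.norm_real, Real.norm_eq_abs, abs_of_nonneg (hk.nonneg _), mul_comm]
    refine mul_le_mul_of_nonneg_left (inv_anti₀ (by linarith) ?_) (hk.nonneg _)
    refine le_trans ?_ (Complex.re_le_norm _)
    rw [hre]; linarith [hp.1]
  have h1 : ∀ v : ℝ, poleLog (s + ((v / X : ℝ) : ℂ) * I) * (k v : ℂ)
      = ∫ w in Set.Ioc (-1 : ℝ) 1, (s + ((v / X : ℝ) : ℂ) * I + w)⁻¹ * (k v : ℂ) := fun v =>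
    (integral_mul_const _ _).symm
  simp only [h1]
  refine ⟨hint.integral_prod_left, ?_⟩
  rw [integral_integral_swap hint]
  refine setIntegral_congr_fun measurableSet_Ioc fun w hw => ?_
  show ∫ v : ℝ, (s + ((v / X : ℝ) : ℂ) * I + w)⁻¹ * (k v : ℂ) = _
  rw [← hk.integral_inv_mul hX (z := s + w) (by rw [add_re, ofReal_re]; linarith [hw.1])]
  refine integral_congr_ae (Eventually.of_forall fun v => ?_)
  show _ * _ = _ * _
  congr 2; ring

lemma GrowthLog.differentiableOn_smoothed {f H : ℂ → ℂ} {A B : ℝ} {m : ℕ} (h : GrowthLog f H A m B)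
    {k : ℝ → ℝ} (hk : BandKernel k) {X : ℝ} (hX : 0 < X) :
    DifferentiableOn ℂ (fun s => ∫ v : ℝ, H (s + ((v / X : ℝ) : ℂ) * I) * (k v : ℂ))
      {s | 1 / 2 < s.re ∧ s.re < 2} := by
  obtain ⟨C, hC, hb⟩ := h.norm_log_le
  refine differentiableOn_integral_of_dominated (fun s hs => ?_) (fun v => ?_) fun s₀ hs₀ => ?_
  · exact (h.integrable_shift hs.1 hs.2.le hX hk).aestronglyMeasurable
  · refine DifferentiableOn.mul_const ?_ _
    exact h.logDiff.comp (by fun_prop) fun s hs => by simpa using hs.1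
  · obtain ⟨d, hd⟩ : ∃ d, d = min ((s₀.re - 1 / 2) / 2) (2 - s₀.re) := ⟨_, rfl⟩
    have hd0 : 0 < d := by rw [hd]; exact lt_min (by linarith [hs₀.1]) (by linarith [hs₀.2])
    have hd1 : d ≤ (s₀.re - 1 / 2) / 2 := hd ▸ min_le_left _ _
    have hd2 : d ≤ 2 - s₀.re := hd ▸ min_le_right _ _
    have hball : ∀ s ∈ Metric.ball s₀ d, |s.re - s₀.re| < d ∧ |s.im - s₀.im| < d := by
      intro s hs
      rw [Metric.mem_ball, dist_eq_norm] at hs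
      exact ⟨(by have := Complex.abs_re_le_norm (s - s₀); rw [sub_re] at this; linarith),
        (by have := Complex.abs_im_le_norm (s - s₀); rw [sub_im] at this; linarith)⟩
    refine ⟨d, hd0, fun v => C / d * (3 + |s₀.im| + d) * (|v| ^ 0 * k v) + C / d / X * (|v| ^ 1 * k v), ?_, ?_, ?_⟩
    · exact ((hk.moment 0).const_mul _).add ((hk.moment 1).const_mul _)
    · intro s hs
      have := abs_lt.1 (hball s hs).1
      exact ⟨by linarith, by linarith⟩
    · refine Eventually.of_forall fun v s hs => ?_
      have h1 := abs_lt.1 (hball s hs).1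
      have h2 := (hball s hs).2
      have hre : (s + ((v / X : ℝ) : ℂ) * I).re = s.re := by simp
      have him : (s + ((v / X : ℝ) : ℂ) * I).im = s.im + v / X := by simp
      have h3 := hb (s + ((v / X : ℝ) : ℂ) * I) (by rw [hre]; linarith) (by rw [hre]; linarith)
      rw [hre, him] at h3
      have h4 : Real.log (3 + |s.im + v / X|) ≤ 3 + |s₀.im| + d + |v| / X := by
        refine (Real.log_le_self (by positivity)).trans ?_
        have e1 := abs_add_le s.im (v / X)
        have e2 := abs_add_le (s.im - s₀.im) s₀.im
        rw [sub_add_cancel] at e2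
        rw [abs_div v, abs_of_pos hX] at e1
        linarith
      have h5 : C / (s.re - 1 / 2) ≤ C / d := div_le_div_of_nonneg_left hC.le hd0 (by linarith)
      rw [norm_mul, Complex.norm_real, Real.norm_eq_abs, abs_of_nonneg (hk.nonneg v)]
      calc _ ≤ (C / d * (3 + |s₀.im| + d + |v| / X)) * k v := by
            refine mul_le_mul_of_nonneg_right (h3.trans (mul_le_mul h5 h4 ?_ (by positivity))) (hk.nonneg v)
            exact Real.log_nonneg (by linarith [abs_nonneg (s.im + v / X)])
        _ = _ := by field_simp

/-- Smoothed explicit formula: the kernel truncates the Dirichlet series of `H`. -/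
theorem GrowthLog.integral_eq_sum {f H : ℂ → ℂ} {A B : ℝ} {m : ℕ} (h : GrowthLog f H A m B)
    {k : ℝ → ℝ} (hk : BandKernel k) {c : ℕ → ℂ} (hc : ∀ n, ‖c n‖ ≤ 1) (hc0 : c 0 = 0) {e : ℂ}
    (hH : ∀ s : ℂ, 1 < s.re → HasSum (fun n : ℕ => c n * (n : ℂ) ^ (-s)) (H s + e * poleLog s))
    {X : ℝ} (hX : 0 < X) {s : ℂ} (hs1 : 1 / 2 < s.re) (hs2 : s.re < 2) :
    ∫ v : ℝ, H (s + ((v / X : ℝ) : ℂ) * I) * (k v : ℂ)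
      = ∑ n ∈ Finset.range (⌊Real.exp X⌋₊ + 1), c n * (n : ℂ) ^ (-s) * kernelFT k (Real.log n / X)
        - e * kernelPole k X s := by
  set U : Set ℂ := {s | 1 / 2 < s.re ∧ s.re < 2} with hU
  have hUo : IsOpen U := (isOpen_lt continuous_const continuous_re).inter (isOpen_lt continuous_re continuous_const)
  have hUc : IsPreconnected U := by
    refine Convex.isPreconnected ?_
    exact (convex_halfSpace_re_gt (1 / 2)).inter (convex_halfSpace_re_lt 2)
  have hcpow : ∀ n : ℕ, Differentiable ℂ fun s : ℂ => c n * (n : ℂ) ^ (-s) := by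
    intro n
    rcases eq_or_ne n 0 with rfl | hn
    · simp [hc0]
    · have : (n : ℂ) ≠ 0 := Nat.cast_ne_zero.2 hn
      intro s
      exact ((differentiableAt_id.neg).const_cpow (Or.inl this)).const_mul _
  have hL := (h.differentiableOn_smoothed hk hX).analyticOnNhd hUo
  have hR : AnalyticOnNhd ℂ (fun s => ∑ n ∈ Finset.range (⌊Real.exp X⌋₊ + 1),
      c n * (n : ℂ) ^ (-s) * kernelFT k (Real.log n / X) - e * kernelPole k X s) U := by
    refine DifferentiableOn.analyticOnNhd (Differentiable.differentiableOn ?_) hUo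
    refine Differentiable.sub (Differentiable.fun_sum fun n _ => (hcpow n).mul_const _)
      ((hk.differentiable_kernelPole hX).const_mul e)
  have h0 : (3 / 2 : ℂ) ∈ U := by constructor <;> norm_num
  refine hL.eqOn_of_preconnected_of_eventuallyEq hR hUc h0 ?_ ⟨hs1, hs2⟩
  have hnear : {s : ℂ | 1 < s.re ∧ s.re < 2} ∈ nhds (3 / 2 : ℂ) := by
    refine IsOpen.mem_nhds ((isOpen_lt continuous_const continuous_re).inter
      (isOpen_lt continuous_re continuous_const)) ?_
    constructor <;> norm_num
  filter_upwards [hnear] with s hs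
  have hnorm : ∀ (n : ℕ) (v : ℝ), ‖c n * (n : ℂ) ^ (-(s + ((v / X : ℝ) : ℂ) * I)) * (k v : ℂ)‖
      ≤ (n : ℝ) ^ (-s.re) * k v := by
    intro n v
    rw [norm_mul, norm_mul, Complex.norm_real, Real.norm_eq_abs, abs_of_nonneg (hk.nonneg v)]
    refine mul_le_mul_of_nonneg_right ?_ (hk.nonneg v)
    rcases Nat.eq_zero_or_pos n with rfl | hn
    · rw [hc0, norm_zero, zero_mul]; positivity
    · rw [Complex.norm_natCast_cpow_of_pos hn]
      have : (-(s + ((v / X : ℝ) : ℂ) * I)).re = -s.re := by simp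
      rw [this]
      exact mul_le_of_le_one_left (by positivity) (hc n)
  have hcont : ∀ n : ℕ, Continuous fun v : ℝ => c n * (n : ℂ) ^ (-(s + ((v / X : ℝ) : ℂ) * I)) * (k v : ℂ) :=
    fun n => ((hcpow n).continuous.comp (g := fun s : ℂ => c n * (n : ℂ) ^ (-s))
      (f := fun v : ℝ => s + ((v / X : ℝ) : ℂ) * I) (by fun_prop)).mul (continuous_ofReal.comp hk.cont)
  have hint : ∀ n : ℕ, Integrable fun v : ℝ =>
      c n * (n : ℂ) ^ (-(s + ((v / X : ℝ) : ℂ) * I)) * (k v : ℂ) := fun n =>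
    (hk.integrable.const_mul _).mono' (hcont n).aestronglyMeasurable (Eventually.of_forall (hnorm n))
  have hsum := hasSum_integral_of_summable_integral_norm hint (by
    refine Summable.of_nonneg_of_le (fun n => integral_nonneg fun v => norm_nonneg _) (fun n => ?_)
      (Real.summable_nat_rpow.2 (by linarith [hs.1] : -s.re < -1))
    refine (integral_mono (hint n).norm (hk.integrable.const_mul _) (hnorm n)).trans (le_of_eq ?_)
    rw [integral_const_mul, hk.integral_eq, mul_one])
  have hterm : ∀ n : ℕ, ∫ v : ℝ, c n * (n : ℂ) ^ (-(s + ((v / X : ℝ) : ℂ) * I)) * (k v : ℂ)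
      = c n * (n : ℂ) ^ (-s) * kernelFT k (Real.log n / X) := by
    intro n
    rcases Nat.eq_zero_or_pos n with rfl | hn
    · simp [hc0]
    · unfold kernelFT
      rw [← integral_const_mul]
      refine integral_congr_ae (Eventually.of_forall fun v => ?_)
      show _ * _ = _ * _
      have hn0 : (n : ℂ) ≠ 0 := Nat.cast_ne_zero.2 hn.ne'
      rw [neg_add, Complex.cpow_add _ _ hn0, Complex.cpow_def_of_ne_zero hn0 (-(((v / X : ℝ) : ℂ) * I)),
        ← Complex.natCast_log]
      have : ((Real.log n : ℝ) : ℂ) * -(((v / X : ℝ) : ℂ) * I) = -((v * (Real.log n / X) : ℝ) : ℂ) * I := by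
        push_cast; ring
      rw [this]; ring
  simp only [hterm] at hsum
  have hfin : HasSum (fun n : ℕ => c n * (n : ℂ) ^ (-s) * kernelFT k (Real.log n / X))
      (∑ n ∈ Finset.range (⌊Real.exp X⌋₊ + 1), c n * (n : ℂ) ^ (-s) * kernelFT k (Real.log n / X)) := by
    refine hasSum_sum_of_ne_finset_zero fun n hn => ?_
    rw [Finset.mem_range, not_lt, Nat.succ_le_iff, Nat.floor_lt (Real.exp_pos _).le] at hn
    rw [hk.kernelFT_eq_zero, mul_zero]
    have h1 : X < Real.log n := (Real.lt_log_iff_exp_lt ((Real.exp_pos _).trans hn)).2 hn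
    refine le_trans ?_ (le_abs_self _)
    rw [le_div_iff₀ hX]; linarith
  have hpole := hk.integral_poleLog_mul hX hs.1
  rw [eq_sub_iff_add_eq]
  have h5 := hfin.unique hsum
  rw [h5, ← hpole.2, ← integral_const_mul, ← integral_add
    (h.integrable_shift (by linarith [hs.1]) hs.2.le hX hk) (hpole.1.const_mul e)]
  refine integral_congr_ae (Eventually.of_forall fun v => ?_)
  have h6 := (hH (s + ((v / X : ℝ) : ℂ) * I) (by simpa using hs.1)).mul_right (k v : ℂ)
  show _ = ∑' n : ℕ, c n * (n : ℂ) ^ (-(s + ((v / X : ℝ) : ℂ) * I)) * (k v : ℂ)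
  rw [h6.tsum_eq]; ring

/-- Pointwise upper bound for `log ‖f‖` on the critical line by a Dirichlet polynomial of length
`exp X`. -/
theorem GrowthLog.exists_log_norm_le_sum {f H : ℂ → ℂ} {A : ℝ} {m : ℕ} {B : ℝ}
    (h : GrowthLog f H A m B) {k : ℝ → ℝ} (hk : BandKernel k) {c : ℕ → ℂ} (hc : ∀ n, ‖c n‖ ≤ 1)
    (hc0 : c 0 = 0) {e : ℂ} (he : ‖e‖ ≤ 1)
    (hH : ∀ s : ℂ, 1 < s.re → HasSum (fun n : ℕ => c n * (n : ℂ) ^ (-s)) (H s + e * poleLog s)) :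
    ∃ a C : ℝ, 1 ≤ a ∧ 0 < C ∧ ∀ t : ℝ, 3 ≤ t → ∀ X : ℝ, 10 * a ≤ X → Real.exp X ≤ t ^ 2 →
      f (1 / 2 + (t : ℂ) * I) ≠ 0 →
      Real.log ‖f (1 / 2 + t * I)‖ ≤
        (∑ n ∈ Finset.range (⌊Real.exp X⌋₊ + 1),
          c n * (n : ℂ) ^ (-(((1 / 2 + a / X : ℝ) : ℂ) + t * I)) * kernelFT k (Real.log n / X)).re
          + C * Real.log t / X + C := by
  obtain ⟨a, C, ha, hC, hmain⟩ := h.exists_log_norm_le hk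
  obtain ⟨C', hC', hpole⟩ := hk.norm_kernelPole_le
  refine ⟨a, C + C', ha, by positivity, fun t ht X hX hXt hf => ?_⟩
  have hX0 : 0 < X := by linarith
  have haX : 0 < a / X := by positivity
  have haX1 : a / X ≤ 1 / 10 := by rw [div_le_iff₀ hX0]; linarith
  have hlog : 0 ≤ Real.log t := Real.log_nonneg (by linarith)
  have hs : ((1 / 2 : ℂ) + (a / X : ℝ) + (t : ℂ) * I) = ((1 / 2 + a / X : ℝ) : ℂ) + t * I := by
    push_cast; ring
  have hre : (((1 / 2 + a / X : ℝ) : ℂ) + t * I).re = 1 / 2 + a / X := by simp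
  have him : (((1 / 2 + a / X : ℝ) : ℂ) + t * I).im = t := by simp
  have h1 := hmain t ht X hX hf
  rw [hs, h.integral_eq_sum hk hc hc0 hH hX0 (by rw [hre]; linarith) (by rw [hre]; linarith)] at h1
  have h2 := hpole X hX0 (((1 / 2 + a / X : ℝ) : ℂ) + t * I) (by rw [hre]; linarith)
    (by rw [him]; linarith)
  rw [him, abs_of_pos (by linarith : 0 < t)] at h2
  have h3 : Real.exp (X / 2) ≤ t := by
    have : Real.exp (X / 2) ^ 2 ≤ t ^ 2 := by
      rw [← Real.exp_nat_mul]; convert hXt using 2; push_cast; ring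
    exact (pow_le_pow_iff_left₀ (Real.exp_pos _).le (by linarith) two_ne_zero).1 this
  have h4 : ‖kernelPole k X (((1 / 2 + a / X : ℝ) : ℂ) + t * I)‖ ≤ C' := by
    refine h2.trans ?_
    rw [div_le_iff₀ (by linarith)]
    exact mul_le_mul_of_nonneg_left h3 hC'.le
  have h5 : -(e * kernelPole k X (((1 / 2 + a / X : ℝ) : ℂ) + t * I)).re ≤ C' := by
    refine (neg_le_abs _).trans ((abs_re_le_norm _).trans ?_)
    rw [norm_mul]
    exact (mul_le_of_le_one_left (norm_nonneg _) he).trans h4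
  rw [sub_re] at h1
  have h6 : C * Real.log t / X ≤ (C + C') * Real.log t / X := by
    gcongr; linarith
  linarith

/-- The contribution of third and higher prime powers is bounded. -/
lemma exists_sum_higher_prime_powers_le :
    ∃ C : ℝ, 0 < C ∧ ∀ S : Finset ℕ,
      (∀ n ∈ S, ∃ p m : ℕ, p.Prime ∧ n = p ^ (m + 3)) → ∑ n ∈ S, (n : ℝ) ^ (-(1 / 2 : ℝ)) ≤ C := by
  set r : ℝ := (2 : ℝ) ^ (-(1 / 2 : ℝ)) with hr
  have hr0 : 0 < r := by positivity
  have hr1 : r < 1 := Real.rpow_lt_one_of_one_lt_of_neg (by norm_num) (by norm_num)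
  have hs1 : Summable fun p : ℕ => (p : ℝ) ^ (-(3 / 2 : ℝ)) :=
    Real.summable_nat_rpow.2 (by norm_num)
  have hs2 : Summable fun m : ℕ => r ^ m := summable_geometric_of_lt_one hr0.le hr1
  have hs := hs1.mul_of_nonneg hs2 (fun p => by positivity) (fun m => by positivity)
  refine ⟨(∑' x : ℕ × ℕ, (x.1 : ℝ) ^ (-(3 / 2 : ℝ)) * r ^ x.2) + 1, by positivity, fun S hS => ?_⟩
  choose! p m hp hm using hS
  have hle : ∀ n ∈ S, (n : ℝ) ^ (-(1 / 2 : ℝ)) ≤ (p n : ℝ) ^ (-(3 / 2 : ℝ)) * r ^ (m n) := by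
    intro n hn
    have hp2 : (2 : ℝ) ≤ p n := by exact_mod_cast (hp n hn).two_le
    have h1 : (n : ℝ) ^ (-(1 / 2 : ℝ)) = (p n : ℝ) ^ (-(3 / 2 : ℝ)) * ((p n : ℝ) ^ (-(1 / 2 : ℝ))) ^ (m n) := by
      conv_lhs => rw [hm n hn]
      rw [← Real.rpow_natCast ((p n : ℝ) ^ (-(1 / 2 : ℝ))), ← Real.rpow_mul (by linarith),
        ← Real.rpow_add (by linarith)]
      push_cast
      rw [← Real.rpow_natCast, ← Real.rpow_mul (by linarith)]
      congr 1
      push_cast; ring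
    rw [h1]
    refine mul_le_mul_of_nonneg_left (pow_le_pow_left₀ (by positivity) ?_ _) (by positivity)
    exact Real.rpow_le_rpow_of_nonpos (by norm_num) hp2 (by norm_num)
  have hinj : Set.InjOn (fun n => (p n, m n)) (S : Set ℕ) := by
    intro n hn n' hn' heq
    simp only [Prod.mk.injEq] at heq
    rw [hm n hn, hm n' hn', heq.1, heq.2]
  have h2 : ∑ n ∈ S, (p n : ℝ) ^ (-(3 / 2 : ℝ)) * r ^ (m n)
      = ∑ x ∈ S.image (fun n => (p n, m n)), (x.1 : ℝ) ^ (-(3 / 2 : ℝ)) * r ^ x.2 :=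
    (Finset.sum_image (f := fun x : ℕ × ℕ => (x.1 : ℝ) ^ (-(3 / 2 : ℝ)) * r ^ x.2) hinj).symm
  have h3 := hs.sum_le_tsum (S.image (fun n => (p n, m n))) (fun x _ => by positivity)
  have h4 := Finset.sum_le_sum hle
  linarith

/-- The coefficients `Λ(n) / log n` of `log ζ`, twisted by `χ`. -/
noncomputable def logCoeff (χ : ℕ → ℂ) (n : ℕ) : ℂ := χ n * ((Λ n / Real.log n : ℝ) : ℂ)

lemma vonMangoldt_div_log_le_one (n : ℕ) : Λ n / Real.log n ≤ 1 :=
  div_le_one_of_le₀ ArithmeticFunction.vonMangoldt_le_log (Real.log_natCast_nonneg n)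

lemma norm_logCoeff_le {χ : ℕ → ℂ} (hχ : ∀ n, ‖χ n‖ ≤ 1) (n : ℕ) : ‖logCoeff χ n‖ ≤ 1 := by
  have h0 : 0 ≤ Λ n / Real.log n :=
    div_nonneg ArithmeticFunction.vonMangoldt_nonneg (Real.log_natCast_nonneg n)
  rw [logCoeff, norm_mul, norm_real, Real.norm_of_nonneg h0]
  exact mul_le_one₀ (hχ n) h0 (vonMangoldt_div_log_le_one n)

lemma logCoeff_zero (χ : ℕ → ℂ) : logCoeff χ 0 = 0 := by simp [logCoeff]

lemma logCoeff_prime (χ : ℕ → ℂ) {p : ℕ} (hp : p.Prime) : logCoeff χ p = χ p := by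
  have : Real.log p ≠ 0 := (Real.log_pos (by exact_mod_cast hp.one_lt)).ne'
  rw [logCoeff, ArithmeticFunction.vonMangoldt_apply_prime hp, div_self this]; simp

lemma logCoeff_prime_sq (χ : ℕ → ℂ) {p : ℕ} (hp : p.Prime) : logCoeff χ (p ^ 2) = χ (p ^ 2) / 2 := by
  have : Real.log p ≠ 0 := (Real.log_pos (by exact_mod_cast hp.one_lt)).ne'
  rw [logCoeff, ArithmeticFunction.vonMangoldt_apply_pow two_ne_zero,
    ArithmeticFunction.vonMangoldt_apply_prime hp]
  have h2 : Real.log p / Real.log ((p ^ 2 : ℕ) : ℝ) = 1 / 2 := by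
    push_cast; rw [Real.log_pow]; field_simp; norm_num
  rw [h2]; push_cast; ring

lemma exists_sum_logCoeff_split {χ : ℕ → ℂ} (hχ : ∀ n, ‖χ n‖ ≤ 1) :
    ∃ C : ℝ, 0 < C ∧ ∀ (N : ℕ) (σ : ℝ), 1 / 2 ≤ σ → ∀ φ : ℕ → ℂ, (∀ n, ‖φ n‖ ≤ 1) →
      ∃ A B : ℕ → ℂ, (∀ p : ℕ, p.Prime → ‖A p‖ ≤ (p : ℝ) ^ (-(1 / 2 : ℝ))) ∧
        (∀ p : ℕ, p.Prime → ‖B p‖ ≤ 1 / (2 * p : ℝ)) ∧ ∀ t : ℝ,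
        (∑ n ∈ Finset.range (N + 1), logCoeff χ n * (n : ℂ) ^ (-((σ : ℂ) + t * I)) * φ n).re ≤
          (∑ p ∈ primesTo N, A p * cexp ((-(1 * Real.log p) * t : ℝ) * I)).re +
          (∑ p ∈ primesTo (Nat.sqrt N), B p * cexp ((-(2 * Real.log p) * t : ℝ) * I)).re + C := by
  obtain ⟨C, hC, hrest⟩ := exists_sum_higher_prime_powers_le
  refine ⟨C, hC, fun N σ hσ φ hφ => ?_⟩
  refine ⟨fun p => χ p * ((p : ℝ) ^ (-σ) : ℝ) * φ p,
    fun p => χ (p ^ 2) / 2 * (((p ^ 2 : ℕ) : ℝ) ^ (-σ) : ℝ) * φ (p ^ 2), ?_, ?_, fun t => ?_⟩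
  · intro p hp
    have hp1 : (1 : ℝ) ≤ p := by exact_mod_cast hp.one_le
    rw [norm_mul, norm_mul, norm_real, Real.norm_of_nonneg (by positivity)]
    calc ‖χ p‖ * (p : ℝ) ^ (-σ) * ‖φ p‖ ≤ 1 * (p : ℝ) ^ (-σ) * 1 := by
          refine mul_le_mul (mul_le_mul_of_nonneg_right (hχ _) (by positivity)) (hφ _)
            (norm_nonneg _) (by positivity)
      _ ≤ _ := by
          rw [one_mul, mul_one]
          exact Real.rpow_le_rpow_of_exponent_le hp1 (by linarith)
  · intro p hp
    have hp1 : (1 : ℝ) ≤ p := by exact_mod_cast hp.one_le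
    rw [norm_mul, norm_mul, norm_real, Real.norm_of_nonneg (by positivity), norm_div]
    have h1 : ((p ^ 2 : ℕ) : ℝ) ^ (-σ) ≤ (p : ℝ)⁻¹ := by
      calc ((p ^ 2 : ℕ) : ℝ) ^ (-σ) ≤ ((p ^ 2 : ℕ) : ℝ) ^ (-(1 / 2 : ℝ)) :=
            Real.rpow_le_rpow_of_exponent_le (by push_cast; nlinarith) (by linarith)
        _ = (p : ℝ)⁻¹ := by
            push_cast
            rw [← Real.rpow_natCast, ← Real.rpow_mul (by linarith), ← Real.rpow_neg_one]
            norm_num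
    calc ‖χ (p ^ 2)‖ / ‖(2 : ℂ)‖ * ((p ^ 2 : ℕ) : ℝ) ^ (-σ) * ‖φ (p ^ 2)‖
        ≤ 1 / 2 * (p : ℝ)⁻¹ * 1 := by
          refine mul_le_mul (mul_le_mul ?_ h1 (by positivity) (by positivity)) (hφ _)
            (norm_nonneg _) (by positivity)
          rw [Complex.norm_ofNat]
          have := hχ (p ^ 2)
          linarith
      _ = _ := by rw [mul_one, one_div, one_div, mul_inv]
  set g : ℕ → ℂ := fun n => logCoeff χ n * (n : ℂ) ^ (-((σ : ℂ) + t * I)) * φ n with hg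
  have hgp : ∀ p ∈ primesTo N, g p
      = χ p * ((p : ℝ) ^ (-σ) : ℝ) * φ p * cexp ((-(1 * Real.log p) * t : ℝ) * I) := by
    intro p hp
    have hp' := (mem_primesTo.1 hp).2
    rw [hg]; simp only
    rw [logCoeff_prime χ hp', natCast_cpow_line hp'.pos, one_mul]; ring
  have hgp2 : ∀ p ∈ primesTo (Nat.sqrt N), g (p ^ 2)
      = χ (p ^ 2) / 2 * (((p ^ 2 : ℕ) : ℝ) ^ (-σ) : ℝ) * φ (p ^ 2) *
        cexp ((-(2 * Real.log p) * t : ℝ) * I) := by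
    intro p hp
    have hp' := (mem_primesTo.1 hp).2
    rw [hg]; simp only
    rw [logCoeff_prime_sq χ hp', natCast_cpow_line (pow_pos hp'.pos 2)]
    have : Real.log ((p ^ 2 : ℕ) : ℝ) = 2 * Real.log p := by push_cast; rw [Real.log_pow]; norm_num
    rw [this]; ring
  rw [← Finset.sum_congr rfl hgp, ← Finset.sum_congr rfl hgp2]
  have hsq : ∑ p ∈ primesTo (Nat.sqrt N), g (p ^ 2)
      = ∑ n ∈ (primesTo (Nat.sqrt N)).image (fun p => p ^ 2), g n :=
    (Finset.sum_image (fun p _ p' _ hpp => Nat.pow_left_injective (n := 2) two_ne_zero hpp)).symm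
  have hdisj : Disjoint (primesTo N) ((primesTo (Nat.sqrt N)).image (fun p => p ^ 2)) := by
    rw [Finset.disjoint_left]
    intro n hn hn'
    obtain ⟨p, hp, rfl⟩ := Finset.mem_image.1 hn'
    exact Nat.Prime.not_prime_pow le_rfl (mem_primesTo.1 hn).2
  have hsub : primesTo N ∪ (primesTo (Nat.sqrt N)).image (fun p => p ^ 2) ⊆ Finset.range (N + 1) := by
    intro n hn
    rw [Finset.mem_range, Nat.lt_succ_iff]
    rcases Finset.mem_union.1 hn with hn | hn
    · exact (mem_primesTo.1 hn).1
    · obtain ⟨p, hp, rfl⟩ := Finset.mem_image.1 hn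
      exact Nat.le_sqrt'.1 (mem_primesTo.1 hp).1
  rw [hsq, ← Finset.sum_sdiff hsub, Finset.sum_union hdisj, add_re, add_re]
  set R := Finset.range (N + 1) \ (primesTo N ∪ (primesTo (Nat.sqrt N)).image (fun p => p ^ 2)) with hR
  suffices (∑ n ∈ R, g n).re ≤ C by linarith
  refine (re_le_norm _).trans ((norm_sum_le _ _).trans ?_)
  rw [← Finset.sum_filter_add_sum_filter_not R (fun n => Λ n = 0)]
  have hz : ∑ n ∈ R with Λ n = 0, ‖g n‖ = 0 := by
    refine Finset.sum_eq_zero fun n hn => ?_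
    have := (Finset.mem_filter.1 hn).2
    simp [hg, logCoeff, this]
  rw [hz, zero_add]
  refine le_trans (Finset.sum_le_sum fun n hn => ?_) (hrest (R.filter fun n => ¬ Λ n = 0) ?_)
  · have hn1 := (Finset.mem_filter.1 hn).2
    have hn0 : 0 < n := Nat.pos_of_ne_zero (by rintro rfl; simp at hn1)
    have hn1' : (1 : ℝ) ≤ n := by exact_mod_cast hn0
    rw [hg]; simp only
    rw [norm_mul, norm_mul, Complex.norm_natCast_cpow_of_pos hn0]
    have hre : (-((σ : ℂ) + t * I)).re = -σ := by simp
    rw [hre]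
    calc ‖logCoeff χ n‖ * (n : ℝ) ^ (-σ) * ‖φ n‖ ≤ 1 * (n : ℝ) ^ (-σ) * 1 := by
          refine mul_le_mul (mul_le_mul_of_nonneg_right (norm_logCoeff_le hχ _) (by positivity)) (hφ _)
            (norm_nonneg _) (by positivity)
      _ ≤ _ := by
          rw [one_mul, mul_one]
          exact Real.rpow_le_rpow_of_exponent_le hn1' (by linarith)
  · intro n hn
    obtain ⟨hnR, hn1⟩ := Finset.mem_filter.1 hn
    rw [hR, Finset.mem_sdiff, Finset.mem_range, Nat.lt_succ_iff, Finset.mem_union, not_or] at hnR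
    obtain ⟨hnN, hnp, hnsq⟩ := hnR
    obtain ⟨p, j, hp, hj, rfl⟩ := (isPrimePow_nat_iff n).1 (ArithmeticFunction.vonMangoldt_ne_zero_iff.1 hn1)
    rcases j with _ | _ | _ | j
    · omega
    · exact absurd (mem_primesTo.2 ⟨hnN, by simpa using hp⟩) hnp
    · exact absurd (Finset.mem_image.2 ⟨p, mem_primesTo.2 ⟨Nat.le_sqrt'.2 hnN, hp⟩, rfl⟩) hnsq
    · exact ⟨p, j, hp, rfl⟩

/-- The pointwise bound, with the Dirichlet polynomial split into primes and squares of primes. -/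
theorem GrowthLog.exists_norm_le_exp {f H : ℂ → ℂ} {A : ℝ} {m : ℕ} {B : ℝ}
    (h : GrowthLog f H A m B) {χ : ℕ → ℂ} (hχ : ∀ n, ‖χ n‖ ≤ 1) {e : ℂ} (he : ‖e‖ ≤ 1)
    (hH : ∀ s : ℂ, 1 < s.re →
      HasSum (fun n : ℕ => logCoeff χ n * (n : ℂ) ^ (-s)) (H s + e * poleLog s)) :
    ∃ X₀ C : ℝ, 1 ≤ X₀ ∧ 0 < C ∧ ∀ X : ℝ, X₀ ≤ X →
      ∃ a b : ℕ → ℂ, (∀ p : ℕ, p.Prime → ‖a p‖ ≤ (p : ℝ) ^ (-(1 / 2 : ℝ))) ∧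
        (∀ p : ℕ, p.Prime → ‖b p‖ ≤ 1 / (2 * p : ℝ)) ∧ ∀ t : ℝ, 3 ≤ t → Real.exp X ≤ t ^ 2 →
        ‖f (1 / 2 + t * I)‖ ≤ Real.exp (
          (∑ p ∈ primesTo ⌊Real.exp X⌋₊, a p * cexp ((-(1 * Real.log p) * t : ℝ) * I)).re +
          (∑ p ∈ primesTo (Nat.sqrt ⌊Real.exp X⌋₊), b p * cexp ((-(2 * Real.log p) * t : ℝ) * I)).re +
          C * Real.log t / X + C) := by
  obtain ⟨k, hk1, hk2, hk3, hk4, hk5, hk6⟩ := exists_bandlimited_kernel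
  have hk : BandKernel k := ⟨hk1, hk2, hk3, hk4, hk5, hk6⟩
  obtain ⟨a, C, ha, hC, hmain⟩ := h.exists_log_norm_le_sum hk (norm_logCoeff_le hχ) (logCoeff_zero χ) he hH
  obtain ⟨C', hC', hsplit⟩ := exists_sum_logCoeff_split hχ
  refine ⟨10 * a, C + C', by linarith, by positivity, fun X hX => ?_⟩
  have hX0 : 0 < X := by linarith
  have haX : 0 < a / X := by positivity
  obtain ⟨A', B', hA, hB, hs⟩ := hsplit ⌊Real.exp X⌋₊ (1 / 2 + a / X) (by linarith)
    (fun n => kernelFT k (Real.log n / X)) (fun n => hk.norm_kernelFT_le _)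
  refine ⟨A', B', hA, hB, fun t ht hXt => ?_⟩
  rcases eq_or_ne (f (1 / 2 + t * I)) 0 with h0 | h0
  · rw [h0, norm_zero]; positivity
  rw [← Real.log_le_iff_le_exp (norm_pos_iff.2 h0)]
  have h1 := hmain t ht X hX hXt h0
  have h2 := hs t
  have h3 : C * Real.log t / X ≤ (C + C') * Real.log t / X := by
    have : 0 ≤ Real.log t := Real.log_nonneg (by linarith)
    gcongr; linarith
  linarith

lemma poleLog_eq {s : ℂ} (hs : 1 < s.re) : poleLog s = Complex.log (s + 1) - Complex.log (s - 1) := by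
  unfold poleLog
  rw [← intervalIntegral.integral_of_le (by norm_num : (-1 : ℝ) ≤ 1)]
  have hre : ∀ w ∈ Set.uIcc (-1 : ℝ) 1, 0 < (s + w).re := by
    intro w hw
    rw [Set.uIcc_of_le (by norm_num)] at hw
    rw [add_re, ofReal_re]; linarith [hw.1]
  rw [intervalIntegral.integral_eq_sub_of_hasDerivAt (f := fun w : ℝ => Complex.log (s + w))]
  · push_cast; ring_nf
  · intro w hw
    have h1 : HasDerivAt (fun w : ℝ => s + (w : ℂ)) 1 w := by
      simpa using (ofRealCLM.hasDerivAt (x := w)).const_add s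
    have := h1.clog_real (Or.inl (hre w hw))
    simpa using this
  · refine ContinuousOn.intervalIntegrable fun w hw => ?_
    refine ContinuousAt.continuousWithinAt (ContinuousAt.inv₀ (by fun_prop) fun h0 => ?_)
    have := hre w hw
    rw [h0] at this; simp at this

lemma exp_neg_poleLog {s : ℂ} (hs : 1 < s.re) : cexp (-poleLog s) = (s - 1) / (s + 1) := by
  have h1 : s + 1 ≠ 0 := fun h => by
    have : (s + 1).re = 0 := by rw [h]; simp
    simp at this; linarith
  have h2 : s - 1 ≠ 0 := fun h => by
    have : (s - 1).re = 0 := by rw [h]; simp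
    simp at this; linarith
  rw [poleLog_eq hs, neg_sub, Complex.exp_sub, Complex.exp_log h1, Complex.exp_log h2]

lemma differentiableOn_poleLog : DifferentiableOn ℂ poleLog {s | 1 < s.re} := by
  have h : DifferentiableOn ℂ (fun s : ℂ => Complex.log (s + 1) - Complex.log (s - 1)) {s | 1 < s.re} := by
    intro s hs
    have hs' : 1 < s.re := hs
    refine (DifferentiableAt.sub (DifferentiableAt.clog (by fun_prop) (Or.inl ?_))
      (DifferentiableAt.clog (by fun_prop) (Or.inl ?_))).differentiableWithinAt
    · simp; linarith
    · simp; linarith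
  exact h.congr fun s hs => poleLog_eq hs

lemma norm_poleLog_le {s : ℂ} (hs : 2 ≤ s.re) : ‖poleLog s‖ ≤ 2 := by
  unfold poleLog
  rw [← intervalIntegral.integral_of_le (by norm_num : (-1 : ℝ) ≤ 1)]
  refine (intervalIntegral.norm_integral_le_of_norm_le_const (C := 1) fun w hw => ?_).trans
    (by norm_num)
  rw [Set.uIoc_of_le (by norm_num)] at hw
  rw [norm_inv]
  refine inv_le_one_of_one_le₀ (le_trans ?_ (re_le_norm _))
  rw [add_re, ofReal_re]; linarith [hw.1]

/-- Two holomorphic logarithms of the same function on a convex open set that agree at a point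
are equal. -/
lemma eqOn_of_cexp_eq {U : Set ℂ} (hc : Convex ℝ U) (ho : IsOpen U) {h₁ h₂ : ℂ → ℂ}
    (hd₁ : DifferentiableOn ℂ h₁ U) (hd₂ : DifferentiableOn ℂ h₂ U)
    (he : ∀ s ∈ U, cexp (h₁ s) = cexp (h₂ s)) {s₀ : ℂ} (hs₀ : s₀ ∈ U) (h0 : h₁ s₀ = h₂ s₀) :
    ∀ s ∈ U, h₁ s = h₂ s := by
  have hD := hd₁.sub hd₂
  have h1 : ∀ s ∈ U, cexp ((h₁ - h₂) s) = 1 := by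
    intro s hs
    rw [Pi.sub_apply, Complex.exp_sub, he s hs, div_self (Complex.exp_ne_zero _)]
  have h2 : U.EqOn (deriv (h₁ - h₂)) 0 := by
    intro s hs
    have hda := (hD.differentiableAt (ho.mem_nhds hs)).hasDerivAt
    have h3 := hda.cexp
    have h4 : (fun s => cexp ((h₁ - h₂) s)) =ᶠ[nhds s] fun _ => 1 :=
      Filter.eventually_of_mem (ho.mem_nhds hs) h1
    have h5 := h3.unique ((hasDerivAt_const s (1 : ℂ)).congr_of_eventuallyEq h4)
    rw [h1 s hs, one_mul] at h5
    exact h5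
  intro s hs
  have h6 := ho.is_const_of_deriv_eq_zero hc.isPreconnected hD h2 hs hs₀
  rw [Pi.sub_apply, Pi.sub_apply, h0, sub_self] at h6
  exact sub_eq_zero.1 h6

section

variable {q : ℕ} [NeZero q]

lemma exists_norm_sub_one_mul_LFunction_le (χ : DirichletCharacter ℂ q) :
    ∃ C : ℝ, 0 < C ∧ ∀ s : ℂ, 1 / 10 ≤ s.re → s.re ≤ 4 →
      ‖(s - 1) * DirichletCharacter.LFunction χ s‖ ≤ C * (1 + ‖s‖) ^ 2 := by
  have hq : (0 : ℝ) < q := by exact_mod_cast Nat.pos_of_ne_zero (NeZero.ne q)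
  have hj : ∀ j : ZMod q, ∃ C : ℝ, 0 < C ∧ ∀ s : ℂ, 1 / 10 ≤ s.re → s.re ≤ 4 →
      ‖(s - 1) * hurwitzZeta (ZMod.toAddCircle j) s‖ ≤ C * (1 + ‖s‖) ^ 2 := by
    intro j
    rcases Nat.eq_zero_or_pos j.val with h0 | h0
    · have : ZMod.toAddCircle j = ((1 : ℝ) : UnitAddCircle) := by
        rw [ZMod.toAddCircle_apply, h0]
        simp [AddCircle.coe_period]
      rw [this]
      exact exists_norm_sub_one_mul_hurwitzZeta_le one_pos le_rfl
    · rw [ZMod.toAddCircle_apply]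
      refine exists_norm_sub_one_mul_hurwitzZeta_le (div_pos (by exact_mod_cast h0) hq) ?_
      rw [div_le_one hq]
      exact_mod_cast (ZMod.val_lt j).le
  choose C hC hb using hj
  refine ⟨∑ j, C j, Finset.sum_pos (fun j _ => hC j) Finset.univ_nonempty, fun s h1 h2 => ?_⟩
  have h3 : (s - 1) * DirichletCharacter.LFunction χ s
      = (q : ℂ) ^ (-s) * ∑ j : ZMod q, χ j * ((s - 1) * hurwitzZeta (ZMod.toAddCircle j) s) := by
    rw [DirichletCharacter.LFunction, ZMod.LFunction, mul_left_comm, Finset.mul_sum]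
    congr 1
    exact Finset.sum_congr rfl fun j _ => by ring
  rw [h3, norm_mul, Complex.norm_natCast_cpow_of_pos (Nat.pos_of_ne_zero (NeZero.ne q))]
  have h4 : (q : ℝ) ^ (-s).re ≤ 1 := by
    refine Real.rpow_le_one_of_one_le_of_nonpos ?_ (by rw [neg_re]; linarith)
    exact_mod_cast Nat.pos_of_ne_zero (NeZero.ne q)
  refine (mul_le_of_le_one_left (norm_nonneg _) h4).trans ((norm_sum_le _ _).trans ?_)
  rw [Finset.sum_mul]
  refine Finset.sum_le_sum fun j _ => ?_
  rw [norm_mul]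
  exact (mul_le_of_le_one_left (norm_nonneg _) (χ.norm_le_one j)).trans (hb j s h1 h2)

/-- The Dirichlet series of `log L(s, χ)`. -/
lemma hasSum_logCoeff (χ : DirichletCharacter ℂ q) {s : ℂ} (hs : 1 < s.re) :
    HasSum (fun n : ℕ => logCoeff (fun n => χ n) n * (n : ℂ) ^ (-s)) (LSeries (logCoeff fun n => χ n) s) ∧
    ‖LSeries (logCoeff fun n => χ n) s‖ ≤ ∑' n : ℕ, (n : ℝ) ^ (-s.re) ∧
    cexp (LSeries (logCoeff fun n => χ n) s) = DirichletCharacter.LFunction χ s ∧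
    LSeriesSummable (logCoeff fun n => χ n) s := by
  have hχ : ∀ n : ℕ, ‖χ n‖ ≤ 1 := fun n => χ.norm_le_one _
  have hsm : Summable fun n : ℕ => (n : ℝ) ^ (-s.re) := Real.summable_nat_rpow.2 (by linarith)
  have hb : ∀ n : ℕ, ‖logCoeff (fun n => χ n) n * (n : ℂ) ^ (-s)‖ ≤ (n : ℝ) ^ (-s.re) := by
    intro n
    rcases Nat.eq_zero_or_pos n with rfl | hn
    · rw [logCoeff_zero, zero_mul, norm_zero]; positivity
    rw [norm_mul, Complex.norm_natCast_cpow_of_pos hn, neg_re]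
    exact mul_le_of_le_one_left (by positivity) (norm_logCoeff_le hχ n)
  have hsum : Summable fun n : ℕ => logCoeff (fun n => χ n) n * (n : ℂ) ^ (-s) :=
    hsm.of_norm_bounded hb
  have hterm : (fun n : ℕ => LSeries.term (logCoeff fun n => χ n) s n)
      = fun n : ℕ => logCoeff (fun n => χ n) n * (n : ℂ) ^ (-s) := by
    funext n
    rw [LSeries.term_def₀ (logCoeff_zero _)]
  have hL : LSeries (logCoeff fun n => χ n) s = ∑' n : ℕ, logCoeff (fun n => χ n) n * (n : ℂ) ^ (-s) := by
    rw [LSeries, ← hterm]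
  refine ⟨hL ▸ hsum.hasSum, ?_, ?_, ?_⟩
  · rw [hL]
    exact tsum_of_norm_bounded hsm.hasSum hb
  · rw [DirichletCharacter.LFunction_eq_LSeries χ hs, ← DirichletCharacter.LSeries_eq_exp_LSeries χ hs]
    congr 2
    funext n
    rw [logCoeff]; push_cast; ring
  · rw [LSeriesSummable, show LSeries.term (logCoeff fun n => χ n) s = _ from hterm]
    exact hsum

lemma differentiableOn_LSeries_logCoeff (χ : DirichletCharacter ℂ q) :
    DifferentiableOn ℂ (LSeries (logCoeff fun n => χ n)) {s | 1 < s.re} := by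
  have habs : LSeries.abscissaOfAbsConv (logCoeff fun n => χ n) ≤ ((1 : ℝ) : EReal) :=
    LSeries.abscissaOfAbsConv_le_of_forall_lt_LSeriesSummable fun y hy =>
      (hasSum_logCoeff χ (s := (y : ℂ)) (by simpa using hy)).2.2.2
  intro s hs
  refine ((LSeries_hasDerivAt (lt_of_le_of_lt habs ?_)).differentiableAt).differentiableWithinAt
  exact_mod_cast hs

lemma exists_growthLog_of_GRHmod (hGRH : GRHmod q) (χ : DirichletCharacter ℂ q) {e : ℕ} (he : e ≤ 1)
    {f : ℂ → ℂ} (hd' : DifferentiableOn ℂ f {s | 1 / 10 < s.re})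
    (hf : ∀ s : ℂ, s ≠ 1 → f s = DirichletCharacter.LFunction χ s * ((s - 1) / (s + 1)) ^ e)
    (h1 : f 1 ≠ 0) :
    ∃ (H : ℂ → ℂ) (A : ℝ) (m : ℕ) (B : ℝ), GrowthLog f H A m B ∧ ∀ s : ℂ, 1 < s.re →
      HasSum (fun n : ℕ => logCoeff (fun n => χ n) n * (n : ℂ) ^ (-s)) (H s + (e : ℂ) * poleLog s) := by
  have hadd : ∀ s : ℂ, 1 / 10 ≤ s.re → s + 1 ≠ 0 := fun s hs h => by
    have : (s + 1).re = 0 := by rw [h]; simp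
    simp at this; linarith
  have hzeros : ∀ s : ℂ, 1 / 10 < s.re → f s = 0 → s.re = 1 / 2 := by
    intro s hs h0
    have hs1 : s ≠ 1 := by rintro rfl; exact h1 h0
    rw [hf s hs1, mul_eq_zero] at h0
    have hL : DirichletCharacter.LFunction χ s = 0 := h0.resolve_right
      (pow_ne_zero _ (div_ne_zero (sub_ne_zero.2 hs1) (hadd s hs.le)))
    refine hGRH χ s hL (by linarith) ?_
    by_contra hcon
    exact DirichletCharacter.LFunction_ne_zero_of_one_le_re χ (Or.inr hs1) (not_lt.1 hcon) hL
  have hconv : ∀ x : ℝ, Convex ℝ {s : ℂ | x < s.re} := fun x => convex_halfSpace_re_gt x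
  have hopen : ∀ x : ℝ, IsOpen {s : ℂ | x < s.re} := fun x => isOpen_lt continuous_const continuous_re
  set H₁ : ℂ → ℂ := fun s => LSeries (logCoeff fun n => χ n) s - (e : ℂ) * poleLog s with hH₁
  have hH₁e : ∀ s : ℂ, 1 < s.re → cexp (H₁ s) = f s := by
    intro s hs
    have hs1 : s ≠ 1 := by rintro rfl; simp at hs
    rw [hf s hs1, ← exp_neg_poleLog hs, ← Complex.exp_nat_mul, ← (hasSum_logCoeff χ hs).2.2.1, ← Complex.exp_add]
    congr 1
    rw [hH₁]; ring
  obtain ⟨H, hHd, hHe, hH2⟩ := exists_log_of_convex (hconv (1 / 2)) (hopen (1 / 2))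
    (hd'.mono fun s (hs : 1 / 2 < s.re) => show 1 / 10 < s.re by linarith)
    (fun s hs h0 => by
      have hs' : 1 / 2 < s.re := hs
      have := hzeros s (by linarith) h0
      linarith) (s₀ := 2) (w := H₁ 2) (show (1 / 2 : ℝ) < (2 : ℂ).re by norm_num)
    (hH₁e 2 (by norm_num))
  have hHH : ∀ s ∈ {s : ℂ | 1 < s.re}, H s = H₁ s := by
    refine eqOn_of_cexp_eq (hconv 1) (hopen 1)
      (hHd.mono fun s (hs : 1 < s.re) => show 1 / 2 < s.re by linarith)
      ((differentiableOn_LSeries_logCoeff χ).sub (differentiableOn_poleLog.const_mul _))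
      (fun s hs => ?_) (s₀ := 2) (show (1 : ℝ) < (2 : ℂ).re by norm_num) hH2
    have hs' : 1 < s.re := hs
    rw [hHe s (show 1 / 2 < s.re by linarith), hH₁e s hs]
  obtain ⟨C, hC, hCb⟩ := exists_norm_sub_one_mul_LFunction_le χ
  obtain ⟨M, hM⟩ := (isCompact_closedBall (1 : ℂ) (1 / 2)).exists_bound_of_continuousOn
    (hd'.continuousOn.mono fun s hs => show 1 / 10 < s.re by
      have h2 := (abs_re_le_norm (s - 1)).trans (mem_closedBall_iff_norm.1 hs)
      rw [sub_re, one_re, abs_le] at h2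
      linarith [h2.1])
  have hbound : ∀ s : ℂ, 1 / 10 ≤ s.re → s.re ≤ 4 → ‖f s‖ ≤ (1 + 2 * C + |M|) * (1 + ‖s‖) ^ 2 := by
    intro s h2 h3
    have hone : 1 ≤ (1 + ‖s‖) ^ 2 := one_le_pow₀ (by linarith [norm_nonneg s])
    rcases le_or_gt ‖s - 1‖ (1 / 2) with h4 | h4
    · have h5 := (hM s (mem_closedBall_iff_norm.2 h4)).trans (le_abs_self M)
      have h6 : 1 * |M| ≤ (1 + ‖s‖) ^ 2 * |M| := mul_le_mul_of_nonneg_right hone (abs_nonneg _)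
      have h7 : 0 ≤ (1 + 2 * C) * (1 + ‖s‖) ^ 2 := by positivity
      linarith
    · have hs1 : s ≠ 1 := by rintro rfl; norm_num at h4
      have h5 := hCb s h2 h3
      have hn : (0 : ℝ) < ‖s - 1‖ := by linarith
      have h6 : ‖f s‖ ≤ 2 * ‖(s - 1) * DirichletCharacter.LFunction χ s‖ := by
        rw [hf s hs1, norm_mul, norm_mul, norm_pow, norm_div]
        have h7 : (‖s - 1‖ / ‖s + 1‖) ^ e ≤ 2 * ‖s - 1‖ := by
          rcases Nat.le_one_iff_eq_zero_or_eq_one.1 he with rfl | rfl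
          · rw [pow_zero]; linarith
          · rw [pow_one]
            have h8 : 1 ≤ ‖s + 1‖ := by
              refine le_trans ?_ (re_le_norm _)
              rw [add_re, one_re]; linarith
            have := div_le_self hn.le h8
            linarith
        calc ‖DirichletCharacter.LFunction χ s‖ * (‖s - 1‖ / ‖s + 1‖) ^ e
            ≤ ‖DirichletCharacter.LFunction χ s‖ * (2 * ‖s - 1‖) :=
              mul_le_mul_of_nonneg_left h7 (norm_nonneg _)
          _ = _ := by ring
      have h7 : 0 ≤ (1 + |M|) * (1 + ‖s‖) ^ 2 := by positivity
      linarith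
  refine ⟨H, 1 + 2 * C + |M|, 2, (∑' n : ℕ, (n : ℝ) ^ (-2 : ℝ)) + 2, ⟨?_, hd', hbound, hzeros, hHd, hHe, fun t => ?_⟩,
    fun s hs => ?_⟩
  · have := abs_nonneg M; linarith
  · have hre : ((2 : ℂ) + t * I).re = 2 := by simp
    have hs : 1 < ((2 : ℂ) + t * I).re := by rw [hre]; norm_num
    rw [hHH _ hs, hH₁]
    have h2 := (hasSum_logCoeff χ hs).2.1
    rw [hre] at h2
    have h3 := norm_poleLog_le (s := 2 + t * I) (by rw [hre])
    refine (norm_sub_le _ _).trans (add_le_add h2 ?_)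
    rw [norm_mul, Complex.norm_natCast]
    have he' : (e : ℝ) ≤ 1 := by exact_mod_cast he
    exact (mul_le_of_le_one_left (norm_nonneg _) he').trans h3
  · rw [hHH s hs, hH₁]
    simp only [sub_add_cancel]
    exact (hasSum_logCoeff χ hs).1

/-- Under GRH, the pointwise bound for `L(1/2 + it, χ)`. -/
theorem exists_norm_LFunction_le_exp (hGRH : GRHmod q) (χ : DirichletCharacter ℂ q) :
    ∃ X₀ C : ℝ, 1 ≤ X₀ ∧ 0 < C ∧ ∀ X : ℝ, X₀ ≤ X →
      ∃ a b : ℕ → ℂ, (∀ p : ℕ, p.Prime → ‖a p‖ ≤ (p : ℝ) ^ (-(1 / 2 : ℝ))) ∧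
        (∀ p : ℕ, p.Prime → ‖b p‖ ≤ 1 / (2 * p : ℝ)) ∧ ∀ t : ℝ, 3 ≤ t → Real.exp X ≤ t ^ 2 →
        ‖DirichletCharacter.LFunction χ (1 / 2 + t * I)‖ ≤ Real.exp (
          (∑ p ∈ primesTo ⌊Real.exp X⌋₊, a p * cexp ((-(1 * Real.log p) * t : ℝ) * I)).re +
          (∑ p ∈ primesTo (Nat.sqrt ⌊Real.exp X⌋₊), b p * cexp ((-(2 * Real.log p) * t : ℝ) * I)).re +
          C * Real.log t / X + C) := by
  have hχ : ∀ n : ℕ, ‖χ n‖ ≤ 1 := fun n => χ.norm_le_one _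
  have key : ∃ (f H : ℂ → ℂ) (A : ℝ) (m : ℕ) (B : ℝ) (e : ℕ), e ≤ 1 ∧ GrowthLog f H A m B ∧
      (∀ s : ℂ, 1 < s.re →
        HasSum (fun n : ℕ => logCoeff (fun n => χ n) n * (n : ℂ) ^ (-s)) (H s + (e : ℂ) * poleLog s)) ∧
      ∀ t : ℝ, 3 ≤ t → ‖DirichletCharacter.LFunction χ (1 / 2 + t * I)‖ ≤ 2 * ‖f (1 / 2 + t * I)‖ := by
    by_cases h1 : χ = 1
    · subst h1
      set g := DirichletCharacter.LFunctionTrivChar₁ q with hg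
      have hgd : Differentiable ℂ g := DirichletCharacter.differentiable_LFunctionTrivChar₁ q
      have hadd : ∀ s : ℂ, 1 / 10 < s.re → s + 1 ≠ 0 := fun s hs h => by
        have : (s + 1).re = 0 := by rw [h]; simp
        simp at this; linarith
      have hf : ∀ s : ℂ, s ≠ 1 → g s / (s + 1)
          = DirichletCharacter.LFunction (1 : DirichletCharacter ℂ q) s * ((s - 1) / (s + 1)) ^ 1 := by
        intro s hs
        rw [hg, DirichletCharacter.LFunctionTrivChar₁, Function.update_of_ne hs]
        simp only [DirichletCharacter.LFunctionTrivChar, pow_one]; ring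
      obtain ⟨H, A, m, B, hGL, hsum⟩ := exists_growthLog_of_GRHmod hGRH 1 (e := 1) le_rfl
        (f := fun s => g s / (s + 1))
        (hgd.differentiableOn.div (by fun_prop) hadd) hf
        (div_ne_zero (DirichletCharacter.LFunctionTrivChar₁_apply_one_ne_zero q) (by norm_num))
      refine ⟨_, H, A, m, B, 1, le_rfl, hGL, hsum, fun t ht => ?_⟩
      have hs1 : (1 / 2 + t * I : ℂ) ≠ 1 := fun h => by
        have := congrArg Complex.im h
        simp at this; linarith
      rw [hf _ hs1, pow_one, norm_mul, norm_div]
      have h2 : ‖(1 / 2 + t * I : ℂ) + 1‖ ≤ 2 * ‖(1 / 2 + t * I : ℂ) - 1‖ := by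
        have h3 : t ≤ ‖(1 / 2 + t * I : ℂ) - 1‖ := by
          refine le_trans (le_of_eq ?_) (im_le_norm _)
          simp
        have h4 : ‖(1 / 2 + t * I : ℂ) + 1‖ ≤ ‖(1 / 2 + t * I : ℂ) - 1‖ + 2 := by
          have := norm_add_le ((1 / 2 + t * I : ℂ) - 1) 2
          rw [Complex.norm_ofNat] at this
          rwa [show (1 / 2 + t * I : ℂ) - 1 + 2 = (1 / 2 + t * I) + 1 by ring] at this
        linarith
      have h5 : 0 < ‖(1 / 2 + t * I : ℂ) + 1‖ := norm_pos_iff.2 (hadd _ (by simp; norm_num))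
      have h6 : 1 / 2 ≤ ‖(1 / 2 + t * I : ℂ) - 1‖ / ‖(1 / 2 + t * I : ℂ) + 1‖ := by
        rw [le_div_iff₀ h5]; linarith
      nlinarith [norm_nonneg (DirichletCharacter.LFunction (1 : DirichletCharacter ℂ q) (1 / 2 + t * I))]
    · have hgd := DirichletCharacter.differentiable_LFunction h1
      obtain ⟨H, A, m, B, hGL, hsum⟩ := exists_growthLog_of_GRHmod hGRH χ (e := 0) (Nat.zero_le _)
        (f := DirichletCharacter.LFunction χ) hgd.differentiableOn (fun s _ => by simp)
        (DirichletCharacter.LFunction_apply_one_ne_zero h1)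
      exact ⟨_, H, A, m, B, 0, Nat.zero_le _, hGL, hsum, fun t ht => by
        linarith [norm_nonneg (DirichletCharacter.LFunction χ (1 / 2 + t * I))]⟩
  obtain ⟨f, H, A, m, B, e, he, hGL, hsum, hfL⟩ := key
  obtain ⟨X₀, C, hX₀, hC, hmain⟩ := hGL.exists_norm_le_exp hχ (e := (e : ℂ))
    (by rw [Complex.norm_natCast]; exact_mod_cast he) hsum
  refine ⟨X₀, C + Real.log 2, hX₀, by positivity, fun X hX => ?_⟩
  obtain ⟨a, b, ha, hb, hab⟩ := hmain X hX
  refine ⟨a, b, ha, hb, fun t ht hXt => (hfL t ht).trans ?_⟩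
  refine (mul_le_mul_of_nonneg_left (hab t ht hXt) zero_le_two).trans ?_
  nth_rewrite 1 [← Real.exp_log (zero_lt_two (α := ℝ))]
  rw [← Real.exp_add, Real.exp_le_exp]
  have h2 : 0 ≤ Real.log 2 * Real.log t / X :=
    div_nonneg (mul_nonneg (Real.log_nonneg (by norm_num)) (Real.log_nonneg (by linarith))) (by linarith)
  have h3 : (C + Real.log 2) * Real.log t / X = C * Real.log t / X + Real.log 2 * Real.log t / X := by ring
  linarith

end

/-- The Dirichlet polynomial `∑ a(p) p^{-iθt}` over a finite set of primes. -/
noncomputable def primePoly (S : Finset ℕ) (a : ℕ → ℂ) (θ t : ℝ) : ℂ :=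
  ∑ p ∈ S, a p * cexp ((-(θ * Real.log p) * t : ℝ) * I)

@[fun_prop]
lemma continuous_primePoly (S : Finset ℕ) (a : ℕ → ℂ) (θ : ℝ) : Continuous (primePoly S a θ) := by
  unfold primePoly
  fun_prop

lemma norm_primePoly_le (S : Finset ℕ) (a : ℕ → ℂ) (θ t : ℝ) : ‖primePoly S a θ t‖ ≤ ∑ p ∈ S, ‖a p‖ := by
  unfold primePoly
  refine (norm_sum_le _ _).trans (Finset.sum_le_sum fun p _ => ?_)
  rw [norm_mul, norm_exp_ofReal_mul_I, mul_one]

lemma integral_norm_primePoly_pow_le {S : Finset ℕ} (hS : ∀ p ∈ S, p.Prime) (a : ℕ → ℂ)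
    {θ x T : ℝ} (hθ : 1 ≤ θ) (hx : 1 ≤ x) (hT : 0 ≤ T) (hSx : ∀ p ∈ S, (p : ℝ) ≤ x)
    (hax : ∑ p ∈ S, ‖a p‖ ≤ x) (l : ℕ) :
    ∫ t in T..(2*T), ‖primePoly S a θ t‖ ^ (2 * l) ≤
      T * (l.factorial * (∑ p ∈ S, ‖a p‖ ^ 2) ^ l) + 2 * x ^ (3 * l) := by
  have h := integral_norm_sq_primePoly_le S hS a (fun r => if r = l then 1 else 0)
    (fun r => by positivity) hθ hx hT hSx l
  have hmem : l ∈ Finset.range (l + 1) := by simp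
  have e1 : ∀ D : ℂ, ∑ r ∈ Finset.range (l + 1), (((if r = l then 1 else 0 : ℝ)) : ℂ) * D ^ r = D ^ l := by
    intro D
    rw [Finset.sum_eq_single_of_mem l hmem (fun r _ hr => by simp [hr])]; simp
  have e2 : ∀ D : ℝ, ∑ r ∈ Finset.range (l + 1), (if r = l then 1 else 0 : ℝ) * D ^ r = D ^ l := by
    intro D
    rw [Finset.sum_eq_single_of_mem l hmem (fun r _ hr => by simp [hr])]; simp
  have e3 : ∀ D : ℝ, ∑ r ∈ Finset.range (l + 1), (if r = l then 1 else 0 : ℝ) ^ 2 * r.factorial * D ^ r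
      = l.factorial * D ^ l := by
    intro D
    rw [Finset.sum_eq_single_of_mem l hmem (fun r _ hr => by simp [hr])]; simp
  simp only [e1, e2, e3] at h
  have e4 : ∀ t : ℝ, ‖primePoly S a θ t‖ ^ (2 * l)
      = ‖(∑ p ∈ S, a p * cexp ((-(θ * Real.log p) * t : ℝ) * I)) ^ l‖ ^ 2 := by
    intro t; rw [primePoly, norm_pow, ← pow_mul, mul_comm]
  simp only [e4]
  refine h.trans (add_le_add le_rfl ?_)
  have h0 : 0 ≤ ∑ p ∈ S, ‖a p‖ := Finset.sum_nonneg fun _ _ => norm_nonneg _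
  calc 2 * x ^ l * ((∑ p ∈ S, ‖a p‖) ^ l) ^ 2 ≤ 2 * x ^ l * (x ^ l) ^ 2 := by
        refine mul_le_mul_of_nonneg_left ?_ (by positivity)
        exact pow_le_pow_left₀ (by positivity) (pow_le_pow_left₀ h0 hax _) _
    _ = 2 * x ^ (3 * l) := by ring

/-- The truncated exponential series. -/
noncomputable def truncExp (N : ℕ) (w : ℂ) : ℂ := ∑ r ∈ Finset.range (N + 1), w ^ r / r.factorial

@[fun_prop]
lemma continuous_truncExp (N : ℕ) : Continuous (truncExp N) := by
  unfold truncExp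
  fun_prop

lemma norm_exp_le_two_mul_norm_truncExp {N : ℕ} {w : ℂ} (hw : ‖w‖ ≤ N / 11) :
    ‖cexp w‖ ≤ 2 * ‖truncExp N w‖ := by
  set r := ‖w‖ with hr
  have hr0 : 0 ≤ r := norm_nonneg _
  have h1 := Complex.norm_exp_sub_sum_le_exp_norm_sub_sum w (N + 1)
  have hs : ∀ y : ℝ, HasSum (fun m : ℕ => y ^ m / m.factorial) (Real.exp y) := by
    intro y
    rw [Real.exp_eq_exp_ℝ]
    exact NormedSpace.expSeries_div_hasSum_exp y
  have hfin : HasSum (fun m : ℕ => if m ∈ Finset.range (N + 1) then r ^ m / m.factorial else 0)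
      (∑ m ∈ Finset.range (N + 1), r ^ m / m.factorial) := by
    have : HasSum (fun m : ℕ => if m ∈ Finset.range (N + 1) then r ^ m / m.factorial else 0)
        (∑ m ∈ Finset.range (N + 1), if m ∈ Finset.range (N + 1) then r ^ m / m.factorial else 0) :=
      hasSum_sum_of_ne_finset_zero fun m hm => by simp only [if_neg hm]
    rwa [Finset.sum_congr rfl fun m hm => if_pos hm] at this
  have h2 : Real.exp r ≤ (∑ m ∈ Finset.range (N + 1), r ^ m / m.factorial)
      + (1 / 10) ^ (N + 1) * Real.exp (10 * r) := by
    refine hasSum_le (fun m => ?_) (hs r) (hfin.add ((hs (10 * r)).mul_left ((1 / 10 : ℝ) ^ (N + 1))))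
    split_ifs with hm
    · exact le_add_of_nonneg_right (by positivity)
    · rw [zero_add]
      rw [Finset.mem_range, not_lt] at hm
      have : (1 : ℝ) ≤ (1 / 10) ^ (N + 1) * 10 ^ m := by
        rw [one_div, inv_pow, ← div_eq_inv_mul, one_le_div (by positivity)]
        exact pow_le_pow_right₀ (by norm_num) hm
      calc r ^ m / m.factorial ≤ ((1 / 10) ^ (N + 1) * 10 ^ m) * (r ^ m / m.factorial) :=
            le_mul_of_one_le_left (by positivity) this
        _ = _ := by rw [mul_pow]; ring
  have h3 : (1 / 10 : ℝ) ^ (N + 1) * Real.exp (10 * r) ≤ 1 / 2 * Real.exp (-r) := by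
    have h4 : Real.exp (10 * r) ≤ Real.exp 1 ^ (N + 1) * Real.exp (-r) := by
      rw [← Real.exp_nat_mul, ← Real.exp_add, Real.exp_le_exp]
      push_cast; linarith
    have h5 : (1 / 10 : ℝ) ^ (N + 1) * Real.exp 1 ^ (N + 1) ≤ 1 / 2 := by
      rw [← mul_pow]
      have he : 1 / 10 * Real.exp 1 ≤ 1 / 2 := by linarith [Real.exp_one_lt_d9]
      exact (pow_le_of_le_one (by positivity) (he.trans (by norm_num)) (Nat.succ_ne_zero N)).trans he
    calc (1 / 10 : ℝ) ^ (N + 1) * Real.exp (10 * r)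
        ≤ (1 / 10 : ℝ) ^ (N + 1) * (Real.exp 1 ^ (N + 1) * Real.exp (-r)) :=
          mul_le_mul_of_nonneg_left h4 (by positivity)
      _ = ((1 / 10 : ℝ) ^ (N + 1) * Real.exp 1 ^ (N + 1)) * Real.exp (-r) := by ring
      _ ≤ _ := mul_le_mul_of_nonneg_right h5 (Real.exp_pos _).le
  have h6 : Real.exp (-r) ≤ ‖cexp w‖ := by
    rw [Complex.norm_exp, Real.exp_le_exp]
    linarith [neg_le_of_abs_le (abs_re_le_norm w)]
  have h7 : ‖cexp w‖ ≤ ‖cexp w - truncExp N w‖ + ‖truncExp N w‖ := by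
    have := norm_add_le (cexp w - truncExp N w) (truncExp N w)
    rwa [sub_add_cancel] at this
  have h8 : ‖cexp w - truncExp N w‖ ≤ 1 / 2 * ‖cexp w‖ := by
    unfold truncExp
    linarith
  linarith

lemma integral_norm_truncExp_primePoly_le {S : Finset ℕ} (hS : ∀ p ∈ S, p.Prime) (a : ℕ → ℂ)
    {θ x T : ℝ} (hθ : 1 ≤ θ) (hx : 1 ≤ x) (hT : 0 ≤ T) (hSx : ∀ p ∈ S, (p : ℝ) ≤ x)
    (hax : ∑ p ∈ S, ‖a p‖ ≤ x) (N : ℕ) {κ : ℝ} (hκ : 0 ≤ κ) :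
    ∫ t in T..(2*T), ‖truncExp N (κ * primePoly S a θ t)‖ ^ 2 ≤
      T * Real.exp (κ ^ 2 * ∑ p ∈ S, ‖a p‖ ^ 2) + 2 * Real.exp κ ^ 2 * x ^ (3 * N) := by
  have h := integral_norm_sq_primePoly_le S hS a (fun r => κ ^ r / r.factorial)
    (fun r => by positivity) hθ hx hT hSx N
  have e1 : ∀ t : ℝ, truncExp N (κ * primePoly S a θ t) = ∑ r ∈ Finset.range (N + 1),
      ((κ ^ r / r.factorial : ℝ) : ℂ) * (∑ p ∈ S, a p * cexp ((-(θ * Real.log p) * t : ℝ) * I)) ^ r := by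
    intro t
    rw [truncExp]
    refine Finset.sum_congr rfl fun r _ => ?_
    rw [primePoly, mul_pow]; push_cast; ring
  simp only [e1]
  refine h.trans (add_le_add (mul_le_mul_of_nonneg_left ?_ hT) ?_)
  · have hq0 : 0 ≤ κ ^ 2 * ∑ p ∈ S, ‖a p‖ ^ 2 := mul_nonneg (by positivity)
      (Finset.sum_nonneg fun _ _ => by positivity)
    refine le_trans (le_of_eq (Finset.sum_congr rfl fun r _ => ?_)) (Real.sum_le_exp_of_nonneg hq0 (N + 1))
    have : (r.factorial : ℝ) ≠ 0 := by positivity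
    rw [mul_pow]
    field_simp
    ring
  · have h0 : 0 ≤ ∑ p ∈ S, ‖a p‖ := Finset.sum_nonneg fun _ _ => norm_nonneg _
    have h1 : ∑ r ∈ Finset.range (N + 1), κ ^ r / r.factorial * (∑ p ∈ S, ‖a p‖) ^ r ≤ Real.exp κ * x ^ N := by
      refine le_trans (Finset.sum_le_sum fun r hr => ?_) (le_of_eq_of_le
        (Finset.sum_mul (Finset.range (N + 1)) (fun r => κ ^ r / r.factorial) (x ^ N)).symm
        (mul_le_mul_of_nonneg_right (Real.sum_le_exp_of_nonneg hκ (N + 1)) (by positivity)))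
      refine mul_le_mul_of_nonneg_left ?_ (by positivity)
      exact (pow_le_pow_left₀ h0 hax r).trans
        (pow_le_pow_right₀ hx (Nat.lt_succ_iff.1 (Finset.mem_range.1 hr)))
    have h2 : 0 ≤ ∑ r ∈ Finset.range (N + 1), κ ^ r / r.factorial * (∑ p ∈ S, ‖a p‖) ^ r :=
      Finset.sum_nonneg fun r _ => by positivity
    calc 2 * x ^ N * (∑ r ∈ Finset.range (N + 1), κ ^ r / r.factorial * (∑ p ∈ S, ‖a p‖) ^ r) ^ 2
        ≤ 2 * x ^ N * (Real.exp κ * x ^ N) ^ 2 :=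
          mul_le_mul_of_nonneg_left (pow_le_pow_left₀ h2 h1 _) (by positivity)
      _ = _ := by ring

/-- A Chebyshev-type moment bound. -/
lemma integral_norm_primePoly_div_pow_le {S : Finset ℕ} (hS : ∀ p ∈ S, p.Prime) (a : ℕ → ℂ)
    {θ x T V W : ℝ} (hθ : 1 ≤ θ) (hx : 1 ≤ x) (hT : 1 ≤ T) (hSx : ∀ p ∈ S, (p : ℝ) ≤ x)
    (hax : ∑ p ∈ S, ‖a p‖ ≤ x) {l : ℕ} (hxl : x ^ (3 * l) ≤ T) (hV : 1 ≤ V)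
    (haV : ∑ p ∈ S, ‖a p‖ ^ 2 ≤ V) (hW : 0 < W) :
    ∫ t in T..(2*T), (‖primePoly S a θ t‖ / W) ^ (2 * l) ≤ 3 * T * (l * V / W ^ 2) ^ l := by
  have h := integral_norm_primePoly_pow_le hS a hθ hx (by linarith : 0 ≤ T) hSx hax l
  have e1 : ∀ t : ℝ, (‖primePoly S a θ t‖ / W) ^ (2 * l) = ‖primePoly S a θ t‖ ^ (2 * l) / W ^ (2 * l) :=
    fun t => div_pow _ _ _
  simp only [e1]
  rw [intervalIntegral.integral_div]
  have h0 : 0 ≤ ∑ p ∈ S, ‖a p‖ ^ 2 := Finset.sum_nonneg fun _ _ => by positivity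
  have hl1 : (1 : ℝ) ≤ (l : ℝ) ^ l := by
    rcases Nat.eq_zero_or_pos l with rfl | hl
    · simp
    · exact one_le_pow₀ (by exact_mod_cast hl)
  have hf : (l.factorial : ℝ) ≤ (l : ℝ) ^ l := by exact_mod_cast Nat.factorial_le_pow l
  have hVl : (∑ p ∈ S, ‖a p‖ ^ 2) ^ l ≤ V ^ l := pow_le_pow_left₀ h0 haV _
  have hV1 : 1 ≤ V ^ l := one_le_pow₀ hV
  have h1 : (l.factorial : ℝ) * (∑ p ∈ S, ‖a p‖ ^ 2) ^ l ≤ (l : ℝ) ^ l * V ^ l :=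
    mul_le_mul hf hVl (by positivity) (by positivity)
  have h2 : 1 ≤ (l : ℝ) ^ l * V ^ l := one_le_mul_of_one_le_of_one_le hl1 hV1
  have h3 : 2 * x ^ (3 * l) ≤ 2 * T * ((l : ℝ) ^ l * V ^ l) := by
    have : T * 1 ≤ T * ((l : ℝ) ^ l * V ^ l) := mul_le_mul_of_nonneg_left h2 (by linarith)
    linarith
  have h4 : T * (l.factorial * (∑ p ∈ S, ‖a p‖ ^ 2) ^ l) ≤ T * ((l : ℝ) ^ l * V ^ l) :=
    mul_le_mul_of_nonneg_left h1 (by linarith)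
  rw [div_le_iff₀ (by positivity)]
  have h5 : 3 * T * (l * V / W ^ 2) ^ l * W ^ (2 * l) = 3 * T * ((l : ℝ) ^ l * V ^ l) := by
    rw [pow_mul, div_pow, mul_pow]
    field_simp
  rw [h5]
  linarith

/-- A nonnegative function that is bounded, in terms of short Dirichlet polynomials over primes, in
the way `‖L(1/2 + it, χ)‖` is under GRH. -/
structure PrimeBound (g : ℝ → ℝ) (A : ℝ) (m : ℕ) (X₀ C : ℝ) : Prop where
  cont : Continuous g
  nonneg : ∀ t, 0 ≤ g t
  poly_pos : 0 < A
  poly : ∀ t, 3 ≤ t → g t ≤ A * t ^ m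
  one_le : 1 ≤ X₀
  pos : 0 < C
  bound : ∀ X : ℝ, X₀ ≤ X →
      ∃ a b : ℕ → ℂ, (∀ p : ℕ, p.Prime → ‖a p‖ ≤ (p : ℝ) ^ (-(1 / 2 : ℝ))) ∧
        (∀ p : ℕ, p.Prime → ‖b p‖ ≤ 1 / (2 * p : ℝ)) ∧ ∀ t : ℝ, 3 ≤ t → Real.exp X ≤ t ^ 2 →
        g t ≤ Real.exp ((primePoly (primesTo ⌊Real.exp X⌋₊) a 1 t).re +
          (primePoly (primesTo (Nat.sqrt ⌊Real.exp X⌋₊)) b 2 t).re + C * Real.log t / X + C)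

lemma card_primesTo_le (n : ℕ) : (primesTo n).card ≤ n := by
  have : primesTo n ⊆ Finset.Icc 1 n := fun p hp => by
    rw [mem_primesTo] at hp
    exact Finset.mem_Icc.2 ⟨hp.2.one_le, hp.1⟩
  simpa using Finset.card_le_card this

lemma sum_norm_le_of_norm_le_one {S : Finset ℕ} {n : ℕ} (hS : S ⊆ primesTo n) {a : ℕ → ℂ}
    (ha : ∀ p : ℕ, p.Prime → ‖a p‖ ≤ 1) : ∑ p ∈ S, ‖a p‖ ≤ n := by
  calc ∑ p ∈ S, ‖a p‖ ≤ ∑ p ∈ S, (1 : ℝ) :=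
        Finset.sum_le_sum fun p hp => ha p (mem_primesTo.1 (hS hp)).2
    _ = (S.card : ℝ) := by simp
    _ ≤ n := by exact_mod_cast (Finset.card_le_card hS).trans (card_primesTo_le n)

lemma norm_le_one_of_rpow {a : ℕ → ℂ} (ha : ∀ p : ℕ, p.Prime → ‖a p‖ ≤ (p : ℝ) ^ (-(1 / 2 : ℝ))) :
    ∀ p : ℕ, p.Prime → ‖a p‖ ≤ 1 := fun p hp => (ha p hp).trans
  (Real.rpow_le_one_of_one_le_of_nonpos (by exact_mod_cast hp.one_le) (by norm_num))

lemma norm_sq_le_inv {a : ℕ → ℂ} (ha : ∀ p : ℕ, p.Prime → ‖a p‖ ≤ (p : ℝ) ^ (-(1 / 2 : ℝ))) {p : ℕ}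
    (hp : p.Prime) : ‖a p‖ ^ 2 ≤ 1 / (p : ℝ) := by
  refine (pow_le_pow_left₀ (norm_nonneg _) (ha p hp) 2).trans (le_of_eq ?_)
  rw [← Real.rpow_natCast, ← Real.rpow_mul (by positivity),
    show -(1 / 2 : ℝ) * (2 : ℕ) = -1 by norm_num, Real.rpow_neg_one, one_div]

lemma two_le_floor_exp {X : ℝ} (hX : 1 ≤ X) : 2 ≤ ⌊Real.exp X⌋₊ := by
  refine Nat.le_floor ?_
  have := Real.add_one_le_exp X
  push_cast; linarith

lemma sum_inv_primesTo_floor_exp_le {X : ℝ} (hX : 1 ≤ X) :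
    ∑ p ∈ primesTo ⌊Real.exp X⌋₊, 1 / (p : ℝ) ≤ Real.log X + 5 := by
  have h2 := two_le_floor_exp hX
  refine (sum_inv_primesTo_le h2).trans ?_
  have h2' : (2 : ℝ) ≤ ⌊Real.exp X⌋₊ := by exact_mod_cast h2
  have h3 : Real.log ⌊Real.exp X⌋₊ ≤ X := by
    rw [Real.log_le_iff_le_exp (by linarith)]
    exact Nat.floor_le (Real.exp_pos _).le
  have h4 : 0 < Real.log ⌊Real.exp X⌋₊ := Real.log_pos (by linarith)
  linarith [Real.log_le_log h4 h3]

lemma sum_norm_sq_le_log {X : ℝ} (hX : 1 ≤ X) {a : ℕ → ℂ}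
    (ha : ∀ p : ℕ, p.Prime → ‖a p‖ ≤ (p : ℝ) ^ (-(1 / 2 : ℝ))) :
    ∑ p ∈ primesTo ⌊Real.exp X⌋₊, ‖a p‖ ^ 2 ≤ Real.log X + 5 :=
  (Finset.sum_le_sum fun _ hp => norm_sq_le_inv ha (mem_primesTo.1 hp).2).trans
    (sum_inv_primesTo_floor_exp_le hX)

lemma primesTo_sqrt_subset (n : ℕ) : primesTo (Nat.sqrt n) ⊆ primesTo n := fun p hp => by
  rw [mem_primesTo] at hp ⊢
  exact ⟨hp.1.trans (Nat.sqrt_le_self n), hp.2⟩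

lemma sum_norm_le_half_log {X : ℝ} (hX : 1 ≤ X) {b : ℕ → ℂ}
    (hb : ∀ p : ℕ, p.Prime → ‖b p‖ ≤ 1 / (2 * p : ℝ)) :
    ∑ p ∈ primesTo (Nat.sqrt ⌊Real.exp X⌋₊), ‖b p‖ ≤ (Real.log X + 5) / 2 := by
  calc ∑ p ∈ primesTo (Nat.sqrt ⌊Real.exp X⌋₊), ‖b p‖
      ≤ ∑ p ∈ primesTo ⌊Real.exp X⌋₊, ‖b p‖ :=
        Finset.sum_le_sum_of_subset_of_nonneg (primesTo_sqrt_subset _) fun _ _ _ => norm_nonneg _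
    _ ≤ ∑ p ∈ primesTo ⌊Real.exp X⌋₊, 1 / (p : ℝ) / 2 :=
        Finset.sum_le_sum fun p hp => (hb p (mem_primesTo.1 hp).2).trans (le_of_eq (by
          rw [div_div, mul_comm]))
    _ = (∑ p ∈ primesTo ⌊Real.exp X⌋₊, 1 / (p : ℝ)) / 2 := (Finset.sum_div _ _ _).symm
    _ ≤ _ := by have := sum_inv_primesTo_floor_exp_le hX; linarith

/-- Stopping-time decomposition: bound `g` by the value at the first good index. -/
lemma le_add_sum_of_first_good {g : ℝ} {n₀ N : ℕ} {E d : ℕ → ℝ} (hE : Monotone E) (hE0 : ∀ n, 0 ≤ E n)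
    (hd : ∀ n, 0 ≤ d n) (hgood : ∀ n, n₀ ≤ n → n ≤ N → d n ≤ 1 → g ≤ E n) (hN : g ≤ E (N + 1)) :
    g ≤ E n₀ + ∑ n ∈ Finset.Icc n₀ N, E (n + 1) * d n ^ (2 * n) := by
  have hterm : ∀ n, 0 ≤ E (n + 1) * d n ^ (2 * n) := fun n =>
    mul_nonneg (hE0 _) (pow_nonneg (hd n) _)
  have hsum : 0 ≤ ∑ n ∈ Finset.Icc n₀ N, E (n + 1) * d n ^ (2 * n) := Finset.sum_nonneg fun n _ => hterm n
  have hstep : ∀ n, n₀ ≤ n → n ≤ N → 1 < d n → g ≤ E (n + 1) →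
      g ≤ E n₀ + ∑ n ∈ Finset.Icc n₀ N, E (n + 1) * d n ^ (2 * n) := by
    intro n h1 h2 h3 h4
    have h5 := Finset.single_le_sum (f := fun n => E (n + 1) * d n ^ (2 * n)) (fun n _ => hterm n)
      (Finset.mem_Icc.2 ⟨h1, h2⟩)
    have h6 : E (n + 1) * 1 ≤ E (n + 1) * d n ^ (2 * n) :=
      mul_le_mul_of_nonneg_left (one_le_pow₀ h3.le) (hE0 _)
    linarith [hE0 n₀]
  by_cases hex : ∃ n, n₀ ≤ n ∧ n ≤ N ∧ d n ≤ 1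
  · have hfind := Nat.find_spec hex
    set n := Nat.find hex with hn
    rcases Nat.eq_or_lt_of_le hfind.1 with h1 | h1
    · have := hgood n hfind.1 hfind.2.1 hfind.2.2
      rw [← h1] at this
      linarith
    · obtain ⟨j, hj⟩ : ∃ j, n = j + 1 := ⟨n - 1, by omega⟩
      have h2 := Nat.find_min hex (m := j) (by omega)
      refine hstep j (by omega) (by omega) ?_ (hj ▸ hgood n hfind.1 hfind.2.1 hfind.2.2)
      by_contra hcon
      exact h2 ⟨by omega, by omega, not_lt.1 hcon⟩
  · push Not at hex
    rcases Nat.lt_or_ge N n₀ with h1 | h1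
    · have := hE (show N + 1 ≤ n₀ by omega)
      linarith
    · exact hstep N h1 le_rfl (hex N h1 le_rfl) hN

/-- A crude bound for all moments. -/
theorem PrimeBound.exists_moment_le {g : ℝ → ℝ} {A : ℝ} {m : ℕ} {X₀ C : ℝ} (h : PrimeBound g A m X₀ C)
    (k : ℕ) : ∃ B : ℝ, 0 < B ∧ ∀ᶠ T : ℝ in atTop,
      ∫ t in T..(2*T), g t ^ (2 * k) ≤ T * Real.exp (B * Real.log (Real.log T)) := by
  have hbound := h.bound
  have hC := h.pos
  have hX₀ := h.one_le
  choose! a b ha hb hab using hbound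
  obtain ⟨K', hK'⟩ : ∃ K', K' = 4 + 13 * C + 6 * X₀ * (|Real.log A| + 2 * m) := ⟨_, rfl⟩
  have hK'0 : 0 < K' := by
    have : 0 ≤ 6 * X₀ * (|Real.log A| + 2 * m) := by positivity
    linarith
  have hK'1 : 4 + 13 * C ≤ K' := by
    have : 0 ≤ 6 * X₀ * (|Real.log A| + 2 * m) := by positivity
    linarith
  have hK'2 : 6 * X₀ * (|Real.log A| + 2 * m) ≤ K' := by linarith
  obtain ⟨w, hw⟩ : ∃ w, w = 2 * k * K' := ⟨_, rfl⟩
  have hw0 : 0 ≤ w := by rw [hw]; positivity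
  obtain ⟨K, hK⟩ : ∃ K, K = 12 * Real.exp w := ⟨_, rfl⟩
  have hK0 : 12 ≤ K := by
    have := Real.one_le_exp hw0
    linarith
  refine ⟨w * K + Real.log 7 + w, by positivity, ?_⟩
  have hLL : Tendsto (fun T : ℝ => Real.log (Real.log T)) atTop atTop :=
    Real.tendsto_log_atTop.comp Real.tendsto_log_atTop
  filter_upwards [eventually_ge_atTop (3 : ℝ), Real.tendsto_log_atTop.eventually_ge_atTop (1 : ℝ),
    hLL.eventually_ge_atTop (1 : ℝ)] with T hT3 hlogT hM
  set Lg := Real.log T with hLg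
  set M := Real.log Lg with hMdef
  set N := ⌊Lg / (6 * X₀)⌋₊ with hN
  set n₀ := ⌈K * M⌉₊ with hn₀
  have hT0 : 0 < T := by linarith
  set X : ℕ → ℝ := fun n => Lg / (6 * n) with hX
  set D : ℕ → ℝ → ℂ := fun n => primePoly (primesTo ⌊Real.exp (X n)⌋₊) (a (X n)) 1 with hD
  have hn₀K : ∀ n : ℕ, n₀ ≤ n → K * M ≤ n := fun n hn => (Nat.le_ceil _).trans (by exact_mod_cast hn)
  have hKM : M ≤ K * M := by nlinarith
  have hnN : ∀ n : ℕ, n₀ ≤ n → n ≤ N → X₀ ≤ X n ∧ X n ≤ Lg / 6 ∧ (1 : ℝ) ≤ n := by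
    intro n h1 h2
    have hn1 : (1 : ℝ) ≤ n := by linarith [hn₀K n h1]
    refine ⟨?_, ?_, hn1⟩
    · have h3 : (n : ℝ) ≤ Lg / (6 * X₀) := (Nat.le_floor_iff (by positivity)).1 h2
      rw [hX]; simp only
      rw [le_div_iff₀ (by positivity)] at h3 ⊢
      linarith
    · rw [hX]; simp only
      exact div_le_div_of_nonneg_left (by linarith) (by norm_num) (by linarith)
  have hlogt : ∀ t ∈ Set.Icc T (2 * T), Real.log t ≤ 2 * Lg := by
    intro t ht
    have h1 : Real.log t ≤ Real.log (T ^ 2) := Real.log_le_log (by linarith [ht.1])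
      (ht.2.trans (by rw [sq]; exact mul_le_mul_of_nonneg_right (by linarith) hT0.le))
    rwa [Real.log_pow] at h1
  have hlogX : ∀ n : ℕ, n₀ ≤ n → n ≤ N → Real.log (X n) ≤ M := by
    intro n h1 h2
    obtain ⟨h3, h4, h5⟩ := hnN n h1 h2
    exact Real.log_le_log (by linarith) (by linarith)
  have hexpL : Real.exp Lg = T := Real.exp_log hT0
  have hpt : ∀ t ∈ Set.Icc T (2 * T), g t ^ (2 * k) ≤ Real.exp (w * n₀) + ∑ n ∈ Finset.Icc n₀ N,
      Real.exp (w * (n + 1 : ℕ)) * (‖D n t‖ / n) ^ (2 * n) := by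
    intro t ht
    have ht3 : 3 ≤ t := hT3.trans ht.1
    have hpow : ∀ n : ℕ, g t ≤ Real.exp (K' * n) → g t ^ (2 * k) ≤ Real.exp (w * n) := by
      intro n hn
      refine (pow_le_pow_left₀ (h.nonneg t) hn (2 * k)).trans (le_of_eq ?_)
      rw [← Real.exp_nat_mul, hw]; push_cast; ring_nf
    refine le_add_sum_of_first_good (E := fun n : ℕ => Real.exp (w * n)) (d := fun n => ‖D n t‖ / n)
      (fun i j hij => Real.exp_le_exp.2 (mul_le_mul_of_nonneg_left (by exact_mod_cast hij) hw0))
      (fun n => (Real.exp_pos _).le) (fun n => by positivity) (fun n h1 h2 h3 => hpow n ?_) (hpow (N + 1) ?_)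
    · obtain ⟨h4, h5, h6⟩ := hnN n h1 h2
      have hXt : Real.exp (X n) ≤ t ^ 2 := by
        have : Real.exp (X n) ≤ T := by rw [← hexpL, Real.exp_le_exp]; linarith
        nlinarith [ht.1]
      refine (hab (X n) h4 t ht3 hXt).trans (Real.exp_le_exp.2 ?_)
      have hre1 : (primePoly (primesTo ⌊Real.exp (X n)⌋₊) (a (X n)) 1 t).re ≤ n := by
        refine (re_le_norm _).trans ?_
        rwa [div_le_one (by linarith)] at h3
      have hre2 : (primePoly (primesTo (Nat.sqrt ⌊Real.exp (X n)⌋₊)) (b (X n)) 2 t).re ≤ (M + 5) / 2 := by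
        refine (re_le_norm _).trans ((norm_primePoly_le _ _ _ _).trans
          ((sum_norm_le_half_log (hX₀.trans h4) (hb _ h4)).trans ?_))
        linarith [hlogX n h1 h2]
      have hcl : C * Real.log t / X n ≤ 12 * C * n := by
        rw [div_le_iff₀ (by linarith)]
        have : X n * (6 * n) = Lg := div_mul_cancel₀ _ (by positivity)
        have h7 := mul_le_mul_of_nonneg_left (hlogt t ht) hC.le
        nlinarith
      have hMn : M ≤ n := hKM.trans (hn₀K n h1)
      have h8 : (4 + 13 * C) * n ≤ K' * n := mul_le_mul_of_nonneg_right hK'1 (by linarith)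
      have h9 : C * 1 ≤ C * n := mul_le_mul_of_nonneg_left h6 hC.le
      linarith
    · refine (h.poly t ht3).trans ?_
      have h1 : A * t ^ m ≤ Real.exp (Real.log A + m * (2 * Lg)) := by
        rw [Real.exp_add, Real.exp_log h.poly_pos, Real.exp_nat_mul]
        refine mul_le_mul_of_nonneg_left (pow_le_pow_left₀ (by linarith) ?_ _) h.poly_pos.le
        rw [← Real.log_le_iff_le_exp (by linarith)]
        exact hlogt t ht
      refine h1.trans (Real.exp_le_exp.2 ?_)
      have h2 : Lg ≤ 6 * X₀ * ((N + 1 : ℕ) : ℝ) := by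
        have := (Nat.lt_floor_add_one (Lg / (6 * X₀))).le
        rw [div_le_iff₀ (by positivity)] at this
        push_cast; linarith
      have h3 : Real.log A ≤ |Real.log A| * Lg :=
        (le_abs_self _).trans (le_mul_of_one_le_right (abs_nonneg _) hlogT)
      have h4 : (|Real.log A| + 2 * m) * Lg ≤ (|Real.log A| + 2 * m) * (6 * X₀ * ((N + 1 : ℕ) : ℝ)) :=
        mul_le_mul_of_nonneg_left h2 (by positivity)
      have h5 : 6 * X₀ * (|Real.log A| + 2 * m) * ((N + 1 : ℕ) : ℝ) ≤ K' * ((N + 1 : ℕ) : ℝ) :=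
        mul_le_mul_of_nonneg_right hK'2 (by positivity)
      linarith
  have hint : ∀ n ∈ Finset.Icc n₀ N, ∫ t in T..(2*T), (‖D n t‖ / n) ^ (2 * n) ≤ 3 * T * (6 / K) ^ n := by
    intro n hn
    obtain ⟨h1, h2⟩ := Finset.mem_Icc.1 hn
    obtain ⟨h4, h5, h6⟩ := hnN n h1 h2
    have hX1 : 1 ≤ X n := hX₀.trans h4
    have hfl : ((⌊Real.exp (X n)⌋₊ : ℕ) : ℝ) ≤ Real.exp (X n) := Nat.floor_le (Real.exp_pos _).le
    have h7 := integral_norm_primePoly_div_pow_le (S := primesTo ⌊Real.exp (X n)⌋₊)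
      (fun p hp => (mem_primesTo.1 hp).2) (a (X n)) (θ := 1) (x := Real.exp (X n)) (T := T) (V := M + 5)
      (W := n) (l := n) le_rfl (Real.one_le_exp (by linarith)) (by linarith)
      (fun p hp => le_trans (by exact_mod_cast (mem_primesTo.1 hp).1) hfl)
      ((sum_norm_le_of_norm_le_one subset_rfl (norm_le_one_of_rpow (ha _ h4))).trans hfl) (by
        rw [← Real.exp_nat_mul, ← hexpL, Real.exp_le_exp]
        have : X n * (6 * n) = Lg := div_mul_cancel₀ _ (by positivity)
        push_cast; linarith) (by linarith)
      ((sum_norm_sq_le_log hX1 (ha _ h4)).trans (by linarith [hlogX n h1 h2])) (by linarith)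
    refine h7.trans (mul_le_mul_of_nonneg_left (pow_le_pow_left₀ (by positivity) ?_ _) (by linarith))
    have h8 := hn₀K n h1
    rw [div_le_div_iff₀ (by positivity) (by linarith)]
    have h9 : K * M * n ≤ (n : ℝ) * n := mul_le_mul_of_nonneg_right h8 (by linarith)
    have h10 : (M + 5) * (n * K) ≤ (6 * M) * (n * K) := mul_le_mul_of_nonneg_right (by linarith) (by positivity)
    nlinarith
  have hDc : ∀ n, Continuous (D n) := fun n => by rw [hD]; fun_prop
  have hgc := h.cont
  calc ∫ t in T..(2*T), g t ^ (2 * k)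
      ≤ ∫ t in T..(2*T), (Real.exp (w * n₀) + ∑ n ∈ Finset.Icc n₀ N,
        Real.exp (w * (n + 1 : ℕ)) * (‖D n t‖ / n) ^ (2 * n)) := by
        refine intervalIntegral.integral_mono_on (by linarith) (Continuous.intervalIntegrable (by fun_prop) _ _)
          (Continuous.intervalIntegrable (by fun_prop) _ _) hpt
    _ = T * Real.exp (w * n₀) + ∑ n ∈ Finset.Icc n₀ N, Real.exp (w * (n + 1 : ℕ)) *
        ∫ t in T..(2*T), (‖D n t‖ / n) ^ (2 * n) := by
        rw [intervalIntegral.integral_add (Continuous.intervalIntegrable (by fun_prop) _ _)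
          (Continuous.intervalIntegrable (by fun_prop) _ _),
          intervalIntegral.integral_finsetSum (fun n _ => Continuous.intervalIntegrable (by fun_prop) _ _)]
        simp only [intervalIntegral.integral_const, intervalIntegral.integral_const_mul, smul_eq_mul]
        ring
    _ ≤ T * Real.exp (w * n₀) + ∑ n ∈ Finset.Icc n₀ N, 3 * T * Real.exp w * (1 / 2) ^ n := by
        refine add_le_add le_rfl (Finset.sum_le_sum fun n hn => ?_)
        refine (mul_le_mul_of_nonneg_left (hint n hn) (Real.exp_pos _).le).trans (le_of_eq ?_)
        have h1 : Real.exp (w * (n + 1 : ℕ)) = Real.exp w * Real.exp w ^ n := by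
          rw [← Real.exp_nat_mul, ← Real.exp_add]; push_cast; ring_nf
        have h2 : (1 / 2 : ℝ) = Real.exp w * (6 / K) := by
          rw [hK]
          have := (Real.exp_pos w).ne'
          field_simp; norm_num
        rw [h1, h2, mul_pow]; ring
    _ ≤ T * Real.exp (w * n₀) + 3 * T * Real.exp w * 2 := by
        rw [← Finset.mul_sum]
        refine add_le_add le_rfl (mul_le_mul_of_nonneg_left ?_ (by positivity))
        have h1 := (summable_geometric_two).sum_le_tsum (Finset.Icc n₀ N) (fun n _ => by positivity)
        rwa [tsum_geometric_two] at h1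
    _ ≤ T * Real.exp ((w * K + Real.log 7 + w) * M) := by
        have h1 : Real.exp (w * n₀) ≤ Real.exp (w * K * M) * Real.exp w := by
          rw [← Real.exp_add, Real.exp_le_exp]
          have h2 := (Nat.ceil_lt_add_one (show 0 ≤ K * M by positivity)).le
          have h3 := mul_le_mul_of_nonneg_left h2 hw0
          linarith
        have h2 : 1 ≤ Real.exp (w * K * M) := Real.one_le_exp (by positivity)
        have h3 : Real.exp w ≤ Real.exp (w * K * M) * Real.exp w :=
          le_mul_of_one_le_left (Real.exp_pos _).le h2
        have h4 : 7 * (Real.exp (w * K * M) * Real.exp w) ≤ Real.exp ((w * K + Real.log 7 + w) * M) := by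
          nth_rewrite 1 [← Real.exp_log (show (0 : ℝ) < 7 by norm_num)]
          rw [← Real.exp_add, ← Real.exp_add, Real.exp_le_exp]
          have h5 : Real.log 7 * 1 ≤ Real.log 7 * M := mul_le_mul_of_nonneg_left hM (Real.log_nonneg (by norm_num))
          have h6 : w * 1 ≤ w * M := mul_le_mul_of_nonneg_left hM hw0
          linarith
        have h5 := mul_le_mul_of_nonneg_left (show Real.exp (w * n₀) + 6 * Real.exp w
          ≤ Real.exp ((w * K + Real.log 7 + w) * M) by linarith) hT0.le
        linarith

lemma sum_norm_sq_filter_le {X Y : ℝ} (hX : 1 ≤ X) (hY : 0 < Y) {a : ℕ → ℂ}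
    (ha : ∀ p : ℕ, p.Prime → ‖a p‖ ≤ (p : ℝ) ^ (-(1 / 2 : ℝ))) :
    ∑ p ∈ (primesTo ⌊Real.exp X⌋₊).filter (fun p : ℕ => Real.exp Y < p), ‖a p‖ ^ 2 ≤ (X + 2) / Y := by
  have h2 := two_le_floor_exp hX
  have h1 := sum_inv_primesTo_filter_le (n := ⌊Real.exp X⌋₊) (z := Real.exp Y) (by omega)
    (Real.one_lt_exp_iff.2 hY)
  refine (Finset.sum_le_sum fun p hp => norm_sq_le_inv ha
    (mem_primesTo.1 (Finset.mem_filter.1 hp).1).2).trans (h1.trans ?_)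
  rw [Real.log_exp]
  refine div_le_div_of_nonneg_right (add_le_add ?_ ?_) hY.le
  · rw [Real.log_le_iff_le_exp (by positivity)]
    exact Nat.floor_le (Real.exp_pos _).le
  · rw [show (4 : ℝ) = 2 ^ 2 by norm_num, Real.log_pow]
    have := Real.log_two_lt_d9
    push_cast; linarith

lemma sum_norm_sq_le_one {n : ℕ} {b : ℕ → ℂ} (hb : ∀ p : ℕ, p.Prime → ‖b p‖ ≤ 1 / (2 * p : ℝ)) :
    ∑ p ∈ primesTo n, ‖b p‖ ^ 2 ≤ 1 := by
  have h := sum_inv_sq_le (s := primesTo n) (m := 1) le_rfl fun p hp => (mem_primesTo.1 hp).2.one_lt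
  refine (Finset.sum_le_sum fun p hp => ?_).trans (h.trans (by norm_num))
  have hp0 : (0 : ℝ) < p := by exact_mod_cast (mem_primesTo.1 hp).2.pos
  rw [← one_div_pow]
  refine pow_le_pow_left₀ (norm_nonneg _) ((hb p (mem_primesTo.1 hp).2).trans ?_) 2
  exact one_div_le_one_div_of_le hp0 (by linarith)

lemma norm_le_one_of_le_inv {b : ℕ → ℂ} (hb : ∀ p : ℕ, p.Prime → ‖b p‖ ≤ 1 / (2 * p : ℝ)) :
    ∀ p : ℕ, p.Prime → ‖b p‖ ≤ 1 := fun p hp => (hb p hp).trans <| by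
  have hp0 : (1 : ℝ) ≤ p := by exact_mod_cast hp.one_le
  rw [div_le_one (by linarith)]
  linarith

lemma primePoly_filter_add (S : Finset ℕ) (P : ℕ → Prop) (a : ℕ → ℂ) (θ t : ℝ) :
    primePoly (S.filter P) a θ t + primePoly (S.filter fun p => ¬ P p) a θ t = primePoly S a θ t :=
  Finset.sum_filter_add_sum_filter_not _ _ _

lemma pow_le_exp_neg {r K A : ℝ} {l : ℕ} (hr0 : 0 ≤ r) (hr : r ≤ Real.exp (-K)) (h : A ≤ K * l) :
    r ^ l ≤ Real.exp (-A) := by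
  refine (pow_le_pow_left₀ hr0 hr l).trans ?_
  rw [← Real.exp_nat_mul, Real.exp_le_exp]
  linarith

lemma le_mul_sq_add_inv {y c : ℝ} (hc : 0 < c) : y ≤ c * y ^ 2 + c⁻¹ := by
  have h1 : c * c⁻¹ = 1 := mul_inv_cancel₀ hc.ne'
  have h2 : 0 < c⁻¹ := inv_pos.2 hc
  have h3 : 0 ≤ c⁻¹ * (c * y - 1) ^ 2 := by positivity
  have h4 : c⁻¹ * (c * y - 1) ^ 2 = (c * c⁻¹) * (c * y ^ 2) - 2 * (c * c⁻¹) * y + c⁻¹ := by ring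
  rw [h4, h1] at h3
  nlinarith [mul_nonneg hc.le (sq_nonneg y)]

/-- Splitting according to whether all three quantities `u i` are small. -/
lemma le_add_of_good {y main c u v w : ℝ} {l l' : ℕ} (hc : 0 < c) (hmain : 0 ≤ main) (hu : 0 ≤ u)
    (hv : 0 ≤ v) (hw : 0 ≤ w) (h : u ≤ 1 → v ≤ 1 → w ≤ 1 → y ≤ main) :
    y ≤ main + (c * y ^ 2 + c⁻¹ * (u ^ (2 * l) + v ^ (2 * l) + w ^ (2 * l'))) := by
  have hc' : 0 < c⁻¹ := inv_pos.2 hc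
  have hy : 0 ≤ c * y ^ 2 := by positivity
  have h1 : 0 ≤ u ^ (2 * l) := pow_nonneg hu _
  have h2 : 0 ≤ v ^ (2 * l) := pow_nonneg hv _
  have h3 : 0 ≤ w ^ (2 * l') := pow_nonneg hw _
  have h4 : 0 ≤ c⁻¹ * (u ^ (2 * l) + v ^ (2 * l) + w ^ (2 * l')) := by positivity
  by_cases hgood : u ≤ 1 ∧ v ≤ 1 ∧ w ≤ 1
  · linarith [h hgood.1 hgood.2.1 hgood.2.2]
  · have h5 : 1 ≤ u ^ (2 * l) + v ^ (2 * l) + w ^ (2 * l') := by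
      by_contra hcon
      refine hgood ⟨?_, ?_, ?_⟩ <;> by_contra hlt
      · linarith [one_le_pow₀ (n := 2 * l) (not_le.1 hlt).le]
      · linarith [one_le_pow₀ (n := 2 * l) (not_le.1 hlt).le]
      · linarith [one_le_pow₀ (n := 2 * l') (not_le.1 hlt).le]
    have h6 := mul_le_mul_of_nonneg_left h5 hc'.le
    linarith [le_mul_sq_add_inv (y := y) hc]

set_option maxHeartbeats 1000000 in
/-- The moment bound, sharp up to `ε` in the exponent. -/
theorem PrimeBound.exists_moment_le_rpow {g : ℝ → ℝ} {A : ℝ} {m : ℕ} {X₀ C : ℝ}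
    (h : PrimeBound g A m X₀ C) {k : ℕ} (hk : 1 ≤ k) {ε : ℝ} (hε : 0 < ε) :
    ∃ K : ℝ, 0 < K ∧ ∀ᶠ T : ℝ in atTop,
      ∫ t in T..(2*T), g t ^ (2 * k) ≤ K * T * Real.log T ^ ((k : ℝ) ^ 2 + ε) := by
  obtain ⟨B, hB, hmom⟩ := h.exists_moment_le (2 * k)
  have hC := h.pos
  have hk1 : (1 : ℝ) ≤ k := by exact_mod_cast hk
  obtain ⟨δ, hδ⟩ : ∃ δ, δ = ε / (6 * k) := ⟨_, rfl⟩
  have hδ0 : 0 < δ := by rw [hδ]; positivity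
  have hδε : 2 * k * (3 * δ) = ε := by rw [hδ]; field_simp; norm_num
  obtain ⟨β, hβ⟩ : ∃ β, β = 2 * C / δ := ⟨_, rfl⟩
  have hβ0 : 0 < β := by rw [hβ]; positivity
  have hβδ : 2 * C = δ * β := by rw [hβ]; field_simp
  obtain ⟨b, hb⟩ : ∃ b, b = 18 * (B + 1) := ⟨_, rfl⟩
  have hb0 : 0 < b := by rw [hb]; positivity
  obtain ⟨c, hc⟩ : ∃ c, c = 3 * (B + 1) + 3 * (11 * k * b + 1) := ⟨_, rfl⟩
  have hkb : 0 < 11 * k * b := by positivity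
  have hc0 : 0 < c := by rw [hc]; positivity
  have hc1 : 3 * (B + 1) ≤ c := by rw [hc]; linarith
  have hc2 : 3 * (11 * k * b + 1) ≤ c := by rw [hc]; linarith
  obtain ⟨V, hV⟩ : ∃ V, V = (β + 2) * c := ⟨_, rfl⟩
  have hV1 : 1 ≤ V := by rw [hV]; nlinarith
  refine ⟨4 * Real.exp (2 * k * C) * (Real.exp (5 * k ^ 2) + 2 * Real.exp k ^ 2) + 1 + 9, by positivity, ?_⟩
  have hLL : Tendsto (fun T : ℝ => Real.log (Real.log T)) atTop atTop :=
    Real.tendsto_log_atTop.comp Real.tendsto_log_atTop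
  have hsmall : ∀ r : ℝ, 0 < r → ∀ᶠ T : ℝ in atTop, r * Real.log (Real.log T) ≤ Real.log T := by
    intro r hr
    have h1 := (Real.isLittleO_log_id_atTop.comp_tendsto Real.tendsto_log_atTop).def (inv_pos.2 hr)
    filter_upwards [h1, Real.tendsto_log_atTop.eventually_ge_atTop (1 : ℝ)] with T hT hT1
    simp only [Function.comp, id, Real.norm_eq_abs] at hT
    rw [abs_of_nonneg (by linarith : 0 ≤ Real.log T)] at hT
    have h2 := mul_le_mul_of_nonneg_left ((le_abs_self _).trans hT) hr.le
    rwa [mul_inv_cancel_left₀ hr.ne'] at h2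
  filter_upwards [hmom, eventually_ge_atTop (3 : ℝ), Real.tendsto_log_atTop.eventually_ge_atTop (1 : ℝ),
    hLL.eventually_ge_atTop (1 : ℝ), hLL.eventually_ge_atTop β, hLL.eventually_ge_atTop (6 * β),
    hLL.eventually_ge_atTop (V * Real.exp (6 * β * B) / (3 * β * δ ^ 2)), hsmall (X₀ / β)
    (div_pos (by linarith [h.one_le]) hβ0), hsmall c hc0, hsmall 1 one_pos]
    with T hmomT hT3 hlogT hM1 hMβ hM6 hMV hX₀M hcM hML
  set Lg := Real.log T with hLg
  set M := Real.log Lg with hMdef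
  have hT0 : 0 < T := by linarith
  have hexpL : Real.exp Lg = T := Real.exp_log hT0
  have hM0 : 0 < M := by linarith
  obtain ⟨X, hX⟩ : ∃ X, X = β * Lg / M := ⟨_, rfl⟩
  obtain ⟨Y, hY⟩ : ∃ Y, Y = Lg / (c * M) := ⟨_, rfl⟩
  have hXM : X * M = β * Lg := by rw [hX]; field_simp
  have hYM : Y * (c * M) = Lg := by rw [hY]; field_simp
  have hX₀X : X₀ ≤ X := by
    rw [hX, le_div_iff₀ hM0]
    rw [div_mul_eq_mul_div, div_le_iff₀ hβ0] at hX₀M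
    linarith
  have hX1 : 1 ≤ X := h.one_le.trans hX₀X
  have hXL : X ≤ Lg := by
    rw [hX, div_le_iff₀ hM0, mul_comm]
    exact mul_le_mul_of_nonneg_left hMβ (by linarith)
  have hY1 : 1 ≤ Y := by
    rw [hY, le_div_iff₀ (by positivity)]
    linarith
  have hYL : Real.log Y ≤ M := by
    refine Real.log_le_log (by linarith) ?_
    rw [hY, div_le_iff₀ (by positivity)]
    have h1 : 1 ≤ c * M := one_le_mul_of_one_le_of_one_le (by linarith) hM1
    exact le_mul_of_one_le_right (by linarith) h1
  obtain ⟨a, b', ha, hb', hab⟩ := h.bound X hX₀X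
  set P := primesTo ⌊Real.exp X⌋₊ with hP
  set Q : ℝ → ℂ := primePoly (P.filter fun p : ℕ => Real.exp Y < p) a 1 with hQ
  set D : ℝ → ℂ := primePoly (P.filter fun p : ℕ => ¬ Real.exp Y < p) a 1 with hD
  set R : ℝ → ℂ := primePoly (primesTo (Nat.sqrt ⌊Real.exp X⌋₊)) b' 2 with hR
  have hQc : Continuous Q := by rw [hQ]; fun_prop
  have hDc : Continuous D := by rw [hD]; fun_prop
  have hRc : Continuous R := by rw [hR]; fun_prop
  have hgc := h.cont
  obtain ⟨l, hl⟩ : ∃ l, l = ⌊M / (3 * β)⌋₊ := ⟨_, rfl⟩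
  obtain ⟨l', hl'⟩ : ∃ l', l' = ⌈B * M⌉₊ := ⟨_, rfl⟩
  obtain ⟨N, hN⟩ : ∃ N, N = ⌈11 * k * b * M⌉₊ := ⟨_, rfl⟩
  have hl1 : (l : ℝ) ≤ M / (3 * β) := by rw [hl]; exact Nat.floor_le (by positivity)
  have hl2 : M ≤ 6 * β * l := by
    have h1 := Nat.lt_floor_add_one (M / (3 * β))
    rw [← hl, div_lt_iff₀ (by positivity)] at h1
    linarith
  have hl'1 : B * M ≤ l' := by rw [hl']; exact Nat.le_ceil _
  have hl'2 : (l' : ℝ) ≤ (B + 1) * M := by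
    have := (Nat.ceil_lt_add_one (show 0 ≤ B * M by positivity)).le
    rw [← hl'] at this
    linarith
  have hN1 : 11 * k * b * M ≤ N := by rw [hN]; exact Nat.le_ceil _
  have hN2 : (N : ℝ) ≤ (11 * k * b + 1) * M := by
    have := (Nat.ceil_lt_add_one (show 0 ≤ 11 * k * b * M by positivity)).le
    rw [← hN] at this
    linarith
  have hxT : Real.exp X ^ (3 * l) ≤ T := by
    rw [← Real.exp_nat_mul, ← hexpL, Real.exp_le_exp]
    rw [le_div_iff₀ (by positivity)] at hl1
    have h1 := mul_le_mul_of_nonneg_left hl1 (by linarith : 0 ≤ X)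
    rw [hXM] at h1
    push_cast
    refine le_of_mul_le_mul_right ?_ hβ0
    linarith
  have hzT : ∀ n : ℕ, 3 * (n : ℝ) ≤ c * M → Real.exp Y ^ (3 * n) ≤ T := by
    intro n hn
    rw [← Real.exp_nat_mul, ← hexpL, Real.exp_le_exp, ← hYM]
    push_cast
    rw [mul_comm]
    exact mul_le_mul_of_nonneg_left hn (by linarith)
  have hzl' : Real.exp Y ^ (3 * l') ≤ T := hzT l' (by
    have := mul_le_mul_of_nonneg_right hc1 hM0.le
    linarith)
  have hzN : Real.exp Y ^ (3 * N) ≤ T := hzT N (by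
    have := mul_le_mul_of_nonneg_right hc2 hM0.le
    linarith)
  have hfl : ((⌊Real.exp X⌋₊ : ℕ) : ℝ) ≤ Real.exp X := Nat.floor_le (Real.exp_pos _).le
  have hflY : ((⌊Real.exp Y⌋₊ : ℕ) : ℝ) ≤ Real.exp Y := Nat.floor_le (Real.exp_pos _).le
  have hPle : ∀ p ∈ P, (p : ℝ) ≤ Real.exp X := fun p hp =>
    le_trans (by exact_mod_cast (mem_primesTo.1 hp).1) hfl
  have hsub : (P.filter fun p : ℕ => ¬ Real.exp Y < p) ⊆ primesTo ⌊Real.exp Y⌋₊ := fun p hp => by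
    rw [Finset.mem_filter] at hp
    exact mem_primesTo.2 ⟨Nat.le_floor (not_lt.1 hp.2), (mem_primesTo.1 hp.1).2⟩
  have hDp : ∀ p ∈ P.filter (fun p : ℕ => ¬ Real.exp Y < p), p.Prime := fun p hp =>
    (mem_primesTo.1 (hsub hp)).2
  have hDle : ∀ p ∈ P.filter (fun p : ℕ => ¬ Real.exp Y < p), (p : ℝ) ≤ Real.exp Y := fun p hp =>
    not_lt.1 (Finset.mem_filter.1 hp).2
  have hDsum : ∑ p ∈ P.filter (fun p : ℕ => ¬ Real.exp Y < p), ‖a p‖ ≤ Real.exp Y :=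
    (sum_norm_le_of_norm_le_one hsub (norm_le_one_of_rpow ha)).trans hflY
  have hDvar : ∑ p ∈ P.filter (fun p : ℕ => ¬ Real.exp Y < p), ‖a p‖ ^ 2 ≤ M + 5 :=
    (Finset.sum_le_sum_of_subset_of_nonneg hsub fun _ _ _ => by positivity).trans
      ((sum_norm_sq_le_log hY1 ha).trans (by linarith))
  have hQvar : ∑ p ∈ P.filter (fun p : ℕ => Real.exp Y < p), ‖a p‖ ^ 2 ≤ V := by
    refine (sum_norm_sq_filter_le hX1 (by linarith) ha).trans ?_
    rw [div_le_iff₀ (by linarith), hV]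
    have h1 : X * M + 2 * M ≤ (β + 2) * Lg := by rw [hXM]; linarith
    have h2 : (β + 2) * Lg = (β + 2) * c * Y * M := by rw [← hYM]; ring
    rw [h2] at h1
    exact le_of_mul_le_mul_right (by linarith) hM0
  have hexp1 : Real.exp 1 ≤ 3 := by linarith [Real.exp_one_lt_d9]
  have hVbase : l * V / (δ * M) ^ 2 ≤ Real.exp (-(6 * β * B)) := by
    rw [div_le_iff₀ (by positivity)] at hMV
    rw [div_le_iff₀ (by positivity), Real.exp_neg, inv_mul_eq_div, le_div_iff₀ (Real.exp_pos _)]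
    rw [le_div_iff₀ (by positivity)] at hl1
    have h1 := mul_le_mul_of_nonneg_right hl1 (show 0 ≤ V * Real.exp (6 * β * B) by positivity)
    have h2 := mul_le_mul_of_nonneg_left hMV hM0.le
    have h3 : 0 < 3 * β := by positivity
    refine le_of_mul_le_mul_right ?_ h3
    linarith
  have hbad1 : ∫ t in T..(2*T), (‖Q t‖ / (δ * M)) ^ (2 * l) ≤ 3 * T * Real.exp (-(B * M)) := by
    refine (integral_norm_primePoly_div_pow_le (fun p hp => (mem_primesTo.1 (Finset.mem_filter.1 hp).1).2)
      a le_rfl (Real.one_le_exp (by linarith)) (by linarith) (fun p hp => hPle p (Finset.mem_filter.1 hp).1)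
      ((sum_norm_le_of_norm_le_one (Finset.filter_subset _ _) (norm_le_one_of_rpow ha)).trans hfl) hxT hV1 hQvar
      (by positivity)).trans (mul_le_mul_of_nonneg_left (pow_le_exp_neg (by positivity) hVbase ?_) (by linarith))
    have := mul_le_mul_of_nonneg_left hl2 hB.le
    linarith
  have hbad2 : ∫ t in T..(2*T), (‖R t‖ / (δ * M)) ^ (2 * l) ≤ 3 * T * Real.exp (-(B * M)) := by
    have hsubR := primesTo_sqrt_subset ⌊Real.exp X⌋₊
    refine (integral_norm_primePoly_div_pow_le (fun p hp => (mem_primesTo.1 hp).2)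
      b' one_le_two (Real.one_le_exp (by linarith)) (by linarith) (fun p hp => hPle p (hsubR hp))
      ((sum_norm_le_of_norm_le_one hsubR (norm_le_one_of_le_inv hb')).trans hfl) hxT hV1
      ((sum_norm_sq_le_one hb').trans hV1)
      (by positivity)).trans (mul_le_mul_of_nonneg_left (pow_le_exp_neg (by positivity) hVbase ?_) (by linarith))
    have := mul_le_mul_of_nonneg_left hl2 hB.le
    linarith
  have hbad3 : ∫ t in T..(2*T), (‖D t‖ / (b * M)) ^ (2 * l') ≤ 3 * T * Real.exp (-(B * M)) := by
    refine (integral_norm_primePoly_div_pow_le hDp a le_rfl (Real.one_le_exp (by linarith)) (by linarith)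
      hDle hDsum hzl' (by linarith) hDvar (by positivity)).trans
      (mul_le_mul_of_nonneg_left (pow_le_exp_neg (K := 1) (by positivity) ?_ (by linarith)) (by linarith))
    rw [div_le_iff₀ (by positivity), Real.exp_neg, inv_mul_eq_div, le_div_iff₀ (Real.exp_pos _)]
    have h1 : (l' : ℝ) * (M + 5) ≤ (B + 1) * M * (6 * M) :=
      mul_le_mul hl'2 (by linarith) (by linarith) (by positivity)
    have h2 : (l' : ℝ) * (M + 5) * Real.exp 1 ≤ (B + 1) * M * (6 * M) * 3 :=
      mul_le_mul h1 hexp1 (Real.exp_pos _).le (by positivity)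
    have h3 : b ≤ b ^ 2 := le_self_pow₀ (by linarith) two_ne_zero
    have h4 := mul_le_mul_of_nonneg_right h3 (sq_nonneg M)
    rw [mul_pow]
    rw [hb] at h4 ⊢
    linarith
  have hlogt : ∀ t ∈ Set.Icc T (2 * T), Real.log t ≤ 2 * Lg := by
    intro t ht
    have h1 : Real.log t ≤ Real.log (T ^ 2) := Real.log_le_log (by linarith [ht.1])
      (ht.2.trans (by rw [sq]; exact mul_le_mul_of_nonneg_right (by linarith) hT0.le))
    rwa [Real.log_pow] at h1
  obtain ⟨F, hF⟩ : ∃ F, F = 4 * Real.exp (2 * k * C) * Real.exp (ε * M) := ⟨_, rfl⟩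
  have hF0 : 0 < F := by rw [hF]; positivity
  have hpt : ∀ t ∈ Set.Icc T (2 * T), g t ^ (2 * k) ≤ F * ‖truncExp N ((k : ℝ) * D t)‖ ^ 2 +
      (Real.exp (-(B * M)) * (g t ^ (2 * k)) ^ 2 + (Real.exp (-(B * M)))⁻¹ *
        ((‖Q t‖ / (δ * M)) ^ (2 * l) + (‖R t‖ / (δ * M)) ^ (2 * l) + (‖D t‖ / (b * M)) ^ (2 * l'))) := by
    intro t ht
    have ht3 : 3 ≤ t := hT3.trans ht.1
    refine le_add_of_good (Real.exp_pos _) (by positivity) (by positivity) (by positivity) (by positivity) ?_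
    intro hu hv hw
    rw [div_le_one (by positivity)] at hu hv hw
    have hXt : Real.exp X ≤ t ^ 2 := by
      have : Real.exp X ≤ T := by rw [← hexpL, Real.exp_le_exp]; exact hXL
      exact this.trans (ht.1.trans (le_self_pow₀ (by linarith) two_ne_zero))
    have hg := hab t ht3 hXt
    rw [← primePoly_filter_add P (fun p : ℕ => Real.exp Y < p) a 1 t, add_re] at hg
    have h1 : C * Real.log t / X ≤ δ * M := by
      rw [div_le_iff₀ (by linarith)]
      have h2 := mul_le_mul_of_nonneg_left (hlogt t ht) hC.le
      have h3 : δ * M * X = 2 * C * Lg := by rw [hβδ, mul_assoc, mul_comm M X, hXM]; ring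
      linarith
    have h2 : g t ≤ Real.exp ((D t).re + 3 * (δ * M) + C) := by
      refine hg.trans (Real.exp_le_exp.2 ?_)
      have := (re_le_norm (Q t)).trans hu
      have := (re_le_norm (R t)).trans hv
      linarith
    have h3 : ‖cexp ((k : ℝ) * D t)‖ ≤ 2 * ‖truncExp N ((k : ℝ) * D t)‖ := by
      refine norm_exp_le_two_mul_norm_truncExp ?_
      rw [norm_mul, norm_real, Real.norm_eq_abs, abs_of_nonneg (by linarith), le_div_iff₀ (by norm_num)]
      have := mul_le_mul_of_nonneg_left hw (by linarith : (0 : ℝ) ≤ k)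
      linarith
    have h4 : ‖cexp ((k : ℝ) * D t)‖ = Real.exp (k * (D t).re) := by
      rw [norm_exp, re_ofReal_mul]
    calc g t ^ (2 * k) ≤ Real.exp ((D t).re + 3 * (δ * M) + C) ^ (2 * k) :=
          pow_le_pow_left₀ (h.nonneg t) h2 _
      _ = Real.exp (2 * k * C) * Real.exp (ε * M) * ‖cexp ((k : ℝ) * D t)‖ ^ 2 := by
          rw [h4, ← Real.exp_nat_mul, ← Real.exp_nat_mul, ← Real.exp_add, ← Real.exp_add, ← hδε]
          push_cast; ring_nf
      _ ≤ Real.exp (2 * k * C) * Real.exp (ε * M) * (2 * ‖truncExp N ((k : ℝ) * D t)‖) ^ 2 :=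
          mul_le_mul_of_nonneg_left (pow_le_pow_left₀ (norm_nonneg _) h3 2) (by positivity)
      _ = _ := by rw [hF]; ring
  have hmain : ∫ t in T..(2*T), ‖truncExp N ((k : ℝ) * D t)‖ ^ 2 ≤
      T * Real.exp (k ^ 2 * M) * (Real.exp (5 * k ^ 2) + 2 * Real.exp k ^ 2) := by
    refine (integral_norm_truncExp_primePoly_le hDp a le_rfl (Real.one_le_exp (by linarith)) hT0.le
      hDle hDsum N (by linarith : (0 : ℝ) ≤ k)).trans ?_
    have h1 : Real.exp ((k : ℝ) ^ 2 * ∑ p ∈ P.filter (fun p : ℕ => ¬ Real.exp Y < p), ‖a p‖ ^ 2) ≤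
        Real.exp (k ^ 2 * M) * Real.exp (5 * k ^ 2) := by
      rw [← Real.exp_add, Real.exp_le_exp]
      have := mul_le_mul_of_nonneg_left hDvar (sq_nonneg (k : ℝ))
      linarith
    have h2 : 2 * Real.exp k ^ 2 * Real.exp Y ^ (3 * N) ≤ 2 * Real.exp k ^ 2 * (T * Real.exp (k ^ 2 * M)) :=
      mul_le_mul_of_nonneg_left (hzN.trans (le_mul_of_one_le_right hT0.le (Real.one_le_exp (by positivity))))
        (by positivity)
    have h3 := mul_le_mul_of_nonneg_left h1 hT0.le
    linarith
  have hint2 : ∫ t in T..(2*T), (g t ^ (2 * k)) ^ 2 ≤ T * Real.exp (B * M) := by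
    refine le_trans (le_of_eq ?_) hmomT
    congr 1 with t
    rw [← pow_mul]; ring_nf
  have hpow : Lg ^ ((k : ℝ) ^ 2 + ε) = Real.exp (k ^ 2 * M) * Real.exp (ε * M) := by
    rw [Real.rpow_def_of_pos (by linarith), ← Real.exp_add, ← hMdef]
    ring_nf
  have hpow1 : 1 ≤ Lg ^ ((k : ℝ) ^ 2 + ε) := Real.one_le_rpow hlogT (by positivity)
  have hexpB : Real.exp (-(B * M)) * Real.exp (B * M) = 1 := by rw [← Real.exp_add]; simp
  calc ∫ t in T..(2*T), g t ^ (2 * k)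
      ≤ ∫ t in T..(2*T), (F * ‖truncExp N ((k : ℝ) * D t)‖ ^ 2 +
        (Real.exp (-(B * M)) * (g t ^ (2 * k)) ^ 2 + (Real.exp (-(B * M)))⁻¹ *
        ((‖Q t‖ / (δ * M)) ^ (2 * l) + (‖R t‖ / (δ * M)) ^ (2 * l) + (‖D t‖ / (b * M)) ^ (2 * l')))) := by
        refine intervalIntegral.integral_mono_on (by linarith) (Continuous.intervalIntegrable (by fun_prop) _ _)
          (Continuous.intervalIntegrable (by fun_prop) _ _) hpt
    _ = F * (∫ t in T..(2*T), ‖truncExp N ((k : ℝ) * D t)‖ ^ 2) +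
        (Real.exp (-(B * M)) * (∫ t in T..(2*T), (g t ^ (2 * k)) ^ 2) + Real.exp (B * M) *
        ((∫ t in T..(2*T), (‖Q t‖ / (δ * M)) ^ (2 * l)) + (∫ t in T..(2*T), (‖R t‖ / (δ * M)) ^ (2 * l)) +
        (∫ t in T..(2*T), (‖D t‖ / (b * M)) ^ (2 * l')))) := by
        rw [intervalIntegral.integral_add (Continuous.intervalIntegrable (by fun_prop) _ _)
            (Continuous.intervalIntegrable (by fun_prop) _ _),
          intervalIntegral.integral_add (Continuous.intervalIntegrable (by fun_prop) _ _)
            (Continuous.intervalIntegrable (by fun_prop) _ _),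
          intervalIntegral.integral_const_mul, intervalIntegral.integral_const_mul,
          intervalIntegral.integral_const_mul,
          intervalIntegral.integral_add (Continuous.intervalIntegrable (by fun_prop) _ _)
            (Continuous.intervalIntegrable (by fun_prop) _ _),
          intervalIntegral.integral_add (Continuous.intervalIntegrable (by fun_prop) _ _)
            (Continuous.intervalIntegrable (by fun_prop) _ _), ← Real.exp_neg, neg_neg]
    _ ≤ F * (T * Real.exp (k ^ 2 * M) * (Real.exp (5 * k ^ 2) + 2 * Real.exp k ^ 2)) +
        (Real.exp (-(B * M)) * (T * Real.exp (B * M)) + Real.exp (B * M) *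
        (3 * T * Real.exp (-(B * M)) + 3 * T * Real.exp (-(B * M)) + 3 * T * Real.exp (-(B * M)))) :=
        add_le_add (mul_le_mul_of_nonneg_left hmain hF0.le)
          (add_le_add (mul_le_mul_of_nonneg_left hint2 (Real.exp_pos _).le)
            (mul_le_mul_of_nonneg_left (add_le_add (add_le_add hbad1 hbad2) hbad3) (Real.exp_pos _).le))
    _ = 4 * Real.exp (2 * k * C) * (Real.exp (5 * k ^ 2) + 2 * Real.exp k ^ 2) * T *
          Lg ^ ((k : ℝ) ^ 2 + ε) + 10 * T * (Real.exp (-(B * M)) * Real.exp (B * M)) := by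
        rw [hpow, hF]; ring
    _ ≤ _ := by
        rw [hexpB]
        have := mul_le_mul_of_nonneg_left hpow1 (show 0 ≤ 10 * T by positivity)
        linarith

lemma one_half_add_mul_I_ne_one (t : ℝ) : (1 / 2 + t * I : ℂ) ≠ 1 := by
  intro h
  have := congrArg re h
  norm_num at this

lemma continuous_norm_LFunction {q : ℕ} [NeZero q] (χ : DirichletCharacter ℂ q) :
    Continuous fun t : ℝ => ‖DirichletCharacter.LFunction χ (1 / 2 + t * I)‖ := by
  refine Continuous.norm (continuous_iff_continuousAt.2 fun t => ?_)
  have h1 := (DirichletCharacter.differentiableAt_LFunction χ _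
    (Or.inl (one_half_add_mul_I_ne_one t))).continuousAt
  have h2 : Continuous fun t : ℝ => (1 / 2 + t * I : ℂ) := by fun_prop
  exact h1.comp (f := fun t : ℝ => (1 / 2 + t * I : ℂ)) h2.continuousAt

lemma exists_primeBound {q : ℕ} [NeZero q] (hGRH : GRHmod q) (χ : DirichletCharacter ℂ q) :
    ∃ (A : ℝ) (m : ℕ) (X₀ C : ℝ),
      PrimeBound (fun t : ℝ => ‖DirichletCharacter.LFunction χ (1 / 2 + t * I)‖) A m X₀ C := by
  obtain ⟨X₀, C, hX₀, hC, hbound⟩ := exists_norm_LFunction_le_exp hGRH χ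
  obtain ⟨A, hA, hpoly⟩ := exists_norm_sub_one_mul_LFunction_le χ
  refine ⟨A * 4, 2, X₀, C, continuous_norm_LFunction χ, fun t => norm_nonneg _, by positivity,
    fun t ht => ?_, hX₀, hC, hbound⟩
  have h1 := hpoly (1 / 2 + t * I) (by norm_num) (by norm_num)
  rw [norm_mul] at h1
  have h2 : 1 ≤ ‖(1 / 2 + t * I - 1 : ℂ)‖ := by
    refine le_trans ?_ (abs_im_le_norm _)
    have : (1 / 2 + t * I - 1 : ℂ).im = t := by simp
    rw [this, abs_of_nonneg (by linarith)]
    linarith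
  have h3 : ‖(1 / 2 + t * I : ℂ)‖ ≤ 1 / 2 + t := by
    refine (norm_add_le _ _).trans (le_of_eq ?_)
    rw [norm_mul, norm_I, norm_real, Real.norm_eq_abs, abs_of_nonneg (by linarith)]
    norm_num
  calc _ ≤ _ := (le_mul_of_one_le_left (norm_nonneg _) h2).trans h1
    _ ≤ A * (2 * t) ^ 2 := by
        refine mul_le_mul_of_nonneg_left (pow_le_pow_left₀ (by positivity) ?_ 2) hA.le
        linarith
    _ = _ := by ring

lemma norm_hurwitzZeta_le_sum {q a : ℕ} [NeZero q] (hgcd : Nat.gcd a q = 1) (s : ℂ) :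
    ‖hurwitzZeta (((a : ℝ) / (q : ℝ) : ℝ) : UnitAddCircle) s‖ ≤
      ‖(q : ℂ) ^ s‖ * ∑ χ : DirichletCharacter ℂ q, ‖DirichletCharacter.LFunction χ s‖ := by
  have hq : (q : ℂ) ≠ 0 := NeZero.ne _
  have hunit : IsUnit (a : ZMod q) := (ZMod.isUnit_iff_coprime a q).2 hgcd
  have hkey : ∑ χ : DirichletCharacter ℂ q, χ (a : ZMod q)⁻¹ * DirichletCharacter.LFunction χ s =
      (q : ℂ) ^ (-s) * (q.totient * hurwitzZeta (((a : ℝ) / (q : ℝ) : ℝ) : UnitAddCircle) s) := by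
    calc _ = (q : ℂ) ^ (-s) * ∑ j : ZMod q,
          (∑ χ : DirichletCharacter ℂ q, χ (a : ZMod q)⁻¹ * χ j) * hurwitzZeta (ZMod.toAddCircle j) s := by
          simp only [DirichletCharacter.LFunction, ZMod.LFunction, mul_left_comm _ ((q : ℂ) ^ (-s)),
            ← Finset.mul_sum]
          congr 1
          simp only [Finset.mul_sum, Finset.sum_mul, ← mul_assoc]
          exact Finset.sum_comm
      _ = _ := by
          simp only [DirichletCharacter.sum_char_inv_mul_char_eq ℂ hunit, ite_mul, zero_mul,
            Finset.sum_ite_eq, Finset.mem_univ, if_true, ZMod.toAddCircle_natCast]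
  have h1 : (q.totient : ℂ) * hurwitzZeta (((a : ℝ) / (q : ℝ) : ℝ) : UnitAddCircle) s =
      (q : ℂ) ^ s * ∑ χ : DirichletCharacter ℂ q, χ (a : ZMod q)⁻¹ * DirichletCharacter.LFunction χ s := by
    rw [hkey, ← mul_assoc, ← cpow_add _ _ hq, add_neg_cancel, cpow_zero, one_mul]
  have hφ : (1 : ℝ) ≤ ‖(q.totient : ℂ)‖ := by
    rw [Complex.norm_natCast]
    exact_mod_cast Nat.totient_pos.2 (NeZero.pos q)
  calc _ ≤ ‖(q.totient : ℂ)‖ * ‖hurwitzZeta (((a : ℝ) / (q : ℝ) : ℝ) : UnitAddCircle) s‖ :=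
        le_mul_of_one_le_left (norm_nonneg _) hφ
    _ = ‖(q : ℂ) ^ s‖ * ‖∑ χ : DirichletCharacter ℂ q, χ (a : ZMod q)⁻¹ * DirichletCharacter.LFunction χ s‖ := by
        rw [← norm_mul, h1, norm_mul]
    _ ≤ _ := by
        refine mul_le_mul_of_nonneg_left (norm_sum_le_of_le _ fun χ _ => ?_) (norm_nonneg _)
        rw [norm_mul]
        exact mul_le_of_le_one_left (norm_nonneg _) (χ.norm_le_one _)

lemma norm_hurwitzZeta_pow_le {q a n : ℕ} [NeZero q] (hgcd : Nat.gcd a q = 1) (t : ℝ) :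
    ‖hurwitzZeta (((a : ℝ) / (q : ℝ) : ℝ) : UnitAddCircle) (1 / 2 + t * I)‖ ^ (n + 1) ≤
      (q : ℝ) ^ (n + 1) * Fintype.card (DirichletCharacter ℂ q) ^ n *
        ∑ χ : DirichletCharacter ℂ q, ‖DirichletCharacter.LFunction χ (1 / 2 + t * I)‖ ^ (n + 1) := by
  have hqs : ‖(q : ℂ) ^ (1 / 2 + t * I : ℂ)‖ ≤ q := by
    rw [norm_natCast_cpow_of_pos (NeZero.pos q)]
    refine (Real.rpow_le_rpow_of_exponent_le (z := 1) (by exact_mod_cast NeZero.pos q) (by norm_num)).trans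
      (Real.rpow_one _).le
  refine (pow_le_pow_left₀ (norm_nonneg _) ((norm_hurwitzZeta_le_sum hgcd _).trans
    (mul_le_mul_of_nonneg_right hqs (Finset.sum_nonneg fun _ _ => norm_nonneg _))) _).trans ?_
  rw [mul_pow, mul_assoc]
  exact mul_le_mul_of_nonneg_left (pow_sum_le_card_mul_sum_pow (fun _ _ => norm_nonneg _) n) (by positivity)

/-- The upper bound for the moments of the Hurwitz zeta function. -/
theorem exists_upper_bound_moment (q a k : ℕ) [NeZero q] (hk : 1 ≤ k) (hgcd : Nat.gcd a q = 1)
    (hGRH : GRHmod q) (ε : ℝ) (hε : 0 < ε) : ∃ C : ℝ, 0 < C ∧ ∀ᶠ T : ℝ in atTop,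
      ∫ t in T..(2*T), ‖hurwitzZeta (((a : ℝ) / (q : ℝ) : ℝ) : UnitAddCircle) (1 / 2 + t * I)‖ ^ (2 * k) ≤
        C * T * Real.log T ^ ((k : ℝ) ^ 2 + ε) := by
  have hmom : ∀ χ : DirichletCharacter ℂ q, ∃ K : ℝ, 0 < K ∧ ∀ᶠ T : ℝ in atTop,
      ∫ t in T..(2*T), ‖DirichletCharacter.LFunction χ (1 / 2 + t * I)‖ ^ (2 * k) ≤
        K * T * Real.log T ^ ((k : ℝ) ^ 2 + ε) := fun χ => by
    obtain ⟨A, m, X₀, C, h⟩ := exists_primeBound hGRH χ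
    exact h.exists_moment_le_rpow hk hε
  choose K hK hmom using hmom
  have hcont := fun χ : DirichletCharacter ℂ q => continuous_norm_LFunction χ
  obtain ⟨W, hW⟩ : ∃ W : ℝ, W = (q : ℝ) ^ (2 * k) * Fintype.card (DirichletCharacter ℂ q) ^ (2 * k - 1) :=
    ⟨_, rfl⟩
  have hq : (0 : ℝ) < q := by exact_mod_cast NeZero.pos q
  have hW0 : 0 < W := by
    have : (0 : ℝ) < Fintype.card (DirichletCharacter ℂ q) := by exact_mod_cast Fintype.card_pos
    rw [hW]; positivity
  refine ⟨W * ∑ χ, K χ, mul_pos hW0 (Finset.sum_pos (fun χ _ => hK χ) Finset.univ_nonempty), ?_⟩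
  filter_upwards [eventually_all.2 hmom, eventually_ge_atTop (0 : ℝ)] with T hT hT0
  have hζ : Continuous fun t : ℝ =>
      hurwitzZeta (((a : ℝ) / (q : ℝ) : ℝ) : UnitAddCircle) (1 / 2 + t * I) :=
    continuous_iff_continuousAt.2 fun t => by
      have h1 := (differentiableAt_hurwitzZeta (((a : ℝ) / (q : ℝ) : ℝ) : UnitAddCircle)
        (one_half_add_mul_I_ne_one t)).continuousAt
      have h2 : Continuous fun t : ℝ => (1 / 2 + t * I : ℂ) := by fun_prop
      exact h1.comp (f := fun t : ℝ => (1 / 2 + t * I : ℂ)) h2.continuousAt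
  calc _ ≤ ∫ t in T..(2*T), W *
        ∑ χ : DirichletCharacter ℂ q, ‖DirichletCharacter.LFunction χ (1 / 2 + t * I)‖ ^ (2 * k) :=
        intervalIntegral.integral_mono_on (by linarith) (Continuous.intervalIntegrable (by fun_prop) _ _)
          (Continuous.intervalIntegrable (by fun_prop) _ _) fun t _ => by
            have h := norm_hurwitzZeta_pow_le (n := 2 * k - 1) hgcd t
            rwa [show 2 * k - 1 + 1 = 2 * k by omega, ← hW] at h
    _ = W * ∑ χ : DirichletCharacter ℂ q,
        ∫ t in T..(2*T), ‖DirichletCharacter.LFunction χ (1 / 2 + t * I)‖ ^ (2 * k) := by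
        rw [intervalIntegral.integral_const_mul, intervalIntegral.integral_finsetSum
          (fun χ _ => Continuous.intervalIntegrable (by fun_prop) _ _)]
    _ ≤ W * ∑ χ, K χ * T * Real.log T ^ ((k : ℝ) ^ 2 + ε) :=
        mul_le_mul_of_nonneg_left (Finset.sum_le_sum fun χ _ => hT χ) hW0.le
    _ = _ := by rw [← Finset.sum_mul, ← Finset.sum_mul]; ring

/-- Assuming GRH for the characters modulo `q`, for `α = a/q` with
`gcd(a,q) = 1` and every fixed `ε > 0`,
`T (log T)^{k²} ≪_{q,k} ∫_T^{2T} |ζ(1/2+it,α)|^{2k} dt ≪_{q,k,ε} T (log T)^{k²+ε}`. -/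
theorem hurwitz_moment_upper_lower (a q k : ℕ) [NeZero q] (hk : 1 ≤ k) (ha : 1 ≤ a) (haq : a ≤ q)
    (hgcd : Nat.gcd a q = 1) (hGRH : GRHmod q) (ε : ℝ) (hε : 0 < ε) :
    ∃ c : ℝ, 0 < c ∧ ∃ C : ℝ, 0 < C ∧ ∃ T₀ : ℝ, ∀ T : ℝ, T₀ ≤ T →
      c * T * Real.log T ^ (k ^ 2) ≤
        (∫ t in T..(2*T),
          ‖hurwitzZeta (((a : ℝ) / (q : ℝ) : ℝ) : UnitAddCircle) (1/2 + t * Complex.I)‖ ^ (2 * k)) ∧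
      (∫ t in T..(2*T),
          ‖hurwitzZeta (((a : ℝ) / (q : ℝ) : ℝ) : UnitAddCircle) (1/2 + t * Complex.I)‖ ^ (2 * k))
        ≤ C * T * Real.log T ^ ((k : ℝ) ^ 2 + ε) := by
  obtain ⟨c, hc, hlower⟩ := exists_lower_bound_moment q a k hk ha haq hgcd
  obtain ⟨C, hC, hupper⟩ := exists_upper_bound_moment q a k hk hgcd hGRH ε hε
  obtain ⟨T₀, hT₀⟩ := eventually_atTop.1 (hlower.and hupper)
  exact ⟨c, hc, C, hC, T₀, hT₀⟩
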